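/- Let d, m ∈ ℕ with m ≥ 2 and let α > 1. There exist constants C, C₀ > 0 depending only on d, m, α such that for every integer N ≥ 2, every W, L, 𝒮, K with W ≥ N, L ≥ 1, 𝒮 ≥ N(d+1), and K ≥ C₀·max{ N^{(d+2m+1−2α)/(2d)}, √(log N) }, and every f ∈ H^α, there exists g ∈ 𝒩𝒩(W, L, 𝒮, K) such that sup_{x ∈ [0,1]^d} |g(x) − f(x)| ≤ C·N^{−min{d+2m+1, 2α}/(2d)}·√(log N) and sup_{x ∈ [0,1]^d} ‖∇g(x) − ∇f(x)‖_∞ ≤ C·N^{−min{d+2m−1, 2(α−1)}/(2d)}·√(log N). -/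

import Mathlib

/-- RePU activation of order `m`: `σ_m(t) = (max{t,0})^m`. -/
noncomputable def repu (m : ℕ) (t : ℝ) : ℝ := (max t 0) ^ m

/-- Hidden-layer forward pass of a RePU network with architecture `arch`
(`arch 0` input units, `arch ℓ` units at layer `ℓ`), weight matrices `A` and biases `b`:
`netFwd m arch A b x ℓ` is the output of the `ℓ`-th hidden layer at input `x`. -/
noncomputable def netFwd (m : ℕ) (arch : ℕ → ℕ)
    (A : ∀ ℓ : ℕ, Matrix (Fin (arch (ℓ + 1))) (Fin (arch ℓ)) ℝ)
    (b : ∀ ℓ : ℕ, Fin (arch (ℓ + 1)) → ℝ)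
    (x : Fin (arch 0) → ℝ) : (ℓ : ℕ) → Fin (arch ℓ) → ℝ
  | 0 => x
  | ℓ + 1 => fun i => repu m ((A ℓ).mulVec (netFwd m arch A b x ℓ) i + b ℓ i)

/-- Real output of a depth-`L` RePU network (the output layer `g_L(x) = A_L x` has one
unit, `arch (L+1) = 1`; we sum the coordinates of the output vector). -/
noncomputable def netOut (m : ℕ) (arch : ℕ → ℕ)
    (A : ∀ ℓ : ℕ, Matrix (Fin (arch (ℓ + 1))) (Fin (arch ℓ)) ℝ)
    (b : ∀ ℓ : ℕ, Fin (arch (ℓ + 1)) → ℝ) (L : ℕ) (x : Fin (arch 0) → ℝ) : ℝ :=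
  ∑ i, (A L).mulVec (netFwd m arch A b x L) i

/-- The `ℓ∞` operator norm of a matrix: `‖A‖_∞ = max_i Σ_j |a_{ij}|`. -/
noncomputable def matInfNorm {p q : ℕ} (A : Matrix (Fin p) (Fin q) ℝ) : ℝ :=
  ⨆ i, ∑ j, |A i j|

/-- `‖(A, b)‖_∞`, the `ℓ∞` operator norm of `A` augmented with the column `b`. -/
noncomputable def augInfNorm {p q : ℕ} (A : Matrix (Fin p) (Fin q) ℝ) (b : Fin p → ℝ) : ℝ :=
  ⨆ i, ((∑ j, |A i j|) + |b i|)

/-- Norm-constraint functional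
`κ(θ) = m^L ‖A_L‖_∞ ∏_{s=0}^{L−1} max{‖(A_s, b_s)‖_∞, 1}^{m^{L−s}}`. -/
noncomputable def kappa (m L : ℕ) (arch : ℕ → ℕ)
    (A : ∀ ℓ : ℕ, Matrix (Fin (arch (ℓ + 1))) (Fin (arch ℓ)) ℝ)
    (b : ∀ ℓ : ℕ, Fin (arch (ℓ + 1)) → ℝ) : ℝ :=
  (m : ℝ) ^ L * matInfNorm (A L) *
    ∏ s ∈ Finset.range L, (max (augInfNorm (A s) (b s)) 1) ^ (m ^ (L - s))

/-- The size `𝒮 = Σ_{s=0}^{L−1} d_{s+1}(d_s + 1)` of an architecture. -/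
def netSize (arch : ℕ → ℕ) (L : ℕ) : ℕ :=
  ∑ s ∈ Finset.range L, arch (s + 1) * (arch s + 1)

/-- The class `𝒩_K` of RePU networks of order `m`, depth `L`, fixed architecture `arch`,
with norm constraint `κ(θ) ≤ K`. -/
def NNclassArch (m L : ℕ) (arch : ℕ → ℕ) (K : ℝ) : Set ((Fin (arch 0) → ℝ) → ℝ) :=
  { g | ∃ A b, kappa m L arch A b ≤ K ∧ g = netOut m arch A b L }


/-- The class `𝒩𝒩(W, L, 𝒮, K)` of all RePU networks of order `m` mapping `ℝ^d → ℝ`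
with depth at most `L`, width at most `W`, size at most `S`, and `κ(θ) ≤ K`. -/
def NNfull (m d W L : ℕ) (S K : ℝ) : Set ((Fin d → ℝ) → ℝ) :=
  { g | ∃ (L' : ℕ) (arch : ℕ → ℕ) (harch : arch 0 = d),
      1 ≤ L' ∧ L' ≤ L ∧ arch (L' + 1) = 1 ∧
      (∀ ℓ, 1 ≤ ℓ → ℓ ≤ L' → arch ℓ ≤ W) ∧
      (netSize arch L' : ℝ) ≤ S ∧
      ∃ A b, kappa m L' arch A b ≤ K ∧
        ∀ x : Fin d → ℝ, g x = netOut m arch A b L' (x ∘ Fin.cast harch) }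

/-- Iterated partial derivative of `f : ℝ^d → ℝ` along a list of coordinate directions. -/
noncomputable def pderivList {d : ℕ} : List (Fin d) → ((Fin d → ℝ) → ℝ) → (Fin d → ℝ) → ℝ
  | [], f => f
  | i :: l, f => fun x => fderiv ℝ (pderivList l f) x (Pi.single i 1)

/-- The Hölder class `H^α` on `ℝ^d` (with respect to the sup norm `‖·‖_∞`):
`α = r + β` with `r ∈ ℕ₀`, `β ∈ (0,1]`, all partial derivatives of order `≤ r` bounded
by `1`, and the order-`r` partial derivatives `β`-Hölder with constant `1`. -/
def HolderClass (d : ℕ) (α : ℝ) : Set ((Fin d → ℝ) → ℝ) :=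
  { f | ∃ (r : ℕ) (β : ℝ), 0 < β ∧ β ≤ 1 ∧ α = r + β ∧ ContDiff ℝ r f ∧
      (∀ l : List (Fin d), l.length ≤ r → ∀ x, |pderivList l f x| ≤ 1) ∧
      (∀ l : List (Fin d), l.length = r → ∀ x y,
        |pderivList l f x - pderivList l f y| ≤ ‖x - y‖ ^ β) }

section Derandomization

open MeasureTheory in
/-- The exponential moment of a centred bounded function under a probability measure. -/
theorem integral_exp_mul_sub_le_one {Ω : Type*} [MeasurableSpace Ω] (μ : Measure Ω)
    [IsProbabilityMeasure μ] (Y : Ω → ℝ) (c u : ℝ) (hY : Measurable Y)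
    (hb : ∀ ω, |Y ω| ≤ c) (hmean : ∫ ω, Y ω ∂μ = 0) :
    Integrable (fun ω => Real.exp (u * Y ω)) μ ∧
      ∫ ω, Real.exp (u * Y ω) ∂μ ≤ Real.exp (u ^ 2 * c ^ 2 / 2) := by
  have h := ProbabilityTheory.hasSubgaussianMGF_of_mem_Icc_of_integral_eq_zero
    (μ := μ) (X := Y) (a := -c) (b := c) hY.aemeasurable
    (Filter.Eventually.of_forall fun ω => abs_le.1 (hb ω)) hmean
  refine ⟨h.integrable_exp_mul u, (h.mgf_le u).trans (le_of_eq ?_)⟩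
  congr 1
  simp only [NNReal.coe_pow, NNReal.coe_div, coe_nnnorm, Real.norm_eq_abs, NNReal.coe_ofNat]
  rw [div_pow, sq_abs]
  ring

open MeasureTheory in
/-- Derandomization of the exponential moment method. -/
theorem exists_sum_exp_le {ι X Ω : Type*} [Fintype X] [MeasurableSpace Ω] [Nonempty Ω]
    (s : Finset ι) (μ : ι → Measure Ω) [∀ i, IsProbabilityMeasure (μ i)]
    (Y : ι → X → Ω → ℝ) (c : ι → X → ℝ) (I : ι → Set Ω) (u : ℝ)
    (hY : ∀ i x, Measurable (Y i x)) (hb : ∀ i x ω, |Y i x ω| ≤ c i x)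
    (hmean : ∀ i x, ∫ ω, Y i x ω ∂(μ i) = 0) (hI : ∀ i, ∀ᵐ ω ∂(μ i), ω ∈ I i) :
    ∃ t : ι → Ω, (∀ i ∈ s, t i ∈ I i) ∧
      ∑ x, Real.exp (u * ∑ i ∈ s, Y i x (t i) - u ^ 2 * (∑ i ∈ s, c i x ^ 2) / 2)
        ≤ Fintype.card X := by
  classical
  induction s using Finset.induction_on with
  | empty => exact ⟨fun _ => Classical.arbitrary Ω, by simp, by simp⟩
  | insert j s hj ih =>
    obtain ⟨t, ht, hsum⟩ := ih
    set w : X → ℝ := fun x =>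
      Real.exp (u * ∑ i ∈ s, Y i x (t i) - u ^ 2 * (∑ i ∈ s, c i x ^ 2) / 2) with hw
    have hmgf := fun x => integral_exp_mul_sub_le_one (μ j) (Y j x) (c j x) u (hY j x)
      (hb j x) (hmean j x)
    have hint : ∀ x, Integrable (fun ω => w x * Real.exp (-(u ^ 2 * c j x ^ 2 / 2)) *
        Real.exp (u * Y j x ω)) (μ j) := fun x => (hmgf x).1.const_mul _
    obtain ⟨ω, hω, hle⟩ := exists_notMem_null_le_integral
      (integrable_finsetSum Finset.univ fun x _ => hint x) (ae_iff.1 (hI j))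
    have hωI : ω ∈ I j := by simpa using hω
    refine ⟨Function.update t j ω, ?_, ?_⟩
    · intro i hi
      by_cases hij : i = j
      · subst hij; simpa using hωI
      · rw [Function.update_of_ne hij]
        exact ht i ((Finset.mem_insert.1 hi).resolve_left hij)
    · have hupd : ∀ x, ∑ i ∈ s, Y i x (Function.update t j ω i) = ∑ i ∈ s, Y i x (t i) :=
        fun x => Finset.sum_congr rfl fun i hi => by
          rw [Function.update_of_ne (by rintro rfl; exact hj hi)]
      refine le_trans (le_of_eq ?_) (hle.trans ?_)
      · refine Finset.sum_congr rfl fun x _ => ?_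
        rw [Finset.sum_insert hj, Finset.sum_insert hj, hupd, Function.update_self, hw]
        rw [← Real.exp_add, ← Real.exp_add]
        congr 1
        ring
      · rw [integral_finsetSum _ fun x _ => hint x]
        refine le_trans (Finset.sum_le_sum fun x _ => ?_) hsum
        rw [integral_const_mul]
        calc _ ≤ w x * Real.exp (-(u ^ 2 * c j x ^ 2 / 2)) * Real.exp (u ^ 2 * c j x ^ 2 / 2) := by
              gcongr
              exact (hmgf x).2
          _ = w x := by
              rw [mul_assoc, ← Real.exp_add]; simp

open MeasureTheory in
/-- Simultaneous derandomized Hoeffding inequality: independent centred bounded choices can be made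
so that all finitely many tests are small. -/
theorem exists_forall_abs_sum_le {ι X Ω : Type*} [Fintype X] [MeasurableSpace Ω] [Nonempty Ω]
    [Nonempty X]
    (s : Finset ι) (μ : ι → Measure Ω) [∀ i, IsProbabilityMeasure (μ i)]
    (Y : ι → X → Ω → ℝ) (c : ι → X → ℝ) (I : ι → Set Ω) (V : ℝ) (hV : 0 < V)
    (hY : ∀ i x, Measurable (Y i x)) (hb : ∀ i x ω, |Y i x ω| ≤ c i x)
    (hmean : ∀ i x, ∫ ω, Y i x ω ∂(μ i) = 0) (hI : ∀ i, ∀ᵐ ω ∂(μ i), ω ∈ I i)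
    (hc : ∀ x, ∑ i ∈ s, c i x ^ 2 ≤ V) :
    ∃ t : ι → Ω, (∀ i ∈ s, t i ∈ I i) ∧
      ∀ x, |∑ i ∈ s, Y i x (t i)| ≤ Real.sqrt (2 * V * Real.log (2 * Fintype.card X)) := by
  classical
  have hcard : (1 : ℝ) ≤ Fintype.card X := by exact_mod_cast Fintype.card_pos
  set Λ := Real.log (2 * Fintype.card X) with hΛ
  have hΛpos : 0 < Λ := Real.log_pos (by linarith)
  set u := Real.sqrt (2 * Λ / V) with hu
  have hupos : 0 < u := Real.sqrt_pos.2 (by positivity)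
  have husq : u ^ 2 = 2 * Λ / V := Real.sq_sqrt (by positivity)
  obtain ⟨t, ht, hsum⟩ := exists_sum_exp_le (X := X × Bool) s μ
    (fun i p ω => (if p.2 then 1 else -1) * Y i p.1 ω) (fun i p => c i p.1) I u
    (fun i p => (hY i p.1).const_mul _)
    (fun i p ω => by
      rcases p with ⟨x, b⟩
      cases b <;> simpa using hb i x ω)
    (fun i p => by rw [integral_const_mul, hmean, mul_zero]) hI
  refine ⟨t, ht, fun x => ?_⟩
  have key : ∀ b : Bool, (if b then 1 else -1) * ∑ i ∈ s, Y i x (t i) ≤ Real.sqrt (2 * V * Λ) := by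
    intro b
    have h1 := (Finset.single_le_sum (f := fun p : X × Bool => Real.exp (u * ∑ i ∈ s,
      (if p.2 then 1 else -1) * Y i p.1 (t i) - u ^ 2 * (∑ i ∈ s, c i p.1 ^ 2) / 2))
      (fun p _ => (Real.exp_pos _).le) (Finset.mem_univ (x, b))).trans hsum
    rw [Fintype.card_prod, Fintype.card_bool, Nat.cast_mul, mul_comm (Fintype.card X : ℝ)] at h1
    have h2 := (Real.le_log_iff_exp_le (by push_cast; positivity)).2 h1
    simp only [Nat.cast_ofNat] at h2
    rw [← hΛ, ← Finset.mul_sum] at h2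
    have h3 : u ^ 2 * (∑ i ∈ s, c i x ^ 2) / 2 ≤ Λ := by
      calc u ^ 2 * (∑ i ∈ s, c i x ^ 2) / 2 ≤ u ^ 2 * V / 2 := by gcongr; exact hc x
        _ = Λ := by rw [husq]; field_simp
    have h4 : u * ((if b then 1 else -1) * ∑ i ∈ s, Y i x (t i)) ≤ 2 * Λ := by linarith
    have h5 : u * Real.sqrt (2 * V * Λ) = 2 * Λ := by
      rw [hu, ← Real.sqrt_mul (by positivity)]
      rw [show 2 * Λ / V * (2 * V * Λ) = (2 * Λ) ^ 2 by field_simp]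
      exact Real.sqrt_sq (by positivity)
    rw [← h5] at h4
    exact le_of_mul_le_mul_left h4 hupos
  exact abs_le'.2 ⟨by simpa using key true, by simpa using key false⟩

end Derandomization

section Interpolation

/-- Uniform Lagrange interpolation data on the unit interval, exact for the monomials
`(s - u) ^ p` with `p ≤ m`. -/
theorem exists_interpolation_weights (m : ℕ) (hm : 1 ≤ m) :
    ∃ (B : ℝ) (ν : Fin (m + 1) → ℝ) (l : Fin (m + 1) → ℝ → ℝ), 1 ≤ B ∧
      (∀ k, ν k ∈ Set.Icc (0 : ℝ) 1) ∧ (∀ k, Continuous (l k)) ∧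
      (∀ k, ∀ u ∈ Set.Icc (0 : ℝ) 1, |l k u| ≤ B) ∧
      (∀ p ≤ m, ∀ s u : ℝ, ∑ k, l k u * (s - ν k) ^ p = (s - u) ^ p) := by
  classical
  set ν : Fin (m + 1) → ℝ := fun k => (k : ℝ) / m with hν
  have hm0 : (0 : ℝ) < m := by exact_mod_cast hm
  have hinj : Function.Injective ν := by
    intro i j hij
    have : (i : ℝ) = j := by
      simp only [hν] at hij
      field_simp at hij
      exact hij
    exact Fin.ext (by exact_mod_cast this)
  set l : Fin (m + 1) → ℝ → ℝ := fun k u => (Lagrange.basis Finset.univ ν k).eval u with hl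
  have hcont : ∀ k, Continuous (l k) := fun k => Polynomial.continuous _
  have hbd : ∀ k, ∃ B, ∀ u ∈ Set.Icc (0 : ℝ) 1, |l k u| ≤ B := fun k => by
    obtain ⟨B, hB⟩ := isCompact_Icc.exists_bound_of_continuousOn (hcont k).continuousOn
      (s := Set.Icc (0 : ℝ) 1)
    exact ⟨B, fun u hu => by simpa using hB u hu⟩
  choose B hB using hbd
  refine ⟨1 + ∑ k, |B k|, ν, l, ?_, ?_, hcont, ?_, ?_⟩
  · linarith [Finset.sum_nonneg fun k (_ : k ∈ Finset.univ) => abs_nonneg (B k)]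
  · intro k
    have : ((k : ℕ) : ℝ) ≤ m := by exact_mod_cast Nat.lt_succ_iff.1 k.2
    exact ⟨by positivity, (div_le_one hm0).2 this⟩
  · intro k u hu
    have := Finset.single_le_sum (fun k (_ : k ∈ Finset.univ) => abs_nonneg (B k))
      (Finset.mem_univ k)
    linarith [hB k u hu, le_abs_self (B k)]
  · intro p hp s u
    have hdeg : ((Polynomial.C s - Polynomial.X) ^ p : Polynomial ℝ).degree
        < (Finset.univ : Finset (Fin (m + 1))).card := by
      rw [Finset.card_univ, Fintype.card_fin]
      refine (Polynomial.degree_pow_le _ _).trans_lt ?_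
      have h1 : (Polynomial.C s - Polynomial.X : Polynomial ℝ).degree ≤ 1 :=
        (Polynomial.degree_sub_le _ _).trans (by
          simp only [Polynomial.degree_X, max_le_iff, le_refl, and_true]
          exact Polynomial.degree_C_le.trans (by norm_num))
      calc p • (Polynomial.C s - Polynomial.X : Polynomial ℝ).degree ≤ p • (1 : WithBot ℕ) :=
            nsmul_le_nsmul_right h1 p
        _ = (p : WithBot ℕ) := by simp
        _ < ((m + 1 : ℕ) : WithBot ℕ) := by exact_mod_cast Nat.lt_succ_of_le hp
    have h := Lagrange.eq_interpolate (s := Finset.univ) (v := ν) hinj.injOn hdeg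
    have h2 := congrArg (Polynomial.eval u) h
    rw [Lagrange.interpolate_apply, Polynomial.eval_finsetSum] at h2
    simp only [Polynomial.eval_mul, Polynomial.eval_C, Polynomial.eval_pow, Polynomial.eval_sub,
      Polynomial.eval_X] at h2
    rw [h2]
    exact Finset.sum_congr rfl fun k _ => mul_comm _ _

/-- The residual of the interpolation of `t ↦ (s - t)₊ ^ p` on one cell `[a, a + τ]` is localized
where `s` lies in the cell. -/
theorem abs_interpolation_residual_le {m : ℕ} {B : ℝ} {ν : Fin (m + 1) → ℝ}
    {l : Fin (m + 1) → ℝ → ℝ} (hB : 1 ≤ B) (hν : ∀ k, ν k ∈ Set.Icc (0 : ℝ) 1)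
    (hlB : ∀ k, ∀ u ∈ Set.Icc (0 : ℝ) 1, |l k u| ≤ B)
    (hl : ∀ p ≤ m, ∀ s u : ℝ, ∑ k, l k u * (s - ν k) ^ p = (s - u) ^ p)
    {p : ℕ} (hp : 1 ≤ p) (hpm : p ≤ m) {a τ s t : ℝ} (hτ : 0 < τ) (ht : t ∈ Set.Icc a (a + τ)) :
    |max (s - t) 0 ^ p - ∑ k, l k ((t - a) / τ) * max (s - (a + τ * ν k)) 0 ^ p|
      ≤ if a < s ∧ s < a + τ then (1 + (m + 1) * B) * τ ^ p else 0 := by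
  have hp0 : p ≠ 0 := by omega
  have hnode : ∀ k, a ≤ a + τ * ν k ∧ a + τ * ν k ≤ a + τ := fun k =>
    ⟨by nlinarith [(hν k).1], by nlinarith [(hν k).2]⟩
  split_ifs with hs
  · have hbd : ∀ t', a ≤ t' → |max (s - t') 0 ^ p| ≤ τ ^ p := fun t' ht' => by
      rw [abs_of_nonneg (by positivity)]
      gcongr
      exact max_le (by linarith) hτ.le
    have hu : (t - a) / τ ∈ Set.Icc (0 : ℝ) 1 :=
      ⟨div_nonneg (by linarith [ht.1]) hτ.le, (div_le_one hτ).2 (by linarith [ht.2])⟩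
    calc _ ≤ |max (s - t) 0 ^ p| + |∑ k, l k ((t - a) / τ) * max (s - (a + τ * ν k)) 0 ^ p| :=
          abs_sub _ _
      _ ≤ τ ^ p + ∑ _k : Fin (m + 1), B * τ ^ p := by
          refine add_le_add (hbd t ht.1) ((Finset.abs_sum_le_sum_abs _ _).trans
            (Finset.sum_le_sum fun k _ => ?_))
          rw [abs_mul]
          exact mul_le_mul (hlB k _ hu) (hbd _ (hnode k).1) (abs_nonneg _) (by linarith)
      _ = (1 + (m + 1) * B) * τ ^ p := by
          simp; ring
  · refine le_of_eq (abs_eq_zero.2 ?_)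
    by_cases h1 : s ≤ a
    · rw [max_eq_right (by linarith [ht.1]), zero_pow hp0, Finset.sum_eq_zero, sub_zero]
      intro k _
      rw [max_eq_right (by linarith [(hnode k).1]), zero_pow hp0, mul_zero]
    · have h2 : a + τ ≤ s := by
        by_contra h
        exact hs ⟨not_le.1 h1, not_le.1 h⟩
      rw [max_eq_left (by linarith [ht.2])]
      have h3 := hl p hpm ((s - a) / τ) ((t - a) / τ)
      have h4 : ∀ k, max (s - (a + τ * ν k)) 0 ^ p = τ ^ p * ((s - a) / τ - ν k) ^ p := fun k => by
        rw [max_eq_left (by linarith [(hnode k).2]), ← mul_pow]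
        congr 1
        field_simp
        ring
      simp_rw [h4]
      rw [show s - t = τ * ((s - a) / τ - (t - a) / τ) by field_simp; ring, mul_pow, ← h3,
        Finset.mul_sum, ← Finset.sum_sub_distrib]
      exact Finset.sum_eq_zero fun k _ => by ring

end Interpolation

section Sampling

open MeasureTheory in
/-- Stratified random sampling, derandomized: integrals `∫ a r` over finitely many sets are
simultaneously replaced by weighted point evaluations. -/
theorem exists_stratified_sample {ι X : Type} [Fintype ι] [Fintype X] [Nonempty X]
    (I : ι → Set ℝ) (hI : ∀ c, MeasurableSet (I c))
    (a : ι → ℝ → ℝ) (ha : ∀ c, Continuous (a c)) (haI : ∀ c, IntegrableOn (a c) (I c))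
    (hIfin : ∀ c, volume (I c) ≠ ⊤) (hIpos : ∀ c, volume (I c) ≠ 0)
    (r : ι → X → ℝ → ℝ) (hr : ∀ c x, Measurable (r c x)) (e : ι → X → ℝ)
    (he : ∀ c x, ∀ t ∈ I c, |r c x t| ≤ e c x) (η S G H : ℝ) (hη : 0 < η) (hG : 0 < G) (hS : 0 < S)
    (hH : 0 < H)
    (hMS : ∑ c, (∫ t in I c, (|a c t| + η)) ^ 2 ≤ S) (heH : ∀ x, ∑ c, e c x ^ 2 ≤ H) :
    ∃ (n : ι → ℕ) (t : (c : ι) → Fin (n c) → ℝ) (w : (c : ι) → Fin (n c) → ℝ),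
      ((∑ c, n c : ℕ) : ℝ) ≤ Fintype.card ι + G ∧ (∀ c k, t c k ∈ I c) ∧
      (∀ c, ∑ k, |w c k| ≤ ∫ t in I c, (|a c t| + η)) ∧
      ∀ x, |∑ c, (∑ k, w c k * r c x (t c k) - ∫ t in I c, a c t * r c x t)|
        ≤ Real.sqrt (8 * (H * S / G) * Real.log (2 * Fintype.card X)) := by
  classical
  set M : ι → ℝ := fun c => ∫ t in I c, (|a c t| + η) with hM
  have hint : ∀ c, IntegrableOn (fun t => |a c t| + η) (I c) := fun c =>
    ((haI c).abs).add (integrableOn_const (hIfin c))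
  have hMpos : ∀ c, 0 < M c := fun c => by
    have h1 : ∫ t in I c, η ≤ M c :=
      setIntegral_mono_on (integrableOn_const (hIfin c)) (hint c) (hI c)
        fun t _ => by linarith [abs_nonneg (a c t)]
    have h2 : 0 < ∫ t in I c, η := by
      rw [setIntegral_const, smul_eq_mul]
      exact mul_pos (ENNReal.toReal_pos (hIpos c) (hIfin c)) hη
    linarith
  set q : ι → ℝ → ℝ := fun c t => (|a c t| + η) / M c with hq
  have hqcont : ∀ c, Continuous (q c) := fun c => by fun_prop
  have hqpos : ∀ c t, 0 < q c t := fun c t => by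
    have := hMpos c; simp only [hq]; positivity
  set μ : ι → Measure ℝ := fun c =>
    (volume.restrict (I c)).withDensity (fun t => ENNReal.ofReal (q c t)) with hμ
  have hintμ : ∀ c (g : ℝ → ℝ), ∫ t, g t ∂(μ c) = ∫ t in I c, q c t * g t := fun c g => by
    rw [hμ]
    rw [integral_withDensity_eq_integral_toReal_smul (by fun_prop)
      (Filter.Eventually.of_forall fun t => ENNReal.ofReal_lt_top)]
    simp only [ENNReal.toReal_ofReal (hqpos c _).le, smul_eq_mul]
  have hprob : ∀ c, IsProbabilityMeasure (μ c) := fun c => by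
    constructor
    rw [hμ, withDensity_apply _ MeasurableSet.univ, setLIntegral_univ,
      ← ofReal_integral_eq_lintegral_ofReal ((hint c).div_const _)
        (Filter.Eventually.of_forall fun t => (hqpos c t).le)]
    simp only [integral_div]
    rw [div_self (hMpos c).ne', ENNReal.ofReal_one]
  set n : ι → ℕ := fun c => 1 + ⌊M c ^ 2 * G / S⌋₊ with hn
  have hnpos : ∀ c, (0 : ℝ) < n c := fun c => by simp only [hn]; positivity
  have hnlow : ∀ c, M c ^ 2 * G / S ≤ n c := fun c => by
    have := (Nat.lt_floor_add_one (M c ^ 2 * G / S)).le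
    simp only [hn]; push_cast; linarith
  have hnup : ∀ c, (n c : ℝ) ≤ 1 + M c ^ 2 * G / S := fun c => by
    have : (⌊M c ^ 2 * G / S⌋₊ : ℝ) ≤ M c ^ 2 * G / S := Nat.floor_le (by positivity)
    simp only [hn]; push_cast; linarith
  -- the single-sample estimator
  set W : ι → ℝ → ℝ := fun c t => M c / n c * (a c t / (|a c t| + η)) with hW
  have hden : ∀ c t, 0 < |a c t| + η := fun c t => by positivity
  have hWcont : ∀ c, Continuous (W c) := fun c =>
    continuous_const.mul ((ha c).div (by fun_prop) fun t => (hden c t).ne')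
  have hWle : ∀ c t, |W c t| ≤ M c / n c := fun c t => by
    have h1 : |a c t / (|a c t| + η)| ≤ 1 := by
      rw [abs_div, abs_of_pos (hden c t), div_le_one (hden c t)]
      linarith
    have h2 : 0 ≤ M c / n c := (div_pos (hMpos c) (hnpos c)).le
    simp only [hW]
    rw [abs_mul, abs_of_nonneg h2]
    exact mul_le_of_le_one_right h2 h1
  set Z : ι → X → ℝ → ℝ := fun c x t => (I c).indicator (fun t => W c t * r c x t) t with hZ
  have hZmeas : ∀ c x, Measurable (Z c x) := fun c x =>
    ((hWcont c).measurable.mul (hr c x)).indicator (hI c)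
  have he0 : ∀ c x, 0 ≤ e c x := fun c x => by
    obtain ⟨t, ht⟩ := nonempty_of_measure_ne_zero (hIpos c)
    exact (abs_nonneg _).trans (he c x t ht)
  have hZle : ∀ c x t, |Z c x t| ≤ M c / n c * e c x := fun c x t => by
    have h2 : 0 ≤ M c / n c := (div_pos (hMpos c) (hnpos c)).le
    by_cases ht : t ∈ I c
    · simp only [hZ, Set.indicator_of_mem ht, abs_mul]
      exact mul_le_mul (hWle c t) (he c x t ht) (abs_nonneg _) h2
    · simp only [hZ, Set.indicator_of_notMem ht, abs_zero]
      exact mul_nonneg h2 (he0 c x)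
  have hZint : ∀ c x, ∫ t, Z c x t ∂(μ c) = (1 / n c) * ∫ t in I c, a c t * r c x t := by
    intro c x
    rw [hintμ, ← integral_const_mul]
    refine setIntegral_congr_fun (hI c) fun t ht => ?_
    have h1 := (hMpos c).ne'
    have h2 := (hden c t).ne'
    have h3 := (hnpos c).ne'
    simp only [hZ, Set.indicator_of_mem ht, hW, hq]
    field_simp
  have hZintble : ∀ c x, Integrable (Z c x) (μ c) := fun c x =>
    Integrable.of_bound (hZmeas c x).aestronglyMeasurable _
      (Filter.Eventually.of_forall fun t => hZle c x t)
  have hmean_le : ∀ c x, |∫ t, Z c x t ∂(μ c)| ≤ M c / n c * e c x := fun c x => by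
    have := norm_integral_le_of_norm_le_const (μ := μ c)
      (Filter.Eventually.of_forall fun t => hZle c x t : ∀ᵐ t ∂(μ c), ‖Z c x t‖ ≤ _)
    simpa using this
  obtain ⟨t, htI, ht⟩ := exists_forall_abs_sum_le (Finset.univ : Finset (Σ c, Fin (n c)))
    (fun p => μ p.1) (fun p x t => Z p.1 x t - ∫ t, Z p.1 x t ∂(μ p.1))
    (fun p x => 2 * (M p.1 / n p.1 * e p.1 x)) (fun p => I p.1) (4 * (H * S / G))
    (by positivity) (fun p x => (hZmeas p.1 x).sub_const _)
    (fun p x t => (abs_sub _ _).trans (by linarith [hZle p.1 x t, hmean_le p.1 x]))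
    (fun p x => by
      rw [integral_sub (hZintble p.1 x) (integrable_const _)]
      simp)
    (fun p => by
      have : ∀ᵐ t ∂(volume.restrict (I p.1)), t ∈ I p.1 := ae_restrict_mem (hI p.1)
      exact (withDensity_absolutelyContinuous _ _).ae_le this)
    (fun x => by
      rw [Fintype.sum_sigma]
      calc ∑ c, ∑ _k : Fin (n c), (2 * (M c / n c * e c x)) ^ 2
          ≤ ∑ c, 4 * (S / G) * e c x ^ 2 := by
            refine Finset.sum_le_sum fun c _ => ?_
            rw [Finset.sum_const, Finset.card_univ, Fintype.card_fin, nsmul_eq_mul]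
            have h1 : M c ^ 2 / n c ≤ S / G := by
              rw [div_le_div_iff₀ (hnpos c) hG]
              have := hnlow c
              rw [div_le_iff₀ hS] at this
              linarith
            calc (n c : ℝ) * (2 * (M c / n c * e c x)) ^ 2 = 4 * (M c ^ 2 / n c) * e c x ^ 2 := by
                  have := (hnpos c).ne'
                  field_simp
                  ring
              _ ≤ 4 * (S / G) * e c x ^ 2 := by gcongr
        _ = 4 * (S / G) * ∑ c, e c x ^ 2 := by rw [Finset.mul_sum]
        _ ≤ 4 * (S / G) * H := by gcongr; exact heH x
        _ = 4 * (H * S / G) := by ring)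
  refine ⟨n, fun c k => t ⟨c, k⟩, fun c k => W c (t ⟨c, k⟩), ?_, fun c k => htI ⟨c, k⟩
      (Finset.mem_univ _),
    ?_, ?_⟩
  · push_cast
    calc ∑ c, (n c : ℝ) ≤ ∑ c, (1 + M c ^ 2 * G / S) := Finset.sum_le_sum fun c _ => hnup c
      _ = Fintype.card ι + (∑ c, M c ^ 2) * (G / S) := by
          rw [Finset.sum_add_distrib, Finset.sum_mul]
          simp [mul_div_assoc]
      _ ≤ Fintype.card ι + S * (G / S) := by gcongr
      _ = Fintype.card ι + G := by field_simp
  · intro c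
    calc ∑ k : Fin (n c), |W c (t ⟨c, k⟩)| ≤ ∑ _k : Fin (n c), M c / n c :=
          Finset.sum_le_sum fun k _ => hWle c _
      _ = M c := by
          have := (hnpos c).ne'
          simp
          field_simp
  · intro x
    have h := ht x
    rw [show 2 * (4 * (H * S / G)) = 8 * (H * S / G) by ring] at h
    refine le_trans (le_of_eq ?_) h
    congr 1
    rw [Fintype.sum_sigma]
    refine Finset.sum_congr rfl fun c _ => ?_
    rw [Finset.sum_sub_distrib]
    congr 1
    · refine Finset.sum_congr rfl fun k _ => ?_
      simp only [hZ]
      rw [Set.indicator_of_mem (htI ⟨c, k⟩ (Finset.mem_univ _))]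
    · change _ = ∑ _k : Fin (n c), ∫ t, Z c x t ∂(μ c)
      rw [Finset.sum_const, Finset.card_univ, Fintype.card_fin, nsmul_eq_mul, hZint]
      have := (hnpos c).ne'
      field_simp

end Sampling

section Residuals

theorem abs_max_pow_sub_le {p : ℕ} {S u v : ℝ} (hu : |u| ≤ S) (hv : |v| ≤ S) :
    |max u 0 ^ p - max v 0 ^ p| ≤ p * S ^ (p - 1) * |u - v| := by
  have hS : 0 ≤ S := (abs_nonneg u).trans hu
  have h1 := abs_pow_sub_pow_le (max u 0) (max v 0) p
  have h2 : |max u 0 - max v 0| ≤ |u - v| := abs_max_sub_max_le_abs u v 0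
  have h3 : max |max u 0| |max v 0| ≤ S := by
    rw [abs_of_nonneg (le_max_right u 0), abs_of_nonneg (le_max_right v 0)]
    exact max_le (max_le (le_of_abs_le hu) hS) (max_le (le_of_abs_le hv) hS)
  calc _ ≤ |max u 0 - max v 0| * p * max |max u 0| |max v 0| ^ (p - 1) := h1
    _ ≤ |u - v| * p * S ^ (p - 1) := by gcongr
    _ = _ := by ring

theorem abs_dotProduct_le {d : ℕ} {w x : Fin d → ℝ} {B R : ℝ} (hw : ∀ i, |w i| ≤ B)
    (hx : ∀ i, |x i| ≤ R) : |w ⬝ᵥ x| ≤ d * B * R := by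
  calc |w ⬝ᵥ x| ≤ ∑ i, |w i * x i| := Finset.abs_sum_le_sum_abs _ _
    _ ≤ ∑ _i : Fin d, B * R := Finset.sum_le_sum fun i _ => by
        rw [abs_mul]
        exact mul_le_mul (hw i) (hx i) (abs_nonneg _) ((abs_nonneg _).trans (hw i))
    _ = d * B * R := by simp; ring

/-- Every point of the unit cube is within `1 / M` of a grid point. -/
theorem exists_grid_point {d : ℕ} (M : ℕ) (hM : 1 ≤ M) (x : Fin d → ℝ) (hx : x ∈ Set.Icc 0 1) :
    ∃ n : Fin d → Fin (M + 1), ∀ i, |x i - (n i : ℕ) / (M : ℝ)| ≤ 1 / M := by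
  have hM0 : (0 : ℝ) < M := by exact_mod_cast hM
  have h : ∀ i, ∃ n : Fin (M + 1), |x i - (n : ℕ) / (M : ℝ)| ≤ 1 / M := fun i => by
    have h0 : 0 ≤ x i := hx.1 i
    have h1 : x i ≤ 1 := hx.2 i
    have h2 : (⌊x i * M⌋₊ : ℝ) ≤ x i * M := Nat.floor_le (by positivity)
    have h3 : x i * M < ⌊x i * M⌋₊ + 1 := Nat.lt_floor_add_one _
    have h4 : ⌊x i * M⌋₊ < M + 1 := by
      have : (⌊x i * M⌋₊ : ℝ) < M + 1 := by nlinarith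
      exact_mod_cast this
    refine ⟨⟨_, h4⟩, ?_⟩
    have h5 : x i - (⌊x i * M⌋₊ : ℝ) / M = (x i * M - ⌊x i * M⌋₊) / M := by field_simp
    rw [h5, abs_div, abs_of_pos hM0, abs_of_nonneg (by linarith)]
    gcongr
    linarith
  choose n hn using h
  exact ⟨n, hn⟩

end Residuals

section Cells

open MeasureTheory in
theorem sum_setIntegral_cells {T : ℕ} (hT : 1 ≤ T) {T₀ τ : ℝ} (hT₀ : 0 ≤ T₀) (hτ : τ = 2 * T₀ / T)
    {g : ℝ → ℝ} (hg : Continuous g) :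
    ∑ j : Fin T, ∫ t in Set.Ioc (-T₀ + τ * (j : ℕ)) (-T₀ + τ * (j : ℕ) + τ), g t
      = ∫ t in (-T₀)..T₀, g t := by
  have hT0 : (0 : ℝ) < T := by exact_mod_cast hT
  have hτ0 : 0 ≤ τ := by rw [hτ]; positivity
  have h := intervalIntegral.sum_integral_adjacent_intervals (μ := volume) (f := g)
    (a := fun j : ℕ => -T₀ + τ * j) (n := T) (fun k _ => hg.intervalIntegrable _ _)
  have h1 : -T₀ + τ * (0 : ℕ) = -T₀ := by simp
  have h2 : -T₀ + τ * (T : ℕ) = T₀ := by rw [hτ]; field_simp; ring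
  simp only [h1, h2] at h
  rw [← h, ← Fin.sum_univ_eq_sum_range
    (fun j => ∫ t in (-T₀ + τ * (j : ℕ))..(-T₀ + τ * ((j + 1 : ℕ) : ℝ)), g t)]
  refine Finset.sum_congr rfl fun j _ => ?_
  rw [intervalIntegral.integral_of_le (by push_cast; nlinarith)]
  congr 2
  push_cast
  rw [mul_add, mul_one, add_assoc]

open MeasureTheory in
theorem setIntegral_sq_le {l τ : ℝ} (hτ : 0 ≤ τ) {g : ℝ → ℝ} (hg : Continuous g) :
    (∫ t in Set.Ioc l (l + τ), g t) ^ 2 ≤ τ * ∫ t in Set.Ioc l (l + τ), g t ^ 2 := by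
  have hl : l ≤ l + τ := by linarith
  rw [← intervalIntegral.integral_of_le hl, ← intervalIntegral.integral_of_le hl]
  rcases hτ.eq_or_lt with h | h
  · subst h; simp
  set A := ∫ t in l..(l + τ), g t with hA
  have h0 : 0 ≤ ∫ t in l..(l + τ), (g t - A / τ) ^ 2 :=
    intervalIntegral.integral_nonneg hl fun _ _ => sq_nonneg _
  have h1 : ∫ t in l..(l + τ), (g t - A / τ) ^ 2
      = (∫ t in l..(l + τ), g t ^ 2) - A ^ 2 / τ := by
    have : ∀ t, (g t - A / τ) ^ 2 = g t ^ 2 - 2 * (A / τ) * g t + (A / τ) ^ 2 := fun t => by ring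
    simp_rw [this]
    rw [intervalIntegral.integral_add, intervalIntegral.integral_sub,
      intervalIntegral.integral_const_mul, ← hA]
    · simp
      field_simp
      ring
    all_goals exact Continuous.intervalIntegrable (by fun_prop) _ _
  rw [h1] at h0
  have h2 : A ^ 2 = τ * (A ^ 2 / τ) := by field_simp
  rw [h2]
  exact mul_le_mul_of_nonneg_left (by linarith) h.le

/-- A point lies in at most one of the disjoint cells. -/
theorem sum_cell_indicator_le {T : ℕ} {l τ s C : ℝ} (hτ : 0 < τ) (hC : 0 ≤ C) :
    ∑ j : Fin T, (if l + τ * (j : ℕ) < s ∧ s < l + τ * (j : ℕ) + τ then C else 0) ≤ C := by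
  classical
  by_cases h : ∃ j : Fin T, l + τ * (j : ℕ) < s ∧ s < l + τ * (j : ℕ) + τ
  · obtain ⟨j, hj1, hj2⟩ := h
    rw [Finset.sum_eq_single j]
    · rw [if_pos ⟨hj1, hj2⟩]
    · intro i _ hij
      rw [if_neg]
      rintro ⟨h1, h2⟩
      apply hij
      apply Fin.ext
      have h3 : ((i : ℕ) : ℝ) < (j : ℕ) + 1 := by nlinarith
      have h4 : ((j : ℕ) : ℝ) < (i : ℕ) + 1 := by nlinarith
      have h5 : (i : ℕ) < (j : ℕ) + 1 := by exact_mod_cast h3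
      have h6 : (j : ℕ) < (i : ℕ) + 1 := by exact_mod_cast h4
      omega
    · simp
  · push Not at h
    rw [Finset.sum_eq_zero]
    · exact hC
    · intro j _
      rw [if_neg]
      rintro ⟨h1, h2⟩
      linarith [h j h1]

/-- Logarithm of the number of tests in the discretization. -/
theorem log_card_tests_le (O d M : ℕ) (hM : 1 ≤ M) :
    Real.log (2 * ((M + 1) ^ d * (O + 1) : ℕ)) ≤
      (d + (O + 2)) * Real.log (M + 1) := by
  have hM1 : (1 : ℝ) ≤ M := by exact_mod_cast hM
  have h2 : (2 : ℝ) * ((O : ℝ) + 1) ≤ (M + 1) ^ (O + 2) := by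
    have h3 : (O : ℝ) + 1 ≤ 2 ^ (O + 1) := by
      have : O + 1 < 2 ^ (O + 1) := Nat.lt_two_pow_self
      exact_mod_cast this.le
    calc (2 : ℝ) * ((O : ℝ) + 1) ≤ 2 * 2 ^ (O + 1) := by linarith
      _ = 2 ^ (O + 2) := by ring
      _ ≤ (M + 1) ^ (O + 2) := by gcongr; linarith
  have h4 : (2 : ℝ) * ((M + 1) ^ d * (O + 1) : ℕ) ≤ (M + 1) ^ (d + (O + 2)) := by
    push_cast
    rw [pow_add]
    calc (2 : ℝ) * (((M : ℝ) + 1) ^ d * (O + 1)) = (M + 1) ^ d * (2 * (O + 1)) := by ring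
      _ ≤ _ := by gcongr
  calc _ ≤ Real.log ((M + 1 : ℝ) ^ (d + (O + 2))) :=
        Real.log_le_log (by positivity) h4
    _ = _ := by rw [Real.log_pow]; push_cast; ring

end Cells

section RidgeDiscretization

set_option maxHeartbeats 2000000 in
open MeasureTheory in
/-- Simultaneous discretization of ridge integrals `∑ₖ g(ωₖ) ∫ aₖ(t) (ωₖ·x - t)₊ ^ p dt` by the same
finite set of neurons, for finitely many pairs `(p, g)`. -/
theorem exists_ridge_discretization (m d : ℕ) {O : Type} [Fintype O] [Nonempty O]
    (p : O → ℕ) (hp : ∀ o, 1 ≤ p o ∧ p o ≤ m) (g : O → (Fin d → ℝ) → ℝ) (B₀ T₀ : ℝ)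
    (hB₀ : 1 ≤ B₀) (hT₀ : 1 ≤ T₀) (hg : ∀ o w, (∀ i, |w i| ≤ B₀) → |g o w| ≤ B₀) :
    ∃ C : ℝ, 0 < C ∧ ∀ (ι : Type) [Fintype ι] (D E : ℝ) (T M : ℕ), 1 ≤ D →
      (Fintype.card ι : ℝ) ≤ D → 0 < E → 1 ≤ T → 1 ≤ M →
      ∀ (ω : ι → Fin d → ℝ) (a : ι → ℝ → ℝ), (∀ k i, |ω k i| ≤ B₀) → (∀ k, Continuous (a k)) →
      (∑ k, ∫ t in (-T₀)..T₀, a k t ^ 2 ≤ E / D) →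
      ∃ (κ : Type) (_ : Fintype κ) (c : κ → ℝ) (w : κ → Fin d → ℝ) (b : κ → ℝ),
        (Fintype.card κ : ℝ) ≤ C * D * T ∧ (∀ j i, |w j i| ≤ B₀) ∧ (∀ j, |b j| ≤ T₀) ∧
        ∑ j, |c j| ≤ C * √E ∧
        ∀ o, ∀ x ∈ Set.Icc (0 : Fin d → ℝ) 1,
          |∑ j, c j * (g o (w j) * max (w j ⬝ᵥ x - b j) 0 ^ p o)
            - ∑ k, g o (ω k) * ∫ t in (-T₀)..T₀, a k t * max (ω k ⬝ᵥ x - t) 0 ^ p o|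
          ≤ C * √E * (√(Real.log (M + 1)) / (√D * T ^ (p o + 1)) + 1 / M) := by
  classical
  have hm : 1 ≤ m := (hp (Classical.arbitrary O)).1.trans (hp (Classical.arbitrary O)).2
  obtain ⟨B, ν, l, hB, hν, hlc, hlB, hl⟩ := exists_interpolation_weights m hm
  set CR : ℝ := 1 + (m + 1) * B with hCR
  have hCR1 : 1 ≤ CR := by rw [hCR]; nlinarith [(Nat.cast_nonneg m : (0:ℝ) ≤ m)]
  set S : ℝ := d * B₀ + T₀ with hS
  have hS1 : 1 ≤ S := by rw [hS]; nlinarith [(Nat.cast_nonneg d : (0:ℝ) ≤ d)]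
  set CA : ℝ := √(8 * T₀) with hCA
  have hCA0 : 0 ≤ CA := Real.sqrt_nonneg _
  set CW : ℝ := CA * (1 + 2 * (m + 1) * B) with hCW
  set CL : ℝ := (CW + CA) * (B₀ * (m * S ^ m * (d * B₀))) with hCL
  set CN : ℝ := B₀ * (2 * T₀) ^ m * CR * √(64 * T₀) * √(d + (Fintype.card O + 2)) with hCN
  have hCW0 : 0 ≤ CW := by positivity
  have hCL0 : 0 ≤ CL := by positivity
  have hCN0 : 0 ≤ CN := by positivity
  refine ⟨(m + 3) + CW + CL + CN, by positivity, ?_⟩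
  intro ι _ D E T M hD hιD hE hT hM ω a hω ha haE
  have hT0 : (0 : ℝ) < T := by exact_mod_cast hT
  have hM0 : (0 : ℝ) < M := by exact_mod_cast hM
  have hD0 : 0 < D := by linarith
  set τ : ℝ := 2 * T₀ / T with hτ
  have hτ0 : 0 < τ := by positivity
  set η : ℝ := √(E / (2 * T₀ * D ^ 2)) with hη
  have hη0 : 0 < η := Real.sqrt_pos.2 (by positivity)
  have hη2 : η ^ 2 = E / (2 * T₀ * D ^ 2) := Real.sq_sqrt (by positivity)
  set lo : ι × Fin T → ℝ := fun c => -T₀ + τ * (c.2 : ℕ) with hlo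
  set I : ι × Fin T → Set ℝ := fun c => Set.Ioc (lo c) (lo c + τ) with hI
  have hloT : ∀ c, -T₀ ≤ lo c ∧ lo c + τ ≤ T₀ := fun c => by
    have h1 : ((c.2 : ℕ) : ℝ) + 1 ≤ T := by exact_mod_cast c.2.2
    have h2 : τ * T = 2 * T₀ := by rw [hτ]; field_simp
    simp only [hlo]
    constructor
    · have : 0 ≤ τ * (c.2 : ℕ) := by positivity
      linarith
    · nlinarith
  have hIint : ∀ c {f : ℝ → ℝ}, Continuous f → IntegrableOn f (I c) := fun c f hf =>
    (hf.integrableOn_Icc (a := lo c) (b := lo c + τ)).mono_set Set.Ioc_subset_Icc_self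
  set x' : (Fin d → Fin (M + 1)) → Fin d → ℝ := fun n i => (n i : ℕ) / (M : ℝ) with hx'
  set R : ℕ → ι × Fin T → ℝ → ℝ → ℝ := fun p c s t =>
    max (s - t) 0 ^ p - ∑ q, l q ((t - lo c) / τ) * max (s - (lo c + τ * ν q)) 0 ^ p with hR
  have hRc : ∀ p c s, Continuous (R p c s) := fun p c s => by
    refine Continuous.sub (by fun_prop) (continuous_finsetSum _ fun q _ => ?_)
    exact ((hlc q).comp (by fun_prop)).mul continuous_const
  set M' : ι × Fin T → ℝ := fun c => ∫ t in I c, (|a c.1 t| + η) with hM'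
  have hM'sq : ∑ c, M' c ^ 2 ≤ 4 * τ * E / D := by
    calc ∑ c, M' c ^ 2 ≤ ∑ c : ι × Fin T, τ * ∫ t in I c, (|a c.1 t| + η) ^ 2 :=
          Finset.sum_le_sum fun c _ => setIntegral_sq_le hτ0.le
            (((ha c.1).abs).add continuous_const)
      _ = ∑ k, τ * ∫ t in (-T₀)..T₀, (|a k t| + η) ^ 2 := by
          rw [Fintype.sum_prod_type]
          refine Finset.sum_congr rfl fun k _ => ?_
          rw [← Finset.mul_sum]
          congr 1
          exact sum_setIntegral_cells hT (by linarith) hτ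
            ((((ha k).abs).add continuous_const).pow 2)
      _ ≤ ∑ k, τ * (2 * (∫ t in (-T₀)..T₀, a k t ^ 2) + 4 * T₀ * η ^ 2) := by
          refine Finset.sum_le_sum fun k _ => mul_le_mul_of_nonneg_left ?_ hτ0.le
          have h1 : ∫ t in (-T₀)..T₀, (2 * a k t ^ 2 + 2 * η ^ 2)
              = 2 * (∫ t in (-T₀)..T₀, a k t ^ 2) + 4 * T₀ * η ^ 2 := by
            rw [intervalIntegral.integral_add, intervalIntegral.integral_const_mul]
            · simp; ring
            all_goals
              have := ha k
              exact Continuous.intervalIntegrable (by fun_prop) _ _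
          rw [← h1]
          have := ha k
          refine intervalIntegral.integral_mono_on (by linarith)
            (Continuous.intervalIntegrable (by fun_prop) _ _)
            (Continuous.intervalIntegrable (by fun_prop) _ _) fun t _ => ?_
          nlinarith [sq_nonneg (|a k t| - η), sq_abs (a k t)]
      _ = τ * (2 * (∑ k, ∫ t in (-T₀)..T₀, a k t ^ 2) + Fintype.card ι * (4 * T₀ * η ^ 2)) := by
          rw [← Finset.mul_sum, Finset.sum_add_distrib, ← Finset.mul_sum]
          simp
      _ ≤ τ * (2 * (E / D) + D * (4 * T₀ * η ^ 2)) := by gcongr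
      _ = 4 * τ * E / D := by
          rw [hη2]
          field_simp
          ring
  have hM'0 : ∀ c, 0 ≤ M' c := fun c =>
    setIntegral_nonneg measurableSet_Ioc fun t _ => by positivity
  have hcells : (Fintype.card (ι × Fin T) : ℝ) ≤ D * T := by
    rw [Fintype.card_prod, Fintype.card_fin]
    push_cast
    gcongr
  have hM'sum : ∑ c, M' c ≤ CA * √E := by
    rw [hCA, ← Real.sqrt_mul (by positivity)]
    refine Real.le_sqrt_of_sq_le ?_
    calc (∑ c, M' c) ^ 2 ≤ Fintype.card (ι × Fin T) * ∑ c, M' c ^ 2 := by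
          exact_mod_cast sq_sum_le_card_mul_sum_sq (s := Finset.univ) (f := M')
      _ ≤ D * T * (4 * τ * E / D) := by gcongr
      _ = 8 * T₀ * E := by rw [hτ]; field_simp; ring
  obtain ⟨n, t, w, hn, htI, hw, happ⟩ := exists_stratified_sample
    (X := (Fin d → Fin (M + 1)) × O) I
    (fun c => measurableSet_Ioc) (fun c => a c.1) (fun c => ha c.1)
    (fun c => hIint c (ha c.1)) (fun c => by simp [hI]) (fun c => by simp [hI, hτ0])
    (fun c z t => g z.2 (ω c.1) / B₀ * (R (p z.2) c (ω c.1 ⬝ᵥ x' z.1) t / τ ^ p z.2))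
    (fun c z => (continuous_const.mul ((hRc _ _ _).div_const _)).measurable)
    (fun c z => if lo c < ω c.1 ⬝ᵥ x' z.1 ∧ ω c.1 ⬝ᵥ x' z.1 < lo c + τ then CR else 0)
    (fun c z t ht => by
      have h1 := abs_interpolation_residual_le hB hν hlB hl (hp z.2).1 (hp z.2).2 (a := lo c)
        (s := ω c.1 ⬝ᵥ x' z.1) hτ0 (Set.Ioc_subset_Icc_self ht)
      have h2 : |g z.2 (ω c.1) / B₀| ≤ 1 := by
        rw [abs_div, abs_of_pos (by linarith : 0 < B₀)]
        exact (div_le_one (by linarith)).2 (hg _ _ (hω c.1))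
      rw [abs_mul]
      refine (mul_le_of_le_one_left (abs_nonneg _) h2).trans ?_
      rw [abs_div, abs_of_pos (by positivity : 0 < τ ^ p z.2), div_le_iff₀ (by positivity)]
      refine h1.trans (le_of_eq ?_)
      split_ifs <;> simp [hCR])
    η (4 * τ * E / D) (D * T) (CR ^ 2 * D) hη0 (by positivity) (by positivity) (by positivity)
    hM'sq
    (fun z => by
      rw [Fintype.sum_prod_type]
      calc _ ≤ ∑ _k : ι, CR ^ 2 := by
            refine Finset.sum_le_sum fun k _ => ?_
            refine le_trans (le_of_eq ?_) (sum_cell_indicator_le (T := T) (l := -T₀) (τ := τ)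
              (s := ω k ⬝ᵥ x' z.1) (C := CR ^ 2) hτ0 (by positivity))
            refine Finset.sum_congr rfl fun j _ => ?_
            simp only [hlo]
            split_ifs <;> simp
        _ = CR ^ 2 * Fintype.card ι := by simp [mul_comm]
        _ ≤ CR ^ 2 * D := by gcongr)
  set β : ι × Fin T → Fin (m + 1) → ℝ := fun c q =>
    (∫ t in I c, a c.1 t * l q ((t - lo c) / τ)) - ∑ k, w c k * l q ((t c k - lo c) / τ) with hβ
  have hu : ∀ c, ∀ t ∈ I c, (t - lo c) / τ ∈ Set.Icc (0 : ℝ) 1 := fun c t ht =>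
    ⟨div_nonneg (by linarith [ht.1]) hτ0.le, (div_le_one hτ0).2 (by linarith [ht.2])⟩
  have hlc' : ∀ c q, Continuous fun t => l q ((t - lo c) / τ) := fun c q =>
    (hlc q).comp (by fun_prop)
  have hβle : ∀ c q, |β c q| ≤ 2 * B * M' c := fun c q => by
    have h1 : |∫ t in I c, a c.1 t * l q ((t - lo c) / τ)| ≤ B * M' c := by
      rw [hM', ← integral_const_mul]
      refine (abs_integral_le_integral_abs).trans (setIntegral_mono_on
        (hIint c ((ha c.1).mul (hlc' c q)).abs)
        (hIint c (continuous_const.mul ((ha c.1).abs.add continuous_const)))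
        measurableSet_Ioc fun t ht => ?_)
      rw [abs_mul]
      rw [mul_comm]
      exact mul_le_mul (hlB q _ (hu c t ht)) (by linarith) (abs_nonneg _) (by linarith)
    have h2 : |∑ k, w c k * l q ((t c k - lo c) / τ)| ≤ B * M' c := by
      calc _ ≤ ∑ k, |w c k * l q ((t c k - lo c) / τ)| := Finset.abs_sum_le_sum_abs _ _
        _ ≤ ∑ k, B * |w c k| := Finset.sum_le_sum fun k _ => by
            rw [abs_mul, mul_comm]
            exact mul_le_mul_of_nonneg_right (hlB q _ (hu c _ (htI c k))) (abs_nonneg _)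
        _ = B * ∑ k, |w c k| := by rw [Finset.mul_sum]
        _ ≤ B * M' c := mul_le_mul_of_nonneg_left (hw c) (by linarith)
    exact (abs_sub _ _).trans (by linarith)
  set cN : (Σ c : ι × Fin T, Fin (n c)) ⊕ ((ι × Fin T) × Fin (m + 1)) → ℝ :=
    Sum.elim (fun z => w z.1 z.2) (fun z => β z.1 z.2) with hcN
  set wN : (Σ c : ι × Fin T, Fin (n c)) ⊕ ((ι × Fin T) × Fin (m + 1)) → Fin d → ℝ :=
    Sum.elim (fun z => ω z.1.1) (fun z => ω z.1.1) with hwN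
  set bN : (Σ c : ι × Fin T, Fin (n c)) ⊕ ((ι × Fin T) × Fin (m + 1)) → ℝ :=
    Sum.elim (fun z => t z.1 z.2) (fun z => lo z.1 + τ * ν z.2) with hbN
  have hwle : ∀ j i, |wN j i| ≤ B₀ := by rintro (z | z) i <;> exact hω _ _
  have hble : ∀ j, |bN j| ≤ T₀ := by
    rintro (z | z)
    · have := htI z.1 z.2
      exact abs_le.2 ⟨by simp only [hbN, Sum.elim_inl]; linarith [this.1, (hloT z.1).1],
        by simp only [hbN, Sum.elim_inl]; linarith [this.2, (hloT z.1).2]⟩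
    · have := hν z.2
      exact abs_le.2 ⟨by simp only [hbN, Sum.elim_inr]; nlinarith [this.1, (hloT z.1).1],
        by simp only [hbN, Sum.elim_inr]; nlinarith [this.2, (hloT z.1).2]⟩
  have hcsum : ∑ j, |cN j| ≤ CW * √E := by
    rw [Fintype.sum_sum_type, Fintype.sum_sigma,
      Fintype.sum_prod_type (f := fun z => |cN (Sum.inr z)|)]
    calc _ ≤ ∑ c, M' c + ∑ c, ∑ _q : Fin (m + 1), 2 * B * M' c :=
          add_le_add (Finset.sum_le_sum fun c _ => hw c)
            (Finset.sum_le_sum fun c _ => Finset.sum_le_sum fun q _ => hβle c q)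
      _ = (1 + 2 * (m + 1) * B) * ∑ c, M' c := by
          simp only [Finset.sum_const, Finset.card_univ, Fintype.card_fin, nsmul_eq_mul,
            ← Finset.mul_sum]
          push_cast
          ring
      _ ≤ (1 + 2 * (m + 1) * B) * (CA * √E) := by gcongr
      _ = CW * √E := by rw [hCW]; ring
  have hasum : ∑ k, ∫ t in (-T₀)..T₀, |a k t| ≤ CA * √E := by
    refine le_trans ?_ hM'sum
    rw [Fintype.sum_prod_type]
    refine Finset.sum_le_sum fun k _ => ?_
    rw [← sum_setIntegral_cells hT (by linarith) hτ (ha k).abs]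
    exact Finset.sum_le_sum fun j _ => setIntegral_mono_on (hIint (k, j) (ha k).abs)
      (hIint (k, j) ((ha k).abs.add continuous_const)) measurableSet_Ioc
      fun t _ => by simp [hη0.le]
  -- the error functional
  set F : O → (Fin d → ℝ) → ℝ := fun o x =>
    ∑ j, cN j * (g o (wN j) * max (wN j ⬝ᵥ x - bN j) 0 ^ p o)
      - ∑ k, g o (ω k) * ∫ t in (-T₀)..T₀, a k t * max (ω k ⬝ᵥ x - t) 0 ^ p o with hF
  have hFeq : ∀ o x, F o x = ∑ c, g o (ω c.1) * (∑ k, w c k * R (p o) c (ω c.1 ⬝ᵥ x) (t c k)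
      - ∫ t in I c, a c.1 t * R (p o) c (ω c.1 ⬝ᵥ x) t) := fun o x => by
    have h1 : ∑ k, g o (ω k) * ∫ t in (-T₀)..T₀, a k t * max (ω k ⬝ᵥ x - t) 0 ^ p o
        = ∑ c : ι × Fin T, g o (ω c.1) * ∫ t in I c, a c.1 t * max (ω c.1 ⬝ᵥ x - t) 0 ^ p o := by
      rw [Fintype.sum_prod_type]
      refine Finset.sum_congr rfl fun k _ => ?_
      change _ = ∑ y : Fin T, g o (ω k) * ∫ t in I (k, y), a k t * max (ω k ⬝ᵥ x - t) 0 ^ p o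
      rw [← Finset.mul_sum]
      congr 1
      have := ha k
      exact (sum_setIntegral_cells hT (by linarith) hτ (by fun_prop)).symm
    simp only [hF]
    rw [h1, Fintype.sum_sum_type, Fintype.sum_sigma,
      Fintype.sum_prod_type (f := fun z => cN (Sum.inr z) * _), ← Finset.sum_add_distrib,
      ← Finset.sum_sub_distrib]
    refine Finset.sum_congr rfl fun c _ => ?_
    simp only [hcN, hwN, hbN, Sum.elim_inl, Sum.elim_inr]
    have h2 : ∫ t in I c, a c.1 t * R (p o) c (ω c.1 ⬝ᵥ x) t
        = (∫ t in I c, a c.1 t * max (ω c.1 ⬝ᵥ x - t) 0 ^ p o)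
          - ∑ q, (∫ t in I c, a c.1 t * l q ((t - lo c) / τ)) *
            max (ω c.1 ⬝ᵥ x - (lo c + τ * ν q)) 0 ^ p o := by
      simp_rw [← integral_mul_const]
      have hac := ha c.1
      have h3 : ∀ q, Continuous fun t => a c.1 t * l q ((t - lo c) / τ) *
          max (ω c.1 ⬝ᵥ x - (lo c + τ * ν q)) 0 ^ p o := fun q =>
        (hac.mul (hlc' c q)).mul continuous_const
      rw [← integral_finsetSum _ fun q _ => hIint c (h3 q),
        ← integral_sub (hIint c (by fun_prop)) (hIint c (continuous_finsetSum _ fun q _ => h3 q))]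
      congr 1
      ext t
      simp only [hR, mul_sub, Finset.mul_sum]
      congr 1
      exact Finset.sum_congr rfl fun q _ => by ring
    rw [h2]
    simp only [hβ, hR, mul_sub, sub_mul, Finset.sum_sub_distrib, Finset.mul_sum, Finset.sum_mul]
    rw [Finset.sum_comm (s := (Finset.univ : Finset (Fin (n c))))]
    have e1 : ∀ u v : ℝ, u * (g o (ω c.1) * v) = g o (ω c.1) * (u * v) := fun u v => by ring
    simp only [e1, mul_assoc]
    ring
  have hnet : ∀ o n, |F o (x' n)| ≤ CN * √E * (√(Real.log (M + 1)) / (√D * T ^ (p o + 1))) := by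
    intro o n
    have h1 := happ (n, o)
    have h2 : F o (x' n) = B₀ * τ ^ p o * ∑ c, (∑ k, w c k * (g o (ω c.1) / B₀ *
        (R (p o) c (ω c.1 ⬝ᵥ x' n) (t c k) / τ ^ p o)) - ∫ t in I c, a c.1 t * (g o (ω c.1) / B₀ *
        (R (p o) c (ω c.1 ⬝ᵥ x' n) t / τ ^ p o))) := by
      rw [hFeq, Finset.mul_sum]
      refine Finset.sum_congr rfl fun c _ => ?_
      rw [mul_sub, mul_sub, ← integral_const_mul, ← integral_const_mul, Finset.mul_sum,
        Finset.mul_sum]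
      have hB0 : B₀ ≠ 0 := by linarith
      congr 1
      · exact Finset.sum_congr rfl fun k _ => by field_simp
      · congr 1
        ext t
        field_simp
    rw [h2, abs_mul, abs_of_pos (by positivity)]
    refine (mul_le_mul_of_nonneg_left h1 (by positivity)).trans ?_
    have hcard : (Fintype.card ((Fin d → Fin (M + 1)) × O) : ℝ)
        ≤ ((M + 1) ^ d * (Fintype.card O + 1) : ℕ) := by
      rw [Fintype.card_prod]
      simp only [Fintype.card_pi, Fintype.card_fin, Finset.prod_const, Finset.card_univ]
      push_cast
      gcongr
      linarith
    have hlog : Real.log (2 * Fintype.card ((Fin d → Fin (M + 1)) × O)) ≤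
        (d + (Fintype.card O + 2)) * Real.log (M + 1) :=
      (Real.log_le_log (by positivity) (by linarith)).trans
        (log_card_tests_le (Fintype.card O) d M hM)
    have hlogM : 0 ≤ Real.log (M + 1) := Real.log_nonneg (by linarith)
    have hsq : √(8 * (CR ^ 2 * D * (4 * τ * E / D) / (D * T)) *
        Real.log (2 * Fintype.card ((Fin d → Fin (M + 1)) × O)))
        ≤ CR * √(64 * T₀) * √(d + (Fintype.card O + 2)) * √E * √(Real.log (M + 1)) / (√D * T) := by
      refine Real.sqrt_le_iff.2 ⟨by positivity, ?_⟩
      rw [div_pow, mul_pow, mul_pow, mul_pow, mul_pow, mul_pow, Real.sq_sqrt (by positivity),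
        Real.sq_sqrt (by positivity), Real.sq_sqrt hE.le, Real.sq_sqrt hlogM, Real.sq_sqrt hD0.le]
      calc _ ≤ 8 * (CR ^ 2 * D * (4 * τ * E / D) / (D * T)) *
            ((d + (Fintype.card O + 2)) * Real.log (M + 1)) := by gcongr
        _ = _ := by rw [hτ]; field_simp; ring
    refine (mul_le_mul_of_nonneg_left hsq (by positivity)).trans ?_
    have hτp : τ ^ p o ≤ (2 * T₀) ^ m / T ^ p o := by
      rw [hτ, div_pow]
      gcongr
      · linarith
      · exact (hp o).2
    calc B₀ * τ ^ p o * (CR * √(64 * T₀) * √(d + (Fintype.card O + 2)) * √E *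
          √(Real.log (M + 1)) / (√D * T))
        ≤ B₀ * ((2 * T₀) ^ m / T ^ p o) * (CR * √(64 * T₀) * √(d + (Fintype.card O + 2)) * √E *
          √(Real.log (M + 1)) / (√D * T)) := by gcongr
      _ = _ := by
        rw [hCN, pow_succ]
        field_simp
  have hLip : ∀ o, ∀ x ∈ Set.Icc (0 : Fin d → ℝ) 1, ∀ y ∈ Set.Icc (0 : Fin d → ℝ) 1,
      (∀ i, |x i - y i| ≤ 1 / M) → |F o x - F o y| ≤ CL * √E * (1 / M) := by
    intro o x hx y hy hxy
    set Q : ℝ := m * S ^ m * (d * B₀ * (1 / M)) with hQ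
    have hσ : ∀ (v : Fin d → ℝ) (b : ℝ), (∀ i, |v i| ≤ B₀) → |b| ≤ T₀ →
        |max (v ⬝ᵥ x - b) 0 ^ p o - max (v ⬝ᵥ y - b) 0 ^ p o| ≤ Q := by
      intro v b hv hb
      have hcube : ∀ z ∈ Set.Icc (0 : Fin d → ℝ) 1, |v ⬝ᵥ z - b| ≤ S := fun z hz => by
        have := abs_dotProduct_le hv (R := 1) (x := z)
          fun i => abs_le.2 ⟨by linarith [show 0 ≤ z i from hz.1 i], hz.2 i⟩
        refine (abs_sub _ _).trans ?_
        rw [hS]; linarith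
      refine (abs_max_pow_sub_le (hcube x hx) (hcube y hy)).trans ?_
      have h1 : |v ⬝ᵥ x - b - (v ⬝ᵥ y - b)| ≤ d * B₀ * (1 / M) := by
        rw [sub_sub_sub_cancel_right, ← dotProduct_sub]
        exact abs_dotProduct_le hv fun i => hxy i
      have h2 : (p o : ℝ) ≤ m := by exact_mod_cast (hp o).2
      have h3 : S ^ (p o - 1) ≤ S ^ m := pow_le_pow_right₀ hS1 (by have := (hp o).2; omega)
      rw [hQ]
      gcongr
    have hQ0 : 0 ≤ Q := by positivity
    have h1 : |∑ j, cN j * (g o (wN j) * max (wN j ⬝ᵥ x - bN j) 0 ^ p o)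
        - ∑ j, cN j * (g o (wN j) * max (wN j ⬝ᵥ y - bN j) 0 ^ p o)| ≤ CW * √E * (B₀ * Q) := by
      rw [← Finset.sum_sub_distrib]
      calc _ ≤ ∑ j, |cN j| * (B₀ * Q) := by
            refine (Finset.abs_sum_le_sum_abs _ _).trans (Finset.sum_le_sum fun j _ => ?_)
            rw [← mul_sub, ← mul_sub, abs_mul, abs_mul]
            gcongr
            · exact hg _ _ (hwle j)
            · exact hσ _ _ (hwle j) (hble j)
        _ ≤ CW * √E * (B₀ * Q) := by
            rw [← Finset.sum_mul]
            gcongr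
    have h2 : |∑ k, g o (ω k) * (∫ t in (-T₀)..T₀, a k t * max (ω k ⬝ᵥ x - t) 0 ^ p o)
        - ∑ k, g o (ω k) * ∫ t in (-T₀)..T₀, a k t * max (ω k ⬝ᵥ y - t) 0 ^ p o|
        ≤ CA * √E * (B₀ * Q) := by
      rw [← Finset.sum_sub_distrib]
      calc _ ≤ ∑ k, (∫ t in (-T₀)..T₀, |a k t|) * (B₀ * Q) := by
            refine (Finset.abs_sum_le_sum_abs _ _).trans (Finset.sum_le_sum fun k _ => ?_)
            have hak := ha k
            rw [← mul_sub, abs_mul, ← intervalIntegral.integral_sub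
              (Continuous.intervalIntegrable (by fun_prop) _ _)
              (Continuous.intervalIntegrable (by fun_prop) _ _)]
            have h3 : |∫ t in (-T₀)..T₀, (a k t * max (ω k ⬝ᵥ x - t) 0 ^ p o
                - a k t * max (ω k ⬝ᵥ y - t) 0 ^ p o)| ≤ (∫ t in (-T₀)..T₀, |a k t|) * Q := by
              rw [← intervalIntegral.integral_mul_const]
              refine (intervalIntegral.abs_integral_le_integral_abs (by linarith)).trans
                (intervalIntegral.integral_mono_on (by linarith)
                (Continuous.intervalIntegrable (by fun_prop) _ _)
                (Continuous.intervalIntegrable (by fun_prop) _ _) fun t ht => ?_)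
              rw [← mul_sub, abs_mul]
              gcongr
              exact hσ _ _ (hω k) (abs_le.2 ⟨ht.1, ht.2⟩)
            have h4 : 0 ≤ ∫ t in (-T₀)..T₀, |a k t| :=
              intervalIntegral.integral_nonneg (by linarith) fun _ _ => abs_nonneg _
            calc _ ≤ B₀ * ((∫ t in (-T₀)..T₀, |a k t|) * Q) :=
                  mul_le_mul (hg _ _ (hω k)) h3 (abs_nonneg _) (by linarith)
              _ = _ := by ring
        _ ≤ CA * √E * (B₀ * Q) := by
            rw [← Finset.sum_mul]
            gcongr
    simp only [hF]
    rw [show ∀ p q r s : ℝ, p - q - (r - s) = (p - r) - (q - s) by intros; ring]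
    refine (abs_sub _ _).trans ((add_le_add h1 h2).trans (le_of_eq ?_))
    rw [hCL, hQ]
    ring
  refine ⟨_, inferInstance, cN, wN, bN, ?_, hwle, hble, hcsum.trans ?_, ?_⟩
  · rw [Fintype.card_sum, Fintype.card_sigma, Fintype.card_prod, Fintype.card_fin]
    simp only [Fintype.card_fin]
    push_cast at hn hcells ⊢
    have hDT : 0 < D * T := by positivity
    calc _ ≤ (D * T + D * T) + D * T * (m + 1) := by
          gcongr
          linarith
      _ = (m + 3) * (D * T) := by ring
      _ ≤ (m + 3 + CW + CL + CN) * (D * T) :=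
          mul_le_mul_of_nonneg_right (by linarith) hDT.le
      _ = _ := by ring
  · gcongr
    have : (0 : ℝ) ≤ m := Nat.cast_nonneg m
    linarith
  · intro o x hx
    obtain ⟨n, hn⟩ := exists_grid_point M hM x hx
    have hn1 : x' n ∈ Set.Icc (0 : Fin d → ℝ) 1 := by
      refine ⟨fun i => ?_, fun i => ?_⟩
      · simp only [hx', Pi.zero_apply]; positivity
      · simp only [hx', Pi.one_apply]
        rw [div_le_one hM0]
        exact_mod_cast Nat.lt_succ_iff.1 (n i).2
    have h1 := hLip o x hx (x' n) hn1 hn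
    have h2 := hnet o n
    change |F o x| ≤ _
    have h3 : |F o x| ≤ |F o x - F o (x' n)| + |F o (x' n)| := by
      have := abs_add_le (F o x - F o (x' n)) (F o (x' n))
      simpa using this
    have hm0 : (0 : ℝ) ≤ m := Nat.cast_nonneg m
    calc |F o x| ≤ CL * √E * (1 / M) + CN * √E * (√(Real.log (M + 1)) / (√D * T ^ (p o + 1))) :=
          h3.trans (add_le_add h1 h2)
      _ ≤ (m + 3 + CW + CL + CN) * √E * (1 / M) + (m + 3 + CW + CL + CN) * √E *
          (√(Real.log (M + 1)) / (√D * T ^ (p o + 1))) := by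
          gcongr <;> linarith
      _ = _ := by ring

end RidgeDiscretization

section TruncatedPowers

open MeasureTheory

/-- Taylor's formula with integral remainder at a point where the whole jet vanishes, written with
a truncated power kernel. -/
theorem eq_integral_mul_max_pow {g : ℝ → ℝ} {n : ℕ} (hn : 1 ≤ n) (hg : ContDiff ℝ (⊤ : ℕ∞) g)
    {T s : ℝ} (h0 : ∀ l, iteratedDeriv l g (-T) = 0) (hs : -T ≤ s) (hsT : s ≤ T) :
    g s = ∫ t in (-T)..T, iteratedDeriv (n + 1) g t / (n.factorial : ℝ) * max (s - t) 0 ^ n := by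
  have hcd : ∀ l, Continuous (iteratedDeriv l g) := fun l =>
    hg.continuous_iteratedDeriv l (by exact_mod_cast le_top)
  have hint : ∀ a b : ℝ, IntervalIntegrable
      (fun t => iteratedDeriv (n + 1) g t / (n.factorial : ℝ) * max (s - t) 0 ^ n) volume a b := by
    intro a b
    apply Continuous.intervalIntegrable
    have := hcd (n + 1)
    fun_prop
  rw [← intervalIntegral.integral_add_adjacent_intervals (hint (-T) s) (hint s T)]
  have h2 : (∫ t in s..T, iteratedDeriv (n + 1) g t / (n.factorial : ℝ) * max (s - t) 0 ^ n)
      = 0 := by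
    rw [intervalIntegral.integral_congr (g := fun _ => (0 : ℝ))]
    · simp
    · intro t ht
      rw [Set.uIcc_of_le hsT] at ht
      simp only
      rw [max_eq_right (by linarith [ht.1]), zero_pow (by omega), mul_zero]
  rw [h2, add_zero]
  rcases hs.eq_or_lt with rfl | hlt
  · simp only [intervalIntegral.integral_same]
    simpa using h0 0
  have hgn : ContDiff ℝ ((n + 1 : ℕ) : ℕ∞) g := hg.of_le (by exact_mod_cast le_top)
  have key := taylor_integral_remainder (f := g) (x := s) (x₀ := -T) (n := n)
    (by exact_mod_cast hgn.contDiffOn)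
  rw [Set.uIcc_of_le hs] at key
  have hud : UniqueDiffOn ℝ (Set.Icc (-T) s) := uniqueDiffOn_Icc hlt
  have hw : ∀ l, ∀ t ∈ Set.Icc (-T) s,
      iteratedDerivWithin l g (Set.Icc (-T) s) t = iteratedDeriv l g t := fun l t ht =>
    iteratedDerivWithin_eq_iteratedDeriv hud
      ((hg.of_le (by exact_mod_cast le_top)).contDiffAt) ht
  have htay : taylorWithinEval g n (Set.Icc (-T) s) (-T) s = 0 := by
    rw [taylor_within_apply]
    refine Finset.sum_eq_zero fun l _ => ?_
    rw [hw l _ ⟨le_rfl, hs⟩, h0, smul_zero]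
  rw [htay, sub_zero] at key
  rw [key]
  refine intervalIntegral.integral_congr fun t ht => ?_
  rw [Set.uIcc_of_le hs] at ht
  simp only [smul_eq_mul]
  rw [hw _ t ht, max_eq_left (by linarith [ht.2])]
  ring

/-- A smooth function on an interval is a superposition of truncated powers, with an `L²` density
controlled by its derivatives up to order `m + 1`. -/
theorem exists_truncatedPower_representation (m : ℕ) (hm : 2 ≤ m) (T : ℝ) (hT : 1 < T) :
    ∃ C : ℝ, 0 < C ∧ ∀ P : ℝ → ℝ, ContDiff ℝ (⊤ : ℕ∞) P → ∃ a : ℝ → ℝ, Continuous a ∧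
      (∀ s, |s| ≤ T - 1 → P s = ∫ t in (-T)..T, a t * max (s - t) 0 ^ m) ∧
      (∀ s, |s| ≤ T - 1 →
        deriv P s = m * ∫ t in (-T)..T, a t * max (s - t) 0 ^ (m - 1)) ∧
      ∫ t in (-T)..T, a t ^ 2 ≤
        C * ∑ l ∈ Finset.range (m + 2), ∫ t in (-T)..T, iteratedDeriv l P t ^ 2 := by
  let ζ : ContDiffBump (0 : ℝ) := ⟨T - 1 / 2, T - 1 / 4, by linarith, by linarith⟩
  have hζ : ContDiff ℝ (⊤ : ℕ∞) (ζ : ℝ → ℝ) := ζ.contDiff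
  have hζc : ∀ l, Continuous (iteratedDeriv l (ζ : ℝ → ℝ)) := fun l =>
    hζ.continuous_iteratedDeriv l (by exact_mod_cast le_top)
  have hbd : ∀ l, ∃ B : ℝ, 0 < B ∧ ∀ t ∈ Set.Icc (-T) T, |iteratedDeriv l (ζ : ℝ → ℝ) t| ≤ B := by
    intro l
    obtain ⟨B, hB⟩ := isCompact_Icc.exists_bound_of_continuousOn
      ((hζc l).continuousOn (s := Set.Icc (-T) T))
    exact ⟨max B 1, by positivity, fun t ht => (hB t ht).trans (le_max_left _ _)⟩
  choose B hB0 hB using hbd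
  set S : ℝ := ∑ l ∈ Finset.range (m + 2), (((m + 1).choose l : ℝ) * B (m + 1 - l)) ^ 2 with hS
  refine ⟨S + 1, by positivity, fun P hP => ?_⟩
  set G : ℝ → ℝ := (ζ : ℝ → ℝ) * P with hG
  have hGs : ContDiff ℝ (⊤ : ℕ∞) G := hζ.mul hP
  have hGc : ∀ l, Continuous (iteratedDeriv l G) := fun l =>
    hGs.continuous_iteratedDeriv l (by exact_mod_cast le_top)
  have hPc : ∀ l, Continuous (iteratedDeriv l P) := fun l =>
    hP.continuous_iteratedDeriv l (by exact_mod_cast le_top)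
  have hG0 : ∀ l, iteratedDeriv l G (-T) = 0 := by
    intro l
    have hev : G =ᶠ[nhds (-T)] fun _ => (0 : ℝ) := by
      have : ∀ᶠ t in nhds (-T), t < -(T - 1 / 4) := eventually_lt_nhds (by linarith)
      filter_upwards [this] with t ht
      have : (ζ : ℝ → ℝ) t = 0 := by
        apply ζ.zero_of_le_dist
        rw [Real.dist_eq, sub_zero, abs_of_neg (by linarith)]
        change T - 1 / 4 ≤ -t
        linarith
      simp [hG, this]
    rw [hev.iteratedDeriv_eq l]
    simp
  have hGP : ∀ s, |s| ≤ T - 1 → G =ᶠ[nhds s] P := by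
    intro s hs
    have : ∀ᶠ t in nhds s, |t| < T - 1 / 2 :=
      (continuous_abs.continuousAt).eventually_lt continuousAt_const (by linarith)
    filter_upwards [this] with t ht
    have : (ζ : ℝ → ℝ) t = 1 := by
      apply ζ.one_of_mem_closedBall
      rw [Metric.mem_closedBall, Real.dist_eq, sub_zero]
      exact ht.le
    simp [hG, this]
  refine ⟨fun t => iteratedDeriv (m + 1) G t / (m.factorial : ℝ), (hGc _).div_const _, ?_, ?_, ?_⟩
  · intro s hs
    rw [← (hGP s hs).eq_of_nhds]
    have := abs_le.1 hs
    exact eq_integral_mul_max_pow (by omega) hGs hG0 (by linarith) (by linarith)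
  · intro s hs
    rw [← (hGP s hs).deriv_eq]
    have := abs_le.1 hs
    obtain ⟨k, rfl⟩ : ∃ k, m = k + 1 := ⟨m - 1, by omega⟩
    have hd : ContDiff ℝ (⊤ : ℕ∞) (deriv G) := by
      have := hGs.iterate_deriv 1
      simpa using this
    rw [eq_integral_mul_max_pow (g := deriv G) (n := k) (T := T) (by omega) hd
      (fun l => by rw [← iteratedDeriv_succ']; exact hG0 _) (by linarith) (by linarith),
      ← intervalIntegral.integral_const_mul]
    refine intervalIntegral.integral_congr fun t _ => ?_
    simp only
    rw [← iteratedDeriv_succ', Nat.factorial_succ]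
    have h1 : (k.factorial : ℝ) ≠ 0 := by positivity
    have h2 : ((k + 1 : ℕ) : ℝ) ≠ 0 := by positivity
    push_cast at h2 ⊢
    field_simp
  · have hpt : ∀ t ∈ Set.Icc (-T) T, (iteratedDeriv (m + 1) G t / (m.factorial : ℝ)) ^ 2
        ≤ (S + 1) * ∑ l ∈ Finset.range (m + 2), iteratedDeriv l P t ^ 2 := by
      intro t ht
      have hf1 : (1 : ℝ) ≤ m.factorial := by
        exact_mod_cast Nat.one_le_iff_ne_zero.2 m.factorial_ne_zero
      have h1 : (iteratedDeriv (m + 1) G t / (m.factorial : ℝ)) ^ 2 ≤ iteratedDeriv (m + 1) G t ^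
          2 := by
        rw [div_pow]
        exact div_le_self (sq_nonneg _) (one_le_pow₀ hf1)
      refine h1.trans ?_
      have hL : iteratedDeriv (m + 1) G t = ∑ l ∈ Finset.range (m + 2),
          (((m + 1).choose l : ℝ) * iteratedDeriv (m + 1 - l) (ζ : ℝ → ℝ) t) *
            iteratedDeriv l P t := by
        rw [hG, mul_comm, iteratedDeriv_mul (hP.of_le (by exact_mod_cast le_top)).contDiffAt
          (hζ.of_le (by exact_mod_cast le_top)).contDiffAt]
        refine Finset.sum_congr rfl fun l _ => by ring
      rw [hL]
      refine (Finset.sum_mul_sq_le_sq_mul_sq _ _ _).trans ?_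
      refine mul_le_mul_of_nonneg_right ?_ (Finset.sum_nonneg fun _ _ => sq_nonneg _)
      refine le_trans (Finset.sum_le_sum fun l _ => ?_) (le_add_of_nonneg_right zero_le_one)
      rw [mul_pow, mul_pow]
      gcongr ?_ * ?_
      rw [← sq_abs]
      exact pow_le_pow_left₀ (abs_nonneg _) (hB _ t ht) 2
    rw [← intervalIntegral.integral_finsetSum (f := fun l t => iteratedDeriv l P t ^ 2)
      (fun l _ => ((hPc l).pow 2).intervalIntegrable _ _), ← intervalIntegral.integral_const_mul]
    refine intervalIntegral.integral_mono_on (by linarith) ?_ ?_ hpt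
    · exact (((hGc _).div_const _).pow 2).intervalIntegrable _ _
    · exact (continuous_const.mul (continuous_finsetSum _ fun l _ => (hPc l).pow
          2)).intervalIntegrable _ _

end TruncatedPowers

section HolderCalculus

/-- The partial derivative of `f` in the `i`-th coordinate. -/
noncomputable def partialD {d : ℕ} (i : Fin d) (f : (Fin d → ℝ) → ℝ) : (Fin d → ℝ) → ℝ :=
  fun x => fderiv ℝ f x (Pi.single i 1)

/-- `f` has `r` derivatives bounded by `C`, the last ones being `β`-Hölder with constant `C`. -/
def IsHolder {d : ℕ} (β C : ℝ) : ℕ → ((Fin d → ℝ) → ℝ) → Prop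
  | 0, f => (∀ x, |f x| ≤ C) ∧ ∀ x y, |f x - f y| ≤ C * ‖x - y‖ ^ β
  | r + 1, f => ContDiff ℝ 1 f ∧ (∀ x, |f x| ≤ C) ∧ ∀ i, IsHolder β C r (partialD i f)

theorem sum_partialD {d : ℕ} (f : (Fin d → ℝ) → ℝ) (x v : Fin d → ℝ) :
    fderiv ℝ f x v = ∑ i, v i * partialD i f x := by
  conv_lhs => rw [show v = ∑ i, v i • (Pi.single i 1 : Fin d → ℝ) by
    ext j; simp [Finset.sum_apply, Pi.single_apply]]
  simp [partialD]

theorem abs_sub_le_of_partialD_le {d : ℕ} {f : (Fin d → ℝ) → ℝ} {C : ℝ} (hf : Differentiable ℝ f)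
    (hC : ∀ i x, |partialD i f x| ≤ C) (x y : Fin d → ℝ) :
    |f x - f y| ≤ d * C * ‖x - y‖ := by
  rcases Nat.eq_zero_or_pos d with rfl | hd
  · have : x = y := Subsingleton.elim _ _
    simp [this]
  have hC0 : 0 ≤ C := (abs_nonneg _).trans (hC ⟨0, hd⟩ 0)
  have hb : ∀ z ∈ (Set.univ : Set (Fin d → ℝ)), ‖fderiv ℝ f z‖ ≤ d * C := by
    intro z _
    refine ContinuousLinearMap.opNorm_le_bound _ (by positivity) fun v => ?_
    rw [sum_partialD, Real.norm_eq_abs]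
    refine (Finset.abs_sum_le_sum_abs _ _).trans ?_
    calc ∑ i, |v i * partialD i f z| ≤ ∑ _i : Fin d, C * ‖v‖ := by
          refine Finset.sum_le_sum fun i _ => ?_
          rw [abs_mul, mul_comm]
          exact mul_le_mul (hC i z) (norm_le_pi_norm v i) (abs_nonneg _) hC0
      _ = d * C * ‖v‖ := by simp; ring
  have := convex_univ.norm_image_sub_le_of_norm_fderiv_le (𝕜 := ℝ)
    (fun z _ => hf z) hb (Set.mem_univ y) (Set.mem_univ x)
  simpa using this

namespace IsHolder

variable {d : ℕ} {β C C' : ℝ} {r : ℕ} {f g : (Fin d → ℝ) → ℝ}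

theorem abs_le (h : IsHolder β C r f) (x : Fin d → ℝ) : |f x| ≤ C := by
  cases r with
  | zero => exact h.1 x
  | succ r => exact h.2.1 x

theorem nonneg (h : IsHolder β C r f) : 0 ≤ C := (abs_nonneg _).trans (h.abs_le 0)

theorem mono (h : IsHolder β C r f) (hC : C ≤ C') : IsHolder β C' r f := by
  induction r generalizing f with
  | zero =>
    exact ⟨fun x => (h.1 x).trans hC, fun x y => (h.2 x y).trans
      (mul_le_mul_of_nonneg_right hC (Real.rpow_nonneg (norm_nonneg _) _))⟩
  | succ r ih => exact ⟨h.1, fun x => (h.2.1 x).trans hC, fun i => ih (h.2.2 i)⟩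

theorem le_mul_rpow {a C L t : ℝ} (hβ0 : 0 < β) (hβ1 : β ≤ 1) (hC : 0 ≤ C) (hL : 0 ≤ L) (ht : 0 ≤ t)
    (h1 : a ≤ 2 * C) (h2 : a ≤ L * t) : a ≤ (2 * C + L) * t ^ β := by
  rcases le_total t 1 with h | h
  · have : t ≤ t ^ β := by
      conv_lhs => rw [← Real.rpow_one t]
      rcases ht.eq_or_lt with rfl | h0
      · rw [Real.zero_rpow one_ne_zero, Real.zero_rpow hβ0.ne']
      · exact Real.rpow_le_rpow_of_exponent_ge h0 h hβ1
    have h3 := Real.rpow_nonneg ht β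
    nlinarith [mul_le_mul_of_nonneg_left this hL]
  · have : 1 ≤ t ^ β := Real.one_le_rpow h hβ0.le
    nlinarith

theorem of_succ (hβ0 : 0 < β) (hβ1 : β ≤ 1) (h : IsHolder β C (r + 1) f) :
    IsHolder β ((d + 2) * C) r f := by
  have hC := h.nonneg
  induction r generalizing f with
  | zero =>
    refine ⟨fun x => (h.2.1 x).trans (by nlinarith [Nat.cast_nonneg (α := ℝ) d]), fun x y => ?_⟩
    have h1 : |f x - f y| ≤ 2 * C := by
      have := abs_sub (f x) (f y)
      linarith [h.2.1 x, h.2.1 y]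
    have h2 := abs_sub_le_of_partialD_le (h.1.differentiable one_ne_zero) (fun i x => (h.2.2 i).1
        x) x y
    have := le_mul_rpow hβ0 hβ1 hC (by positivity) (norm_nonneg _) h1 h2
    refine this.trans (le_of_eq (by ring))
  | succ r ih =>
    exact ⟨h.1, fun x => (h.2.1 x).trans (by nlinarith [Nat.cast_nonneg (α := ℝ) d]),
      fun i => ih (h.2.2 i)⟩

theorem continuous (hβ0 : 0 < β) (h : IsHolder β C r f) : Continuous f := by
  cases r with
  | zero =>
    rw [continuous_iff_continuousAt]
    intro x
    rw [ContinuousAt, tendsto_iff_dist_tendsto_zero]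
    simp only [Real.dist_eq]
    refine squeeze_zero (fun _ => abs_nonneg _) (fun y => h.2 y x) ?_
    have : Continuous fun y : Fin d → ℝ => C * ‖y - x‖ ^ β := by
      refine continuous_const.mul (Continuous.rpow_const (by fun_prop) fun _ => Or.inr hβ0.le)
    have h2 := this.tendsto x
    simpa [Real.zero_rpow hβ0.ne'] using h2
  | succ r => exact h.1.continuous

theorem add (hf : IsHolder β C r f) (hg : IsHolder β C' r g) :
    IsHolder β (C + C') r (fun x => f x + g x) := by
  induction r generalizing f g with
  | zero =>
    refine ⟨fun x => (abs_add_le _ _).trans (add_le_add (hf.1 x) (hg.1 x)), fun x y => ?_⟩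
    rw [add_sub_add_comm, add_mul]
    exact (abs_add_le _ _).trans (add_le_add (hf.2 x y) (hg.2 x y))
  | succ r ih =>
    refine ⟨hf.1.add hg.1, fun x => (abs_add_le _ _).trans (add_le_add (hf.2.1 x) (hg.2.1 x)),
      fun i => ?_⟩
    have : partialD i (fun x => f x + g x) = fun x => partialD i f x + partialD i g x := by
      ext x
      simp only [partialD]
      rw [fderiv_fun_add (hf.1.differentiable one_ne_zero x) (hg.1.differentiable one_ne_zero x)]
      rfl
    rw [this]
    exact ih (hf.2.2 i) (hg.2.2 i)

theorem mul (hβ0 : 0 < β) (hβ1 : β ≤ 1) (hf : IsHolder β C r f) (hg : IsHolder β C' r g) :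
    IsHolder β (2 * (2 * (d + 2)) ^ r * (C * C')) r (fun x => f x * g x) := by
  have hC := hf.nonneg
  have hC' := hg.nonneg
  have hd : (1 : ℝ) ≤ 2 * (d + 2) := by nlinarith [Nat.cast_nonneg (α := ℝ) d]
  have hb : ∀ x, |f x * g x| ≤ 2 * (2 * (d + 2)) ^ r * (C * C') := fun x => by
    rw [abs_mul]
    refine (mul_le_mul (hf.abs_le x) (hg.abs_le x) (abs_nonneg _) hC).trans ?_
    have h1 : (1 : ℝ) ≤ (2 * (d + 2)) ^ r := one_le_pow₀ hd
    nlinarith [mul_nonneg hC hC', mul_le_mul_of_nonneg_right h1 (mul_nonneg hC hC')]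
  induction r generalizing f g C C' with
  | zero =>
    refine ⟨hb, fun x y => ?_⟩
    have e : f x * g x - f y * g y = f x * (g x - g y) + (f x - f y) * g y := by ring
    rw [e]
    refine (abs_add_le _ _).trans ?_
    rw [abs_mul, abs_mul]
    have h1 := mul_le_mul (hf.1 x) (hg.2 x y) (abs_nonneg _) hC
    have h2 := mul_le_mul (hf.2 x y) (hg.1 y) (abs_nonneg _)
      (mul_nonneg hC (Real.rpow_nonneg (norm_nonneg _) _))
    rw [pow_zero]
    linarith
  | succ r ih =>
    refine ⟨hf.1.mul hg.1, hb, fun i => ?_⟩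
    have : partialD i (fun x => f x * g x) =
        fun x => f x * partialD i g x + partialD i f x * g x := by
      ext x
      simp only [partialD]
      rw [fderiv_fun_mul (hf.1.differentiable one_ne_zero x) (hg.1.differentiable one_ne_zero x)]
      simp only [add_apply, smul_apply, smul_eq_mul]
      ring
    rw [this]
    have hbd : ∀ {D D' : ℝ} {u v : (Fin d → ℝ) → ℝ}, IsHolder β D r u → IsHolder β D' r v →
        IsHolder β (2 * (2 * (d + 2)) ^ r * (D * D')) r fun x => u x * v x := by
      intro D D' u v hu hv
      refine ih hu hv hu.nonneg hv.nonneg fun x => ?_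
      rw [abs_mul]
      refine (mul_le_mul (hu.abs_le x) (hv.abs_le x) (abs_nonneg _) hu.nonneg).trans ?_
      have h1 : (1 : ℝ) ≤ (2 * (d + 2)) ^ r := one_le_pow₀ hd
      nlinarith [mul_nonneg hu.nonneg hv.nonneg,
        mul_le_mul_of_nonneg_right h1 (mul_nonneg hu.nonneg hv.nonneg)]
    refine ((hbd (hf.of_succ hβ0 hβ1) (hg.2.2 i)).add
      (hbd (hf.2.2 i) (hg.of_succ hβ0 hβ1))).mono (le_of_eq ?_)
    ring

theorem of_contDiff_hasCompactSupport (hβ0 : 0 < β) (hβ1 : β ≤ 1) (r : ℕ) :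
    ∀ f : (Fin d → ℝ) → ℝ, ContDiff ℝ (⊤ : ℕ∞) f → HasCompactSupport f → ∃ C, IsHolder β C r f := by
  induction r with
  | zero =>
    intro f hf hs
    obtain ⟨C, hC⟩ := hs.exists_bound_of_continuous hf.continuous
    have h1 : ∀ i, ∃ D, ∀ x, ‖partialD i f x‖ ≤ D := fun i =>
      HasCompactSupport.exists_bound_of_continuous
        (hs.fderiv_apply (𝕜 := ℝ) _) ((hf.continuous_fderiv (by simp)).clm_apply continuous_const)
    choose D hD using h1
    set L := ∑ i, |D i|
    have hL0 : 0 ≤ L := Finset.sum_nonneg fun _ _ => abs_nonneg _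
    have hL : ∀ i x, |partialD i f x| ≤ L := fun i x =>
      ((hD i x).trans (le_abs_self _)).trans
        (Finset.single_le_sum (f := fun i => |D i|) (fun _ _ => abs_nonneg _) (Finset.mem_univ i))
    have hC0 : 0 ≤ C := (norm_nonneg _).trans (hC 0)
    refine ⟨2 * C + d * L, fun x => (hC x).trans (by
      nlinarith [mul_nonneg d.cast_nonneg (α := ℝ) hL0]),
      fun x y => ?_⟩
    refine le_mul_rpow hβ0 hβ1 hC0 (by positivity) (norm_nonneg _) ?_
      (abs_sub_le_of_partialD_le (hf.differentiable (by simp)) hL x y)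
    have := abs_sub (f x) (f y)
    have h2 := hC x
    have h3 := hC y
    rw [Real.norm_eq_abs] at h2 h3
    linarith
  | succ r ih =>
    intro f hf hs
    obtain ⟨C, hC⟩ := hs.exists_bound_of_continuous hf.continuous
    have h1 : ∀ i, ∃ D, IsHolder β D r (partialD i f) := fun i =>
      ih _ ((hf.fderiv_right (m := (⊤ : ℕ∞)) (by simp)).clm_apply contDiff_const)
        (hs.fderiv_apply (𝕜 := ℝ) _)
    choose D hD using h1
    have hC0 : 0 ≤ C := (norm_nonneg _).trans (hC 0)
    refine ⟨C + ∑ i, |D i|, hf.of_le (by exact_mod_cast le_top), fun x => (hC x).trans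
      (le_add_of_nonneg_right (Finset.sum_nonneg fun _ _ => abs_nonneg _)), fun i => (hD i).mono ?_⟩
    have : |D i| ≤ ∑ i, |D i| :=
      Finset.single_le_sum (f := fun i => |D i|) (fun _ _ => abs_nonneg _) (Finset.mem_univ i)
    linarith [le_abs_self (D i)]

end IsHolder

end HolderCalculus

section HolderMembership

variable {d : ℕ}

theorem contDiff_pderivList {f : (Fin d → ℝ) → ℝ} {r : ℕ} (hf : ContDiff ℝ r f) :
    ∀ (l : List (Fin d)) (k : ℕ), l.length + k ≤ r → ContDiff ℝ k (pderivList l f)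
  | [], k, h => hf.of_le (by exact_mod_cast (by simpa using h))
  | i :: l, k, h => by
    have := contDiff_pderivList hf l (k + 1) (by simp at h; omega)
    exact (this.fderiv_right (m := k) (by exact_mod_cast le_rfl)).clm_apply contDiff_const

/-- Membership in the Hölder class gives the recursive Hölder condition. -/
theorem isHolder_of_pderivList {f : (Fin d → ℝ) → ℝ} {r : ℕ} {β : ℝ} (hf : ContDiff ℝ r f)
    (h1 : ∀ l : List (Fin d), l.length ≤ r → ∀ x, |pderivList l f x| ≤ 1)
    (h2 : ∀ l : List (Fin d), l.length = r → ∀ x y,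
      |pderivList l f x - pderivList l f y| ≤ ‖x - y‖ ^ β) : IsHolder β 1 r f := by
  have key : ∀ (k : ℕ) (l : List (Fin d)), l.length + k = r → IsHolder β 1 k (pderivList l f) := by
    intro k
    induction k with
    | zero =>
      intro l hl
      exact ⟨h1 l (by omega), fun x y => by rw [one_mul]; exact h2 l (by omega) x y⟩
    | succ k ih =>
      intro l hl
      refine ⟨(contDiff_pderivList hf l (k + 1) (by omega)).of_le (by simp), h1 l (by omega),
        fun i => ih (i :: l) (by simp; omega)⟩
  exact key r [] (by simp)

theorem contDiff_fwdDiff_iter {f : (Fin d → ℝ) → ℝ} (hf : ContDiff ℝ 1 f) (y : Fin d → ℝ) (n : ℕ) :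
    ContDiff ℝ 1 ((fwdDiff y)^[n] f) := by
  induction n generalizing f with
  | zero => exact hf
  | succ n ih =>
    rw [Function.iterate_succ_apply]
    exact ih ((hf.comp (contDiff_id.add contDiff_const)).sub hf)

theorem partialD_fwdDiff_iter {f : (Fin d → ℝ) → ℝ} (hf : ContDiff ℝ 1 f) (i : Fin d)
    (y : Fin d → ℝ) (n : ℕ) :
    partialD i ((fwdDiff y)^[n] f) = (fwdDiff y)^[n] (partialD i f) := by
  induction n generalizing f with
  | zero => rfl
  | succ n ih =>
    have h1 : ContDiff ℝ 1 (fwdDiff y f) := (hf.comp (contDiff_id.add contDiff_const)).sub hf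
    rw [Function.iterate_succ_apply, Function.iterate_succ_apply, ih h1]
    congr 1
    ext x
    have e : fwdDiff y f = fun z => f (z + y) - f z := rfl
    have h3 := hf.differentiable one_ne_zero
    simp only [partialD, fwdDiff]
    rw [e, fderiv_fun_sub (by fun_prop) (h3 x), fderiv_comp_add_right]
    rfl

theorem IsHolder.abs_fwdDiff_iter_le {β C : ℝ} {r : ℕ} {f : (Fin d → ℝ) → ℝ} (hβ : 0 < β)
    (h : IsHolder β C r f) (y x : Fin d → ℝ) :
    |(fwdDiff y)^[r + 1] f x| ≤ d ^ r * C * ‖y‖ ^ ((r : ℝ) + β) := by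
  induction r generalizing f x with
  | zero =>
    have := h.2 (x + y) x
    simpa [fwdDiff] using this
  | succ r ih =>
    rw [Function.iterate_succ_apply']
    have h1 := (contDiff_fwdDiff_iter h.1 y (r + 1)).differentiable one_ne_zero
    have h2 : ∀ i z, |partialD i ((fwdDiff y)^[r + 1] f) z| ≤ d ^ r * C * ‖y‖ ^ ((r : ℝ) + β) := by
      intro i z
      rw [partialD_fwdDiff_iter h.1]
      exact ih (h.2.2 i) z
    have h3 := abs_sub_le_of_partialD_le h1 h2 (x + y) x
    rw [add_sub_cancel_left] at h3
    refine h3.trans (le_of_eq ?_)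
    rw [show ((r + 1 : ℕ) : ℝ) + β = ((r : ℝ) + β) + 1 by push_cast; ring,
      Real.rpow_add_one' (norm_nonneg _) (by positivity)]
    ring

/-- Iterated finite differences of higher order than needed. -/
theorem IsHolder.abs_fwdDiff_iter_le' {β C : ℝ} {r : ℕ} {f : (Fin d → ℝ) → ℝ} (hβ : 0 < β)
    (h : IsHolder β C r f) (y x : Fin d → ℝ) (k : ℕ) :
    |(fwdDiff y)^[r + 1 + k] f x| ≤ 2 ^ k * (d ^ r * C * ‖y‖ ^ ((r : ℝ) + β)) := by
  induction k generalizing x with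
  | zero => simpa using h.abs_fwdDiff_iter_le hβ y x
  | succ k ih =>
    rw [← add_assoc, Function.iterate_succ_apply', fwdDiff]
    refine (abs_sub _ _).trans ?_
    have := ih (x + y)
    have := ih x
    rw [pow_succ]
    linarith

end HolderMembership

section HolderExtension

/-- Localisation of a Hölder function near the unit cube. -/
theorem exists_compactSupport_isHolder (d r : ℕ) {β : ℝ} (hβ0 : 0 < β) (hβ1 : β ≤ 1) :
    ∃ C : ℝ, ∀ f : (Fin d → ℝ) → ℝ, IsHolder β 1 r f → ∃ F : (Fin d → ℝ) → ℝ,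
      IsHolder β C r F ∧ tsupport F ⊆ Metric.closedBall 0 3 ∧
      ∀ x ∈ Set.Icc (0 : Fin d → ℝ) 1, F =ᶠ[nhds x] f := by
  let ψ : ContDiffBump (0 : Fin d → ℝ) := ⟨2, 3, by norm_num, by norm_num⟩
  obtain ⟨C, hC⟩ := IsHolder.of_contDiff_hasCompactSupport hβ0 hβ1 r (ψ : (Fin d → ℝ) → ℝ)
    ψ.contDiff ψ.hasCompactSupport
  refine ⟨2 * (2 * (d + 2)) ^ r * (C * 1), fun f hf => ⟨fun x => ψ x * f x, hC.mul hβ0 hβ1 hf,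
    ?_, ?_⟩⟩
  · refine (tsupport_mul_subset_left (f := (ψ : (Fin d → ℝ) → ℝ))).trans ?_
    rw [ψ.tsupport_eq]
  · intro x hx
    have h1 : ‖x‖ < 2 := by
      refine lt_of_le_of_lt ((pi_norm_le_iff_of_nonneg zero_le_one).2 fun i => ?_) one_lt_two
      rw [Real.norm_eq_abs, abs_of_nonneg (hx.1 i)]
      exact hx.2 i
    have : ∀ᶠ z in nhds x, ‖z‖ < 2 := continuous_norm.continuousAt.eventually_lt
      continuousAt_const h1
    filter_upwards [this] with z hz
    have : (ψ : (Fin d → ℝ) → ℝ) z = 1 := by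
      apply ψ.one_of_mem_closedBall
      rw [Metric.mem_closedBall, dist_zero_right]
      exact hz.le
    rw [this, one_mul]

variable {d : ℕ} {β C : ℝ} {r : ℕ} {f : (Fin d → ℝ) → ℝ}

theorem tsupport_partialD_subset (i : Fin d) (f : (Fin d → ℝ) → ℝ) :
    tsupport (partialD i f) ⊆ tsupport f :=
  tsupport_fderiv_apply_subset ℝ _

theorem IsHolder.iterate_partialD (i : Fin d) (k : ℕ) {l : ℕ} (h : IsHolder β C (k + l) f) :
    IsHolder β C l ((partialD i)^[k] f) := by
  induction k generalizing f with
  | zero => simpa using h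
  | succ k ih =>
    rw [Function.iterate_succ_apply]
    rw [show k + 1 + l = (k + l) + 1 by ring] at h
    exact ih (h.2.2 i)

theorem tsupport_iterate_partialD_subset (i : Fin d) (k : ℕ) (f : (Fin d → ℝ) → ℝ) :
    tsupport ((partialD i)^[k] f) ⊆ tsupport f := by
  induction k with
  | zero => exact subset_rfl
  | succ k ih =>
    rw [Function.iterate_succ_apply']
    exact (tsupport_partialD_subset i _).trans ih

end HolderExtension

section PlancherelTheorem

open MeasureTheory FourierTransform
open scoped SchwartzMap ContDiff

section Plancherel

variable {V : Type*} [NormedAddCommGroup V] [InnerProductSpace ℝ V] [FiniteDimensional ℝ V]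
  [MeasurableSpace V] [BorelSpace V]

theorem norm_sq_eq_integral_norm_sq (F : Lp ℂ 2 (volume : Measure V)) :
    ‖F‖ ^ 2 = ∫ x, ‖F x‖ ^ 2 := by
  have h := @inner_self_eq_norm_sq_to_K ℂ _ _ _ _ F
  rw [L2.inner_def] at h
  have h2 : (∫ x, inner ℂ (F x) (F x)) = ((∫ x, ‖F x‖ ^ 2 : ℝ) : ℂ) := by
    rw [← integral_complex_ofReal]
    refine integral_congr_ae (.of_forall fun x => ?_)
    simp only
    rw [inner_self_eq_norm_sq_to_K]
    push_cast
    rfl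
  rw [h2] at h
  refine Complex.ofReal_injective (Eq.trans ?_ h.symm)
  push_cast
  rfl

/-- The `L²` Fourier transform of a continuous compactly supported function is its Fourier
integral. -/
theorem coeFn_fourier_toLp_ae_eq {f : V → ℂ} (hf : Continuous f) (hs : HasCompactSupport f) :
    ⇑(𝓕 ((hf.memLp_of_hasCompactSupport hs : MemLp f 2 volume).toLp f) : Lp ℂ 2 (volume : Measure
        V))
      =ᵐ[volume] 𝓕 f := by
  set hm := (hf.memLp_of_hasCompactSupport hs : MemLp f 2 volume)
  set F := hm.toLp f with hF
  have hfi : Integrable f := hf.integrable_of_hasCompactSupport hs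
  have hcont : Continuous (𝓕 f) := VectorFourier.fourierIntegral_continuous
    Real.continuous_fourierChar (by exact continuous_inner) hfi
  have hloc : LocallyIntegrable (fun x => (𝓕 F : Lp ℂ 2 (volume : Measure V)) x - 𝓕 f x) volume :=
    ((Lp.memLp _).locallyIntegrable (by norm_num)).sub hcont.locallyIntegrable
  have key := ae_eq_zero_of_integral_contDiff_smul_eq_zero (μ := volume) hloc ?_
  · filter_upwards [key] with x hx
    exact sub_eq_zero.1 hx
  · intro g hg hgs
    have hgs' : HasCompactSupport (fun x => (g x : ℂ)) := hgs.comp_left (g := fun t : ℝ => (t : ℂ))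
        rfl
    let θ : 𝓢(V, ℂ) := hgs'.toSchwartzMap (Complex.ofRealCLM.contDiff.comp hg)
    have hθ : ∀ x, θ x = (g x : ℂ) := fun x => rfl
    have h1 := congrArg (fun T : 𝓢'(V, ℂ) => T θ) (Lp.fourier_toTemperedDistribution_eq F)
    simp only [TemperedDistribution.fourier_apply, Lp.toTemperedDistribution_apply] at h1
    have h2 : ∫ x, 𝓕 (θ : V → ℂ) x • f x = ∫ x, θ x • 𝓕 f x :=
      VectorFourier.integral_fourierIntegral_smul_eq_flip (μ := volume) (ν := volume)
        (L := innerₗ V) Real.continuous_fourierChar continuous_inner θ.integrable hfi |>.trans (by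
          rw [flip_innerₗ]; rfl)
    have h3 : ∫ x, (𝓕 θ) x • F x = ∫ x, 𝓕 (θ : V → ℂ) x • f x := by
      refine integral_congr_ae ?_
      filter_upwards [hm.coeFn_toLp] with x hx
      rw [hF, hx]; rfl
    rw [h3, h2] at h1
    have i1 : Integrable fun x => θ x • (𝓕 F : Lp ℂ 2 (volume : Measure V)) x := by
      have := (θ.memLp 2 (volume : Measure V))
      exact this.integrable_mul (Lp.memLp _)
    have i2 : Integrable fun x => θ x • 𝓕 f x := by
      refine Continuous.integrable_of_hasCompactSupport (θ.continuous.smul hcont) ?_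
      exact HasCompactSupport.smul_right (f := fun x => (g x : ℂ)) hgs'
    have : ∀ x, g x • ((𝓕 F : Lp ℂ 2 (volume : Measure V)) x - 𝓕 f x)
        = θ x • (𝓕 F : Lp ℂ 2 (volume : Measure V)) x - θ x • 𝓕 f x := by
      intro x
      rw [hθ, smul_sub]
      simp
    simp_rw [this]
    rw [integral_sub i1 i2, ← h1, sub_self]

/-- Plancherel's identity for continuous compactly supported functions. -/
theorem integral_norm_sq_fourier_of_hasCompactSupport {f : V → ℂ} (hf : Continuous f)
    (hs : HasCompactSupport f) :
    Integrable (fun ξ => ‖𝓕 f ξ‖ ^ 2) ∧ ∫ ξ, ‖𝓕 f ξ‖ ^ 2 = ∫ x, ‖f x‖ ^ 2 := by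
  have hae := coeFn_fourier_toLp_ae_eq hf hs
  set hm := (hf.memLp_of_hasCompactSupport hs : MemLp f 2 volume)
  constructor
  · have := (Lp.memLp (𝓕 (hm.toLp f) : Lp ℂ 2 (volume : Measure V))).integrable_norm_pow
      (by norm_num)
    refine this.congr ?_
    filter_upwards [hae] with x hx
    rw [hx]
  · have h1 := norm_sq_eq_integral_norm_sq (𝓕 (hm.toLp f) : Lp ℂ 2 (volume : Measure V))
    rw [Lp.norm_fourier_eq, norm_sq_eq_integral_norm_sq] at h1
    rw [integral_congr_ae (g := fun x => ‖f x‖ ^ 2)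
      (by filter_upwards [hm.coeFn_toLp] with x hx; rw [hx])] at h1
    rw [h1]
    refine integral_congr_ae ?_
    filter_upwards [hae] with x hx
    rw [hx]

end Plancherel

end PlancherelTheorem

section FourierOnPi

open MeasureTheory FourierTransform
open scoped SchwartzMap ContDiff Matrix

variable {d : ℕ}

/-- The dot product on `Fin d → ℝ` as a continuous bilinear map. -/
noncomputable def dotCLM (d : ℕ) : (Fin d → ℝ) →L[ℝ] (Fin d → ℝ) →L[ℝ] ℝ :=
  (dotProductBilin ℝ ℝ : (Fin d → ℝ) →ₗ[ℝ] (Fin d → ℝ) →ₗ[ℝ] ℝ).toContinuousBilinearMap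

/-- The Fourier transform on `Fin d → ℝ`, with the pairing given by the dot product. -/
noncomputable def piFourier (f : (Fin d → ℝ) → ℂ) : (Fin d → ℝ) → ℂ :=
  VectorFourier.fourierIntegral Real.fourierChar volume (dotCLM d).toLinearMap₁₂ f

theorem piFourier_apply (f : (Fin d → ℝ) → ℂ) (ξ : Fin d → ℝ) :
    piFourier f ξ = ∫ y, Real.fourierChar (-(y ⬝ᵥ ξ)) • f y := rfl

theorem continuous_dotCLM : Continuous fun p : (Fin d → ℝ) × (Fin d → ℝ) =>
    (dotCLM d).toLinearMap₁₂ p.1 p.2 := by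
  change Continuous fun p : (Fin d → ℝ) × (Fin d → ℝ) => dotCLM d p.1 p.2
  fun_prop

theorem piFourier_eq (f : (Fin d → ℝ) → ℂ) (ξ : Fin d → ℝ) :
    piFourier f ξ = 𝓕 (fun v : EuclideanSpace ℝ (Fin d) => f v.ofLp) (WithLp.toLp 2 ξ) := by
  rw [piFourier_apply, Real.fourier_eq]
  rw [← (PiLp.volume_preserving_ofLp (Fin d)).integral_comp
    (MeasurableEquiv.toLp 2 (Fin d → ℝ)).symm.measurableEmbedding]
  refine integral_congr_ae (.of_forall fun v => ?_)
  simp only [EuclideanSpace.inner_eq_star_dotProduct, star_trivial]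
  rw [dotProduct_comm]

theorem continuous_piFourier {f : (Fin d → ℝ) → ℂ} (hf : Integrable f) :
    Continuous (piFourier f) :=
  VectorFourier.fourierIntegral_continuous Real.continuous_fourierChar continuous_dotCLM hf

theorem norm_piFourier_le (f : (Fin d → ℝ) → ℂ) (ξ : Fin d → ℝ) :
    ‖piFourier f ξ‖ ≤ ∫ y, ‖f y‖ :=
  VectorFourier.norm_fourierIntegral_le_integral_norm _ _ _ _ _

theorem piFourier_comp_add_right (f : (Fin d → ℝ) → ℂ) (y ξ : Fin d → ℝ) :
    piFourier (fun x => f (x + y)) ξ = Real.fourierChar (y ⬝ᵥ ξ) • piFourier f ξ := by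
  have := congrFun (VectorFourier.fourierIntegral_comp_add_right Real.fourierChar volume
    (dotCLM d).toLinearMap₁₂ f y) ξ
  exact this

theorem piFourier_fderiv {f : (Fin d → ℝ) → ℂ} (hf : ContDiff ℝ 1 f) (hs : HasCompactSupport f)
    (v ξ : Fin d → ℝ) :
    piFourier (fun x => fderiv ℝ f x v) ξ =
      (2 * Real.pi * Complex.I * (v ⬝ᵥ ξ : ℝ)) * piFourier f ξ := by
  have hc := hf.continuous_fderiv one_ne_zero
  have hi : Integrable (fderiv ℝ f) := hc.integrable_of_hasCompactSupport (hs.fderiv (𝕜 := ℝ))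
  have h := VectorFourier.fourierIntegral_fderiv (μ := volume) (dotCLM d)
    (hf.continuous.integrable_of_hasCompactSupport hs) (hf.differentiable one_ne_zero) hi
  have h2 := congrFun h ξ
  have h3 := congrArg (fun T : (Fin d → ℝ) →L[ℝ] ℂ => T v) h2
  simp only [VectorFourier.fourierSMulRight_apply] at h3
  have h4 : piFourier (fun x => fderiv ℝ f x v) ξ =
      VectorFourier.fourierIntegral Real.fourierChar volume (dotCLM d).toLinearMap₁₂
        (fderiv ℝ f) ξ v := by
    rw [VectorFourier.fourierIntegral, ContinuousLinearMap.integral_apply]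
    · rfl
    · exact (VectorFourier.fourierIntegral_convergent_iff Real.continuous_fourierChar
        continuous_dotCLM ξ).2 hi
  rw [h4, h3]
  change _ = 2 * Real.pi * Complex.I * ((dotCLM d v ξ : ℝ) : ℂ) * _
  simp only [neg_apply, ContinuousLinearMap.flip_apply, smul_eq_mul, piFourier]
  rw [Complex.real_smul]
  push_cast
  ring

theorem integral_norm_sq_piFourier {f : (Fin d → ℝ) → ℂ} (hf : Continuous f)
    (hs : HasCompactSupport f) :
    Integrable (fun ξ => ‖piFourier f ξ‖ ^ 2) ∧ ∫ ξ, ‖piFourier f ξ‖ ^ 2 = ∫ x, ‖f x‖ ^ 2 := by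
  have hs' : HasCompactSupport (fun v : EuclideanSpace ℝ (Fin d) => f v.ofLp) :=
    hs.comp_homeomorph (PiLp.homeomorph 2 fun _ : Fin d => ℝ)
  obtain ⟨h1, h2⟩ := integral_norm_sq_fourier_of_hasCompactSupport
    (f := fun v : EuclideanSpace ℝ (Fin d) => f v.ofLp)
    (hf.comp (PiLp.continuous_ofLp 2 _)) hs'
  have hmp := PiLp.volume_preserving_toLp (Fin d)
  have hme : MeasurableEmbedding (WithLp.toLp 2 : (Fin d → ℝ) → EuclideanSpace ℝ (Fin d)) :=
    (MeasurableEquiv.toLp 2 (Fin d → ℝ)).measurableEmbedding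
  simp_rw [piFourier_eq]
  constructor
  · exact (hmp.integrable_comp_emb hme).2 h1
  · rw [hmp.integral_comp hme (fun v => ‖𝓕 (fun v : EuclideanSpace ℝ (Fin d) => f v.ofLp) v‖ ^ 2),
      h2, ← hmp.integral_comp hme]

/-- The Fourier transform of a test function has all moments, and its integral is the value of the
test function at the origin. -/
theorem integrable_piFourier_test {Φ : (Fin d → ℝ) → ℂ} (hΦ : ContDiff ℝ (⊤ : ℕ∞) Φ)
    (hs : HasCompactSupport Φ) :
    (∀ k : ℕ, Integrable fun z => ‖z‖ ^ k * ‖piFourier Φ z‖) ∧ ∫ z, piFourier Φ z = Φ 0 := by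
  have hs' : HasCompactSupport (fun v : EuclideanSpace ℝ (Fin d) => Φ v.ofLp) :=
    hs.comp_homeomorph (PiLp.homeomorph 2 fun _ : Fin d => ℝ)
  let θ : 𝓢(EuclideanSpace ℝ (Fin d), ℂ) := hs'.toSchwartzMap
    (hΦ.comp (PiLp.contDiff_ofLp))
  have hθ : ∀ z, piFourier Φ z = (𝓕 θ) (WithLp.toLp 2 z) := fun z => piFourier_eq Φ z
  have hmp := PiLp.volume_preserving_toLp (Fin d)
  have hme : MeasurableEmbedding (WithLp.toLp 2 : (Fin d → ℝ) → EuclideanSpace ℝ (Fin d)) :=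
    (MeasurableEquiv.toLp 2 (Fin d → ℝ)).measurableEmbedding
  constructor
  · intro k
    have h1 := (hmp.integrable_comp_emb hme).2 ((𝓕 θ).integrable_pow_mul volume k)
    refine h1.mono ?_ (.of_forall fun z => ?_)
    · refine Continuous.aestronglyMeasurable ?_
      have : Continuous (piFourier Φ) :=
        continuous_piFourier (hΦ.continuous.integrable_of_hasCompactSupport hs)
      fun_prop
    · simp only [Function.comp, norm_mul, norm_pow, norm_norm, hθ]
      gcongr
      refine (pi_norm_le_iff_of_nonneg (norm_nonneg _)).2 fun i => ?_
      exact PiLp.norm_apply_le (WithLp.toLp 2 z) i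
  · simp_rw [hθ]
    rw [hmp.integral_comp hme (⇑(𝓕 θ : 𝓢(EuclideanSpace ℝ (Fin d), ℂ)))]
    have h0 : 𝓕⁻ (𝓕 θ) = θ := FourierTransform.fourierInv_fourier_eq θ
    have h1 := congrArg (fun T : 𝓢(EuclideanSpace ℝ (Fin d), ℂ) => T 0) h0
    simp only [SchwartzMap.fourierInv_coe] at h1
    rw [Real.fourierInv_eq] at h1
    simp only [inner_zero_right, AddChar.map_zero_eq_one, one_smul] at h1
    exact h1

end FourierOnPi

section FourierScaling

open MeasureTheory
open scoped Matrix

variable {d : ℕ}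

theorem piFourier_comp_smul (f : (Fin d → ℝ) → ℂ) {a : ℝ} (ha : 0 < a) (ξ : Fin d → ℝ) :
    piFourier (fun y => f (a • y)) ξ = ((a ^ d)⁻¹ : ℝ) • piFourier f (a⁻¹ • ξ) := by
  rw [piFourier_apply, piFourier_apply]
  have h := Measure.integral_comp_smul (volume : Measure (Fin d → ℝ))
    (fun y => Real.fourierChar (-(y ⬝ᵥ (a⁻¹ • ξ))) • f y) a
  simp only [Module.finrank_fin_fun] at h
  rw [abs_of_pos (by positivity)] at h
  rw [← h]
  refine integral_congr_ae (.of_forall fun y => ?_)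
  simp only [smul_dotProduct, dotProduct_smul, smul_eq_mul]
  rw [inv_mul_cancel_left₀ ha.ne']

/-- Dilated frequency cutoffs act as averages over translates. -/
theorem integral_cutoff_mul_piFourier {Φ : (Fin d → ℝ) → ℂ} (hΦ : Integrable Φ)
    {f : (Fin d → ℝ) → ℂ} (hf : Integrable f) (x : Fin d → ℝ) {a : ℝ} (ha : 0 < a) :
    ∫ ξ, Φ (a • ξ) * (piFourier f ξ * Real.fourierChar (x ⬝ᵥ ξ)) =
      ∫ z, piFourier Φ z * f (x + a • z) := by
  have h1 : ∀ ξ, piFourier f ξ * Real.fourierChar (x ⬝ᵥ ξ) = piFourier (fun y => f (y + x)) ξ := by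
    intro ξ
    rw [piFourier_comp_add_right, Circle.smul_def, smul_eq_mul, mul_comm]
  simp_rw [h1]
  have h2 : ∀ ξ, piFourier (fun y => f (y + x)) ξ =
      ((a ^ d : ℝ) : ℂ) * piFourier (fun y => f (a • y + x)) (a • ξ) := by
    intro ξ
    rw [piFourier_comp_smul (fun y => f (y + x)) ha (a • ξ), smul_smul, inv_mul_cancel₀ ha.ne',
      one_smul, Complex.real_smul, ← mul_assoc, ← Complex.ofReal_mul,
      mul_inv_cancel₀ (by positivity), Complex.ofReal_one, one_mul]
  simp_rw [h2]
  have h3 := Measure.integral_comp_smul (volume : Measure (Fin d → ℝ))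
    (fun ξ => Φ ξ * (((a ^ d : ℝ) : ℂ) * piFourier (fun y => f (a • y + x)) ξ)) a
  simp only [Module.finrank_fin_fun] at h3
  rw [abs_of_pos (by positivity)] at h3
  rw [h3]
  have h4 : ∀ ξ, Φ ξ * (((a ^ d : ℝ) : ℂ) * piFourier (fun y => f (a • y + x)) ξ) =
      ((a ^ d : ℝ) : ℂ) * (Φ ξ * piFourier (fun y => f (a • y + x)) ξ) := fun ξ => by ring
  simp_rw [h4]
  rw [integral_const_mul, Complex.real_smul, ← mul_assoc, ← Complex.ofReal_mul,
    inv_mul_cancel₀ (by positivity), Complex.ofReal_one, one_mul]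
  have hfi : Integrable fun y => f (a • y + x) := by
    have := hf.comp_add_right x
    exact (integrable_comp_smul_iff volume (fun y => f (y + x)) ha.ne').2 this
  have h5 := VectorFourier.integral_fourierIntegral_smul_eq_flip (μ := volume) (ν := volume)
    (L := (dotCLM d).toLinearMap₁₂) Real.continuous_fourierChar continuous_dotCLM hΦ hfi
  have h6 : (dotCLM d).toLinearMap₁₂.flip = (dotCLM d).toLinearMap₁₂ := by
    refine LinearMap.ext fun x => LinearMap.ext fun y => ?_
    exact dotProduct_comm y x
  rw [h6] at h5
  simp only [smul_eq_mul] at h5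
  refine h5.symm.trans ?_
  refine integral_congr_ae (.of_forall fun y => ?_)
  simp only
  rw [add_comm x]
  rfl

/-- Reproduction error of the high-order frequency cutoff built from `Φ`. -/
theorem exists_reproduction_bound {Φ : (Fin d → ℝ) → ℝ} (hΦ : ContDiff ℝ (⊤ : ℕ∞) Φ)
    (hs : HasCompactSupport Φ) (h0 : Φ 0 = 1) (n : ℕ) {γ : ℝ} (hγ : 0 ≤ γ) :
    ∃ C, 0 < C ∧ ∀ (f : (Fin d → ℝ) → ℝ) (A F : ℝ), Continuous f → HasCompactSupport f → 0 ≤ A →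
      0 < F → (∀ y x, |(fwdDiff y)^[n] f x| ≤ A * ‖y‖ ^ γ) → ∀ x,
      ‖(f x : ℂ) - ∫ ξ, ((∑ l ∈ Finset.range n, (-1 : ℝ) ^ l * (n.choose (l + 1) : ℝ) *
        Φ (((l + 1 : ℕ) / F : ℝ) • ξ) : ℝ) : ℂ) *
          (piFourier (fun y => (f y : ℂ)) ξ * Real.fourierChar (x ⬝ᵥ ξ))‖ ≤ C * A * F ^ (-γ) := by
  set Φc : (Fin d → ℝ) → ℂ := fun ξ => (Φ ξ : ℂ) with hΦc
  have hΦcs : HasCompactSupport Φc := hs.comp_left (g := fun t : ℝ => (t : ℂ)) rfl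
  have hΦcd : ContDiff ℝ (⊤ : ℕ∞) Φc := Complex.ofRealCLM.contDiff.comp hΦ
  have hΦi : Integrable Φc := hΦcd.continuous.integrable_of_hasCompactSupport hΦcs
  obtain ⟨hmom, hone⟩ := integrable_piFourier_test hΦcd hΦcs
  set ψ := piFourier Φc with hψ
  have hψc : Continuous ψ := continuous_piFourier hΦi
  have hψi : Integrable ψ := by
    have := hmom 0
    simp only [pow_zero, one_mul] at this
    exact (integrable_norm_iff hψc.aestronglyMeasurable).1 this
  have hmomγ : Integrable fun z => ‖z‖ ^ γ * ‖ψ z‖ := by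
    refine Integrable.mono' ((hmom 0).add (hmom ⌈γ⌉₊)) ?_ (.of_forall fun z => ?_)
    · refine Continuous.aestronglyMeasurable ?_
      exact (continuous_norm.rpow_const fun _ => Or.inr hγ).mul hψc.norm
    · rw [norm_mul, norm_norm, Real.norm_of_nonneg (Real.rpow_nonneg (norm_nonneg _) _)]
      simp only [Pi.add_apply, pow_zero, ← add_mul]
      refine mul_le_mul_of_nonneg_right ?_ (norm_nonneg _)
      rcases le_total ‖z‖ 1 with h | h
      · have := Real.rpow_le_one (norm_nonneg z) h hγ
        have := pow_nonneg (norm_nonneg z) ⌈γ⌉₊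
        linarith
      · have := Real.rpow_le_rpow_of_exponent_le h (Nat.le_ceil γ)
        rw [Real.rpow_natCast] at this
        linarith
  refine ⟨(∫ z, ‖z‖ ^ γ * ‖ψ z‖) + 1, by
    have : 0 ≤ ∫ z, ‖z‖ ^ γ * ‖ψ z‖ := integral_nonneg fun z => by positivity
    positivity, fun f A F hf hfs hA hF hΔ x => ?_⟩
  set fc : (Fin d → ℝ) → ℂ := fun y => (f y : ℂ) with hfc
  have hfcc : Continuous fc := Complex.continuous_ofReal.comp hf
  have hfcs : HasCompactSupport fc := hfs.comp_left (g := fun t : ℝ => (t : ℂ)) rfl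
  have hfi : Integrable fc := hfcc.integrable_of_hasCompactSupport hfcs
  obtain ⟨B, hB⟩ := hfcs.exists_bound_of_continuous hfcc
  have hgi : ∀ a : ℝ, Integrable fun z => ψ z * fc (x + a • z) := by
    intro a
    refine hψi.mul_of_top_left (memLp_top_of_bound ?_ B (.of_forall fun z => hB _))
    exact Continuous.aestronglyMeasurable (by fun_prop)
  have hFc : Continuous (piFourier fc) := continuous_piFourier hfi
  have hcut : ∀ l : ℕ, Integrable fun ξ => Φc (((l + 1 : ℕ) / F : ℝ) • ξ) *
      (piFourier fc ξ * Real.fourierChar (x ⬝ᵥ ξ)) := by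
    intro l
    have h1 : Integrable fun ξ => Φc (((l + 1 : ℕ) / F : ℝ) • ξ) :=
      (integrable_comp_smul_iff volume Φc (by positivity)).2 hΦi
    refine h1.mul_of_top_left (memLp_top_of_bound (Continuous.aestronglyMeasurable ?_)
      (∫ y, ‖fc y‖) (.of_forall fun ξ => ?_))
    · have := Real.continuous_fourierChar
      fun_prop
    · rw [norm_mul, Circle.norm_coe, mul_one]
      exact norm_piFourier_le _ _
  have e1 : ∫ ξ, ((∑ l ∈ Finset.range n, (-1 : ℝ) ^ l * (n.choose (l + 1) : ℝ) *
        Φ (((l + 1 : ℕ) / F : ℝ) • ξ) : ℝ) : ℂ) *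
          (piFourier (fun y => (f y : ℂ)) ξ * Real.fourierChar (x ⬝ᵥ ξ)) =
      ∑ l ∈ Finset.range n, ((-1 : ℂ) ^ l * (n.choose (l + 1) : ℂ)) *
        ∫ z, ψ z * fc (x + ((l + 1 : ℕ) / F : ℝ) • z) := by
    rw [Finset.sum_congr rfl fun l _ => by
      rw [← integral_cutoff_mul_piFourier hΦi hfi x (a := ((l + 1 : ℕ) / F : ℝ)) (by positivity),
        ← integral_const_mul]]
    rw [← integral_finsetSum _ fun l _ => (hcut l).const_mul _]
    refine integral_congr_ae (.of_forall fun ξ => ?_)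
    simp only [hΦc]
    push_cast
    rw [Finset.sum_mul]
    refine Finset.sum_congr rfl fun l _ => by ring
  have e2 : (f x : ℂ) = ∫ z, ψ z * fc x := by
    rw [integral_mul_const, hone]
    simp [hΦc, h0, hfc]
  rw [e1, e2]
  rw [Finset.sum_congr rfl fun l _ => by rw [← integral_const_mul]]
  rw [← integral_finsetSum _ fun l _ => (hgi _).const_mul _, ← integral_sub (hψi.mul_const _)
    (integrable_finsetSum _ fun l _ => (hgi _).const_mul _)]
  have hpt : ∀ z, ‖ψ z * fc x - ∑ l ∈ Finset.range n, ((-1 : ℂ) ^ l * (n.choose (l + 1) : ℂ)) *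
      (ψ z * fc (x + ((l + 1 : ℕ) / F : ℝ) • z))‖ ≤ A * F ^ (-γ) * (‖z‖ ^ γ * ‖ψ z‖) := by
    intro z
    have h1 := hΔ (F⁻¹ • z) x
    rw [fwdDiff_iter_eq_sum_shift, Finset.sum_range_succ'] at h1
    have h2 : ψ z * fc x - ∑ l ∈ Finset.range n, ((-1 : ℂ) ^ l * (n.choose (l + 1) : ℂ)) *
      (ψ z * fc (x + ((l + 1 : ℕ) / F : ℝ) • z)) = ψ z * ((((-1 : ℝ) ^ n * (∑ k ∈ Finset.range n,
        ((-1 : ℤ) ^ (n - (k + 1)) * (n.choose (k + 1) : ℤ)) • f (x + (k + 1) • F⁻¹ • z) +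
          ((-1 : ℤ) ^ (n - 0) * (n.choose 0 : ℤ)) • f (x + 0 • F⁻¹ • z)) : ℝ)) : ℂ) := by
      simp only [Nat.sub_zero, Nat.choose_zero_right, zero_smul, add_zero, zsmul_eq_mul]
      push_cast
      rw [mul_add, mul_add, add_comm, sub_eq_add_neg]
      congr 1
      · rw [← mul_assoc ((-1 : ℂ) ^ n), mul_one, ← mul_pow]
        simp [hfc]
      · rw [Finset.mul_sum, Finset.mul_sum, ← Finset.sum_neg_distrib]
        refine Finset.sum_congr rfl fun l hl => ?_
        have hl' := Finset.mem_range.1 hl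
        have e3 : ((((l : ℝ) + 1) / F : ℝ) • z) = (l + 1) • F⁻¹ • z := by
          rw [← Nat.cast_smul_eq_nsmul ℝ (l + 1), smul_smul, div_eq_mul_inv]
          push_cast
          rfl
        have e4 : (-1 : ℂ) ^ n * (-1) ^ (n - (l + 1)) = - (-1) ^ l := by
          obtain ⟨j, rfl⟩ : ∃ j, n = j + (l + 1) := ⟨n - (l + 1), by omega⟩
          rw [Nat.add_sub_cancel, pow_add, mul_right_comm, ← mul_pow]
          simp [pow_succ]
        rw [← e3]
        generalize x + (((l : ℝ) + 1) / F : ℝ) • z = w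
        calc _ = (-(-1 : ℂ) ^ l) * ((n.choose (l + 1) : ℂ) * (ψ z * fc w)) := by
              ring
          _ = _ := by rw [← e4]; simp only [hfc]; ring
    rw [h2, norm_mul, Complex.norm_real, norm_mul, norm_pow, norm_neg, norm_one, one_pow, one_mul,
      Real.norm_eq_abs]
    refine (mul_le_mul_of_nonneg_left h1 (norm_nonneg _)).trans (le_of_eq ?_)
    rw [norm_smul, Real.norm_of_nonneg (by positivity), Real.mul_rpow (by positivity)
      (norm_nonneg _), Real.inv_rpow hF.le, Real.rpow_neg hF.le]
    ring
  refine (norm_integral_le_of_norm_le (hmomγ.const_mul _) (.of_forall hpt)).trans ?_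
  rw [integral_const_mul]
  have : 0 ≤ A * F ^ (-γ) := mul_nonneg hA (Real.rpow_nonneg hF.le _)
  nlinarith

end FourierScaling

section PoissonSummation

open MeasureTheory FourierTransform
open scoped ContDiff Matrix

/-- Polynomial decay of the Fourier transform of a smooth compactly supported function. -/
theorem norm_fourier_le_of_iteratedDeriv {g : ℝ → ℂ} (hg : ContDiff ℝ ∞ g) {R B : ℝ} (hR : 0 ≤ R)
    (hsupp : ∀ v, R < |v| → g v = 0) {q : ℕ} (hB : ∀ v, ‖iteratedDeriv q g v‖ ≤ B) (η : ℝ) :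
    (2 * Real.pi * |η|) ^ q * ‖𝓕 g η‖ ≤ 2 * R * B := by
  have hts : tsupport g ⊆ Set.Icc (-R) R := by
    refine closure_minimal (fun v hv => ?_) isClosed_Icc
    by_contra h
    exact hv (hsupp v (by rw [← not_le, abs_le]; exact h))
  have hgc : HasCompactSupport g := isCompact_Icc.of_isClosed_subset (isClosed_tsupport g) hts
  have hci : ∀ n : ℕ, HasCompactSupport (iteratedDeriv n g) := by
    intro n
    induction n with
    | zero => simpa using hgc
    | succ k ih => rw [iteratedDeriv_succ]; exact ih.deriv
  have hcont : ∀ n : ℕ, Continuous (iteratedDeriv n g) := fun n =>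
    hg.continuous_iteratedDeriv n (by exact_mod_cast le_top)
  have hi : ∀ n : ℕ, (n : ℕ∞) ≤ ⊤ → Integrable (iteratedDeriv n g) := fun n _ =>
    (hcont n).integrable_of_hasCompactSupport (hci n)
  have h1 := congrFun (Real.fourier_iteratedDeriv (n := q) (N := ⊤) hg hi le_top) η
  have h2 : ‖𝓕 (iteratedDeriv q g) η‖ = (2 * Real.pi * |η|) ^ q * ‖𝓕 g η‖ := by
    rw [h1, norm_smul, norm_pow]
    simp [abs_of_pos Real.pi_pos]
  rw [← h2]
  have hsub : Function.support (iteratedDeriv q g) ⊆ Set.Icc (-R) R := by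
    refine (subset_tsupport _).trans (Set.Subset.trans ?_ hts)
    clear h1 h2 hB
    induction q with
    | zero => simp
    | succ k ih =>
      rw [iteratedDeriv_succ]
      exact (closure_minimal support_deriv_subset (isClosed_tsupport _)).trans ih
  rw [Real.fourier_eq]
  have h3 : ∀ v : ℝ, ‖Real.fourierChar (-(inner ℝ v η)) • iteratedDeriv q g v‖ ≤
      (Set.Icc (-R) R).indicator (fun _ => B) v := by
    intro v
    rw [Circle.norm_smul]
    by_cases hv : v ∈ Set.Icc (-R) R
    · rw [Set.indicator_of_mem hv]; exact hB v
    · rw [Set.indicator_of_notMem hv, Function.notMem_support.1 fun h => hv (hsub h), norm_zero]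
  refine (norm_integral_le_of_norm_le ?_ (.of_forall h3)).trans ?_
  · exact (integrable_indicator_iff measurableSet_Icc).2 (by simp)
  · rw [integral_indicator measurableSet_Icc]
    simp only [integral_const, smul_eq_mul]
    rw [measureReal_restrict_apply_univ, Real.volume_real_Icc_of_le (by linarith)]
    linarith

theorem norm_riemannSum_sub_integral_le {R : ℝ} (hR : 0 ≤ R) {q : ℕ} (hq : 2 ≤ q) :
    ∃ C : ℝ, 0 < C ∧ ∀ (B δ lam : ℝ) (g : ℝ → ℂ) (M : ℕ), 0 < δ → |lam| * δ ≤ 1 / 4 → R ≤ M * δ →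
      ContDiff ℝ ∞ g → (∀ v, R < |v| → g v = 0) → (∀ v, ‖iteratedDeriv q g v‖ ≤ B) →
      ‖(δ : ℂ) * ∑ k : Finset.Icc (-(M : ℤ)) M, g (δ * (k : ℤ)) *
        Real.fourierChar (lam * (δ * (k : ℤ))) - ∫ v, g v * Real.fourierChar (lam * v)‖
        ≤ C * B * δ ^ q := by
  have hsum : Summable fun n : ℤ => 1 / |(n : ℝ)| ^ q := by
    refine ((Real.summable_one_div_int_pow (p := q)).2 (by omega)).abs.congr fun n => ?_
    rw [abs_div, abs_one, abs_pow]
  refine ⟨2 * R * (∑' n : ℤ, 1 / |(n : ℝ)| ^ q) + 1, ?_, ?_⟩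
  · have : 0 ≤ ∑' n : ℤ, 1 / |(n : ℝ)| ^ q := tsum_nonneg fun n => by positivity
    positivity
  intro B δ lam g M hδ hlam hM hg hsupp hB
  have hB0 : 0 ≤ B := (norm_nonneg _).trans (hB 0)
  have hts : tsupport g ⊆ Set.Icc (-R) R := by
    refine closure_minimal (fun v hv => ?_) isClosed_Icc
    by_contra h
    exact hv (hsupp v (by rw [← not_le, abs_le]; exact h))
  have hgc : HasCompactSupport g := isCompact_Icc.of_isClosed_subset (isClosed_tsupport g) hts
  set h : ℝ → ℂ := fun t => g (δ * t) * Real.fourierChar (lam * (δ * t)) with hh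
  have hhs : ContDiff ℝ ∞ h := by
    have : ContDiff ℝ ∞ fun t : ℝ => (Real.fourierChar (lam * (δ * t)) : ℂ) := by
      simp only [Real.fourierChar_apply]
      exact (((Complex.ofRealCLM.contDiff.comp (by fun_prop : ContDiff ℝ ∞ fun t : ℝ =>
        2 * Real.pi * (lam * (δ * t)))).mul contDiff_const).cexp)
    exact (hg.comp (by fun_prop)).mul this
  have hhc : HasCompactSupport h := by
    refine HasCompactSupport.mul_right ?_
    exact hgc.comp_homeomorph (Homeomorph.mulLeft₀ δ hδ.ne')
  have hP := SchwartzMap.tsum_eq_tsum_fourier (hhc.toSchwartzMap hhs) 0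
  have hL : ∑' n : ℤ, (hhc.toSchwartzMap hhs) (0 + n) =
      ∑ k : Finset.Icc (-(M : ℤ)) M, g (δ * (k : ℤ)) * Real.fourierChar (lam * (δ * (k : ℤ))) := by
    rw [tsum_eq_sum (s := Finset.Icc (-(M : ℤ)) M)]
    · rw [← Finset.sum_coe_sort]
      refine Finset.sum_congr rfl fun k _ => ?_
      rw [zero_add]; rfl
    · intro k hk
      rw [zero_add]
      change g (δ * k) * _ = 0
      rw [hsupp, zero_mul]
      have : (M : ℤ) + 1 ≤ |k| := by
        by_contra hcon
        exact hk (Finset.mem_Icc.2 (abs_le.1 (by omega)))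
      have h2 : (M : ℝ) + 1 ≤ |(k : ℝ)| := by exact_mod_cast this
      rw [abs_mul, abs_of_pos hδ]
      nlinarith
  have hF : ∀ η : ℝ, (δ : ℂ) * 𝓕 h η = 𝓕 g (η / δ - lam) := by
    intro η
    rw [Real.fourier_eq, Real.fourier_eq]
    have h1 := Measure.integral_comp_mul_left
      (fun v => Real.fourierChar (-(inner ℝ v (η / δ - lam))) • g v) δ
    rw [abs_of_pos (inv_pos.2 hδ)] at h1
    have h3 : ∫ v, Real.fourierChar (-(inner ℝ v (η / δ - lam))) • g v = δ • (δ⁻¹ •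
      ∫ v, Real.fourierChar (-(inner ℝ v (η / δ - lam))) • g v) := by
      rw [smul_smul, mul_inv_cancel₀ hδ.ne', one_smul]
    rw [h3, ← h1, Complex.real_smul]
    congr 1
    refine integral_congr_ae (.of_forall fun t => ?_)
    simp only [hh, Circle.smul_def, smul_eq_mul]
    rw [mul_comm (g _), ← mul_assoc, ← Circle.coe_mul, ← AddChar.map_add_eq_mul]
    congr 3
    simp only [RCLike.inner_apply, conj_trivial]
    field_simp
    ring
  have hdec : ∀ n : ℤ, n ≠ 0 → ‖𝓕 g (n / δ - lam)‖ ≤ 2 * R * B * δ ^ q * (1 / |(n : ℝ)| ^ q) := by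
    intro n hn
    have h1 := norm_fourier_le_of_iteratedDeriv hg hR hsupp hB (n / δ - lam)
    have hn1 : (1 : ℝ) ≤ |(n : ℝ)| := by exact_mod_cast Int.one_le_abs hn
    have h2 : |(n : ℝ)| / δ ≤ 2 * Real.pi * |n / δ - lam| := by
      have h3 : |(n : ℝ)| / δ ≤ |n / δ - lam| + |lam| := by
        have := abs_add_le (n / δ - lam) lam
        rwa [sub_add_cancel, abs_div, abs_of_pos hδ] at this
      have h4 : |lam| ≤ |(n : ℝ)| / δ / 4 := by
        rw [le_div_iff₀ (by norm_num), le_div_iff₀ hδ]; linarith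
      have := Real.pi_gt_three
      have : 0 ≤ |(n : ℝ)| / δ := by positivity
      nlinarith [abs_nonneg (n / δ - lam)]
    have h5 : (|(n : ℝ)| / δ) ^ q * ‖𝓕 g (n / δ - lam)‖ ≤ 2 * R * B :=
      (mul_le_mul_of_nonneg_right (pow_le_pow_left₀ (by positivity) h2 q) (norm_nonneg _)).trans h1
    rw [div_pow, div_mul_eq_mul_div, div_le_iff₀ (by positivity)] at h5
    rw [mul_one_div, le_div_iff₀ (by positivity)]
    linarith
  have hR' : ∑' n : ℤ, 𝓕 (hhc.toSchwartzMap hhs) n * fourier n ((0 : ℝ) : UnitAddCircle) =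
      ∑' n : ℤ, 𝓕 h n := by
    refine tsum_congr fun n => ?_
    rw [fourier_coe_apply]
    simp
    rfl
  rw [hL, hR'] at hP
  rw [hP, ← tsum_mul_left]
  simp only [hF]
  have hint : ∫ v, g v * Real.fourierChar (lam * v) = 𝓕 g (-lam) := by
    rw [Real.fourier_eq]
    refine integral_congr_ae (.of_forall fun v => ?_)
    simp only [Circle.smul_def, smul_eq_mul, RCLike.inner_apply, conj_trivial]
    rw [mul_comm]; congr 3; ring
  have hs1 : Summable fun n : ℤ => ‖if n = 0 then 0 else 𝓕 g (n / δ - lam)‖ := by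
    refine Summable.of_nonneg_of_le (fun n => norm_nonneg _) (fun n => ?_)
      (hsum.mul_left (2 * R * B * δ ^ q))
    split_ifs with hn
    · rw [norm_zero]; positivity
    · exact hdec n hn
  have hs2 : Summable fun n : ℤ => 𝓕 g (n / δ - lam) := by
    refine (summable_congr_cofinite ?_).1 hs1.of_norm
    filter_upwards [(Set.finite_singleton (0 : ℤ)).compl_mem_cofinite] with n hn
    rw [if_neg (by simpa using hn)]
  rw [hint, hs2.tsum_eq_add_tsum_ite 0]
  simp only [Int.cast_zero, zero_div, zero_sub, add_sub_cancel_left]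
  refine (norm_tsum_le_tsum_norm hs1).trans ?_
  refine (hs1.tsum_le_tsum (fun n => ?_) (hsum.mul_left (2 * R * B * δ ^ q))).trans ?_
  · split_ifs with hn
    · rw [norm_zero]; positivity
    · exact hdec n hn
  · rw [tsum_mul_left]
    have : 0 ≤ B * δ ^ q := by positivity
    nlinarith

end PoissonSummation

section LatticeSums

open MeasureTheory FourierTransform
open scoped ContDiff Matrix

/-- Integrals over `Fin (n + 1) → ℝ` by slicing along the coordinate `i`. -/
theorem integral_insertNth {n : ℕ} {E : Type*} [NormedAddCommGroup E] [NormedSpace ℝ E]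
    (i : Fin (n + 1)) {f : (Fin (n + 1) → ℝ) → E} (hf : Integrable f) :
    ∫ v, f v = ∫ t : ℝ, ∫ v : Fin n → ℝ, f (i.insertNth t v) := by
  have h := volume_preserving_piFinSuccAbove (fun _ : Fin (n + 1) => ℝ) i
  have h1 := h.symm.integral_comp (MeasurableEquiv.measurableEmbedding _) f
  rw [← h1, Measure.volume_eq_prod, integral_prod]
  · rfl
  · exact (h.symm.integrable_comp_emb (MeasurableEquiv.measurableEmbedding _)).2 hf

theorem integral_insertNth' {n : ℕ} {E : Type*} [NormedAddCommGroup E] [NormedSpace ℝ E]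
    (i : Fin (n + 1)) {f : (Fin (n + 1) → ℝ) → E} (hf : Integrable f) :
    ∫ v, f v = ∫ v : Fin n → ℝ, ∫ t : ℝ, f (i.insertNth t v) := by
  have h := volume_preserving_piFinSuccAbove (fun _ : Fin (n + 1) => ℝ) i
  have h1 := h.symm.integral_comp (MeasurableEquiv.measurableEmbedding _) f
  rw [← h1, Measure.volume_eq_prod, integral_prod_symm]
  · rfl
  · exact (h.symm.integrable_comp_emb (MeasurableEquiv.measurableEmbedding _)).2 hf

theorem exists_forall_norm_iteratedDeriv_update_le {n : ℕ} {χ : (Fin n → ℝ) → ℂ}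
    (hχ : ContDiff ℝ ∞ χ) (hc : HasCompactSupport χ) (q : ℕ) :
    ∃ B : ℝ, ∀ i v t, ‖iteratedDeriv q (fun s : ℝ => χ (Function.update v i s)) t‖ ≤ B := by
  obtain ⟨B, hB⟩ := (hχ.continuous_iteratedFDeriv (m := q)
    (by exact_mod_cast le_top)).bounded_above_of_compact_support (hc.iteratedFDeriv q)
  refine ⟨B, fun i v t => ?_⟩
  have h1 : (fun s : ℝ => χ (Function.update v i s)) =
      (fun y => χ (Function.update v i 0 + y)) ∘ (ContinuousLinearMap.single ℝ (fun _ => ℝ) i) := by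
    funext s
    simp only [Function.comp_apply]
    congr 1
    ext j
    by_cases hj : j = i
    · subst hj; simp
    · simp [hj]
  rw [← norm_iteratedFDeriv_eq_norm_iteratedDeriv, h1,
    ContinuousLinearMap.iteratedFDeriv_comp_right _ (n := ∞) (by fun_prop) _
      (by exact_mod_cast le_top)]
  refine (ContinuousMultilinearMap.norm_compContinuousLinearMap_le _ _).trans ?_
  rw [iteratedFDeriv_comp_add_left]
  have h2 : ‖ContinuousLinearMap.single ℝ (fun _ : Fin n => ℝ) i‖ ≤ 1 :=
    ContinuousLinearMap.opNorm_le_bound _ zero_le_one fun x => by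
      simp [Pi.norm_single]
  calc _ ≤ B * 1 := by
        refine mul_le_mul (hB _) (Finset.prod_le_one (fun _ _ => norm_nonneg _) fun _ _ => h2)
          (Finset.prod_nonneg fun _ _ => norm_nonneg _) ((norm_nonneg _).trans (hB 0))
    _ = B := mul_one B

theorem norm_latticeSum_sub_integral_le {R : ℝ} (hR : 0 ≤ R) {q : ℕ} (hq : 2 ≤ q) (n : ℕ) :
    ∃ C : ℝ, 0 < C ∧ ∀ (B δ : ℝ) (lam : Fin n → ℝ) (χ : (Fin n → ℝ) → ℂ) (M : ℕ), 0 ≤ B →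
      0 < δ → δ ≤ 1 →
      (∀ i, |lam i| * δ ≤ 1 / 4) → R ≤ M * δ → M * δ ≤ R + 1 →
      ContDiff ℝ ∞ χ → (∀ v i, R < |v i| → χ v = 0) →
      (∀ i v t, ‖iteratedDeriv q (fun s : ℝ => χ (Function.update v i s)) t‖ ≤ B) →
      ‖(δ : ℂ) ^ n * ∑ k : Fin n → Finset.Icc (-(M : ℤ)) M, χ (fun i => δ * (k i : ℤ)) *
        Real.fourierChar (lam ⬝ᵥ fun i => δ * (k i : ℤ)) -
          ∫ v, χ v * Real.fourierChar (lam ⬝ᵥ v)‖ ≤ C * B * δ ^ q := by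
  obtain ⟨C₁, hC₁, H₁⟩ := norm_riemannSum_sub_integral_le hR hq
  induction n with
  | zero =>
    refine ⟨1, one_pos, fun B δ lam χ M hB0 hδ _ _ _ _ _ _ _ => ?_⟩
    rw [Fintype.sum_unique, integral_unique]
    have : Measure.real (volume : Measure (Fin 0 → ℝ)) Set.univ = 1 := by
      rw [Measure.real, volume_pi, Measure.pi_of_empty, Measure.dirac_apply_of_mem (Set.mem_univ _),
        ENNReal.toReal_one]
    rw [this]
    simp only [pow_zero, one_mul, one_smul]
    rw [sub_eq_zero_of_eq, norm_zero]
    · positivity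
    · congr 2
      · exact Subsingleton.elim _ _
  | succ n ih =>
    obtain ⟨C₂, hC₂, H₂⟩ := ih
    refine ⟨(2 * R + 3) * C₂ + (2 * R) ^ n * C₁, by positivity, ?_⟩
    intro B δ lam χ M hB0 hδ hδ1 hlam hM1 hM2 hχ hsupp hB
    have hcons : ∀ t : ℝ, ContDiff ℝ ∞ fun v' : Fin n → ℝ => (Fin.cons t v' : Fin (n + 1) → ℝ) := by
      intro t
      rw [contDiff_pi]
      intro i
      refine Fin.cases ?_ (fun j => ?_) i
      · simp only [Fin.cons_zero]; fun_prop
      · simp only [Fin.cons_succ]; fun_prop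
    have hcons' : ∀ v' : Fin n → ℝ, ContDiff ℝ ∞ fun t : ℝ => (Fin.cons t v' : Fin (n + 1) →
        ℝ) := by
      intro t
      rw [contDiff_pi]
      intro i
      refine Fin.cases ?_ (fun j => ?_) i
      · simp only [Fin.cons_zero]; fun_prop
      · simp only [Fin.cons_succ]; fun_prop
    have hdot : ∀ (t : ℝ) (v' : Fin n → ℝ), (Real.fourierChar (lam ⬝ᵥ Fin.cons t v') : ℂ) =
        Real.fourierChar (lam 0 * t) * Real.fourierChar (Fin.tail lam ⬝ᵥ v') := by
      intro t v'
      rw [← Circle.coe_mul, ← AddChar.map_add_eq_mul]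
      congr 2
      simp [dotProduct, Fin.sum_univ_succ, Fin.tail]
    have hcs : HasCompactSupport χ := by
      refine HasCompactSupport.intro (isCompact_closedBall (0 : Fin (n + 1) → ℝ) R) fun v hv => ?_
      rw [Metric.mem_closedBall, dist_zero_right, pi_norm_le_iff_of_nonneg hR] at hv
      push Not at hv
      obtain ⟨i, hi⟩ := hv
      exact hsupp v i hi
    have hfc : Continuous fun v : Fin (n + 1) → ℝ => (Real.fourierChar (lam ⬝ᵥ v) : ℂ) := by
      have : Continuous fun v : Fin (n + 1) → ℝ => lam ⬝ᵥ v := by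
        simp only [dotProduct]; fun_prop
      fun_prop
    have hint : Integrable fun v => χ v * (Real.fourierChar (lam ⬝ᵥ v) : ℂ) :=
      (hχ.continuous.mul hfc).integrable_of_hasCompactSupport hcs.mul_right
    -- the sums over the last coordinates
    set S : ℝ → ℂ := fun t => (δ : ℂ) ^ n * ∑ k : Fin n → Finset.Icc (-(M : ℤ)) M,
      χ (Fin.cons t fun i => δ * (k i : ℤ)) *
        Real.fourierChar (Fin.tail lam ⬝ᵥ fun i => δ * (k i : ℤ)) with hS
    set I : ℝ → ℂ := fun t => ∫ v' : Fin n → ℝ,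
      χ (Fin.cons t v') * Real.fourierChar (Fin.tail lam ⬝ᵥ v') with hI
    have hSI : ∀ t, ‖S t - I t‖ ≤ C₂ * B * δ ^ q := by
      intro t
      refine H₂ B δ (Fin.tail lam) (fun v' => χ (Fin.cons t v')) M hB0 hδ hδ1
        (fun i => hlam i.succ) hM1 hM2 (hχ.comp (hcons t)) (fun v i hi => ?_) (fun i v s => ?_)
      · exact hsupp _ i.succ (by simpa using hi)
      · simp only [Fin.cons_update]
        exact hB i.succ _ s
    set K := Finset.Icc (-(M : ℤ)) M with hK
    have hsum : (δ : ℂ) ^ (n + 1) * ∑ k : Fin (n + 1) → K, χ (fun i => δ * (k i : ℤ)) *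
        Real.fourierChar (lam ⬝ᵥ fun i => δ * (k i : ℤ)) =
        (δ : ℂ) * ∑ k₀ : K, S (δ * (k₀ : ℤ)) * Real.fourierChar (lam 0 * (δ * (k₀ : ℤ))) := by
      rw [← (Fin.consEquiv fun _ => (K : Type)).sum_comp, Fintype.sum_prod_type, pow_succ',
        mul_assoc, Finset.mul_sum]
      congr 1
      refine Finset.sum_congr rfl fun k₀ _ => ?_
      rw [hS]
      simp only
      rw [mul_assoc, Finset.sum_mul]
      congr 1
      refine Finset.sum_congr rfl fun k _ => ?_
      have h1 : (fun i => δ * (((Fin.consEquiv fun _ => (K : Type)) (k₀, k) i : ℤ) : ℝ)) =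
          Fin.cons (δ * (k₀ : ℤ)) fun i => δ * (k i : ℤ) := by
        funext i
        refine Fin.cases ?_ (fun j => ?_) i <;> simp [Fin.consEquiv]
      rw [h1, hdot]
      ring
    have hIint : ∀ t, Integrable fun v' : Fin n → ℝ =>
        χ (Fin.cons t v') * (Real.fourierChar (Fin.tail lam ⬝ᵥ v') : ℂ) := by
      intro t
      have h1 : Continuous fun v' : Fin n → ℝ => (Real.fourierChar (Fin.tail lam ⬝ᵥ v') : ℂ) := by
        have : Continuous fun v : Fin n → ℝ => Fin.tail lam ⬝ᵥ v := by
          simp only [dotProduct]; fun_prop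
        fun_prop
      refine ((hχ.comp (hcons t)).continuous.mul h1).integrable_of_hasCompactSupport
        (HasCompactSupport.mul_right ?_)
      refine HasCompactSupport.intro (isCompact_closedBall (0 : Fin n → ℝ) R) fun v hv => ?_
      rw [Metric.mem_closedBall, dist_zero_right, pi_norm_le_iff_of_nonneg hR] at hv
      push Not at hv
      obtain ⟨i, hi⟩ := hv
      exact hsupp _ i.succ (by simpa using hi)
    have hmain : ‖(δ : ℂ) * ∑ k₀ : K, I (δ * (k₀ : ℤ)) *
        Real.fourierChar (lam 0 * (δ * (k₀ : ℤ))) - ∫ v, χ v * Real.fourierChar (lam ⬝ᵥ v)‖ ≤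
        (2 * R) ^ n * (C₁ * B * δ ^ q) := by
      rw [integral_insertNth' 0 hint]
      have h1 : (δ : ℂ) * ∑ k₀ : K, I (δ * (k₀ : ℤ)) *
          Real.fourierChar (lam 0 * (δ * (k₀ : ℤ))) =
          ∫ v' : Fin n → ℝ, ((δ : ℂ) * ∑ k₀ : K, χ (Fin.cons (δ * (k₀ : ℤ)) v') *
            Real.fourierChar (lam 0 * (δ * (k₀ : ℤ)))) *
              Real.fourierChar (Fin.tail lam ⬝ᵥ v') := by
        rw [Finset.mul_sum]
        simp_rw [Finset.mul_sum, Finset.sum_mul]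
        rw [integral_finsetSum]
        · refine Finset.sum_congr rfl fun k₀ _ => ?_
          rw [hI]
          simp only
          rw [← integral_mul_const, ← integral_const_mul]
          congr 1; funext v'; ring
        · intro k₀ _
          refine (((hIint (δ * (k₀ : ℤ))).mul_const
            (Real.fourierChar (lam 0 * (δ * (k₀ : ℤ))) : ℂ)).const_mul (δ : ℂ)).congr
            (.of_forall fun v' => ?_)
          simp only; ring
      have h2 : ∫ v' : Fin n → ℝ, ∫ t : ℝ, χ (Fin.insertNth 0 t v') *
          (Real.fourierChar (lam ⬝ᵥ Fin.insertNth 0 t v') : ℂ) =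
          ∫ v' : Fin n → ℝ, (∫ t : ℝ, χ (Fin.cons t v') * Real.fourierChar (lam 0 * t)) *
            Real.fourierChar (Fin.tail lam ⬝ᵥ v') := by
        refine integral_congr_ae (.of_forall fun v' => ?_)
        simp only
        rw [← integral_mul_const]
        refine integral_congr_ae (.of_forall fun t => ?_)
        simp only
        rw [Fin.insertNth_zero', hdot]; ring
      have i1 : Integrable fun v' : Fin n → ℝ => ((δ : ℂ) * ∑ k₀ : K, χ (Fin.cons (δ * (k₀ : ℤ))
          v') *
            Real.fourierChar (lam 0 * (δ * (k₀ : ℤ)))) *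
              Real.fourierChar (Fin.tail lam ⬝ᵥ v') := by
        simp_rw [Finset.mul_sum, Finset.sum_mul]
        refine integrable_finsetSum _ fun k₀ _ => ?_
        refine (((hIint (δ * (k₀ : ℤ))).mul_const
            (Real.fourierChar (lam 0 * (δ * (k₀ : ℤ))) : ℂ)).const_mul (δ : ℂ)).congr
            (.of_forall fun v' => ?_)
        simp only; ring
      have i2 : Integrable fun v' : Fin n → ℝ =>
          (∫ t : ℝ, χ (Fin.cons t v') * Real.fourierChar (lam 0 * t)) *
            Real.fourierChar (Fin.tail lam ⬝ᵥ v') := by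
        have hp := volume_preserving_piFinSuccAbove (fun _ : Fin (n + 1) => ℝ) 0
        have h3 := (hp.symm.integrable_comp_emb (MeasurableEquiv.measurableEmbedding _)).2 hint
        rw [Measure.volume_eq_prod] at h3
        refine h3.integral_prod_right.congr (.of_forall fun v' => ?_)
        simp only
        rw [← integral_mul_const]
        refine integral_congr_ae (.of_forall fun t => ?_)
        simp only [Function.comp_apply]
        change χ (Fin.insertNth 0 t v') *
          (Real.fourierChar (lam ⬝ᵥ Fin.insertNth 0 t v') : ℂ) = _
        rw [Fin.insertNth_zero', hdot]; ring
      rw [h1, h2, ← integral_sub i1 i2]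
      have h4 : ∀ v' : Fin n → ℝ, ‖((δ : ℂ) * ∑ k₀ : K, χ (Fin.cons (δ * (k₀ : ℤ)) v') *
            Real.fourierChar (lam 0 * (δ * (k₀ : ℤ)))) * Real.fourierChar (Fin.tail lam ⬝ᵥ v') -
          (∫ t : ℝ, χ (Fin.cons t v') * Real.fourierChar (lam 0 * t)) *
            Real.fourierChar (Fin.tail lam ⬝ᵥ v')‖ ≤
          (Set.Icc (fun _ => -R) (fun _ => R)).indicator (fun _ => C₁ * B * δ ^ q) v' := by
        intro v'
        rw [← sub_mul, norm_mul, Circle.norm_coe, mul_one]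
        by_cases hv : v' ∈ Set.Icc (fun _ => -R) (fun _ : Fin n => R)
        · rw [Set.indicator_of_mem hv]
          refine H₁ B δ (lam 0) (fun t => χ (Fin.cons t v')) M hδ (hlam 0) hM1
            (hχ.comp (hcons' v')) (fun t ht => hsupp _ 0 (by simpa using ht)) fun t => ?_
          have := hB 0 (Fin.cons 0 v') t
          simpa only [Fin.update_cons_zero] using this
        · rw [Set.indicator_of_notMem hv]
          have h5 : ∃ i, R < |v' i| := by
            by_contra hcon
            push Not at hcon
            exact hv ⟨fun i => (abs_le.1 (hcon i)).1, fun i => (abs_le.1 (hcon i)).2⟩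
          obtain ⟨i, hi⟩ := h5
          have h6 : ∀ t : ℝ, χ (Fin.cons t v') = 0 := fun t => hsupp _ i.succ (by simpa using hi)
          simp [h6]
      refine (norm_integral_le_of_norm_le ?_ (.of_forall h4)).trans ?_
      · refine (integrable_indicator_iff measurableSet_Icc).2 ?_
        exact integrableOn_const isCompact_Icc.measure_lt_top.ne
      · rw [integral_indicator measurableSet_Icc]
        simp only [integral_const, smul_eq_mul]
        rw [measureReal_restrict_apply_univ, Measure.real, Real.volume_Icc_pi_toReal]
        · simp only [Finset.prod_const, Finset.card_univ, Fintype.card_fin]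
          rw [sub_neg_eq_add, ← two_mul]
        · intro i; simp only; linarith
    have hfirst : ‖(δ : ℂ) * ∑ k₀ : K, S (δ * (k₀ : ℤ)) *
        Real.fourierChar (lam 0 * (δ * (k₀ : ℤ))) - (δ : ℂ) * ∑ k₀ : K, I (δ * (k₀ : ℤ)) *
        Real.fourierChar (lam 0 * (δ * (k₀ : ℤ)))‖ ≤ (2 * R + 3) * (C₂ * B * δ ^ q) := by
      rw [← mul_sub, ← Finset.sum_sub_distrib, norm_mul, Complex.norm_real,
        Real.norm_of_nonneg hδ.le]
      have h1 : ‖∑ k₀ : K, (S (δ * (k₀ : ℤ)) * Real.fourierChar (lam 0 * (δ * (k₀ : ℤ))) -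
          I (δ * (k₀ : ℤ)) * Real.fourierChar (lam 0 * (δ * (k₀ : ℤ))))‖ ≤
          ∑ _k₀ : K, C₂ * B * δ ^ q := by
        refine norm_sum_le_of_le _ fun k₀ _ => ?_
        rw [← sub_mul, norm_mul, Circle.norm_coe, mul_one]
        exact hSI _
      have h2 : (Fintype.card K : ℝ) = 2 * M + 1 := by
        rw [Fintype.card_coe, hK, Int.card_Icc]
        have : ((M : ℤ) + 1 - -(M : ℤ)).toNat = 2 * M + 1 := by omega
        rw [this]; push_cast; ring
      rw [Finset.sum_const, Finset.card_univ, nsmul_eq_mul, h2] at h1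
      have : 0 ≤ C₂ * B * δ ^ q := by positivity
      calc _ ≤ δ * ((2 * M + 1) * (C₂ * B * δ ^ q)) := by gcongr
        _ = (2 * (M * δ) + δ) * (C₂ * B * δ ^ q) := by ring
        _ ≤ _ := mul_le_mul_of_nonneg_right (by linarith) this
    rw [hsum]
    refine (norm_sub_le_norm_sub_add_norm_sub _ _ _).trans ((add_le_add hfirst hmain).trans ?_)
    linarith

end LatticeSums

section Superposition

open MeasureTheory FourierTransform
open scoped ContDiff Matrix

/-- Lattice sums of `χ` against a superposition of low-frequency characters. -/
theorem exists_norm_latticeSum_superposition_le {n : ℕ} {χ : (Fin n → ℝ) → ℂ}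
    (hχ : ContDiff ℝ ∞ χ) {R : ℝ} (hR : 0 ≤ R) (hsupp : ∀ v i, R < |v i| → χ v = 0)
    {q : ℕ} (hq : 2 ≤ q) :
    ∃ C : ℝ, 0 < C ∧ ∀ (X : Type) [MeasureSpace X] [SFinite (volume : Measure X)] (A : X → ℂ)
      (lam : X → Fin n → ℝ) (δ : ℝ) (M : ℕ), Integrable A → Measurable lam → 0 < δ → δ ≤ 1 →
      (∀ p, A p ≠ 0 → ∀ i, |lam p i| * δ ≤ 1 / 4) → R ≤ M * δ → M * δ ≤ R + 1 →
      ‖(δ : ℂ) ^ n * ∑ k : Fin n → Finset.Icc (-(M : ℤ)) M, χ (fun i => δ * (k i : ℤ)) *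
        (∫ p, A p * Real.fourierChar (lam p ⬝ᵥ fun i => δ * (k i : ℤ))) -
          ∫ v, χ v * ∫ p, A p * Real.fourierChar (lam p ⬝ᵥ v)‖ ≤ C * δ ^ q * ∫ p, ‖A p‖ := by
  obtain ⟨C, hC, H⟩ := norm_latticeSum_sub_integral_le hR hq n
  have hcs : HasCompactSupport χ := by
    refine HasCompactSupport.intro (isCompact_closedBall (0 : Fin n → ℝ) R) fun v hv => ?_
    rw [Metric.mem_closedBall, dist_zero_right, pi_norm_le_iff_of_nonneg hR] at hv
    push Not at hv
    obtain ⟨i, hi⟩ := hv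
    exact hsupp v i hi
  obtain ⟨B', hB'⟩ := exists_forall_norm_iteratedDeriv_update_le hχ hcs q
  set B := max B' 1 with hBdef
  have hB1 : 1 ≤ B := le_max_right _ _
  refine ⟨C * B, by positivity, fun X _ _ A lam δ M hA hlam hδ hδ1 hAl hM1 hM2 => ?_⟩
  have hchar : ∀ v : Fin n → ℝ, Measurable fun p => (Real.fourierChar (lam p ⬝ᵥ v) : ℂ) := by
    intro v
    have h1 : Measurable fun p => lam p ⬝ᵥ v := by
      simp only [dotProduct]
      exact Finset.measurable_sum _ fun i _ => ((measurable_pi_apply i).comp hlam).mul_const _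
    have h2 : Continuous fun t : ℝ => (Real.fourierChar t : ℂ) := by fun_prop
    exact h2.measurable.comp h1
  have hAi : ∀ v : Fin n → ℝ, Integrable fun p => A p * (Real.fourierChar (lam p ⬝ᵥ v) : ℂ) := by
    intro v
    refine hA.mul_bdd (c := 1) (hchar v).aestronglyMeasurable (.of_forall fun p => ?_)
    rw [Circle.norm_coe]
  have hχi : Integrable χ := hχ.continuous.integrable_of_hasCompactSupport hcs
  have hprod : Integrable (fun z : (Fin n → ℝ) × X =>
      χ z.1 * (A z.2 * (Real.fourierChar (lam z.2 ⬝ᵥ z.1) : ℂ))) (volume.prod volume) := by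
    have h1 : Measurable fun z : (Fin n → ℝ) × X => (Real.fourierChar (lam z.2 ⬝ᵥ z.1) : ℂ) := by
      have h1 : Measurable fun z : (Fin n → ℝ) × X => lam z.2 ⬝ᵥ z.1 := by
        simp only [dotProduct]
        exact Finset.measurable_sum _ fun i _ =>
          ((measurable_pi_apply i).comp (hlam.comp measurable_snd)).mul
            ((measurable_pi_apply i).comp measurable_fst)
      have h2 : Continuous fun t : ℝ => (Real.fourierChar t : ℂ) := by fun_prop
      exact h2.measurable.comp h1
    refine ((hχi.mul_prod hA).mul_bdd (c := 1) h1.aestronglyMeasurable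
      (.of_forall fun p => ?_)).congr (.of_forall fun z => ?_)
    · rw [Circle.norm_coe]
    · simp only; ring
  have e1 : ∫ v, χ v * ∫ p, A p * Real.fourierChar (lam p ⬝ᵥ v) =
      ∫ p, A p * ∫ v, χ v * Real.fourierChar (lam p ⬝ᵥ v) := by
    simp_rw [← integral_const_mul]
    rw [integral_integral_swap hprod]
    refine integral_congr_ae (.of_forall fun p => integral_congr_ae (.of_forall fun v => ?_))
    simp only; ring
  have hsw : Integrable fun p => A p * ∫ v, χ v * Real.fourierChar (lam p ⬝ᵥ v) := by
    refine hprod.integral_prod_right.congr (.of_forall fun p => ?_)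
    simp only
    rw [← integral_const_mul]
    refine integral_congr_ae (.of_forall fun v => ?_)
    simp only; ring
  have e2 : (δ : ℂ) ^ n * ∑ k : Fin n → Finset.Icc (-(M : ℤ)) M, χ (fun i => δ * (k i : ℤ)) *
        ∫ p, A p * Real.fourierChar (lam p ⬝ᵥ fun i => δ * (k i : ℤ)) =
      ∫ p, A p * ((δ : ℂ) ^ n * ∑ k : Fin n → Finset.Icc (-(M : ℤ)) M,
        χ (fun i => δ * (k i : ℤ)) * Real.fourierChar (lam p ⬝ᵥ fun i => δ * (k i : ℤ))) := by
    simp_rw [← integral_const_mul]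
    rw [← integral_finsetSum _ fun k _ => (hAi _).const_mul _, ← integral_const_mul]
    refine integral_congr_ae (.of_forall fun p => ?_)
    simp only [Finset.mul_sum]
    refine Finset.sum_congr rfl fun k _ => ?_
    ring
  have hs2 : Integrable fun p => A p * ((δ : ℂ) ^ n * ∑ k : Fin n → Finset.Icc (-(M : ℤ)) M,
        χ (fun i => δ * (k i : ℤ)) * Real.fourierChar (lam p ⬝ᵥ fun i => δ * (k i : ℤ))) := by
    have := (integrable_finsetSum Finset.univ fun (k : Fin n → Finset.Icc (-(M : ℤ)) M) _ =>
      (hAi (fun i => δ * (k i : ℤ))).const_mul (χ fun i => δ * (k i : ℤ))).const_mul ((δ : ℂ) ^ n)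
    refine this.congr (.of_forall fun p => ?_)
    simp only [Finset.mul_sum]
    refine Finset.sum_congr rfl fun k _ => ?_
    ring
  rw [e1, e2, ← integral_sub hs2 hsw, ← integral_const_mul]
  refine norm_integral_le_of_norm_le (hA.norm.const_mul _) (.of_forall fun p => ?_)
  rw [← mul_sub, norm_mul, mul_comm]
  by_cases hp : A p = 0
  · simp [hp]
  refine mul_le_mul_of_nonneg_right ?_ (norm_nonneg _)
  exact H B δ (lam p) χ M (by positivity) hδ hδ1 (hAl p hp) hM1 hM2 hχ hsupp
    fun i v t => (hB' i v t).trans (le_max_left _ _)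

/-- Polar-type coordinates adapted to the cone around the `i`-th axis. -/
theorem integral_cone {n : ℕ} (i : Fin (n + 1)) {K : (Fin (n + 1) → ℝ) → ℝ} (hK : Continuous K)
    (hKc : HasCompactSupport K) {χ : (Fin n → ℝ) → ℝ} (hχ : Continuous χ)
    (hχc : HasCompactSupport χ) {φ : ℝ → ℝ} (hφ : Continuous φ) (hφc : HasCompactSupport φ)
    (hKχ : ∀ v r, r ≠ 0 → K (r • i.insertNth 1 v) = χ v * φ r)
    {G : (Fin (n + 1) → ℝ) → ℂ} (hG : Continuous G) :
    ∫ ξ, (K ξ : ℂ) * G ξ =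
      ∫ v : Fin n → ℝ, (χ v : ℂ) * ∫ r : ℝ, ((|r| ^ n * φ r : ℝ) : ℂ) *
        G (r • i.insertNth (1 : ℝ) v) := by
  have hint : Integrable fun ξ => (K ξ : ℂ) * G ξ := by
    refine ((Complex.continuous_ofReal.comp hK).mul hG).integrable_of_hasCompactSupport ?_
    exact (hKc.comp_left (g := ((↑) : ℝ → ℂ)) Complex.ofReal_zero).mul_right
  have hdir : Continuous fun z : (Fin n → ℝ) × ℝ =>
      (z.2 • (i.insertNth (1 : ℝ) z.1 : Fin (n + 1) → ℝ)) := by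
    refine continuous_pi fun j => ?_
    refine Fin.succAboveCases i ?_ (fun l => ?_) j
    · simp only [Pi.smul_apply, Fin.insertNth_apply_same]; fun_prop
    · simp only [Pi.smul_apply, Fin.insertNth_apply_succAbove]; fun_prop
  rw [integral_insertNth i hint]
  have h1 : ∀ r : ℝ, r ≠ 0 → ∫ v : Fin n → ℝ, (K (i.insertNth r v) : ℂ) * G (i.insertNth r v) =
      ∫ v : Fin n → ℝ, (χ v : ℂ) * (((|r| ^ n * φ r : ℝ) : ℂ) *
        G (r • i.insertNth (1 : ℝ) v)) := by
    intro r hr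
    have h2 := Measure.integral_comp_smul (volume : Measure (Fin n → ℝ))
      (fun v => (K (i.insertNth r v) : ℂ) * G (i.insertNth r v)) r
    have h4 : ∀ v : Fin n → ℝ, (i.insertNth r (r • v) : Fin (n + 1) → ℝ) =
        r • i.insertNth (1 : ℝ) v := by
      intro v
      funext j
      refine Fin.succAboveCases i ?_ (fun l => ?_) j <;> simp
    have h3 : |r| ^ n ≠ 0 := pow_ne_zero _ (abs_ne_zero.2 hr)
    simp only [h4, Module.finrank_fin_fun, abs_inv, abs_pow] at h2
    have h5 : ∀ z : ℂ, z = ((|r| ^ n : ℝ) : ℂ) * ((|r| ^ n)⁻¹ • z) := by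
      intro z
      rw [Complex.real_smul, ← mul_assoc, ← Complex.ofReal_mul, mul_inv_cancel₀ h3,
        Complex.ofReal_one, one_mul]
    rw [h5 (∫ v : Fin n → ℝ, (K (i.insertNth r v) : ℂ) * G (i.insertNth r v)), ← h2,
      ← integral_const_mul]
    refine integral_congr_ae (.of_forall fun v => ?_)
    simp only [hKχ v r hr]
    push_cast
    ring
  have h0 : ∀ᵐ r : ℝ, r ≠ 0 := by
    rw [ae_iff]; simp
  rw [integral_congr_ae (h0.mono h1)]
  simp_rw [← integral_const_mul]
  rw [integral_integral_swap]
  have hc : Continuous fun z : ℝ × (Fin n → ℝ) => (χ z.2 : ℂ) * (((|z.1| ^ n * φ z.1 : ℝ) : ℂ) *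
        G (z.1 • i.insertNth (1 : ℝ) z.2)) := by
    have := hG.comp (hdir.comp (continuous_snd.prodMk continuous_fst :
      Continuous fun z : ℝ × (Fin n → ℝ) => (z.2, z.1)))
    simp only [Function.comp_def] at this
    fun_prop
  refine hc.integrable_of_hasCompactSupport
    (HasCompactSupport.intro (hφc.isCompact.prod hχc.isCompact) fun z hz => ?_)
  rw [Set.mem_prod, not_and_or] at hz
  rcases hz with h | h
  · rw [image_eq_zero_of_notMem_tsupport h]; simp
  · rw [image_eq_zero_of_notMem_tsupport h]; simp

end Superposition

section CharIntegrals

open MeasureTheory FourierTransform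
open scoped ContDiff Matrix

/-- Superposition of one-dimensional characters with density `u`. -/
noncomputable def charIntegral (u : ℝ → ℂ) (t : ℝ) : ℂ := ∫ r, u r * Real.fourierChar (r * t)

theorem charIntegral_eq_fourier (u : ℝ → ℂ) : charIntegral u = 𝓕 fun r => u (-r) := by
  funext t
  rw [Real.fourier_eq, charIntegral, ← integral_neg_eq_self]
  refine integral_congr_ae (.of_forall fun r => ?_)
  simp only [Circle.smul_def, smul_eq_mul, RCLike.inner_apply, conj_trivial]
  rw [mul_comm]; congr 3; ring

section

variable {u : ℝ → ℂ}

theorem integrable_pow_smul_comp_neg (hu : Continuous u) (hc : HasCompactSupport u) (n : ℕ) :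
    Integrable fun x : ℝ => x ^ n • u (-x) := by
  have h1 : HasCompactSupport fun x => u (-x) := hc.comp_homeomorph (Homeomorph.neg ℝ)
  have h2 : Continuous fun x : ℝ => x ^ n • u (-x) := by fun_prop
  refine h2.integrable_of_hasCompactSupport (h1.mono fun x hx => ?_)
  exact right_ne_zero_of_smul hx

theorem contDiff_charIntegral (hu : Continuous u) (hc : HasCompactSupport u) :
    ContDiff ℝ ∞ (charIntegral u) := by
  rw [charIntegral_eq_fourier]
  refine Real.contDiff_fourier fun n _ => ?_
  refine (integrable_pow_smul_comp_neg hu hc n).norm.congr (.of_forall fun x => ?_)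
  simp

theorem iteratedDeriv_charIntegral (hu : Continuous u) (hc : HasCompactSupport u) (l : ℕ) :
    iteratedDeriv l (charIntegral u) =
      charIntegral fun r => (2 * Real.pi * Complex.I * r) ^ l * u r := by
  rw [charIntegral_eq_fourier, charIntegral_eq_fourier,
    Real.iteratedDeriv_fourier (N := ⊤) (fun n _ => integrable_pow_smul_comp_neg hu hc n) le_top]
  congr 1
  funext r
  rw [smul_eq_mul]
  push_cast
  ring

theorem integral_norm_sq_charIntegral (hu : Continuous u) (hc : HasCompactSupport u) :
    Integrable (fun t => ‖charIntegral u t‖ ^ 2) ∧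
      ∫ t, ‖charIntegral u t‖ ^ 2 = ∫ r, ‖u r‖ ^ 2 := by
  rw [charIntegral_eq_fourier]
  have h := integral_norm_sq_fourier_of_hasCompactSupport (f := fun r => u (-r)) (by fun_prop)
    (hc.comp_homeomorph (Homeomorph.neg ℝ))
  refine ⟨h.1, h.2.trans ?_⟩
  exact integral_neg_eq_self (fun r => ‖u r‖ ^ 2) volume

theorem contDiff_re_charIntegral (hu : Continuous u) (hc : HasCompactSupport u) :
    ContDiff ℝ ∞ fun t => (charIntegral u t).re :=
  Complex.reCLM.contDiff.comp (contDiff_charIntegral hu hc)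

theorem iteratedDeriv_re_charIntegral (hu : Continuous u) (hc : HasCompactSupport u) (l : ℕ)
    (t : ℝ) : iteratedDeriv l (fun t => (charIntegral u t).re) t =
      (charIntegral (fun r => (2 * Real.pi * Complex.I * r) ^ l * u r) t).re := by
  rw [← iteratedDeriv_charIntegral hu hc]
  have h := Complex.reCLM.iteratedFDeriv_comp_left (x := t) (n := ∞)
    (contDiff_charIntegral hu hc).contDiffAt (i := l) (by exact_mod_cast le_top)
  rw [iteratedDeriv_eq_iteratedFDeriv, iteratedDeriv_eq_iteratedFDeriv]
  change iteratedFDeriv ℝ l (Complex.reCLM ∘ charIntegral u) t _ = _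
  rw [h]
  rfl

theorem integral_sq_iteratedDeriv_re_charIntegral_le (hu : Continuous u)
    (hc : HasCompactSupport u) (l : ℕ) {T : ℝ} (hT : 0 ≤ T) :
    ∫ t in (-T)..T, iteratedDeriv l (fun t => (charIntegral u t).re) t ^ 2 ≤
      ∫ r, (2 * Real.pi * r) ^ (2 * l) * ‖u r‖ ^ 2 := by
  have hu' : Continuous fun r : ℝ => (2 * Real.pi * Complex.I * r) ^ l * u r := by fun_prop
  have hc' : HasCompactSupport fun r : ℝ => (2 * Real.pi * Complex.I * r) ^ l * u r := hc.mul_left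
  obtain ⟨h1, h2⟩ := integral_norm_sq_charIntegral hu' hc'
  have e : ∫ r, (2 * Real.pi * r) ^ (2 * l) * ‖u r‖ ^ 2 =
      ∫ r : ℝ, ‖(2 * Real.pi * Complex.I * r) ^ l * u r‖ ^ 2 := by
    refine integral_congr_ae (.of_forall fun r => ?_)
    simp only [norm_mul, norm_pow, Complex.norm_ofNat, Complex.norm_real, Complex.norm_I, mul_one]
    rw [mul_pow (_ ^ l), ← pow_mul, mul_comm l 2, pow_mul, pow_mul]
    congr 2
    rw [Real.norm_eq_abs, Real.norm_eq_abs, mul_pow, mul_pow, mul_pow, mul_pow, sq_abs, sq_abs]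
  rw [e, ← h2, intervalIntegral.integral_of_le (by linarith)]
  have hcont := (contDiff_charIntegral hu' hc').continuous
  have hcr : Continuous fun t => iteratedDeriv l (fun t => (charIntegral u t).re) t ^ 2 := by
    simp_rw [iteratedDeriv_re_charIntegral hu hc]
    exact (Complex.continuous_re.comp hcont).pow 2
  refine (setIntegral_mono ?_ h1.integrableOn fun t => ?_).trans
    (setIntegral_le_integral h1 (.of_forall fun t => by positivity))
  · exact hcr.integrableOn_Ioc
  · simp only
    rw [iteratedDeriv_re_charIntegral hu hc, ← sq_abs]
    exact pow_le_pow_left₀ (abs_nonneg _) (Complex.abs_re_le_norm _) 2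

end

section

variable {n : ℕ}

theorem insertNth_one_dotProduct (i : Fin (n + 1)) (v : Fin n → ℝ) (x : Fin (n + 1) → ℝ) :
    i.insertNth (1 : ℝ) v ⬝ᵥ x = x i + i.removeNth x ⬝ᵥ v := by
  rw [dotProduct, Fin.sum_univ_succAbove _ i]
  simp [dotProduct, Fin.removeNth, mul_comm]

theorem abs_le_norm_pi {ι : Type*} [Fintype ι] (x : ι → ℝ) (i : ι) : |x i| ≤ ‖x‖ :=
  norm_le_pi_norm x i

/-- Discretising the direction variable in a cone of plane waves. -/
theorem exists_norm_latticeSum_ridge_le {χ : (Fin n → ℝ) → ℂ}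
    (hχ : ContDiff ℝ ∞ χ) {R : ℝ} (hR : 0 ≤ R) (hsupp : ∀ v i, R < |v i| → χ v = 0)
    {q : ℕ} (hq : 2 ≤ q) (i : Fin (n + 1)) :
    ∃ C : ℝ, 0 < C ∧ ∀ (ρ : ℝ → ℝ) (f : (Fin (n + 1) → ℝ) → ℂ) (Λ δ : ℝ) (M : ℕ)
      (x : Fin (n + 1) → ℝ), Continuous ρ → (∀ r, Λ < |r| → ρ r = 0) → Continuous f →
      (∀ y, 3 < ‖y‖ → f y = 0) → 0 < δ → δ ≤ 1 → 24 * Λ * δ ≤ 1 → R ≤ M * δ → M * δ ≤ R + 1 →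
      ‖x‖ ≤ 1 →
      ‖(δ : ℂ) ^ n * ∑ k : Fin n → Finset.Icc (-(M : ℤ)) M, χ (fun j => δ * (k j : ℤ)) *
        charIntegral (fun r => ρ r * piFourier f (r • i.insertNth 1 fun j => δ * (k j : ℤ)))
          (i.insertNth (1 : ℝ) (fun j => δ * (k j : ℤ)) ⬝ᵥ x) -
        ∫ v, χ v * charIntegral (fun r => ρ r * piFourier f (r • i.insertNth 1 v))
          (i.insertNth (1 : ℝ) v ⬝ᵥ x)‖ ≤ C * δ ^ q * ((∫ r, |ρ r|) * ∫ y, ‖f y‖) := by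
  obtain ⟨C, hC, H⟩ := exists_norm_latticeSum_superposition_le hχ hR hsupp hq
  refine ⟨C, hC, fun ρ f Λ δ M x hρ hρs hf hfs hδ hδ1 hΛ hM1 hM2 hx => ?_⟩
  have hfc : HasCompactSupport f := HasCompactSupport.intro (isCompact_closedBall 0 3)
    fun y hy => hfs y (by simpa using hy)
  have hρc : HasCompactSupport ρ := HasCompactSupport.intro (isCompact_Icc (a := -Λ) (b := Λ))
    fun r hr => hρs r (by rw [← not_le, abs_le]; exact hr)
  have hfi := hf.integrable_of_hasCompactSupport hfc (μ := volume)
  have hρi := hρ.integrable_of_hasCompactSupport hρc (μ := volume)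
  set A : ℝ × (Fin (n + 1) → ℝ) → ℂ := fun p => ((ρ p.1 : ℂ) * f p.2) *
    Real.fourierChar (p.1 * (x i - p.2 i)) with hA
  set lam : ℝ × (Fin (n + 1) → ℝ) → Fin n → ℝ := fun p => p.1 • i.removeNth (x - p.2) with hlam
  have hprod : Integrable fun p : ℝ × (Fin (n + 1) → ℝ) => (ρ p.1 : ℂ) * f p.2 :=
    hρi.ofReal.mul_prod hfi
  have hAi : Integrable A := by
    refine hprod.mul_bdd (c := 1) (Continuous.aestronglyMeasurable (by fun_prop))
      (.of_forall fun p => by rw [Circle.norm_coe])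
  have hlamc : Continuous lam := by
    refine continuous_pi fun j => ?_
    simp only [hlam, Pi.smul_apply, Fin.removeNth, Pi.sub_apply]
    fun_prop
  have hkey : ∀ v, charIntegral (fun r => ρ r * piFourier f (r • i.insertNth 1 v))
      (i.insertNth (1 : ℝ) v ⬝ᵥ x) = ∫ p, A p * Real.fourierChar (lam p ⬝ᵥ v) := by
    intro v
    have hi1 : Integrable (fun p => A p * (Real.fourierChar (lam p ⬝ᵥ v) : ℂ)) := by
      have : Continuous fun p => lam p ⬝ᵥ v := by simp only [dotProduct]; fun_prop
      exact hAi.mul_bdd (c := 1) (Continuous.aestronglyMeasurable (by fun_prop))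
        (.of_forall fun p => by rw [Circle.norm_coe])
    rw [Measure.volume_eq_prod, integral_prod _ hi1, charIntegral]
    refine integral_congr_ae (.of_forall fun r => ?_)
    simp only
    rw [piFourier_apply, ← integral_const_mul, ← integral_mul_const]
    refine integral_congr_ae (.of_forall fun y => ?_)
    simp only [hA, hlam, Circle.smul_def, smul_eq_mul]
    have e1 : -(y ⬝ᵥ (r • i.insertNth (1 : ℝ) v : Fin (n + 1) → ℝ)) +
        r * (i.insertNth (1 : ℝ) v ⬝ᵥ x) =
        r * (x i - y i) + (r • i.removeNth (x - y)) ⬝ᵥ v := by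
      rw [dotProduct_smul, dotProduct_comm y, insertNth_one_dotProduct, insertNth_one_dotProduct,
        smul_dotProduct]
      have : i.removeNth (x - y) = i.removeNth x - i.removeNth y := rfl
      rw [this, sub_dotProduct]
      simp only [smul_eq_mul]
      ring
    have e2 := congrArg (fun t => (Real.fourierChar t : ℂ)) e1
    simp only [AddChar.map_add_eq_mul, Circle.coe_mul] at e2
    linear_combination ((ρ r : ℂ) * f y) * e2
  simp_rw [hkey]
  have hb := H (ℝ × (Fin (n + 1) → ℝ)) A lam δ M hAi hlamc.measurable hδ hδ1 ?_ hM1 hM2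
  · refine hb.trans (le_of_eq ?_)
    congr 1
    have : ∀ p : ℝ × (Fin (n + 1) → ℝ), ‖A p‖ = |ρ p.1| * ‖f p.2‖ := by
      intro p
      simp only [hA, norm_mul, Circle.norm_coe, mul_one, Complex.norm_real, Real.norm_eq_abs]
    simp_rw [this]
    rw [Measure.volume_eq_prod, integral_prod_mul (fun r => |ρ r|) fun y => ‖f y‖]
  · intro p hp l
    have h1 : |p.1| ≤ Λ := by
      by_contra h
      exact hp (by simp [hA, hρs p.1 (not_le.1 h)])
    have h2 : ‖p.2‖ ≤ 3 := by
      by_contra h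
      exact hp (by simp [hA, hfs p.2 (not_le.1 h)])
    have h3 : |lam p l| ≤ Λ * 4 := by
      simp only [hlam, Pi.smul_apply, smul_eq_mul, abs_mul, Fin.removeNth, Pi.sub_apply]
      refine mul_le_mul h1 ((abs_sub _ _).trans ?_) (abs_nonneg _) ((abs_nonneg _).trans h1)
      have := abs_le_norm_pi x (i.succAbove l)
      have := abs_le_norm_pi p.2 (i.succAbove l)
      linarith
    have h4 : 0 ≤ Λ := (abs_nonneg _).trans h1
    nlinarith

/-- Discretising the direction variable in the energy of a cone of plane waves. -/
theorem exists_norm_latticeSum_energy_le {χ : (Fin n → ℝ) → ℂ}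
    (hχ : ContDiff ℝ ∞ χ) {R : ℝ} (hR : 0 ≤ R) (hsupp : ∀ v i, R < |v i| → χ v = 0)
    {q : ℕ} (hq : 2 ≤ q) (i : Fin (n + 1)) :
    ∃ C : ℝ, 0 < C ∧ ∀ (w : ℝ → ℝ) (f : (Fin (n + 1) → ℝ) → ℂ) (Λ δ : ℝ) (M : ℕ),
      Continuous w → (∀ r, Λ < |r| → w r = 0) → Continuous f →
      (∀ y, 3 < ‖y‖ → f y = 0) → 0 < δ → δ ≤ 1 → 24 * Λ * δ ≤ 1 → R ≤ M * δ → M * δ ≤ R + 1 →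
      ‖(δ : ℂ) ^ n * ∑ k : Fin n → Finset.Icc (-(M : ℤ)) M, χ (fun j => δ * (k j : ℤ)) *
        (∫ r, (w r : ℂ) *
          ((‖piFourier f (r • i.insertNth 1 fun j => δ * (k j : ℤ))‖ ^ 2 : ℝ) : ℂ)) -
        ∫ v, χ v * ∫ r, (w r : ℂ) * ((‖piFourier f (r • i.insertNth 1 v)‖ ^ 2 : ℝ) : ℂ)‖ ≤
          C * δ ^ q * ((∫ r, |w r|) * (∫ y, ‖f y‖) ^ 2) := by
  obtain ⟨C, hC, H⟩ := exists_norm_latticeSum_superposition_le hχ hR hsupp hq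
  refine ⟨C, hC, fun ρ f Λ δ M hρ hρs hf hfs hδ hδ1 hΛ hM1 hM2 => ?_⟩
  have hfc : HasCompactSupport f := HasCompactSupport.intro (isCompact_closedBall 0 3)
    fun y hy => hfs y (by simpa using hy)
  have hρc : HasCompactSupport ρ := HasCompactSupport.intro (isCompact_Icc (a := -Λ) (b := Λ))
    fun r hr => hρs r (by rw [← not_le, abs_le]; exact hr)
  have hfi := hf.integrable_of_hasCompactSupport hfc (μ := volume)
  have hρi := hρ.integrable_of_hasCompactSupport hρc (μ := volume)
  have hfsi : Integrable fun y => star (f y) := hfi.norm.mono'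
    (Continuous.aestronglyMeasurable (by fun_prop)) (.of_forall fun y => by simp)
  set A : ℝ × ((Fin (n + 1) → ℝ) × (Fin (n + 1) → ℝ)) → ℂ := fun p =>
    ((ρ p.1 : ℂ) * (f p.2.1 * star (f p.2.2))) *
      Real.fourierChar (p.1 * (p.2.2 i - p.2.1 i)) with hA
  set lam : ℝ × ((Fin (n + 1) → ℝ) × (Fin (n + 1) → ℝ)) → Fin n → ℝ := fun p =>
    p.1 • i.removeNth (p.2.2 - p.2.1) with hlam
  have hprod : Integrable fun p : ℝ × ((Fin (n + 1) → ℝ) × (Fin (n + 1) → ℝ)) =>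
      (ρ p.1 : ℂ) * (f p.2.1 * star (f p.2.2)) :=
    hρi.ofReal.mul_prod (hfi.mul_prod hfsi)
  have hAi : Integrable A := by
    refine hprod.mul_bdd (c := 1) (Continuous.aestronglyMeasurable (by fun_prop))
      (.of_forall fun p => by rw [Circle.norm_coe])
  have hlamc : Continuous lam := by
    refine continuous_pi fun j => ?_
    simp only [hlam, Pi.smul_apply, Fin.removeNth, Pi.sub_apply]
    fun_prop
  have hkey : ∀ v, ∫ r, (ρ r : ℂ) * ((‖piFourier f (r • i.insertNth 1 v)‖ ^ 2 : ℝ) : ℂ) =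
      ∫ p, A p * Real.fourierChar (lam p ⬝ᵥ v) := by
    intro v
    have hi1 : Integrable (fun p => A p * (Real.fourierChar (lam p ⬝ᵥ v) : ℂ)) := by
      have : Continuous fun p => lam p ⬝ᵥ v := by simp only [dotProduct]; fun_prop
      exact hAi.mul_bdd (c := 1) (Continuous.aestronglyMeasurable (by fun_prop))
        (.of_forall fun p => by rw [Circle.norm_coe])
    rw [Measure.volume_eq_prod, integral_prod _ hi1]
    refine integral_congr_ae (.of_forall fun r => ?_)
    simp only
    have e0 : ((‖piFourier f (r • i.insertNth 1 v)‖ ^ 2 : ℝ) : ℂ) =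
        piFourier f (r • i.insertNth 1 v) * star (piFourier f (r • i.insertNth 1 v)) := by
      rw [Complex.star_def, Complex.mul_conj, Complex.normSq_eq_norm_sq]
    have e1 : star (piFourier f (r • i.insertNth 1 v)) = ∫ z, star (f z) *
        Real.fourierChar (z ⬝ᵥ (r • i.insertNth (1 : ℝ) v : Fin (n + 1) → ℝ)) := by
      rw [piFourier_apply, Complex.star_def, ← integral_conj]
      refine integral_congr_ae (.of_forall fun z => ?_)
      simp only [Circle.smul_def, smul_eq_mul, map_mul, AddChar.map_neg_eq_inv, Circle.coe_inv]
      rw [← Circle.coe_inv, Circle.coe_inv_eq_conj, Complex.conj_conj, mul_comm]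
    rw [e0, e1, piFourier_apply, ← integral_prod_mul, ← integral_const_mul,
      Measure.volume_eq_prod]
    refine integral_congr_ae (.of_forall fun y => ?_)
    simp only [hA, hlam, Circle.smul_def, smul_eq_mul]
    have e1 : -(y.1 ⬝ᵥ (r • i.insertNth (1 : ℝ) v : Fin (n + 1) → ℝ)) +
        y.2 ⬝ᵥ (r • i.insertNth (1 : ℝ) v : Fin (n + 1) → ℝ) =
        r * (y.2 i - y.1 i) + (r • i.removeNth (y.2 - y.1)) ⬝ᵥ v := by
      rw [dotProduct_smul, dotProduct_smul, dotProduct_comm y.1, dotProduct_comm y.2,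
        insertNth_one_dotProduct, insertNth_one_dotProduct, smul_dotProduct]
      have : i.removeNth (y.2 - y.1) = i.removeNth y.2 - i.removeNth y.1 := rfl
      rw [this, sub_dotProduct]
      simp only [smul_eq_mul]
      ring
    have e2 := congrArg (fun t => (Real.fourierChar t : ℂ)) e1
    simp only [AddChar.map_add_eq_mul, Circle.coe_mul] at e2
    linear_combination ((ρ r : ℂ) * f y.1 * star (f y.2)) * e2
  simp_rw [hkey]
  have hb := H _ A lam δ M hAi hlamc.measurable hδ hδ1 ?_ hM1 hM2
  · refine hb.trans (le_of_eq ?_)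
    congr 1
    have : ∀ p : ℝ × ((Fin (n + 1) → ℝ) × (Fin (n + 1) → ℝ)),
        ‖A p‖ = |ρ p.1| * (‖f p.2.1‖ * ‖f p.2.2‖) := by
      intro p
      simp only [hA, norm_mul, Circle.norm_coe, mul_one, Complex.norm_real, Real.norm_eq_abs,
        norm_star]
    simp_rw [this]
    rw [Measure.volume_eq_prod, integral_prod_mul (fun r => |ρ r|)
      fun y : (Fin (n + 1) → ℝ) × (Fin (n + 1) → ℝ) => ‖f y.1‖ * ‖f y.2‖,
      Measure.volume_eq_prod, integral_prod_mul (fun y => ‖f y‖) fun y => ‖f y‖, sq]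
  · intro p hp l
    have h1 : |p.1| ≤ Λ := by
      by_contra h
      exact hp (by simp [hA, hρs p.1 (not_le.1 h)])
    have h2 : ‖p.2.1‖ ≤ 3 := by
      by_contra h
      exact hp (by simp [hA, hfs p.2.1 (not_le.1 h)])
    have h2' : ‖p.2.2‖ ≤ 3 := by
      by_contra h
      exact hp (by simp [hA, hfs p.2.2 (not_le.1 h)])
    have h3 : |lam p l| ≤ Λ * 6 := by
      simp only [hlam, Pi.smul_apply, smul_eq_mul, abs_mul, Fin.removeNth, Pi.sub_apply]
      refine mul_le_mul h1 ((abs_sub _ _).trans ?_) (abs_nonneg _) ((abs_nonneg _).trans h1)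
      have := abs_le_norm_pi p.2.1 (i.succAbove l)
      have := abs_le_norm_pi p.2.2 (i.succAbove l)
      linarith
    nlinarith

end

end CharIntegrals

section Cones

open MeasureTheory
open scoped ContDiff Matrix

/-- A partition of unity into smooth homogeneous functions supported in cones around the axes. -/
structure ConePartition (n : ℕ) where
  toFun : Fin (n + 1) → (Fin (n + 1) → ℝ) → ℝ
  contDiffAt : ∀ i ξ, ξ ≠ 0 → ContDiffAt ℝ ∞ (toFun i) ξ
  nonneg : ∀ i ξ, 0 ≤ toFun i ξ
  le_one : ∀ i ξ, toFun i ξ ≤ 1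
  sum_eq_one : ∀ ξ, ξ ≠ 0 → ∑ i, toFun i ξ = 1
  smul_eq : ∀ i ξ (r : ℝ), r ≠ 0 → toFun i (r • ξ) = toFun i ξ
  abs_le : ∀ i ξ, toFun i ξ ≠ 0 → ∀ j, |ξ j| ≤ 2 * (n + 1) * |ξ i|

namespace ConePartition

theorem nonempty (n : ℕ) : Nonempty (ConePartition n) := by
  set N : (Fin (n + 1) → ℝ) → ℝ := fun ξ => ∑ j, ξ j ^ 2 with hN
  have hN0 : ∀ ξ, 0 ≤ N ξ := fun ξ => Finset.sum_nonneg fun j _ => sq_nonneg _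
  have hNpos : ∀ ξ, ξ ≠ 0 → 0 < N ξ := by
    intro ξ hξ
    refine (hN0 ξ).lt_of_ne' fun h => hξ ?_
    funext j
    have := (Finset.sum_eq_zero_iff_of_nonneg fun j _ => sq_nonneg (ξ j)).1 h j (Finset.mem_univ j)
    simpa using this
  set w : Fin (n + 1) → (Fin (n + 1) → ℝ) → ℝ := fun i ξ =>
    Real.smoothTransition (ξ i ^ 2 / N ξ - 1 / (2 * (n + 1))) with hw
  have hw0 : ∀ i ξ, 0 ≤ w i ξ := fun i ξ => Real.smoothTransition.nonneg _
  set W : (Fin (n + 1) → ℝ) → ℝ := fun ξ => ∑ i, w i ξ with hW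
  have hW0 : ∀ ξ, 0 ≤ W ξ := fun ξ => Finset.sum_nonneg fun j _ => hw0 j ξ
  have hWpos : ∀ ξ, ξ ≠ 0 → 0 < W ξ := by
    intro ξ hξ
    obtain ⟨i, -, hi⟩ := Finset.exists_max_image Finset.univ (fun j => ξ j ^ 2)
      ⟨0, Finset.mem_univ _⟩
    have h1 : N ξ ≤ (n + 1) * ξ i ^ 2 := by
      have := Finset.sum_le_sum hi
      simpa using this
    refine Finset.sum_pos' (fun j _ => hw0 j ξ) ⟨i, Finset.mem_univ _, ?_⟩
    refine Real.smoothTransition.pos_of_pos ?_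
    have h2 := hNpos ξ hξ
    rw [sub_pos, div_lt_div_iff₀ (by positivity) h2]
    nlinarith
  have hNs : ContDiff ℝ ∞ N := by
    simp only [hN]; fun_prop
  have hws : ∀ i ξ, ξ ≠ 0 → ContDiffAt ℝ ∞ (w i) ξ := by
    intro i ξ hξ
    refine Real.smoothTransition.contDiff.contDiffAt.comp ξ ?_
    refine ContDiffAt.sub (ContDiffAt.div (by fun_prop) hNs.contDiffAt (hNpos ξ hξ).ne') (by
        fun_prop)
  refine ⟨⟨fun i ξ => w i ξ / W ξ, fun i ξ hξ => ?_, fun i ξ => div_nonneg (hw0 i ξ) (hW0 ξ),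
    fun i ξ => ?_, fun ξ hξ => ?_, fun i ξ r hr => ?_, fun i ξ h j => ?_⟩⟩
  · refine (hws i ξ hξ).div ?_ (hWpos ξ hξ).ne'
    exact ContDiffAt.sum fun j _ => hws j ξ hξ
  · refine div_le_one_of_le₀ ?_ (hW0 ξ)
    exact Finset.single_le_sum (f := fun i => w i ξ) (fun j _ => hw0 j ξ) (Finset.mem_univ i)
  · rw [← Finset.sum_div, div_self (hWpos ξ hξ).ne']
  · have h1 : ∀ i, w i (r • ξ) = w i ξ := by
      intro i
      have h2 : N (r • ξ) = r ^ 2 * N ξ := by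
        simp only [hN, Pi.smul_apply, smul_eq_mul, mul_pow, Finset.mul_sum]
      simp only [hw, h2, Pi.smul_apply, smul_eq_mul, mul_pow]
      rw [mul_div_mul_left _ _ (pow_ne_zero 2 hr)]
    simp only [hW, h1]
  · have h1 : w i ξ ≠ 0 := fun h0 => h (by simp [h0])
    have h2 : 1 / (2 * ((n : ℝ) + 1)) < ξ i ^ 2 / N ξ := by
      by_contra hcon
      exact h1 (Real.smoothTransition.zero_of_nonpos (by linarith))
    have h3 : 0 < N ξ := by
      refine (hN0 ξ).lt_of_ne' fun h0 => ?_
      rw [h0, div_zero] at h2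
      have : (0 : ℝ) < 1 / (2 * (n + 1)) := by positivity
      linarith
    rw [div_lt_div_iff₀ (by positivity) h3] at h2
    have h4 : ξ j ^ 2 ≤ N ξ := Finset.single_le_sum (f := fun j => ξ j ^ 2)
      (fun j _ => sq_nonneg _) (Finset.mem_univ j)
    refine abs_le_of_sq_le_sq' ?_ (by positivity) |> fun h => _root_.abs_le.2 h
    rw [mul_pow, sq_abs]
    have : (0 : ℝ) ≤ n := Nat.cast_nonneg n
    nlinarith [sq_nonneg (ξ i), mul_nonneg this (sq_nonneg (ξ i)),
      mul_nonneg (mul_nonneg this this) (sq_nonneg (ξ i))]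

variable {n : ℕ} (κ : ConePartition n)

/-- The trace of a cone cutoff on the affine chart `ξ i = 1`. -/
noncomputable def chart (i : Fin (n + 1)) (v : Fin n → ℝ) : ℝ := κ.toFun i (i.insertNth 1 v)

theorem contDiff_insertNth_one (i : Fin (n + 1)) :
    ContDiff ℝ ∞ fun v : Fin n → ℝ => (i.insertNth (1 : ℝ) v : Fin (n + 1) → ℝ) := by
  rw [contDiff_pi]
  intro j
  refine Fin.succAboveCases i ?_ (fun l => ?_) j
  · simp only [Fin.insertNth_apply_same]; fun_prop
  · simp only [Fin.insertNth_apply_succAbove]; fun_prop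

theorem insertNth_one_ne_zero (i : Fin (n + 1)) (v : Fin n → ℝ) :
    (i.insertNth (1 : ℝ) v : Fin (n + 1) → ℝ) ≠ 0 := fun h => by
  simpa using congrFun h i

theorem contDiff_chart (i : Fin (n + 1)) : ContDiff ℝ ∞ (κ.chart i) :=
  contDiff_iff_contDiffAt.2 fun v => (κ.contDiffAt i _ (insertNth_one_ne_zero i v)).comp v
    (contDiff_insertNth_one i).contDiffAt

theorem chart_eq_zero (i : Fin (n + 1)) (v : Fin n → ℝ) (j : Fin n) (hj : 2 * (n + 1 : ℝ) < |v j|) :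
    κ.chart i v = 0 := by
  by_contra h
  have := κ.abs_le i _ h (i.succAbove j)
  simp at this
  linarith

theorem hasCompactSupport_chart (i : Fin (n + 1)) : HasCompactSupport (κ.chart i) := by
  refine HasCompactSupport.intro (isCompact_closedBall (0 : Fin n → ℝ) (2 * (n + 1))) fun v hv => ?_
  rw [Metric.mem_closedBall, dist_zero_right, pi_norm_le_iff_of_nonneg (by positivity)] at hv
  push Not at hv
  obtain ⟨j, hj⟩ := hv
  exact κ.chart_eq_zero i v j hj

theorem toFun_smul_insertNth (i : Fin (n + 1)) (v : Fin n → ℝ) {r : ℝ} (hr : r ≠ 0) :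
    κ.toFun i (r • i.insertNth 1 v) = κ.chart i v := κ.smul_eq i _ r hr

theorem contDiff_mul_comp (i : Fin (n + 1)) {φ : ℝ → ℝ} (hφ : ContDiff ℝ ∞ φ) {ε : ℝ} (hε : 0 < ε)
    (h0 : ∀ t, |t| ≤ ε → φ t = 0) : ContDiff ℝ ∞ fun ξ => κ.toFun i ξ * φ (ξ i) := by
  refine contDiff_iff_contDiffAt.2 fun ξ => ?_
  by_cases hξ : ξ = 0
  · have h1 : (fun ξ => κ.toFun i ξ * φ (ξ i)) =ᶠ[nhds ξ] fun _ => 0 := by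
      filter_upwards [Metric.ball_mem_nhds ξ hε] with y hy
      rw [h0 (y i), mul_zero]
      rw [hξ, mem_ball_zero_iff] at hy
      exact (abs_le_norm_pi y i).trans hy.le
    exact contDiffAt_const.congr_of_eventuallyEq h1
  · refine (κ.contDiffAt i ξ hξ).mul (hφ.contDiffAt.comp ξ ?_)
    fun_prop

theorem mul_comp_eq_zero (i : Fin (n + 1)) {φ : ℝ → ℝ} {Λ : ℝ} (h : ∀ t, Λ < |t| → φ t = 0)
    (ξ : Fin (n + 1) → ℝ) (hξ : 2 * (n + 1) * Λ < ‖ξ‖) (hΛ : 0 ≤ Λ) :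
    κ.toFun i ξ * φ (ξ i) = 0 := by
  by_contra hne
  have h1 := κ.abs_le i ξ (left_ne_zero_of_mul hne)
  have h2 : |ξ i| ≤ Λ := by
    by_contra hcon
    exact right_ne_zero_of_mul hne (h _ (not_le.1 hcon))
  refine hξ.not_ge ((pi_norm_le_iff_of_nonneg (by positivity)).2 fun j => (h1 j).trans ?_)
  gcongr

theorem hasCompactSupport_mul_comp (i : Fin (n + 1)) {φ : ℝ → ℝ} {Λ : ℝ} (hΛ : 0 ≤ Λ)
    (h : ∀ t, Λ < |t| → φ t = 0) : HasCompactSupport fun ξ => κ.toFun i ξ * φ (ξ i) :=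
  HasCompactSupport.intro (isCompact_closedBall 0 (2 * (n + 1) * Λ)) fun ξ hξ =>
    κ.mul_comp_eq_zero i h ξ (by simpa using hξ) hΛ

end ConePartition

/-- A fixed smooth even-type cutoff on the line. -/
noncomputable def lineBump : ContDiffBump (0 : ℝ) := ⟨1 / 2, 1, by norm_num, by norm_num⟩

theorem lineBump_eq_one {t : ℝ} (ht : |t| ≤ 1 / 2) : lineBump t = 1 :=
  lineBump.one_of_mem_closedBall (by simpa [lineBump] using ht)

theorem lineBump_eq_zero {t : ℝ} (ht : 1 ≤ |t|) : lineBump t = 0 :=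
  lineBump.zero_of_le_dist (by simpa [lineBump] using ht)

/-- The combination of dilated cutoffs matching an `N`-th order difference. -/
noncomputable def diffCutoff (N : ℕ) (t : ℝ) : ℝ :=
  ∑ l ∈ Finset.range N, (-1) ^ l * (N.choose (l + 1) : ℝ) * lineBump ((l + 1) * t)

theorem contDiff_diffCutoff (N : ℕ) : ContDiff ℝ ∞ (diffCutoff N) := by
  refine ContDiff.sum fun l _ => contDiff_const.mul ?_
  exact lineBump.contDiff.comp (by fun_prop)

theorem diffCutoff_eq_zero (N : ℕ) {t : ℝ} (ht : 1 ≤ |t|) : diffCutoff N t = 0 := by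
  refine Finset.sum_eq_zero fun l _ => ?_
  rw [lineBump_eq_zero, mul_zero]
  rw [abs_mul, abs_of_nonneg (by positivity)]
  have : (0 : ℝ) ≤ l := Nat.cast_nonneg l
  nlinarith

theorem sum_alternating_choose_succ {N : ℕ} (hN : 1 ≤ N) :
    ∑ l ∈ Finset.range N, (-1 : ℝ) ^ l * (N.choose (l + 1) : ℝ) = 1 := by
  have h := Int.alternating_sum_range_choose_of_ne (n := N) (by omega)
  rw [Finset.sum_range_succ'] at h
  have h2 : ∑ l ∈ Finset.range N, (-1 : ℝ) ^ (l + 1) * (N.choose (l + 1) : ℝ) + 1 = 0 := by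
    have := congrArg (fun z : ℤ => (z : ℝ)) h
    simpa using this
  have h3 : ∑ l ∈ Finset.range N, (-1 : ℝ) ^ l * (N.choose (l + 1) : ℝ) =
      - ∑ l ∈ Finset.range N, (-1 : ℝ) ^ (l + 1) * (N.choose (l + 1) : ℝ) := by
    rw [← Finset.sum_neg_distrib]
    exact Finset.sum_congr rfl fun l _ => by ring
  linarith

theorem diffCutoff_eq_one {N : ℕ} (hN : 1 ≤ N) {t : ℝ} (ht : |t| ≤ 1 / (2 * N)) :
    diffCutoff N t = 1 := by
  rw [← sum_alternating_choose_succ hN]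
  refine Finset.sum_congr rfl fun l hl => ?_
  rw [lineBump_eq_one, mul_one]
  have h1 : (l : ℝ) + 1 ≤ N := by exact_mod_cast Finset.mem_range.1 hl
  have h2 : (0 : ℝ) < N := by exact_mod_cast hN
  rw [abs_mul, abs_of_nonneg (by positivity)]
  calc ((l : ℝ) + 1) * |t| ≤ N * (1 / (2 * N)) := by gcongr
    _ = 1 / 2 := by field_simp

theorem abs_diffCutoff_le (N : ℕ) (t : ℝ) : |diffCutoff N t| ≤ 2 ^ N := by
  refine (Finset.abs_sum_le_sum_abs _ _).trans ?_
  have h1 : ∀ l ∈ Finset.range N, |(-1 : ℝ) ^ l * (N.choose (l + 1) : ℝ) * lineBump ((l + 1) * t)| ≤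
      (N.choose (l + 1) : ℝ) := by
    intro l _
    rw [abs_mul, abs_mul, abs_pow, abs_neg, abs_one, one_pow, one_mul, Nat.abs_cast,
      abs_of_nonneg lineBump.nonneg]
    exact mul_le_of_le_one_right (Nat.cast_nonneg _) lineBump.le_one
  refine (Finset.sum_le_sum h1).trans ?_
  have h2 := Nat.sum_range_choose N
  rw [Finset.sum_range_succ'] at h2
  have h3 : ∑ l ∈ Finset.range N, N.choose (l + 1) ≤ 2 ^ N := by omega
  exact_mod_cast h3

end Cones

section Bands

open MeasureTheory
open scoped ContDiff Matrix

/-- The band cutoff between the frequencies `b` and `a`. -/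
noncomputable def bandCutoff (N : ℕ) (a b t : ℝ) : ℝ := diffCutoff N (t / a) - diffCutoff N (t / b)

theorem contDiff_bandCutoff (N : ℕ) (a b : ℝ) : ContDiff ℝ ∞ (bandCutoff N a b) :=
  ((contDiff_diffCutoff N).comp (contDiff_id.div_const a)).sub
    ((contDiff_diffCutoff N).comp (contDiff_id.div_const b))

theorem bandCutoff_eq_zero_of_le {N : ℕ} (hN : 1 ≤ N) {a b : ℝ} (hb : 0 < b) (hab : b ≤ a) {t : ℝ}
    (ht : |t| ≤ b / (2 * N)) : bandCutoff N a b t = 0 := by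
  have hN0 : (0 : ℝ) < N := by exact_mod_cast hN
  have h : ∀ c, b ≤ c → diffCutoff N (t / c) = 1 := fun c hc => by
    refine diffCutoff_eq_one hN ?_
    have hc0 : 0 < c := hb.trans_le hc
    rw [abs_div, abs_of_pos hc0, div_le_iff₀ hc0]
    refine ht.trans ?_
    rw [div_eq_mul_one_div, mul_comm]
    gcongr
  rw [bandCutoff, h a hab, h b le_rfl, sub_self]

theorem bandCutoff_eq_zero_of_ge (N : ℕ) {a b : ℝ} (hb : 0 < b) (hab : b ≤ a) {t : ℝ}
    (ht : a ≤ |t|) : bandCutoff N a b t = 0 := by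
  have h : ∀ c, 0 < c → c ≤ a → diffCutoff N (t / c) = 0 := fun c hc0 hc => by
    refine diffCutoff_eq_zero N ?_
    rw [abs_div, abs_of_pos hc0, one_le_div hc0]
    exact hc.trans ht
  rw [bandCutoff, h a (hb.trans_le hab) le_rfl, h b hb hab, sub_self]

theorem abs_bandCutoff_le (N : ℕ) (a b t : ℝ) : |bandCutoff N a b t| ≤ 2 ^ (N + 1) := by
  refine (abs_sub _ _).trans ?_
  have h1 := abs_diffCutoff_le N (t / a)
  have h2 := abs_diffCutoff_le N (t / b)
  rw [pow_succ]; linarith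

theorem hasCompactSupport_bandCutoff (N : ℕ) {a b : ℝ} (hb : 0 < b) (hab : b ≤ a) :
    HasCompactSupport (bandCutoff N a b) :=
  HasCompactSupport.intro (isCompact_closedBall 0 a) fun r hr =>
    bandCutoff_eq_zero_of_ge N hb hab (by
      have : a < |r| := by simpa using hr
      exact this.le)

namespace ConePartition

variable {n : ℕ} (κ : ConePartition n)

/-- A smooth compactly supported anisotropic low-pass multiplier adapted to the cones. -/
noncomputable def lowPass (ξ : Fin (n + 1) → ℝ) : ℝ :=
  1 + ∑ i, κ.toFun i ξ * (lineBump (ξ i) - 1)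

theorem lowPass_zero : κ.lowPass 0 = 1 := by
  have : lineBump 0 = 1 := lineBump_eq_one (by norm_num)
  simp [lowPass, this]

theorem lowPass_eq {ξ : Fin (n + 1) → ℝ} (hξ : ξ ≠ 0) :
    κ.lowPass ξ = ∑ i, κ.toFun i ξ * lineBump (ξ i) := by
  simp only [lowPass, mul_sub, Finset.sum_sub_distrib, mul_one, κ.sum_eq_one ξ hξ]
  ring

theorem contDiff_lowPass : ContDiff ℝ ∞ κ.lowPass := by
  refine contDiff_const.add (ContDiff.sum fun i _ => ?_)
  refine κ.contDiff_mul_comp i (φ := fun t => lineBump t - 1)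
    (lineBump.contDiff.sub contDiff_const) (ε := 1 / 2) (by norm_num) fun t ht => ?_
  rw [lineBump_eq_one ht, sub_self]

theorem hasCompactSupport_lowPass : HasCompactSupport κ.lowPass := by
  refine HasCompactSupport.intro (isCompact_closedBall 0 (2 * (n + 1) * 1)) fun ξ hξ => ?_
  have h1 : 2 * (n + 1) * 1 < ‖ξ‖ := by simpa using hξ
  have h0 : ξ ≠ 0 := by
    rintro rfl
    rw [norm_zero] at h1
    have : (0 : ℝ) ≤ n := Nat.cast_nonneg n
    linarith
  rw [κ.lowPass_eq h0]
  exact Finset.sum_eq_zero fun i _ => κ.mul_comp_eq_zero i (φ := lineBump)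
    (fun t ht => lineBump_eq_zero ht.le) ξ h1 zero_le_one

theorem sum_lowPass_eq (N : ℕ) {F : ℝ} (hF : 0 < F) {ξ : Fin (n + 1) → ℝ} (hξ : ξ ≠ 0) :
    ∑ l ∈ Finset.range N, (-1 : ℝ) ^ l * (N.choose (l + 1) : ℝ) *
      κ.lowPass (((l + 1 : ℕ) / F : ℝ) • ξ) = ∑ i, κ.toFun i ξ * diffCutoff N (ξ i / F) := by
  have h1 : ∀ l : ℕ, κ.lowPass (((l + 1 : ℕ) / F : ℝ) • ξ) =
      ∑ i, κ.toFun i ξ * lineBump ((l + 1) * (ξ i / F)) := by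
    intro l
    have hl : ((l + 1 : ℕ) / F : ℝ) ≠ 0 := by positivity
    rw [κ.lowPass_eq (smul_ne_zero hl hξ)]
    refine Finset.sum_congr rfl fun i _ => ?_
    rw [κ.smul_eq i ξ _ hl, Pi.smul_apply, smul_eq_mul]
    congr 2
    push_cast
    ring
  simp only [h1, diffCutoff, Finset.mul_sum]
  rw [Finset.sum_comm]
  refine Finset.sum_congr rfl fun i _ => Finset.sum_congr rfl fun l _ => by ring

theorem sum_mul_diffCutoff_eq_zero (N : ℕ) {F : ℝ} (hF : 0 < F) {ξ : Fin (n + 1) → ℝ}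
    (hξ : 2 * (n + 1) * F < ‖ξ‖) : ∑ i, κ.toFun i ξ * diffCutoff N (ξ i / F) = 0 := by
  refine Finset.sum_eq_zero fun i _ => κ.mul_comp_eq_zero i
    (φ := fun t => diffCutoff N (t / F)) (Λ := F) (fun t ht => ?_) ξ hξ hF.le
  refine diffCutoff_eq_zero N ?_
  rw [abs_div, abs_of_pos hF, one_le_div hF]
  exact ht.le

/-- The contribution of one cone and one frequency band, as a superposition of ridge functions. -/
noncomputable def bandIntegral (N : ℕ) (i : Fin (n + 1)) (a b : ℝ) (f : (Fin (n + 1) → ℝ) → ℝ)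
    (x : Fin (n + 1) → ℝ) : ℂ :=
  ∫ v, (κ.chart i v : ℂ) * charIntegral (fun r => ((|r| ^ n * bandCutoff N a b r : ℝ) : ℂ) *
    piFourier (fun y => (f y : ℂ)) (r • i.insertNth 1 v)) (i.insertNth (1 : ℝ) v ⬝ᵥ x)

theorem contDiff_mul_bandCutoff {N : ℕ} (hN : 1 ≤ N) (i : Fin (n + 1)) {a b : ℝ} (hb : 0 < b)
    (hab : b ≤ a) : ContDiff ℝ ∞ fun ξ => κ.toFun i ξ * bandCutoff N a b (ξ i) :=
  κ.contDiff_mul_comp i (contDiff_bandCutoff N a b)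
    (by have : (0 : ℝ) < N := by exact_mod_cast hN
        positivity : 0 < b / (2 * N))
    fun _ ht => bandCutoff_eq_zero_of_le hN hb hab ht

theorem hasCompactSupport_mul_bandCutoff (N : ℕ) (i : Fin (n + 1)) {a b : ℝ} (hb : 0 < b)
    (hab : b ≤ a) : HasCompactSupport fun ξ => κ.toFun i ξ * bandCutoff N a b (ξ i) :=
  κ.hasCompactSupport_mul_comp i (hb.le.trans hab)
    fun _ ht => bandCutoff_eq_zero_of_ge N hb hab ht.le

theorem integral_mul_bandCutoff {N : ℕ} (hN : 1 ≤ N) (i : Fin (n + 1)) {a b : ℝ} (hb : 0 < b)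
    (hab : b ≤ a) {f : (Fin (n + 1) → ℝ) → ℝ} (hf : Continuous f) (hs : HasCompactSupport f)
    (x : Fin (n + 1) → ℝ) :
    ∫ ξ, ((κ.toFun i ξ * bandCutoff N a b (ξ i) : ℝ) : ℂ) *
      (piFourier (fun y => (f y : ℂ)) ξ * Real.fourierChar (x ⬝ᵥ ξ)) =
      κ.bandIntegral N i a b f x := by
  have hfc : Continuous (piFourier fun y => (f y : ℂ)) :=
    continuous_piFourier ((Complex.continuous_ofReal.comp hf).integrable_of_hasCompactSupport
      (hs.comp_left Complex.ofReal_zero))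
  have hG : Continuous fun ξ : Fin (n + 1) → ℝ =>
      piFourier (fun y => (f y : ℂ)) ξ * (Real.fourierChar (x ⬝ᵥ ξ) : ℂ) := by
    refine hfc.mul (continuous_subtype_val.comp (Real.continuous_fourierChar.comp ?_))
    change Continuous fun ξ : Fin (n + 1) → ℝ => ∑ j, x j * ξ j
    fun_prop
  rw [integral_cone i (κ.contDiff_mul_bandCutoff hN i hb hab).continuous
    (κ.hasCompactSupport_mul_bandCutoff N i hb hab) (κ.contDiff_chart i).continuous
    (κ.hasCompactSupport_chart i) (contDiff_bandCutoff N a b).continuous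
    (hasCompactSupport_bandCutoff N hb hab) (fun v r hr => by
      rw [κ.toFun_smul_insertNth i v hr]; simp) hG, bandIntegral]
  congr 1
  funext v
  rw [charIntegral]
  congr 2
  funext r
  rw [← mul_assoc]
  congr 4
  rw [dotProduct_smul, dotProduct_comm, smul_eq_mul]

theorem sum_bandCutoff (N : ℕ) (F : ℕ → ℝ) (Q : ℕ) (t : ℝ) :
    ∑ q ∈ Finset.range Q, bandCutoff N (F q) (F (q + 1)) t =
      diffCutoff N (t / F 0) - diffCutoff N (t / F Q) :=
  Finset.sum_range_sub' (fun q => diffCutoff N (t / F q)) Q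

/-- Reproduction of a function from its cone and band components. -/
theorem exists_cone_reproduction {N : ℕ} (hN : 1 ≤ N) {γ : ℝ} (hγ : 0 ≤ γ) :
    ∃ C, 0 < C ∧ ∀ (f : (Fin (n + 1) → ℝ) → ℝ) (A : ℝ) (F : ℕ → ℝ) (Q : ℕ), Continuous f →
      HasCompactSupport f → 0 ≤ A → (∀ q, 0 < F q) → Antitone F →
      (∀ y x, |(fwdDiff y)^[N] f x| ≤ A * ‖y‖ ^ γ) → ∀ x,
      |f x - ∑ i, ∑ q ∈ Finset.range Q, (κ.bandIntegral N i (F q) (F (q + 1)) f x).re| ≤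
        C * (A * F 0 ^ (-γ) + F Q ^ (n + 1) * ∫ y, ‖f y‖) := by
  obtain ⟨C, hC, h⟩ := exists_reproduction_bound κ.contDiff_lowPass κ.hasCompactSupport_lowPass
    κ.lowPass_zero N hγ
  set C' : ℝ := 2 ^ N * (2 * (2 * (n + 1))) ^ (n + 1) with hC'
  have hC'0 : 0 < C' := by positivity
  refine ⟨C + C', by positivity, fun f A F Q hf hs hA hF hanti hdiff x => ?_⟩
  have h1 := h f A (F 0) hf hs hA (hF 0) hdiff x
  have hfc : Continuous (piFourier fun y => (f y : ℂ)) :=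
    continuous_piFourier ((Complex.continuous_ofReal.comp hf).integrable_of_hasCompactSupport
      (hs.comp_left Complex.ofReal_zero))
  set G : (Fin (n + 1) → ℝ) → ℂ := fun ξ =>
      piFourier (fun y => (f y : ℂ)) ξ * (Real.fourierChar (x ⬝ᵥ ξ) : ℂ) with hGdef
  have hG : Continuous G := by
    refine hfc.mul (continuous_subtype_val.comp (Real.continuous_fourierChar.comp ?_))
    change Continuous fun ξ : Fin (n + 1) → ℝ => ∑ j, x j * ξ j
    fun_prop
  have hGle : ∀ ξ, ‖G ξ‖ ≤ ∫ y, ‖f y‖ := by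
    intro ξ
    rw [hGdef]
    simp only [norm_mul, Circle.norm_coe, mul_one]
    refine (norm_piFourier_le _ ξ).trans_eq ?_
    simp only [Complex.norm_real]
  set B : (Fin (n + 1) → ℝ) → ℝ := fun ξ => ∑ l ∈ Finset.range N, (-1 : ℝ) ^ l *
    (N.choose (l + 1) : ℝ) * κ.lowPass (((l + 1 : ℕ) / F 0 : ℝ) • ξ) with hB
  set S : (Fin (n + 1) → ℝ) → ℝ := fun ξ => ∑ i, ∑ q ∈ Finset.range Q,
    κ.toFun i ξ * bandCutoff N (F q) (F (q + 1)) (ξ i) with hS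
  have hBc : Continuous B := continuous_finsetSum _ fun l _ => continuous_const.mul
    (κ.contDiff_lowPass.continuous.comp (by fun_prop))
  have hle : ∀ q, F (q + 1) ≤ F q := fun q => hanti (Nat.le_succ q)
  have hterm : ∀ i q, Continuous fun ξ => κ.toFun i ξ * bandCutoff N (F q) (F (q + 1)) (ξ i) :=
    fun i q => (κ.contDiff_mul_bandCutoff hN i (hF _) (hle q)).continuous
  have hSc : Continuous S := continuous_finsetSum _ fun i _ => continuous_finsetSum _ fun q _ =>
    hterm i q
  have hBs : HasCompactSupport B := by
    refine HasCompactSupport.intro (isCompact_closedBall 0 (2 * (n + 1) * F 0)) fun ξ hξ => ?_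
    have h2 : 2 * (n + 1) * F 0 < ‖ξ‖ := by simpa using hξ
    have h3 : ξ ≠ 0 := by
      rintro rfl
      rw [norm_zero] at h2
      have := hF 0
      have h4 : 0 ≤ 2 * (n + 1) * F 0 := by positivity
      linarith
    exact (κ.sum_lowPass_eq N (hF 0) h3).trans (κ.sum_mul_diffCutoff_eq_zero N (hF 0) h2)
  have hiB : Integrable fun ξ => (B ξ : ℂ) * G ξ :=
    ((Complex.continuous_ofReal.comp hBc).mul hG).integrable_of_hasCompactSupport
      (hBs.comp_left (g := ((↑) : ℝ → ℂ)) Complex.ofReal_zero).mul_right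
  have hiT : ∀ i q, Integrable fun ξ =>
      ((κ.toFun i ξ * bandCutoff N (F q) (F (q + 1)) (ξ i) : ℝ) : ℂ) * G ξ := fun i q =>
    ((Complex.continuous_ofReal.comp (hterm i q)).mul hG).integrable_of_hasCompactSupport
      ((κ.hasCompactSupport_mul_bandCutoff N i (hF _) (hle q)).comp_left
        (g := ((↑) : ℝ → ℂ)) Complex.ofReal_zero).mul_right
  have hSsum : ∀ ξ, (S ξ : ℂ) * G ξ = ∑ i, ∑ q ∈ Finset.range Q,
      ((κ.toFun i ξ * bandCutoff N (F q) (F (q + 1)) (ξ i) : ℝ) : ℂ) * G ξ := by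
    intro ξ
    rw [hS]
    simp only [Complex.ofReal_sum, Finset.sum_mul]
  have hiS : Integrable fun ξ => (S ξ : ℂ) * G ξ := by
    simp only [hSsum]
    exact integrable_finsetSum _ fun i _ => integrable_finsetSum _ fun q _ => hiT i q
  have hSint : ∫ ξ, (S ξ : ℂ) * G ξ =
      ∑ i, ∑ q ∈ Finset.range Q, κ.bandIntegral N i (F q) (F (q + 1)) f x := by
    simp only [hSsum]
    rw [integral_finsetSum _ fun i _ => integrable_finsetSum _ fun q _ => hiT i q]
    refine Finset.sum_congr rfl fun i _ => ?_
    rw [integral_finsetSum _ fun q _ => hiT i q]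
    exact Finset.sum_congr rfl fun q _ => κ.integral_mul_bandCutoff hN i (hF _) (hle q) hf hs x
  have hres : ∀ ξ, ξ ≠ 0 → B ξ - S ξ = ∑ i, κ.toFun i ξ * diffCutoff N (ξ i / F Q) := by
    intro ξ hξ
    rw [hB, hS]
    simp only [κ.sum_lowPass_eq N (hF 0) hξ, ← Finset.mul_sum, sum_bandCutoff]
    rw [← Finset.sum_sub_distrib]
    exact Finset.sum_congr rfl fun i _ => by ring
  set ball := Metric.closedBall (0 : Fin (n + 1) → ℝ) (2 * (n + 1) * F Q) with hball
  have hI0 : 0 ≤ ∫ y, ‖f y‖ := integral_nonneg fun _ => norm_nonneg _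
  have hvol : (volume ball).toReal = (2 * (2 * (n + 1) * F Q)) ^ (n + 1) := by
    have h0 : 0 ≤ 2 * (n + 1) * F Q := by have := hF Q; positivity
    rw [hball, Real.volume_pi_closedBall _ h0, Fintype.card_fin, ENNReal.toReal_ofReal]
    positivity
  have hnorm : ‖(∫ ξ, (B ξ : ℂ) * G ξ) - ∫ ξ, (S ξ : ℂ) * G ξ‖ ≤
      C' * (F Q ^ (n + 1) * ∫ y, ‖f y‖) := by
    rw [← integral_sub hiB hiS]
    have hae : ∀ᵐ ξ : Fin (n + 1) → ℝ, ‖(B ξ : ℂ) * G ξ - (S ξ : ℂ) * G ξ‖ ≤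
        ball.indicator (fun _ => 2 ^ N * ∫ y, ‖f y‖) ξ := by
      have : ∀ᵐ ξ : Fin (n + 1) → ℝ, ξ ≠ 0 := by
        have h9 : volume ({0} : Set (Fin (n + 1) → ℝ)) = 0 := measure_singleton 0
        exact measure_eq_zero_iff_ae_notMem.1 h9
      filter_upwards [this] with ξ hξ
      rw [← sub_mul, ← Complex.ofReal_sub, norm_mul, Complex.norm_real, Real.norm_eq_abs, hres ξ hξ]
      by_cases hb : ξ ∈ ball
      · rw [Set.indicator_of_mem hb]
        gcongr
        · refine (Finset.abs_sum_le_sum_abs _ _).trans ?_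
          calc _ ≤ ∑ i, κ.toFun i ξ * 2 ^ N := by
                refine Finset.sum_le_sum fun i _ => ?_
                rw [abs_mul, abs_of_nonneg (κ.nonneg i ξ)]
                exact mul_le_mul_of_nonneg_left (abs_diffCutoff_le N _) (κ.nonneg i ξ)
            _ = 2 ^ N := by rw [← Finset.sum_mul, κ.sum_eq_one ξ hξ, one_mul]
        · exact hGle ξ
      · rw [Set.indicator_of_notMem hb]
        have h0 : ∑ i, κ.toFun i ξ * diffCutoff N (ξ i / F Q) = 0 :=
          κ.sum_mul_diffCutoff_eq_zero N (hF Q) (by simpa [hball] using hb)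
        rw [h0, abs_zero, zero_mul]
    have hmeas : MeasurableSet ball := Metric.isClosed_closedBall.measurableSet
    have hfin : volume ball ≠ ⊤ := (isCompact_closedBall _ _).measure_ne_top
    refine (norm_integral_le_of_norm_le ((integrable_indicator_iff hmeas).2
      (integrableOn_const hfin)) hae).trans_eq ?_
    rw [integral_indicator hmeas, setIntegral_const, Measure.real, hvol, smul_eq_mul, hC',
      ← mul_assoc 2, mul_pow _ (F Q)]
    ring
  rw [hSint] at hnorm
  have hfinal : ‖(f x : ℂ) - ∑ i, ∑ q ∈ Finset.range Q,
      κ.bandIntegral N i (F q) (F (q + 1)) f x‖ ≤ C * A * F 0 ^ (-γ) +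
        C' * (F Q ^ (n + 1) * ∫ y, ‖f y‖) := by
    refine (norm_sub_le_norm_sub_add_norm_sub _ (∫ ξ, (B ξ : ℂ) * G ξ) _).trans ?_
    exact add_le_add h1 hnorm
  have hre := (Complex.abs_re_le_norm _).trans hfinal
  simp only [Complex.sub_re, Complex.ofReal_re, Complex.re_sum] at hre
  refine hre.trans ?_
  have e1 : 0 ≤ A * F 0 ^ (-γ) := mul_nonneg hA (Real.rpow_nonneg (hF 0).le _)
  have e2 : 0 ≤ F Q ^ (n + 1) * ∫ y, ‖f y‖ := mul_nonneg (pow_nonneg (hF Q).le _) hI0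
  nlinarith [mul_nonneg hC'0.le e1, mul_nonneg hC.le e2]

end ConePartition

end Bands

section RidgeProfiles

open MeasureTheory
open scoped ContDiff Matrix

theorem charIntegral_const_mul (c : ℂ) (u : ℝ → ℂ) (t : ℝ) :
    charIntegral (fun r => c * u r) t = c * charIntegral u t := by
  simp only [charIntegral, ← integral_const_mul, mul_assoc]

theorem partialD_ofReal {d : ℕ} {f : (Fin d → ℝ) → ℝ} (hf : ContDiff ℝ 1 f) (l : Fin d)
    (x : Fin d → ℝ) :
    ((partialD l f x : ℝ) : ℂ) = fderiv ℝ (fun y => (f y : ℂ)) x (Pi.single l 1) := by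
  have h1 := (hf.differentiable (by norm_num) x).hasFDerivAt
  have h2 := (Complex.ofRealCLM.hasFDerivAt (x := f x)).comp x h1
  have h3 : HasFDerivAt (fun y => (f y : ℂ)) (Complex.ofRealCLM.comp (fderiv ℝ f x)) x := h2
  rw [h3.fderiv]
  rfl

theorem piFourier_partialD {d : ℕ} {f : (Fin d → ℝ) → ℝ} (hf : ContDiff ℝ 1 f)
    (hs : HasCompactSupport f) (l : Fin d) (ξ : Fin d → ℝ) :
    piFourier (fun x => ((partialD l f x : ℝ) : ℂ)) ξ =
      (2 * Real.pi * Complex.I * (ξ l : ℝ)) * piFourier (fun y => (f y : ℂ)) ξ := by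
  simp only [partialD_ofReal hf]
  have h1 : ContDiff ℝ 1 fun y => (f y : ℂ) := Complex.ofRealCLM.contDiff.comp hf
  rw [piFourier_fderiv h1 (hs.comp_left Complex.ofReal_zero), single_dotProduct, one_mul]

section

variable {n : ℕ}

/-- One lattice profile of the ridge superposition. -/
noncomputable def ridgeProfile (c : ℝ) (ρ : ℝ → ℝ) (f : (Fin (n + 1) → ℝ) → ℝ)
    (θ : Fin (n + 1) → ℝ) (t : ℝ) : ℝ :=
  (charIntegral (fun r => (c : ℂ) * (ρ r * piFourier (fun y => (f y : ℂ)) (r • θ))) t).re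

variable {ρ : ℝ → ℝ} {f : (Fin (n + 1) → ℝ) → ℝ}

theorem ridgeProfile_eq (c : ℝ) (ρ : ℝ → ℝ) (f : (Fin (n + 1) → ℝ) → ℝ)
    (θ : Fin (n + 1) → ℝ) (t : ℝ) : ridgeProfile c ρ f θ t =
      ((c : ℂ) * charIntegral (fun r => ρ r * piFourier (fun y => (f y : ℂ)) (r • θ)) t).re := by
  rw [ridgeProfile, charIntegral_const_mul]

theorem continuous_ridgeDensity (hρ : Continuous ρ) (hf : Continuous f) (hs : HasCompactSupport f)
    (c : ℝ) (θ : Fin (n + 1) → ℝ) : Continuous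
      fun r : ℝ => (c : ℂ) * (ρ r * piFourier (fun y => (f y : ℂ)) (r • θ)) := by
  have h1 : Continuous (piFourier fun y => (f y : ℂ)) :=
    continuous_piFourier ((Complex.continuous_ofReal.comp hf).integrable_of_hasCompactSupport
      (hs.comp_left Complex.ofReal_zero))
  have h2 : Continuous fun r : ℝ => piFourier (fun y => (f y : ℂ)) (r • θ) :=
    h1.comp (by fun_prop)
  fun_prop

theorem hasCompactSupport_ridgeDensity {Λ : ℝ} (hΛ : ∀ r, Λ < |r| → ρ r = 0)
    (c : ℝ) (θ : Fin (n + 1) → ℝ) : HasCompactSupport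
      fun r : ℝ => (c : ℂ) * (ρ r * piFourier (fun y => (f y : ℂ)) (r • θ)) :=
  HasCompactSupport.intro (isCompact_closedBall 0 Λ) fun r hr => by
    rw [hΛ r (by simpa using hr)]; simp

theorem contDiff_ridgeProfile {Λ : ℝ} (hρ : Continuous ρ) (hΛ : ∀ r, Λ < |r| → ρ r = 0)
    (hf : Continuous f) (hs : HasCompactSupport f) (c : ℝ) (θ : Fin (n + 1) → ℝ) :
    ContDiff ℝ ∞ (ridgeProfile c ρ f θ) :=
  contDiff_re_charIntegral (continuous_ridgeDensity hρ hf hs c θ)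
    (hasCompactSupport_ridgeDensity hΛ c θ)

theorem mul_deriv_ridgeProfile {Λ : ℝ} (hρ : Continuous ρ) (hΛ : ∀ r, Λ < |r| → ρ r = 0)
    (hf : ContDiff ℝ 1 f) (hs : HasCompactSupport f) (c : ℝ) (θ : Fin (n + 1) → ℝ)
    (l : Fin (n + 1)) (t : ℝ) :
    θ l * deriv (ridgeProfile c ρ f θ) t = ridgeProfile c ρ (partialD l f) θ t := by
  have h := iteratedDeriv_re_charIntegral (continuous_ridgeDensity hρ hf.continuous hs c θ)
    (hasCompactSupport_ridgeDensity hΛ c θ) 1 t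
  rw [iteratedDeriv_one] at h
  have h1 : deriv (ridgeProfile c ρ f θ) t = _ := h
  rw [h1, ← Complex.re_ofReal_mul, ← charIntegral_const_mul, ridgeProfile]
  congr 2
  funext r
  rw [piFourier_partialD hf hs, Pi.smul_apply, smul_eq_mul]
  push_cast
  ring

theorem integral_sq_iteratedDeriv_ridgeProfile_le {Λ : ℝ} (hρ : Continuous ρ)
    (hΛ : ∀ r, Λ < |r| → ρ r = 0) (hf : Continuous f) (hs : HasCompactSupport f) (c : ℝ)
    (θ : Fin (n + 1) → ℝ) (l : ℕ) {T : ℝ} (hT : 0 ≤ T) :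
    ∫ t in (-T)..T, iteratedDeriv l (ridgeProfile c ρ f θ) t ^ 2 ≤
      c ^ 2 * ∫ r, (2 * Real.pi * r) ^ (2 * l) * ρ r ^ 2 *
        ‖piFourier (fun y => (f y : ℂ)) (r • θ)‖ ^ 2 := by
  refine (integral_sq_iteratedDeriv_re_charIntegral_le (continuous_ridgeDensity hρ hf hs c θ)
    (hasCompactSupport_ridgeDensity hΛ c θ) l hT).trans_eq ?_
  rw [← integral_const_mul]
  congr 1
  funext r
  rw [norm_mul, norm_mul, Complex.norm_real, Complex.norm_real, Real.norm_eq_abs,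
    Real.norm_eq_abs, mul_pow (|c|), mul_pow (|ρ r|), sq_abs, sq_abs]
  ring

end

end RidgeProfiles

section RidgeNeurons

open MeasureTheory
open scoped ContDiff Matrix

section

variable {n : ℕ}

theorem abs_ridgeProfile_sum_sub_le {χ : (Fin n → ℝ) → ℝ} (i : Fin (n + 1)) (ρ : ℝ → ℝ)
    (f : (Fin (n + 1) → ℝ) → ℝ) (δ : ℝ) (M : ℕ) (x : Fin (n + 1) → ℝ) {ε : ℝ}
    (h : ‖(δ : ℂ) ^ n * ∑ k : Fin n → Finset.Icc (-(M : ℤ)) M, (χ (fun j => δ * (k j : ℤ)) : ℂ) *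
        charIntegral (fun r => ρ r * piFourier (fun y => (f y : ℂ))
          (r • i.insertNth 1 fun j => δ * (k j : ℤ)))
          (i.insertNth (1 : ℝ) (fun j => δ * (k j : ℤ)) ⬝ᵥ x) -
        ∫ v, (χ v : ℂ) * charIntegral (fun r => ρ r * piFourier (fun y => (f y : ℂ))
          (r • i.insertNth 1 v)) (i.insertNth (1 : ℝ) v ⬝ᵥ x)‖ ≤ ε) :
    |(∑ k : Fin n → Finset.Icc (-(M : ℤ)) M,
        ridgeProfile (δ ^ n * χ (fun j => δ * (k j : ℤ))) ρ f
          (i.insertNth (1 : ℝ) (fun j => δ * (k j : ℤ)))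
          (i.insertNth (1 : ℝ) (fun j => δ * (k j : ℤ)) ⬝ᵥ x)) -
      (∫ v, (χ v : ℂ) * charIntegral (fun r => ρ r * piFourier (fun y => (f y : ℂ))
          (r • i.insertNth 1 v)) (i.insertNth (1 : ℝ) v ⬝ᵥ x)).re| ≤ ε := by
  refine le_trans ?_ ((Complex.abs_re_le_norm _).trans h)
  rw [Complex.sub_re, Finset.mul_sum, Complex.re_sum]
  refine le_of_eq ?_
  congr 2
  refine Finset.sum_congr rfl fun (k : Fin n → Finset.Icc (-(M : ℤ)) M) _ => ?_
  rw [ridgeProfile_eq, ← mul_assoc]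
  push_cast
  rfl

theorem sum_sq_ridgeProfile_le {χ : (Fin n → ℝ) → ℝ} (i : Fin (n + 1)) {ρ : ℝ → ℝ} {Λ : ℝ}
    (hρ : Continuous ρ) (hΛ : ∀ r, Λ < |r| → ρ r = 0) {f : (Fin (n + 1) → ℝ) → ℝ}
    (hf : Continuous f) (hs : HasCompactSupport f) {δ : ℝ} (hδ : 0 ≤ δ) (M l : ℕ) {E₁ ε T : ℝ}
    (hT : 0 ≤ T)
    (hE : ∫ v, χ v ^ 2 * ∫ r, (2 * Real.pi * r) ^ (2 * l) * ρ r ^ 2 *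
      ‖piFourier (fun y => (f y : ℂ)) (r • i.insertNth 1 v)‖ ^ 2 ≤ E₁)
    (h : ‖(δ : ℂ) ^ n * ∑ k : Fin n → Finset.Icc (-(M : ℤ)) M,
        ((χ (fun j => δ * (k j : ℤ)) ^ 2 : ℝ) : ℂ) *
        (∫ r, (((2 * Real.pi * r) ^ (2 * l) * ρ r ^ 2 : ℝ) : ℂ) *
          ((‖piFourier (fun y => (f y : ℂ)) (r • i.insertNth 1 fun j => δ * (k j : ℤ))‖ ^ 2 : ℝ)
            : ℂ)) -
        ∫ v, ((χ v ^ 2 : ℝ) : ℂ) * ∫ r, (((2 * Real.pi * r) ^ (2 * l) * ρ r ^ 2 : ℝ) : ℂ) *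
          ((‖piFourier (fun y => (f y : ℂ)) (r • i.insertNth 1 v)‖ ^ 2 : ℝ) : ℂ)‖ ≤ ε) :
    ∑ k : Fin n → Finset.Icc (-(M : ℤ)) M, ∫ t in (-T)..T,
      iteratedDeriv l (ridgeProfile (δ ^ n * χ (fun j => δ * (k j : ℤ))) ρ f
        (i.insertNth (1 : ℝ) (fun j => δ * (k j : ℤ)))) t ^ 2 ≤ δ ^ n * (E₁ + ε) := by
  set G : (Fin n → ℝ) → ℝ := fun v => ∫ r, (2 * Real.pi * r) ^ (2 * l) * ρ r ^ 2 *
      ‖piFourier (fun y => (f y : ℂ)) (r • i.insertNth 1 v)‖ ^ 2 with hG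
  have hGc : ∀ v, (∫ r, (((2 * Real.pi * r) ^ (2 * l) * ρ r ^ 2 : ℝ) : ℂ) *
      ((‖piFourier (fun y => (f y : ℂ)) (r • i.insertNth 1 v)‖ ^ 2 : ℝ) : ℂ)) = (G v : ℂ) := by
    intro v
    simp only [← Complex.ofReal_mul]
    exact integral_ofReal
  simp only [hGc] at h
  simp only [← Complex.ofReal_mul] at h
  rw [integral_complex_ofReal, ← Complex.ofReal_sum, ← Complex.ofReal_pow, ← Complex.ofReal_mul,
    ← Complex.ofReal_sub, Complex.norm_real, Real.norm_eq_abs] at h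
  have h2 := (abs_le.1 h).2
  calc _ ≤ ∑ k : Fin n → Finset.Icc (-(M : ℤ)) M,
        (δ ^ n * χ (fun j => δ * (k j : ℤ))) ^ 2 * G (fun j => δ * (k j : ℤ)) :=
        Finset.sum_le_sum fun k _ =>
          integral_sq_iteratedDeriv_ridgeProfile_le hρ hΛ hf hs _ _ l hT
    _ = δ ^ n * (δ ^ n * ∑ k : Fin n → Finset.Icc (-(M : ℤ)) M,
        χ (fun j => δ * (k j : ℤ)) ^ 2 * G (fun j => δ * (k j : ℤ))) := by
        rw [Finset.mul_sum, Finset.mul_sum]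
        refine Finset.sum_congr rfl fun k _ => by ring
    _ ≤ δ ^ n * (E₁ + ε) := by gcongr; linarith

/-- A ridge superposition with controlled spectral energy is approximated, together with its
gradient, by a sampled shallow network. -/
theorem exists_neurons_of_ridgeIntegral {m : ℕ} (hm : 2 ≤ m) {χ : (Fin n → ℝ) → ℝ}
    (hχ : ContDiff ℝ ∞ χ) {R : ℝ} (hR : 1 ≤ R) (hsupp : ∀ v i, R < |v i| → χ v = 0)
    {q : ℕ} (hq : 2 ≤ q) (i : Fin (n + 1)) :
    ∃ C : ℝ, 0 < C ∧ ∀ (ρ : ℝ → ℝ) (f : (Fin (n + 1) → ℝ) → ℝ) (Λ δ E ε : ℝ) (T M : ℕ),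
      Continuous ρ → (∀ r, Λ < |r| → ρ r = 0) → ContDiff ℝ 1 f → (∀ y, 3 < ‖y‖ → f y = 0) →
      0 < δ → δ ≤ 1 → 24 * Λ * δ ≤ 1 → 0 < E → 1 ≤ T → 1 ≤ M →
      (∀ l ≤ m + 1, ∫ v, χ v ^ 2 * ∫ r, (2 * Real.pi * r) ^ (2 * l) * ρ r ^ 2 *
        ‖piFourier (fun y => (f y : ℂ)) (r • i.insertNth 1 v)‖ ^ 2 ≤ E) →
      (∀ l ≤ m + 1, δ ^ q * ((∫ r, |(2 * Real.pi * r) ^ (2 * l) * ρ r ^ 2|) * (∫ y, ‖f y‖) ^ 2) ≤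
        E) →
      δ ^ q * ((∫ r, |ρ r|) * ∫ y, ‖f y‖) ≤ ε →
      (∀ l, δ ^ q * ((∫ r, |ρ r|) * ∫ y, ‖partialD l f y‖) ≤ ε) →
      ∃ (κ : Type) (_ : Fintype κ) (c : κ → ℝ) (w : κ → Fin (n + 1) → ℝ) (b : κ → ℝ),
        (Fintype.card κ : ℝ) ≤ C * (1 / δ) ^ n * T ∧ (∀ j i, |w j i| ≤ C) ∧ (∀ j, |b j| ≤ C) ∧
        ∑ j, |c j| ≤ C * √E ∧
        ∀ x ∈ Set.Icc (0 : Fin (n + 1) → ℝ) 1,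
          |∑ j, c j * max (w j ⬝ᵥ x - b j) 0 ^ m - (∫ v, (χ v : ℂ) *
            charIntegral (fun r => ρ r * piFourier (fun y => (f y : ℂ)) (r • i.insertNth 1 v))
              (i.insertNth (1 : ℝ) v ⬝ᵥ x)).re| ≤
            C * (√E * (√(Real.log (M + 1)) * √(δ ^ n) / T ^ (m + 1) + 1 / M) + ε) ∧
          ∀ l, |∑ j, c j * (m * (w j l * max (w j ⬝ᵥ x - b j) 0 ^ (m - 1))) -
            (∫ v, (χ v : ℂ) * charIntegral
              (fun r => ρ r * piFourier (fun y => (partialD l f y : ℂ)) (r • i.insertNth 1 v))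
              (i.insertNth (1 : ℝ) v ⬝ᵥ x)).re| ≤
            C * (√E * (√(Real.log (M + 1)) * √(δ ^ n) / T ^ m + 1 / M) + ε) := by
  have hR0 : 0 ≤ R := by linarith
  have hχc : ContDiff ℝ ∞ fun v => (χ v : ℂ) := Complex.ofRealCLM.contDiff.comp hχ
  have hχ2 : ContDiff ℝ ∞ fun v => ((χ v ^ 2 : ℝ) : ℂ) :=
    Complex.ofRealCLM.contDiff.comp (hχ.pow 2)
  obtain ⟨C₁, hC₁, h₁⟩ := exists_norm_latticeSum_ridge_le hχc hR0
    (fun v i hv => by rw [hsupp v i hv]; simp) hq i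
  obtain ⟨C₂, hC₂, h₂⟩ := exists_norm_latticeSum_energy_le hχ2 hR0
    (fun v i hv => by rw [hsupp v i hv]; simp) hq i
  set T₀ : ℝ := (n + 1) * (R + 1) + 1 with hT₀
  have hn0 : (0 : ℝ) ≤ n := Nat.cast_nonneg n
  have hT₀1 : 1 < T₀ := by rw [hT₀]; nlinarith
  have hRT : R + 1 ≤ T₀ := by rw [hT₀]; nlinarith
  obtain ⟨C₃, hC₃, h₃⟩ := exists_truncatedPower_representation m hm T₀ hT₀1
  obtain ⟨C₄, hC₄, h₄⟩ := exists_ridge_discretization m (n + 1) (O := Option (Fin (n + 1)))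
    (fun o => o.elim m fun _ => m - 1) (by rintro (_ | l) <;> simp <;> omega)
    (fun o w => o.elim 1 fun l => w l) T₀ T₀ hT₀1.le hT₀1.le
    (by
      rintro (_ | l) w hw
      · simpa using hT₀1.le
      · exact hw l)
  set C₅ : ℝ := C₃ * ((m + 2) * (1 + C₂)) * (2 * R + 3) ^ n with hC₅
  have hC₅0 : 0 < C₅ := by positivity
  set C : ℝ := C₄ * (2 * R + 3) ^ n + T₀ + C₄ * √C₅ + m * (C₄ * √C₅) + C₁ with hC
  have hc1 : C₄ * (2 * R + 3) ^ n ≤ C := by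
    have : 0 ≤ C₄ * √C₅ := by positivity
    have : 0 ≤ m * (C₄ * √C₅) := by positivity
    linarith
  have hc2 : T₀ ≤ C := by
    have : 0 ≤ C₄ * √C₅ := by positivity
    have : 0 ≤ m * (C₄ * √C₅) := by positivity
    have : 0 ≤ C₄ * (2 * R + 3) ^ n := by positivity
    linarith
  have hc3 : C₄ * √C₅ ≤ C := by
    have : 0 ≤ m * (C₄ * √C₅) := by positivity
    have : 0 ≤ C₄ * (2 * R + 3) ^ n := by positivity
    linarith
  have hc4 : m * (C₄ * √C₅) ≤ C := by
    have : 0 ≤ C₄ * √C₅ := by positivity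
    have : 0 ≤ C₄ * (2 * R + 3) ^ n := by positivity
    linarith
  have hc5 : C₁ ≤ C := by
    have : 0 ≤ C₄ * √C₅ := by positivity
    have : 0 ≤ m * (C₄ * √C₅) := by positivity
    have : 0 ≤ C₄ * (2 * R + 3) ^ n := by positivity
    linarith
  refine ⟨C, by linarith, ?_⟩
  intro ρ f Λ δ E ε T M hρ hΛ hf hsf hδ hδ1 hΛδ hE hT hM hen hal hε hε'
  have hs : HasCompactSupport f := HasCompactSupport.intro (isCompact_closedBall 0 3)
    fun y hy => hsf y (by simpa using hy)
  set L : ℕ := ⌈R / δ⌉₊ with hL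
  have hL1 : R ≤ L * δ := by
    rw [← div_le_iff₀ hδ]; exact Nat.le_ceil _
  have hL2 : L * δ ≤ R + 1 := by
    have := (Nat.ceil_lt_add_one (by positivity : 0 ≤ R / δ)).le
    calc L * δ ≤ (R / δ + 1) * δ := by gcongr
      _ = R + δ := by field_simp
      _ ≤ R + 1 := by linarith
  set ι := Fin n → Finset.Icc (-(L : ℤ)) L with hι
  set pt : ι → Fin n → ℝ := fun k j => δ * (k j : ℤ) with hpt
  set dir : ι → Fin (n + 1) → ℝ := fun k => i.insertNth (1 : ℝ) (pt k) with hdir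
  have hdirb : ∀ k j, |dir k j| ≤ R + 1 := by
    intro k j
    refine Fin.succAboveCases i ?_ (fun l => ?_) j
    · simp [hdir]; linarith
    · simp only [hdir, Fin.insertNth_apply_succAbove, hpt]
      have h5 := Finset.mem_Icc.1 (k l).2
      have h6 : |((k l : ℤ) : ℝ)| ≤ L := by
        rw [abs_le]; exact ⟨by exact_mod_cast h5.1, by exact_mod_cast h5.2⟩
      rw [abs_mul, abs_of_pos hδ]
      calc δ * |((k l : ℤ) : ℝ)| ≤ δ * L := by gcongr
        _ ≤ R + 1 := by linarith
  have hdot : ∀ k, ∀ x ∈ Set.Icc (0 : Fin (n + 1) → ℝ) 1, |dir k ⬝ᵥ x| ≤ T₀ - 1 := by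
    intro k x hx
    have : T₀ - 1 = ∑ _j : Fin (n + 1), (R + 1) := by simp [hT₀]; ring
    rw [this]
    refine (Finset.abs_sum_le_sum_abs _ _).trans (Finset.sum_le_sum fun j _ => ?_)
    rw [abs_mul]
    have h1 := hx.1 j
    have h2 := hx.2 j
    simp only [Pi.zero_apply, Pi.one_apply] at h1 h2
    rw [abs_of_nonneg h1]
    calc |dir k j| * x j ≤ (R + 1) * 1 := mul_le_mul (hdirb k j) h2 h1 (by linarith)
      _ = R + 1 := mul_one _
  set P : ι → ℝ → ℝ := fun k => ridgeProfile (δ ^ n * χ (pt k)) ρ f (dir k) with hP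
  have hPs : ∀ k, ContDiff ℝ (⊤ : ℕ∞) (P k) := fun k =>
    contDiff_ridgeProfile hρ hΛ hf.continuous hs _ _
  choose a ha1 ha2 ha3 ha4 using fun k => h₃ (P k) (hPs k)
  have hfc : Continuous fun y => (f y : ℂ) := Complex.continuous_ofReal.comp hf.continuous
  have hnorm : ∀ g : (Fin (n + 1) → ℝ) → ℝ, (∫ y, ‖(g y : ℂ)‖) = ∫ y, ‖g y‖ := fun g => by
    simp only [Complex.norm_real]
  have hener : ∀ l ∈ Finset.range (m + 2), ∑ k, ∫ t in (-T₀)..T₀, iteratedDeriv l (P k) t ^ 2 ≤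
      δ ^ n * (E + C₂ * E) := by
    intro l hl
    have hl' : l ≤ m + 1 := by have := Finset.mem_range.1 hl; omega
    have h5 := h₂ (fun r => (2 * Real.pi * r) ^ (2 * l) * ρ r ^ 2) (fun y => (f y : ℂ)) Λ δ L
      (by fun_prop) (fun r hr => by simp [hΛ r hr]) hfc (fun y hy => by simp [hsf y hy])
      hδ hδ1 hΛδ hL1 hL2
    refine sum_sq_ridgeProfile_le i hρ hΛ hf.continuous hs hδ.le L l (by linarith)
      (hen l hl') (h5.trans ?_)
    rw [hnorm, mul_assoc]
    exact mul_le_mul_of_nonneg_left (hal l hl') hC₂.le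
  set D : ℝ := ((2 * R + 3) / δ) ^ n with hD
  have hD1 : 1 ≤ D := one_le_pow₀ ((one_le_div hδ).2 (by linarith))
  have hcard : (Fintype.card ι : ℝ) ≤ D := by
    have hc : Fintype.card ι = Fintype.card (Finset.Icc (-(L : ℤ)) L) ^ Fintype.card (Fin n) :=
      Fintype.card_fun
    rw [hc, Fintype.card_fin, Fintype.card_coe, Int.card_Icc]
    have : ((L : ℤ) + 1 - -(L : ℤ)).toNat = 2 * L + 1 := by omega
    rw [this, hD]
    push_cast
    gcongr
    rw [le_div_iff₀ hδ]
    nlinarith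
  have hsum : ∑ k, ∫ t in (-T₀)..T₀, a k t ^ 2 ≤ C₅ * E / D := by
    calc _ ≤ ∑ k, C₃ * ∑ l ∈ Finset.range (m + 2), ∫ t in (-T₀)..T₀,
          iteratedDeriv l (P k) t ^ 2 := Finset.sum_le_sum fun k _ => ha4 k
      _ = C₃ * ∑ l ∈ Finset.range (m + 2), ∑ k, ∫ t in (-T₀)..T₀,
          iteratedDeriv l (P k) t ^ 2 := by rw [← Finset.mul_sum, Finset.sum_comm]
      _ ≤ C₃ * ∑ l ∈ Finset.range (m + 2), δ ^ n * (E + C₂ * E) := by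
          gcongr with l hl; exact hener l hl
      _ = C₅ * E / D := by
          rw [Finset.sum_const, Finset.card_range, hC₅, hD, div_pow]
          have : (2 * R + 3) ^ n ≠ 0 := by positivity
          field_simp
          simp only [nsmul_eq_mul]
          push_cast
          ring
  obtain ⟨κ, hκ, c, w, b, k1, k2, k3, k4, k5⟩ := h₄ ι D (C₅ * E) T M hD1 hcard (by positivity) hT
    hM dir a (fun k j => (hdirb k j).trans hRT) ha1 hsum
  have hsqrt : √(C₅ * E) = √C₅ * √E := Real.sqrt_mul hC₅0.le _
  have hTpos : (0 : ℝ) < T := by exact_mod_cast hT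
  have hDle : ∀ p : ℕ, √(Real.log (M + 1)) / (√D * (T : ℝ) ^ p) ≤
      √(Real.log (M + 1)) * √(δ ^ n) / T ^ p := by
    intro p
    have h6 : 1 ≤ √D * √(δ ^ n) := by
      rw [← Real.sqrt_mul (by positivity), Real.one_le_sqrt, hD, ← mul_pow,
        div_mul_cancel₀ _ hδ.ne']
      exact one_le_pow₀ (by linarith)
    have h7 : 0 < √D := Real.sqrt_pos.2 (by positivity)
    rw [div_le_div_iff₀ (by positivity) (by positivity)]
    calc √(Real.log (M + 1)) * T ^ p = √(Real.log (M + 1)) * 1 * T ^ p := by ring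
      _ ≤ √(Real.log (M + 1)) * (√D * √(δ ^ n)) * T ^ p := by gcongr
      _ = _ := by ring
  have hal1 : ∀ g : (Fin (n + 1) → ℝ) → ℝ, Continuous g → (∀ y, 3 < ‖y‖ → g y = 0) →
      δ ^ q * ((∫ r, |ρ r|) * ∫ y, ‖g y‖) ≤ ε → ∀ x ∈ Set.Icc (0 : Fin (n + 1) → ℝ) 1,
      |(∑ k, ridgeProfile (δ ^ n * χ (pt k)) ρ g (dir k) (dir k ⬝ᵥ x)) - (∫ v, (χ v : ℂ) *
            charIntegral (fun r => ρ r * piFourier (fun y => (g y : ℂ)) (r • i.insertNth 1 v))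
              (i.insertNth (1 : ℝ) v ⬝ᵥ x)).re| ≤ C₁ * ε := by
    intro g hg hsg hgε x hx
    have hx1 : ‖x‖ ≤ 1 := (pi_norm_le_iff_of_nonneg zero_le_one).2 fun j => by
      rw [Real.norm_eq_abs, abs_of_nonneg (hx.1 j)]; exact hx.2 j
    refine abs_ridgeProfile_sum_sub_le i ρ g δ L x ?_
    refine (h₁ ρ (fun y => (g y : ℂ)) Λ δ L x hρ hΛ (Complex.continuous_ofReal.comp hg)
      (fun y hy => by simp [hsg y hy]) hδ hδ1 hΛδ hL1 hL2 hx1).trans ?_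
    rw [hnorm, mul_assoc]
    exact mul_le_mul_of_nonneg_left hgε hC₁.le
  have hε0 : 0 ≤ ε := le_trans (by positivity) hε
  refine ⟨κ, hκ, c, w, b, ?_, fun j l => (k2 j l).trans hc2, fun j => (k3 j).trans hc2, ?_, ?_⟩
  · refine k1.trans ?_
    rw [hD, div_eq_mul_one_div, mul_pow, ← mul_assoc]
    gcongr
  · refine k4.trans ?_
    rw [hsqrt, ← mul_assoc]
    gcongr
  intro x hx
  have hfin : ∀ (p : ℕ) (c' : ℝ), 0 ≤ c' → c' * (C₄ * √C₅) ≤ C → ∀ u s t : ℝ,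
      |u - s| ≤ c' * (C₄ * √(C₅ * E) * (√(Real.log (M + 1)) / (√D * T ^ p) + 1 / M)) →
      |s - t| ≤ C₁ * ε →
      |u - t| ≤ C * (√E * (√(Real.log (M + 1)) * √(δ ^ n) / T ^ p + 1 / M) + ε) := by
    intro p c' hc' hcC u s t h6 h7
    calc |u - t| ≤ |u - s| + |s - t| := abs_sub_le _ _ _
      _ ≤ c' * (C₄ * √(C₅ * E) * (√(Real.log (M + 1)) / (√D * T ^ p) + 1 / M)) + C₁ * ε :=
          add_le_add h6 h7
      _ = c' * (C₄ * √C₅) * (√E * (√(Real.log (M + 1)) / (√D * T ^ p) + 1 / M)) + C₁ * ε := by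
          rw [hsqrt]; ring
      _ ≤ C * (√E * (√(Real.log (M + 1)) * √(δ ^ n) / T ^ p + 1 / M)) + C * ε := by
          have h9 := hDle p
          have h10 : √(Real.log (M + 1)) / (√D * T ^ p) + 1 / M ≤
            √(Real.log (M + 1)) * √(δ ^ n) / T ^ p + 1 / M := by linarith
          have hC0 : 0 ≤ C := by linarith
          have h11 : 0 ≤ √(Real.log (M + 1)) / (√D * T ^ p) + 1 / M := by positivity
          refine add_le_add (mul_le_mul hcC (mul_le_mul_of_nonneg_left h10 (Real.sqrt_nonneg _))
            (by positivity) hC0) (mul_le_mul_of_nonneg_right hc5 hε0)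
      _ = _ := by ring
  constructor
  · have h6 := k5 none x hx
    simp only [Option.elim_none, one_mul] at h6
    refine hfin (m + 1) 1 zero_le_one (by rw [one_mul]; exact hc3) _ _ _ (by rw [one_mul]; exact h6)
      ?_
    have h7 : ∀ k, (∫ t in (-T₀)..T₀, a k t * max (dir k ⬝ᵥ x - t) 0 ^ m) = P k (dir k ⬝ᵥ x) :=
      fun k => (ha2 k _ (hdot k x hx)).symm
    simp only [h7]
    exact hal1 f hf.continuous hsf hε x hx
  · intro l
    have h6 := k5 (some l) x hx
    simp only [Option.elim_some] at h6
    have hm1 : m - 1 + 1 = m := by omega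
    rw [hm1] at h6
    have h7 : ∀ k, (m : ℝ) * (dir k l * ∫ t in (-T₀)..T₀, a k t * max (dir k ⬝ᵥ x - t) 0 ^ (m - 1))
        = ridgeProfile (δ ^ n * χ (pt k)) ρ (partialD l f) (dir k) (dir k ⬝ᵥ x) := by
      intro k
      rw [← mul_deriv_ridgeProfile hρ hΛ hf hs]
      have h8 := ha3 k _ (hdot k x hx)
      simp only [hP] at h8
      rw [h8]
      ring
    refine hfin m m (Nat.cast_nonneg m) hc4 _
      (∑ k, (m : ℝ) * (dir k l * ∫ t in (-T₀)..T₀, a k t * max (dir k ⬝ᵥ x - t) 0 ^ (m - 1))) _ ?_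
          ?_
    · have h8 : ∑ j, c j * (m * (w j l * max (w j ⬝ᵥ x - b j) 0 ^ (m - 1))) =
          m * ∑ j, c j * (w j l * max (w j ⬝ᵥ x - b j) 0 ^ (m - 1)) := by
        rw [Finset.mul_sum]; exact Finset.sum_congr rfl fun j _ => by ring
      rw [h8, ← Finset.mul_sum, ← mul_sub, abs_mul, Nat.abs_cast]
      exact mul_le_mul_of_nonneg_left h6 (Nat.cast_nonneg m)
    · simp only [h7]
      have hcont : Continuous (partialD l f) :=
        (hf.continuous_fderiv (by norm_num)).clm_apply continuous_const
      refine hal1 (partialD l f) hcont (fun y hy => ?_) (hε' l) x hx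
      have : f =ᶠ[nhds y] fun _ => 0 := by
        filter_upwards [(isOpen_lt continuous_const continuous_norm).mem_nhds hy] with z hz
        exact hsf z hz
      simp [partialD, this.fderiv_eq]

end

end RidgeNeurons

section SpectralDecay

open MeasureTheory
open scoped ContDiff Matrix

theorem sixteen_mul_sq_le_norm_fourierChar_sub_one_sq {t : ℝ} (ht : |t| ≤ 1 / 2) :
    16 * t ^ 2 ≤ ‖(Real.fourierChar t : ℂ) - 1‖ ^ 2 := by
  have h1 : ‖(Real.fourierChar t : ℂ) - 1‖ = ‖2 * Real.sin (2 * Real.pi * t / 2)‖ := by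
    rw [← Complex.norm_exp_I_mul_ofReal_sub_one, Real.fourierChar_apply, mul_comm Complex.I]
  have h2 : |Real.pi * t| ≤ Real.pi / 2 := by
    rw [abs_mul, abs_of_pos Real.pi_pos]
    nlinarith [Real.pi_pos]
  have h3 := Real.mul_abs_le_abs_sin h2
  rw [abs_mul, abs_of_pos Real.pi_pos, ← mul_assoc, div_mul_cancel₀ _ Real.pi_ne_zero] at h3
  rw [h1, show 2 * Real.pi * t / 2 = Real.pi * t by ring, norm_mul, Real.norm_eq_abs,
    Real.norm_eq_abs, abs_two, ← sq_abs t]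
  nlinarith [abs_nonneg t]

section

variable {d : ℕ} {β A : ℝ} {r : ℕ} {f : (Fin d → ℝ) → ℝ}

theorem hasCompactSupport_of_norm (hsf : ∀ y, 3 < ‖y‖ → f y = 0) : HasCompactSupport f :=
  HasCompactSupport.intro (isCompact_closedBall 0 3) fun y hy => hsf y (by simpa using hy)

theorem tsupport_subset_of_norm (hsf : ∀ y, 3 < ‖y‖ → f y = 0) :
    tsupport f ⊆ Metric.closedBall 0 3 :=
  closure_minimal (fun y hy => by
    by_contra h
    exact hy (hsf y (by simpa using h))) Metric.isClosed_closedBall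

theorem iterate_partialD_eq_zero (hsf : ∀ y, 3 < ‖y‖ → f y = 0) (i : Fin d) (k : ℕ)
    {y : Fin d → ℝ} (hy : 3 < ‖y‖) : (partialD i)^[k] f y = 0 := by
  refine image_eq_zero_of_notMem_tsupport fun h => ?_
  have := (tsupport_iterate_partialD_subset i k f).trans (tsupport_subset_of_norm hsf) h
  rw [mem_closedBall_zero_iff] at this
  linarith

theorem piFourier_iterate_partialD (hf : IsHolder β A r f) (hsf : ∀ y, 3 < ‖y‖ → f y = 0)
    (i : Fin d) {k : ℕ} (hk : k ≤ r) (ξ : Fin d → ℝ) :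
    piFourier (fun y => (((partialD i)^[k] f y : ℝ) : ℂ)) ξ =
      (2 * Real.pi * Complex.I * (ξ i : ℝ)) ^ k * piFourier (fun y => (f y : ℂ)) ξ := by
  induction k with
  | zero => simp
  | succ k ih =>
    have h1 : IsHolder β A (r - k - 1 + 1) ((partialD i)^[k] f) := by
      refine IsHolder.iterate_partialD i k ?_
      convert hf using 1; omega
    simp only [Function.iterate_succ_apply']
    rw [piFourier_partialD h1.1 (hasCompactSupport_of_norm fun y hy =>
      iterate_partialD_eq_zero hsf i k hy), ih (by omega)]
    ring

theorem integral_sq_le_of_abs_le {g : (Fin d → ℝ) → ℝ} {B R : ℝ} (hR : 0 ≤ R)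
    (hB : ∀ y, |g y| ≤ B) (hsg : ∀ y, R < ‖y‖ → g y = 0) :
    ∫ y, ‖(g y : ℂ)‖ ^ 2 ≤ (2 * R) ^ d * B ^ 2 := by
  set ball := Metric.closedBall (0 : Fin d → ℝ) R with hball
  have hmeas : MeasurableSet ball := Metric.isClosed_closedBall.measurableSet
  have hfin : volume ball ≠ ⊤ := (isCompact_closedBall _ _).measure_ne_top
  have hvol : (volume ball).toReal = (2 * R) ^ d := by
    rw [hball, Real.volume_pi_closedBall _ hR, Fintype.card_fin, ENNReal.toReal_ofReal]
    positivity
  calc ∫ y, ‖(g y : ℂ)‖ ^ 2 ≤ ∫ y, ball.indicator (fun _ => B ^ 2) y := by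
        refine integral_mono_of_nonneg (.of_forall fun y => by positivity)
          ((integrable_indicator_iff hmeas).2 (integrableOn_const hfin)) (.of_forall fun y => ?_)
        beta_reduce
        rw [Complex.norm_real, Real.norm_eq_abs]
        by_cases hy : y ∈ ball
        · rw [Set.indicator_of_mem hy]
          exact pow_le_pow_left₀ (abs_nonneg _) (hB y) 2
        · rw [Set.indicator_of_notMem hy, hsg y (by simpa [hball] using hy)]
          simp
    _ = (2 * R) ^ d * B ^ 2 := by
        rw [integral_indicator hmeas, setIntegral_const, Measure.real, hvol, smul_eq_mul]

theorem integrable_pow_mul_norm_sq_piFourier (hf : IsHolder β A r f) (hβ : 0 < β)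
    (hsf : ∀ y, 3 < ‖y‖ → f y = 0) (i : Fin d) {k : ℕ} (hk : k ≤ r) :
    Integrable (fun ξ => |ξ i| ^ (2 * k) * ‖piFourier (fun y => (f y : ℂ)) ξ‖ ^ 2) ∧
      ∫ ξ, |ξ i| ^ (2 * k) * ‖piFourier (fun y => (f y : ℂ)) ξ‖ ^ 2 ≤ 6 ^ d * A ^ 2 := by
  have h1 : IsHolder β A (r - k) ((partialD i)^[k] f) := by
    refine IsHolder.iterate_partialD i k ?_
    convert hf using 1; omega
  have h0 : ∀ y, 3 < ‖y‖ → (partialD i)^[k] f y = 0 := fun y hy =>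
    iterate_partialD_eq_zero hsf i k hy
  have hc : Continuous fun y => (((partialD i)^[k] f y : ℝ) : ℂ) :=
    Complex.continuous_ofReal.comp (h1.continuous hβ)
  obtain ⟨h2, h3⟩ := integral_norm_sq_piFourier hc
    ((hasCompactSupport_of_norm h0).comp_left Complex.ofReal_zero)
  have h4 : ∀ ξ : Fin d → ℝ, ‖piFourier (fun y => (((partialD i)^[k] f y : ℝ) : ℂ)) ξ‖ ^ 2 =
      (2 * Real.pi) ^ (2 * k) * (|ξ i| ^ (2 * k) * ‖piFourier (fun y => (f y : ℂ)) ξ‖ ^ 2) := by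
    intro ξ
    rw [piFourier_iterate_partialD hf hsf i hk, norm_mul, norm_pow, mul_pow, ← pow_mul, mul_comm k,
      ← mul_assoc, ← mul_pow]
    congr 2
    simp [abs_of_pos Real.pi_pos]
  simp only [h4] at h2 h3
  have hpi : (1 : ℝ) ≤ (2 * Real.pi) ^ (2 * k) := one_le_pow₀ (by linarith [Real.pi_gt_three])
  have h5 : Integrable (fun ξ : Fin d → ℝ => |ξ i| ^ (2 * k) *
      ‖piFourier (fun y => (f y : ℂ)) ξ‖ ^ 2) := by
    refine (h2.const_mul ((2 * Real.pi) ^ (2 * k))⁻¹).congr (.of_forall fun ξ => ?_)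
    simp only
    rw [← mul_assoc, inv_mul_cancel₀ (by positivity), one_mul]
  refine ⟨h5, ?_⟩
  rw [integral_const_mul] at h3
  have h6 := integral_sq_le_of_abs_le (by norm_num : (0 : ℝ) ≤ 3) h1.abs_le h0
  rw [← h3] at h6
  have h7 : 0 ≤ ∫ ξ : Fin d → ℝ, |ξ i| ^ (2 * k) * ‖piFourier (fun y => (f y : ℂ)) ξ‖ ^ 2 :=
    integral_nonneg fun ξ => by positivity
  norm_num at h6
  nlinarith

/-- Low frequencies of the top order derivatives, weighted by one extra derivative. -/
theorem setIntegral_lowFreq_le (hf : IsHolder β A r f) (hβ : 0 < β)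
    (hsf : ∀ y, 3 < ‖y‖ → f y = 0) (i : Fin d) {F : ℝ} (hF : 1 ≤ F) :
    ∫ ξ in {ξ : Fin d → ℝ | |ξ i| ≤ F}, |ξ i| ^ (2 * (r + 1)) *
      ‖piFourier (fun y => (f y : ℂ)) ξ‖ ^ 2 ≤ 8 ^ d * A ^ 2 * F ^ (2 - 2 * β) := by
  have hF0 : 0 < F := by linarith
  have h1 : IsHolder β A 0 ((partialD i)^[r] f) := IsHolder.iterate_partialD i r hf
  set g := (partialD i)^[r] f with hg
  have h0 : ∀ y, 3 < ‖y‖ → g y = 0 := fun y hy => iterate_partialD_eq_zero hsf i r hy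
  set z : Fin d → ℝ := Pi.single i (1 / (2 * F)) with hz
  have hzn : ‖z‖ = 1 / (2 * F) := by
    rw [hz, Pi.norm_single, Real.norm_eq_abs, abs_of_pos (by positivity)]
  have hz1 : ‖z‖ ≤ 1 := by
    rw [hzn, div_le_one (by positivity)]; linarith
  set u : (Fin d → ℝ) → ℝ := fun y => g (y + z) - g y with hu
  have hgc : Continuous g := h1.continuous hβ
  have huc : Continuous u := by fun_prop
  have hu0 : ∀ y, 4 < ‖y‖ → u y = 0 := by
    intro y hy
    have : ‖y‖ ≤ ‖y + z‖ + ‖z‖ := by simpa using norm_sub_le (y + z) z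
    rw [hu]
    simp only
    rw [h0 _ (by linarith), h0 _ (by linarith), sub_zero]
  have hus : HasCompactSupport u := HasCompactSupport.intro (isCompact_closedBall 0 4)
    fun y hy => hu0 y (by simpa using hy)
  have huB : ∀ y, |u y| ≤ A * F ^ (-β) := by
    intro y
    refine (h1.2 _ _).trans ?_
    have hA := h1.nonneg
    rw [add_sub_cancel_left, hzn, Real.rpow_neg hF0.le, ← Real.inv_rpow hF0.le]
    gcongr
    rw [one_div]
    gcongr
    linarith
  have huF : ∀ ξ, piFourier (fun y => (u y : ℂ)) ξ = ((Real.fourierChar (ξ i / (2 * F)) : ℂ) - 1) *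
      ((2 * Real.pi * Complex.I * (ξ i : ℝ)) ^ r * piFourier (fun y => (f y : ℂ)) ξ) := by
    intro ξ
    have e1 : piFourier (fun y => (u y : ℂ)) ξ = piFourier (fun y => (g (y + z) : ℂ)) ξ -
        piFourier (fun y => (g y : ℂ)) ξ := by
      rw [piFourier_apply, piFourier_apply, piFourier_apply, ← integral_sub]
      · congr 1; funext y
        rw [hu]; push_cast; rw [smul_sub]
      · have := (Complex.continuous_ofReal.comp
          (hgc.comp (continuous_add_const z))).integrable_of_hasCompactSupport (μ := volume)
          (((hasCompactSupport_of_norm h0).comp_homeomorph (Homeomorph.addRight z)).comp_left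
            Complex.ofReal_zero)
        refine (this.norm.mono' ?_ (.of_forall fun y => ?_))
        · refine Continuous.aestronglyMeasurable ?_
          refine Continuous.mul (continuous_subtype_val.comp (Real.continuous_fourierChar.comp ?_))
            (by fun_prop)
          change Continuous fun y : Fin d → ℝ => -∑ j, y j * ξ j
          fun_prop
        · rw [Circle.norm_smul]; exact le_rfl
      · have := (Complex.continuous_ofReal.comp hgc).integrable_of_hasCompactSupport
          (μ := volume) ((hasCompactSupport_of_norm h0).comp_left Complex.ofReal_zero)
        refine (this.norm.mono' ?_ (.of_forall fun y => ?_))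
        · refine Continuous.aestronglyMeasurable ?_
          refine Continuous.mul (continuous_subtype_val.comp (Real.continuous_fourierChar.comp ?_))
            (by fun_prop)
          change Continuous fun y : Fin d → ℝ => -∑ j, y j * ξ j
          fun_prop
        · rw [Circle.norm_smul]; exact le_rfl
    rw [e1, piFourier_comp_add_right (fun y => (g y : ℂ)), hg,
      piFourier_iterate_partialD hf hsf i le_rfl, hz, single_dotProduct, Circle.smul_def,
      smul_eq_mul, sub_mul, one_mul]
    congr 4
    rw [one_div, div_eq_inv_mul]
  obtain ⟨h2, h3⟩ := integral_norm_sq_piFourier (Complex.continuous_ofReal.comp huc)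
    (hus.comp_left Complex.ofReal_zero)
  have h4 : ∫ y, ‖(u y : ℂ)‖ ^ 2 ≤ (2 * 4) ^ d * (A * F ^ (-β)) ^ 2 :=
    integral_sq_le_of_abs_le (by norm_num) huB hu0
  have hset : MeasurableSet {ξ : Fin d → ℝ | |ξ i| ≤ F} :=
    (isClosed_le (by fun_prop) continuous_const).measurableSet
  have hpt : ∀ ξ ∈ {ξ : Fin d → ℝ | |ξ i| ≤ F}, |ξ i| ^ (2 * (r + 1)) *
      ‖piFourier (fun y => (f y : ℂ)) ξ‖ ^ 2 ≤
        F ^ 2 * ‖piFourier (fun y => (u y : ℂ)) ξ‖ ^ 2 := by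
    intro ξ hξ
    have hξ' : |ξ i / (2 * F)| ≤ 1 / 2 := by
      rw [abs_div, abs_of_pos (by positivity : 0 < 2 * F), div_le_div_iff₀ (by positivity) two_pos]
      have : |ξ i| ≤ F := hξ
      linarith
    have h5 := sixteen_mul_sq_le_norm_fourierChar_sub_one_sq hξ'
    rw [huF, norm_mul, norm_mul, norm_pow, mul_pow, mul_pow, ← pow_mul]
    have h6 : |ξ i| ^ (2 * r) ≤ ‖(2 * Real.pi * Complex.I * (ξ i : ℝ) : ℂ)‖ ^ (r * 2) := by
      rw [mul_comm r]
      refine pow_le_pow_left₀ (abs_nonneg _) ?_ _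
      simp only [norm_mul, Complex.norm_real, Complex.norm_I, Real.norm_eq_abs,
        abs_of_pos Real.pi_pos, mul_one, Complex.norm_ofNat]
      nlinarith [abs_nonneg (ξ i), Real.pi_gt_three]
    have h7 : |ξ i| ^ 2 ≤ F ^ 2 * ‖(Real.fourierChar (ξ i / (2 * F)) : ℂ) - 1‖ ^ 2 := by
      have : F ^ 2 * (16 * (ξ i / (2 * F)) ^ 2) ≤
        F ^ 2 * ‖(Real.fourierChar (ξ i / (2 * F)) : ℂ) - 1‖ ^ 2 := by gcongr
      refine le_trans ?_ this
      have e : F ^ 2 * (16 * (ξ i / (2 * F)) ^ 2) = 4 * ξ i ^ 2 := by field_simp; ring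
      rw [e, sq_abs]; nlinarith [sq_nonneg (ξ i)]
    calc |ξ i| ^ (2 * (r + 1)) * ‖piFourier (fun y => (f y : ℂ)) ξ‖ ^ 2
        = |ξ i| ^ 2 * (|ξ i| ^ (2 * r) * ‖piFourier (fun y => (f y : ℂ)) ξ‖ ^ 2) := by ring
      _ ≤ (F ^ 2 * ‖(Real.fourierChar (ξ i / (2 * F)) : ℂ) - 1‖ ^ 2) *
          (‖(2 * Real.pi * Complex.I * (ξ i : ℝ) : ℂ)‖ ^ (r * 2) *
            ‖piFourier (fun y => (f y : ℂ)) ξ‖ ^ 2) := by gcongr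
      _ = _ := by ring
  have hnn : ∀ ξ : Fin d → ℝ, 0 ≤ |ξ i| ^ (2 * (r + 1)) *
      ‖piFourier (fun y => (f y : ℂ)) ξ‖ ^ 2 := fun ξ => by positivity
  calc _ ≤ ∫ ξ in {ξ : Fin d → ℝ | |ξ i| ≤ F}, F ^ 2 * ‖piFourier (fun y => (u y : ℂ)) ξ‖ ^ 2 := by
        refine integral_mono_of_nonneg (.of_forall hnn) (h2.integrableOn.const_mul _) ?_
        exact (ae_restrict_iff' hset).2 (.of_forall hpt)
    _ ≤ ∫ ξ, F ^ 2 * ‖piFourier (fun y => (u y : ℂ)) ξ‖ ^ 2 :=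
        setIntegral_le_integral (h2.const_mul _) (.of_forall fun ξ => by positivity)
    _ = F ^ 2 * ∫ y, ‖(u y : ℂ)‖ ^ 2 := by
        rw [integral_const_mul]; congr 1
    _ ≤ F ^ 2 * ((2 * 4) ^ d * (A * F ^ (-β)) ^ 2) := by gcongr
    _ = 8 ^ d * A ^ 2 * F ^ (2 - 2 * β) := by
        have e : F ^ (2 - 2 * β) = F ^ 2 * (F ^ (-β)) ^ 2 := by
          rw [← Real.rpow_natCast, ← Real.rpow_natCast, ← Real.rpow_mul hF0.le,
            ← Real.rpow_add hF0]
          congr 1; push_cast; ring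
        rw [e]; norm_num; ring

end

end SpectralDecay

section ShellEnergy

open MeasureTheory
open scoped ContDiff Matrix

section

variable {d : ℕ} {β A : ℝ} {r : ℕ} {f : (Fin d → ℝ) → ℝ}

theorem continuous_piFourier_of_isHolder (hf : IsHolder β A r f) (hβ : 0 < β)
    (hsf : ∀ y, 3 < ‖y‖ → f y = 0) : Continuous (piFourier fun y => (f y : ℂ)) :=
  continuous_piFourier ((Complex.continuous_ofReal.comp
    (hf.continuous hβ)).integrable_of_hasCompactSupport
      ((hasCompactSupport_of_norm hsf).comp_left Complex.ofReal_zero))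

theorem measurableSet_band (i : Fin d) (a b : ℝ) :
    MeasurableSet {ξ : Fin d → ℝ | b ≤ |ξ i| ∧ |ξ i| ≤ a} :=
  (measurableSet_le (f := fun _ => b) (g := fun ξ : Fin d → ℝ => |ξ i|) (by fun_prop)
    (by fun_prop)).inter (measurableSet_le (f := fun ξ : Fin d → ℝ => |ξ i|) (g := fun _ => a)
    (by fun_prop) (by fun_prop))

theorem integrableOn_max_pow_mul_norm_sq_piFourier (hf : IsHolder β A r f) (hβ : 0 < β)
    (hsf : ∀ y, 3 < ‖y‖ → f y = 0) (i : Fin d) (p : ℕ) (a b : ℝ) :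
    IntegrableOn (fun ξ => max |ξ i| 1 ^ p * ‖piFourier (fun y => (f y : ℂ)) ξ‖ ^ 2)
      {ξ : Fin d → ℝ | b ≤ |ξ i| ∧ |ξ i| ≤ a} := by
  have h0 := (integrable_pow_mul_norm_sq_piFourier hf hβ hsf i (Nat.zero_le r)).1
  simp only [mul_zero, pow_zero, one_mul] at h0
  have hset : MeasurableSet {ξ : Fin d → ℝ | b ≤ |ξ i| ∧ |ξ i| ≤ a} :=
    measurableSet_band i _ _
  refine Integrable.mono' (g := fun ξ => max a 1 ^ p *
    ‖piFourier (fun y => (f y : ℂ)) ξ‖ ^ 2) (h0.integrableOn.const_mul _) ?_ ?_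
  · have := continuous_piFourier_of_isHolder hf hβ hsf
    exact Continuous.aestronglyMeasurable (by fun_prop)
  · refine (ae_restrict_iff' hset).2 (.of_forall fun ξ hξ => ?_)
    rw [Real.norm_of_nonneg (by positivity)]
    gcongr
    exact hξ.2

theorem setIntegral_shell_le (hf : IsHolder β A r f) (hβ : 0 < β)
    (hsf : ∀ y, 3 < ‖y‖ → f y = 0) (i : Fin d) (p : ℕ) {a : ℝ} (ha : 0 < a) :
    ∫ ξ in {ξ : Fin d → ℝ | a / 2 ≤ |ξ i| ∧ |ξ i| ≤ a}, max |ξ i| 1 ^ p *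
      ‖piFourier (fun y => (f y : ℂ)) ξ‖ ^ 2 ≤
        8 ^ d * 4 ^ (r + 1) * A ^ 2 * max a 1 ^ (max (p - 2 * (r + β)) 0) := by
  have hset : MeasurableSet {ξ : Fin d → ℝ | a / 2 ≤ |ξ i| ∧ |ξ i| ≤ a} :=
    measurableSet_band i _ _
  have hc := continuous_piFourier_of_isHolder hf hβ hsf
  have h4 : (1 : ℝ) ≤ 4 ^ (r + 1) := one_le_pow₀ (by norm_num)
  rcases le_or_gt a 1 with h1 | h1
  · obtain ⟨h2, h3⟩ := integrable_pow_mul_norm_sq_piFourier hf hβ hsf i (Nat.zero_le r)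
    simp only [mul_zero, pow_zero, one_mul] at h2 h3
    rw [max_eq_right h1, Real.one_rpow, mul_one]
    calc _ ≤ ∫ ξ in {ξ : Fin d → ℝ | a / 2 ≤ |ξ i| ∧ |ξ i| ≤ a},
          ‖piFourier (fun y => (f y : ℂ)) ξ‖ ^ 2 := by
          refine setIntegral_mono_on (integrableOn_max_pow_mul_norm_sq_piFourier hf hβ hsf i p _ _)
            h2.integrableOn hset fun ξ hξ => ?_
          rw [max_eq_right (hξ.2.trans h1), one_pow, one_mul]
      _ ≤ ∫ ξ, ‖piFourier (fun y => (f y : ℂ)) ξ‖ ^ 2 :=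
          setIntegral_le_integral h2 (.of_forall fun ξ => by positivity)
      _ ≤ 6 ^ d * A ^ 2 := h3
      _ ≤ 8 ^ d * 4 ^ (r + 1) * A ^ 2 := by
          have : (6 : ℝ) ^ d ≤ 8 ^ d := pow_le_pow_left₀ (by norm_num) (by norm_num) d
          have h5 : (8 : ℝ) ^ d ≤ 8 ^ d * 4 ^ (r + 1) := le_mul_of_one_le_right (by positivity) h4
          gcongr
          exact this.trans h5
  · have h2 := setIntegral_lowFreq_le hf hβ hsf i h1.le
    have hset2 : MeasurableSet {ξ : Fin d → ℝ | |ξ i| ≤ a} :=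
      (isClosed_le (by fun_prop) continuous_const).measurableSet
    have hint2 : IntegrableOn (fun ξ : Fin d → ℝ => |ξ i| ^ (2 * (r + 1)) *
        ‖piFourier (fun y => (f y : ℂ)) ξ‖ ^ 2) {ξ : Fin d → ℝ | |ξ i| ≤ a} := by
      refine ((integrableOn_max_pow_mul_norm_sq_piFourier hf hβ hsf i (2 * (r + 1)) a 0).mono_set
        fun ξ (hξ : |ξ i| ≤ a) => ⟨abs_nonneg _, hξ⟩).mono' ?_ ?_
      · exact Continuous.aestronglyMeasurable (by fun_prop)
      · refine .of_forall fun ξ => ?_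
        rw [Real.norm_of_nonneg (by positivity)]
        gcongr
        exact le_max_left _ _
    have ha2 : (0 : ℝ) < (a / 2) ^ (2 * (r + 1)) := by positivity
    have hA : 0 ≤ A := hf.nonneg
    rw [max_eq_left h1.le]
    calc _ ≤ ∫ ξ in {ξ : Fin d → ℝ | a / 2 ≤ |ξ i| ∧ |ξ i| ≤ a},
          a ^ p / (a / 2) ^ (2 * (r + 1)) * (|ξ i| ^ (2 * (r + 1)) *
            ‖piFourier (fun y => (f y : ℂ)) ξ‖ ^ 2) := by
          refine setIntegral_mono_on (integrableOn_max_pow_mul_norm_sq_piFourier hf hβ hsf i p _ _)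
            ((hint2.mono_set fun ξ hξ => hξ.2).const_mul _) hset fun ξ hξ => ?_
          rw [← mul_assoc]
          gcongr
          rw [div_mul_eq_mul_div, le_div_iff₀ ha2]
          have h5 : max |ξ i| 1 ≤ a := max_le hξ.2 h1.le
          gcongr
          exact hξ.1
      _ = a ^ p / (a / 2) ^ (2 * (r + 1)) * ∫ ξ in {ξ : Fin d → ℝ | a / 2 ≤ |ξ i| ∧ |ξ i| ≤ a},
          (|ξ i| ^ (2 * (r + 1)) * ‖piFourier (fun y => (f y : ℂ)) ξ‖ ^ 2) :=
          integral_const_mul _ _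
      _ ≤ a ^ p / (a / 2) ^ (2 * (r + 1)) * (8 ^ d * A ^ 2 * a ^ (2 - 2 * β)) := by
          gcongr
          refine le_trans (setIntegral_mono_set hint2 (.of_forall fun ξ => by positivity) ?_) h2
          exact Filter.Eventually.of_forall fun ξ hξ => hξ.2
      _ = 8 ^ d * 4 ^ (r + 1) * A ^ 2 * a ^ ((p : ℝ) - 2 * (r + β)) := by
          have e : a ^ ((p : ℝ) - 2 * (r + β)) = a ^ p / a ^ (2 * (r + 1)) * a ^ (2 - 2 * β) := by
            rw [← Real.rpow_natCast, ← Real.rpow_natCast, ← Real.rpow_sub ha, ← Real.rpow_add ha]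
            congr 1; push_cast; ring
          rw [e, div_pow, pow_mul 2 2]
          norm_num
          field_simp
      _ ≤ _ := by
          gcongr
          · exact h1.le
          · exact le_max_left _ _

theorem setIntegral_band_le (hf : IsHolder β A r f) (hβ : 0 < β)
    (hsf : ∀ y, 3 < ‖y‖ → f y = 0) (i : Fin d) (p S : ℕ) {a b : ℝ} (ha : 0 < a)
    (hab : a ≤ 2 ^ S * b) :
    ∫ ξ in {ξ : Fin d → ℝ | b ≤ |ξ i| ∧ |ξ i| ≤ a}, max |ξ i| 1 ^ p *
      ‖piFourier (fun y => (f y : ℂ)) ξ‖ ^ 2 ≤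
        (S + 1) * (8 ^ d * 4 ^ (r + 1) * A ^ 2 * max a 1 ^ (max (p - 2 * (r + β)) 0)) := by
  have hint := integrableOn_max_pow_mul_norm_sq_piFourier hf hβ hsf i p
  have hnn : ∀ (s : Set (Fin d → ℝ)), 0 ≤ᵐ[volume.restrict s] fun ξ : Fin d → ℝ =>
      max |ξ i| 1 ^ p * ‖piFourier (fun y => (f y : ℂ)) ξ‖ ^ 2 := fun s =>
    .of_forall fun ξ => by positivity
  induction S generalizing a with
  | zero =>
    simp only [Nat.cast_zero, one_mul, zero_add]
    refine le_trans (setIntegral_mono_set (hint _ _) (hnn _) (.of_forall fun ξ hξ => ⟨?_, hξ.2⟩))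
      (setIntegral_shell_le hf hβ hsf i p ha)
    refine le_trans ?_ hξ.1
    rw [pow_zero, one_mul] at hab
    linarith
  | succ S ih =>
    have h1 := ih (a := a / 2) (by positivity) (by rw [pow_succ] at hab; linarith)
    have h2 := setIntegral_shell_le hf hβ hsf i p ha
    have h3 : ∫ ξ in {ξ : Fin d → ℝ | b ≤ |ξ i| ∧ |ξ i| ≤ a}, max |ξ i| 1 ^ p *
        ‖piFourier (fun y => (f y : ℂ)) ξ‖ ^ 2 ≤
        (∫ ξ in {ξ : Fin d → ℝ | b ≤ |ξ i| ∧ |ξ i| ≤ a / 2}, max |ξ i| 1 ^ p *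
          ‖piFourier (fun y => (f y : ℂ)) ξ‖ ^ 2) +
        ∫ ξ in {ξ : Fin d → ℝ | a / 2 ≤ |ξ i| ∧ |ξ i| ≤ a}, max |ξ i| 1 ^ p *
          ‖piFourier (fun y => (f y : ℂ)) ξ‖ ^ 2 := by
      have h5 := integral_mono_measure (Measure.restrict_union_le
        {ξ : Fin d → ℝ | b ≤ |ξ i| ∧ |ξ i| ≤ a / 2} {ξ | a / 2 ≤ |ξ i| ∧ |ξ i| ≤ a})
        (f := fun ξ : Fin d → ℝ => max |ξ i| 1 ^ p * ‖piFourier (fun y => (f y : ℂ)) ξ‖ ^ 2)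
        (.of_forall fun ξ => by positivity)
        (Integrable.add_measure (hint _ _) (hint _ _))
      rw [integral_add_measure (hint _ _) (hint _ _)] at h5
      refine le_trans (setIntegral_mono_set ((hint _ _).union (hint _ _)) (hnn _)
        (.of_forall fun ξ hξ => ?_)) h5
      rcases le_total |ξ i| (a / 2) with h | h
      · exact Or.inl ⟨hξ.1, h⟩
      · exact Or.inr ⟨h, hξ.2⟩
    have hA : 0 ≤ A := hf.nonneg
    have h4 : max (a / 2) 1 ^ (max ((p : ℝ) - 2 * (r + β)) 0) ≤
        max a 1 ^ (max ((p : ℝ) - 2 * (r + β)) 0) := by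
      gcongr
      linarith
    have h6 : (S + 1) * (8 ^ d * 4 ^ (r + 1) * A ^ 2 *
        max (a / 2) 1 ^ (max ((p : ℝ) - 2 * (r + β)) 0)) ≤
        (S + 1) * (8 ^ d * 4 ^ (r + 1) * A ^ 2 * max a 1 ^ (max ((p : ℝ) - 2 * (r + β)) 0)) := by
      gcongr
    push_cast
    linarith

theorem setIntegral_low_le (hf : IsHolder β A r f) (hβ : 0 < β)
    (hsf : ∀ y, 3 < ‖y‖ → f y = 0) (i : Fin d) (k : ℕ) {F : ℝ} (hF : 1 ≤ F) (b : ℝ) :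
    ∫ ξ in {ξ : Fin d → ℝ | b ≤ |ξ i| ∧ |ξ i| ≤ F}, max |ξ i| 1 ^ (2 * k) *
      ‖piFourier (fun y => (f y : ℂ)) ξ‖ ^ 2 ≤
        2 * 8 ^ d * A ^ 2 * F ^ (max (2 * k - 2 * (r + β)) 0) := by
  have hset : MeasurableSet {ξ : Fin d → ℝ | b ≤ |ξ i| ∧ |ξ i| ≤ F} :=
    measurableSet_band i _ _
  have hc := continuous_piFourier_of_isHolder hf hβ hsf
  have hF0 : 0 < F := by linarith
  have hpw : 1 ≤ F ^ (max (2 * k - 2 * (r + β)) 0) := Real.one_le_rpow hF (le_max_right _ _)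
  have hint0 : ∀ j, IntegrableOn (fun ξ : Fin d → ℝ => |ξ i| ^ (2 * j) *
      ‖piFourier (fun y => (f y : ℂ)) ξ‖ ^ 2) {ξ : Fin d → ℝ | |ξ i| ≤ F} := fun j => by
    refine ((integrableOn_max_pow_mul_norm_sq_piFourier hf hβ hsf i (2 * j) F 0).mono_set
      fun ξ (hξ : |ξ i| ≤ F) => ⟨abs_nonneg _, hξ⟩).mono' ?_ ?_
    · exact Continuous.aestronglyMeasurable (by fun_prop)
    · refine .of_forall fun ξ => ?_
      rw [Real.norm_of_nonneg (by positivity)]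
      gcongr
      exact le_max_left _ _
  have h68 : (6 : ℝ) ^ d ≤ 8 ^ d := pow_le_pow_left₀ (by norm_num) (by norm_num) d
  have hlow : ∀ j ≤ r, ∫ ξ in {ξ : Fin d → ℝ | |ξ i| ≤ F}, |ξ i| ^ (2 * j) *
      ‖piFourier (fun y => (f y : ℂ)) ξ‖ ^ 2 ≤
        8 ^ d * A ^ 2 * F ^ (max (2 * k - 2 * (r + β)) 0) := by
    intro j hj
    obtain ⟨h1, h2⟩ := integrable_pow_mul_norm_sq_piFourier hf hβ hsf i hj
    calc _ ≤ ∫ ξ : Fin d → ℝ, |ξ i| ^ (2 * j) * ‖piFourier (fun y => (f y : ℂ)) ξ‖ ^ 2 :=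
          setIntegral_le_integral h1 (.of_forall fun ξ => by positivity)
      _ ≤ 8 ^ d * A ^ 2 := h2.trans (by gcongr)
      _ ≤ _ := le_mul_of_one_le_right (by positivity) hpw
  have hhigh : ∫ ξ in {ξ : Fin d → ℝ | |ξ i| ≤ F}, |ξ i| ^ (2 * k) *
      ‖piFourier (fun y => (f y : ℂ)) ξ‖ ^ 2 ≤
        8 ^ d * A ^ 2 * F ^ (max (2 * k - 2 * (r + β)) 0) := by
    rcases le_or_gt k r with hk | hk
    · exact hlow k hk
    · obtain ⟨j, rfl⟩ := Nat.exists_eq_add_of_le (Nat.succ_le_of_lt hk)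
      have h2 := setIntegral_lowFreq_le hf hβ hsf i hF
      have hset2 : MeasurableSet {ξ : Fin d → ℝ | |ξ i| ≤ F} :=
        (isClosed_le (by fun_prop) continuous_const).measurableSet
      calc _ ≤ ∫ ξ in {ξ : Fin d → ℝ | |ξ i| ≤ F}, F ^ (2 * j) * (|ξ i| ^ (2 * (r + 1)) *
            ‖piFourier (fun y => (f y : ℂ)) ξ‖ ^ 2) := by
            refine setIntegral_mono_on (hint0 _) ((hint0 _).const_mul _) hset2 fun ξ hξ => ?_
            have hξ' : |ξ i| ≤ F := hξ
            rw [← mul_assoc, Nat.succ_eq_add_one, mul_add 2 (r + 1), pow_add, mul_comm (|ξ i| ^ _)]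
            gcongr
        _ = F ^ (2 * j) * ∫ ξ in {ξ : Fin d → ℝ | |ξ i| ≤ F}, |ξ i| ^ (2 * (r + 1)) *
            ‖piFourier (fun y => (f y : ℂ)) ξ‖ ^ 2 := integral_const_mul _ _
        _ ≤ F ^ (2 * j) * (8 ^ d * A ^ 2 * F ^ (2 - 2 * β)) := by gcongr
        _ = 8 ^ d * A ^ 2 * F ^ (2 * ((r.succ + j : ℕ) : ℝ) - 2 * (r + β)) := by
            have : F ^ (2 * ((r.succ + j : ℕ) : ℝ) - 2 * (r + β)) =
                F ^ (2 * j) * F ^ (2 - 2 * β) := by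
              rw [← Real.rpow_natCast, ← Real.rpow_add hF0]
              congr 1; push_cast; ring
            rw [this]; ring
        _ ≤ _ := by
            gcongr
            exact le_max_left _ _
  calc ∫ ξ in {ξ : Fin d → ℝ | b ≤ |ξ i| ∧ |ξ i| ≤ F}, max |ξ i| 1 ^ (2 * k) *
        ‖piFourier (fun y => (f y : ℂ)) ξ‖ ^ 2
      ≤ ∫ ξ in {ξ : Fin d → ℝ | |ξ i| ≤ F}, max |ξ i| 1 ^ (2 * k) *
        ‖piFourier (fun y => (f y : ℂ)) ξ‖ ^ 2 := by
        refine setIntegral_mono_set ?_ (.of_forall fun ξ => by positivity)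
          (.of_forall fun ξ hξ => hξ.2)
        exact (integrableOn_max_pow_mul_norm_sq_piFourier hf hβ hsf i (2 * k) F 0).mono_set
          fun ξ (hξ : |ξ i| ≤ F) => ⟨abs_nonneg _, hξ⟩
    _ ≤ ∫ ξ in {ξ : Fin d → ℝ | |ξ i| ≤ F}, (|ξ i| ^ (2 * 0) *
          ‖piFourier (fun y => (f y : ℂ)) ξ‖ ^ 2 + |ξ i| ^ (2 * k) *
          ‖piFourier (fun y => (f y : ℂ)) ξ‖ ^ 2) := by
        refine setIntegral_mono ?_ ((hint0 0).add (hint0 k)) fun ξ => ?_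
        · exact (integrableOn_max_pow_mul_norm_sq_piFourier hf hβ hsf i (2 * k) F 0).mono_set
            fun ξ (hξ : |ξ i| ≤ F) => ⟨abs_nonneg _, hξ⟩
        · simp only
          rw [← add_mul]
          gcongr
          rcases max_cases |ξ i| 1 with ⟨h, _⟩ | ⟨h, _⟩ <;> rw [h]
          · simp
          · simp
    _ = (∫ ξ in {ξ : Fin d → ℝ | |ξ i| ≤ F}, |ξ i| ^ (2 * 0) *
          ‖piFourier (fun y => (f y : ℂ)) ξ‖ ^ 2) + ∫ ξ in {ξ : Fin d → ℝ | |ξ i| ≤ F},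
            |ξ i| ^ (2 * k) * ‖piFourier (fun y => (f y : ℂ)) ξ‖ ^ 2 :=
        integral_add (hint0 0) (hint0 k)
    _ ≤ _ := (add_le_add (hlow 0 (Nat.zero_le _)) hhigh).trans_eq (by ring)

end

namespace ConePartition

variable {n : ℕ} (κ : ConePartition n) {β A : ℝ} {r : ℕ} {f : (Fin (n + 1) → ℝ) → ℝ}

theorem integral_chart_energy {N : ℕ} (hN : 1 ≤ N) (i : Fin (n + 1)) {a b : ℝ} (hb : 0 < b)
    (hab : b ≤ a) (l : ℕ) (hfc : Continuous (piFourier fun y => (f y : ℂ))) :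
    ∫ v, κ.chart i v ^ 2 * ∫ t, (2 * Real.pi * t) ^ (2 * l) * (|t| ^ n * bandCutoff N a b t) ^ 2 *
      ‖piFourier (fun y => (f y : ℂ)) (t • i.insertNth 1 v)‖ ^ 2 =
    ∫ ξ, (κ.toFun i ξ * bandCutoff N a b (ξ i)) ^ 2 * (|ξ i| ^ n * (2 * Real.pi * ξ i) ^ (2 * l)) *
      ‖piFourier (fun y => (f y : ℂ)) ξ‖ ^ 2 := by
  have hK := (κ.contDiff_mul_bandCutoff hN i hb hab).continuous
  have hφ := (contDiff_bandCutoff N a b).continuous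
  set K : (Fin (n + 1) → ℝ) → ℝ := fun ξ => (κ.toFun i ξ * bandCutoff N a b (ξ i)) ^ 2 *
    (|ξ i| ^ n * (2 * Real.pi * ξ i) ^ (2 * l)) with hKdef
  set φ : ℝ → ℝ := fun t => bandCutoff N a b t ^ 2 * (|t| ^ n * (2 * Real.pi * t) ^ (2 * l))
    with hφdef
  have hKc : Continuous K := (hK.pow 2).mul (by fun_prop)
  have hKs : HasCompactSupport K := by
    refine (κ.hasCompactSupport_mul_bandCutoff N i hb hab).mono fun ξ hξ => ?_
    contrapose! hξ
    have : κ.toFun i ξ * bandCutoff N a b (ξ i) = 0 := Function.notMem_support.1 hξ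
    simp only [hKdef, this, Function.notMem_support]
    ring
  have hφc : Continuous φ := (hφ.pow 2).mul (by fun_prop)
  have hφs : HasCompactSupport φ := by
    refine (hasCompactSupport_bandCutoff N hb hab).mono fun t ht => ?_
    contrapose! ht
    have : bandCutoff N a b t = 0 := by simpa using ht
    simp [hφdef, this]
  have hχs : HasCompactSupport fun v => κ.chart i v ^ 2 := by
    refine (κ.hasCompactSupport_chart i).mono fun v hv => ?_
    contrapose! hv
    have : κ.chart i v = 0 := by simpa using hv
    simp [this]
  have hG : Continuous fun ξ => ((‖piFourier (fun y => (f y : ℂ)) ξ‖ ^ 2 : ℝ) : ℂ) := by fun_prop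
  have h := integral_cone i hKc hKs ((κ.contDiff_chart i).continuous.pow 2) hχs hφc hφs
    (fun v t ht => by
      simp only [hKdef, hφdef, Pi.pow_apply]
      rw [κ.toFun_smul_insertNth i v ht]
      simp only [Pi.smul_apply, Fin.insertNth_apply_same, smul_eq_mul, mul_one]
      ring) hG
  simp only [← Complex.ofReal_mul, integral_complex_ofReal, Complex.ofReal_inj] at h
  rw [h]
  congr 1; funext v; congr 2; funext t
  ring

theorem integral_chart_energy_le (hf : IsHolder β A r f) (hβ : 0 < β)
    (hsf : ∀ y, 3 < ‖y‖ → f y = 0) {N : ℕ} (hN : 1 ≤ N) (i : Fin (n + 1)) {a b : ℝ} (hb : 0 < b)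
    (hab : b ≤ a) {l m : ℕ} (hl : l ≤ m) :
    ∫ v, κ.chart i v ^ 2 * ∫ t, (2 * Real.pi * t) ^ (2 * l) * (|t| ^ n * bandCutoff N a b t) ^ 2 *
      ‖piFourier (fun y => (f y : ℂ)) (t • i.insertNth 1 v)‖ ^ 2 ≤
    4 ^ (N + 1) * (2 * Real.pi) ^ (2 * m) *
      ∫ ξ in {ξ : Fin (n + 1) → ℝ | b / (2 * N) ≤ |ξ i| ∧ |ξ i| ≤ a}, max |ξ i| 1 ^ (n + 2 * m) *
        ‖piFourier (fun y => (f y : ℂ)) ξ‖ ^ 2 := by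
  have hfc := continuous_piFourier_of_isHolder hf hβ hsf
  have hset : MeasurableSet {ξ : Fin (n + 1) → ℝ | b / (2 * N) ≤ |ξ i| ∧ |ξ i| ≤ a} :=
    measurableSet_band i _ _
  rw [κ.integral_chart_energy hN i hb hab l hfc, ← integral_const_mul,
    ← integral_indicator hset]
  refine integral_mono_of_nonneg (.of_forall fun ξ => ?_)
    ((integrable_indicator_iff hset).2
      ((integrableOn_max_pow_mul_norm_sq_piFourier hf hβ hsf i _ _ _).const_mul _))
    (.of_forall fun ξ => ?_)
  · have : 0 ≤ (2 * Real.pi * ξ i) ^ (2 * l) := by rw [pow_mul]; positivity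
    simp only [Pi.zero_apply]
    positivity
  · by_cases hξ : ξ ∈ {ξ : Fin (n + 1) → ℝ | b / (2 * N) ≤ |ξ i| ∧ |ξ i| ≤ a}
    · rw [Set.indicator_of_mem hξ]
      simp only
      rw [← mul_assoc (4 ^ (N + 1) * _)]
      refine mul_le_mul_of_nonneg_right ?_ (sq_nonneg _)
      have h1 : (κ.toFun i ξ * bandCutoff N a b (ξ i)) ^ 2 ≤ 4 ^ (N + 1) := by
        rw [← sq_abs, abs_mul, abs_of_nonneg (κ.nonneg i ξ), show (4 : ℝ) = 2 ^ 2 by norm_num,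
          ← pow_mul, mul_comm 2 (N + 1), pow_mul]
        refine pow_le_pow_left₀ (mul_nonneg (κ.nonneg i ξ) (abs_nonneg _)) ?_ 2
        calc _ ≤ 1 * |bandCutoff N a b (ξ i)| := by gcongr; exact κ.le_one i ξ
          _ ≤ _ := by rw [one_mul]; exact abs_bandCutoff_le N a b _
      have h2 : |ξ i| ^ n * (2 * Real.pi * ξ i) ^ (2 * l) ≤
          (2 * Real.pi) ^ (2 * m) * max |ξ i| 1 ^ (n + 2 * m) := by
        rw [pow_mul, ← sq_abs, ← pow_mul, abs_mul, abs_of_pos (by positivity : 0 < 2 * Real.pi),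
          mul_pow, pow_add]
        have hpi : (1 : ℝ) ≤ 2 * Real.pi := by linarith [Real.pi_gt_three]
        calc |ξ i| ^ n * ((2 * Real.pi) ^ (2 * l) * |ξ i| ^ (2 * l)) ≤
            max |ξ i| 1 ^ n * ((2 * Real.pi) ^ (2 * l) * max |ξ i| 1 ^ (2 * l)) := by
              gcongr <;> exact le_max_left _ _
          _ ≤ max |ξ i| 1 ^ n * ((2 * Real.pi) ^ (2 * m) * max |ξ i| 1 ^ (2 * m)) := by
              gcongr
              exact le_max_right _ _
          _ = _ := by ring
      have h0 : 0 ≤ |ξ i| ^ n * (2 * Real.pi * ξ i) ^ (2 * l) := by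
        have : 0 ≤ (2 * Real.pi * ξ i) ^ (2 * l) := by rw [pow_mul]; positivity
        positivity
      calc _ ≤ 4 ^ (N + 1) * ((2 * Real.pi) ^ (2 * m) * max |ξ i| 1 ^ (n + 2 * m)) :=
            mul_le_mul h1 h2 h0 (by positivity)
        _ = _ := by ring
    · rw [Set.indicator_of_notMem hξ]
      have h0 : bandCutoff N a b (ξ i) = 0 := by
        by_contra h
        refine hξ ⟨?_, ?_⟩
        · by_contra h'
          exact h (bandCutoff_eq_zero_of_le hN hb hab (not_le.1 h').le)
        · by_contra h'
          exact h (bandCutoff_eq_zero_of_ge N hb hab (not_le.1 h').le)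
      simp [h0]

end ConePartition

end ShellEnergy

section PieceNeurons

open MeasureTheory
open scoped ContDiff Matrix

theorem integral_abs_le_of_abs_le {g : ℝ → ℝ} {B R : ℝ} (hR : 0 ≤ R) (hB : ∀ t, |g t| ≤ B)
    (hg : ∀ t, R < |t| → g t = 0) : ∫ t, |g t| ≤ 2 * R * B := by
  have hB' : ∀ t, |g t| ≤ (Set.Icc (-R) R).indicator (fun _ => B) t := fun t => by
    by_cases ht : t ∈ Set.Icc (-R) R
    · rw [Set.indicator_of_mem ht]; exact hB t
    · rw [Set.indicator_of_notMem ht, hg t (not_le.1 fun h => ht (abs_le.1 h)), abs_zero]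
  refine (integral_mono_of_nonneg (.of_forall fun t => abs_nonneg _)
    ((integrable_indicator_iff measurableSet_Icc).2 (integrableOn_const (by simp)))
      (.of_forall hB')).trans_eq ?_
  rw [integral_indicator measurableSet_Icc, setIntegral_const, Measure.real, Real.volume_Icc,
    ENNReal.toReal_ofReal (by linarith), smul_eq_mul]
  ring

theorem integral_norm_le_of_abs_le {d : ℕ} {g : (Fin d → ℝ) → ℝ} {B : ℝ}
    (hB : ∀ y, |g y| ≤ B) (hg : ∀ y, 3 < ‖y‖ → g y = 0) : ∫ y, ‖g y‖ ≤ 6 ^ d * B := by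
  set ball := Metric.closedBall (0 : Fin d → ℝ) 3 with hball
  have hmeas : MeasurableSet ball := Metric.isClosed_closedBall.measurableSet
  have hfin : volume ball ≠ ⊤ := (isCompact_closedBall _ _).measure_ne_top
  have hvol : (volume ball).toReal = 6 ^ d := by
    rw [hball, Real.volume_pi_closedBall _ (by norm_num), Fintype.card_fin,
      ENNReal.toReal_ofReal (by positivity)]
    norm_num
  have hB' : ∀ y, ‖g y‖ ≤ ball.indicator (fun _ => B) y := fun y => by
    by_cases hy : y ∈ ball
    · rw [Set.indicator_of_mem hy]; exact hB y
    · rw [Set.indicator_of_notMem hy, hg y (by simpa [hball] using hy), norm_zero]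
  refine (integral_mono_of_nonneg (.of_forall fun y => norm_nonneg _)
    ((integrable_indicator_iff hmeas).2 (integrableOn_const hfin)) (.of_forall hB')).trans_eq ?_
  rw [integral_indicator hmeas, setIntegral_const, Measure.real, hvol, smul_eq_mul]

theorem abs_pow_mul_bandCutoff_le (n N : ℕ) {a b : ℝ} (hb : 0 < b) (hab : b ≤ a) (t : ℝ) :
    |(|t| ^ n * bandCutoff N a b t)| ≤ a ^ n * 2 ^ (N + 1) := by
  have ha : 0 < a := hb.trans_le hab
  rcases le_or_gt a |t| with h | h
  · rw [bandCutoff_eq_zero_of_ge N hb hab h, mul_zero, abs_zero]; positivity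
  · rw [abs_mul, abs_pow, abs_abs]
    gcongr
    exact abs_bandCutoff_le N a b t

theorem integral_abs_pow_mul_bandCutoff_le (n N : ℕ) {a b : ℝ} (hb : 0 < b) (hab : b ≤ a) :
    ∫ t, |(|t| ^ n * bandCutoff N a b t)| ≤ 2 ^ (N + 2) * a ^ (n + 1) := by
  refine (integral_abs_le_of_abs_le (hb.le.trans hab) (abs_pow_mul_bandCutoff_le n N hb hab)
    fun t ht => ?_).trans_eq (by ring)
  rw [bandCutoff_eq_zero_of_ge N hb hab ht.le, mul_zero]

theorem integral_abs_pow_mul_sq_bandCutoff_le (n N l : ℕ) {a b : ℝ} (hb : 0 < b) (hab : b ≤ a) :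
    ∫ t, |(2 * Real.pi * t) ^ (2 * l) * (|t| ^ n * bandCutoff N a b t) ^ 2| ≤
      2 * (2 * Real.pi) ^ (2 * l) * 4 ^ (N + 1) * a ^ (2 * n + 2 * l + 1) := by
  have ha : 0 < a := hb.trans_le hab
  refine (integral_abs_le_of_abs_le (B := (2 * Real.pi * a) ^ (2 * l) * (a ^ n * 2 ^ (N + 1)) ^ 2)
    ha.le (fun t => ?_) fun t ht => ?_).trans_eq ?_
  · rcases le_or_gt a |t| with h | h
    · rw [bandCutoff_eq_zero_of_ge N hb hab h, mul_zero, zero_pow two_ne_zero, mul_zero, abs_zero]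
      positivity
    · rw [abs_mul, abs_pow, abs_pow]
      gcongr
      · rw [abs_mul, abs_of_pos (by positivity : 0 < 2 * Real.pi)]
        gcongr
      · exact abs_pow_mul_bandCutoff_le n N hb hab t
  · rw [bandCutoff_eq_zero_of_ge N hb hab ht.le, mul_zero, zero_pow two_ne_zero, mul_zero]
  · have : (4 : ℝ) ^ (N + 1) = (2 ^ (N + 1)) ^ 2 := by
      rw [← pow_mul, mul_comm, pow_mul]; norm_num
    rw [this]
    ring

variable {n : ℕ}

/-- Discretization of one frequency band in one cone by ridge neurons. -/
theorem ConePartition.exists_neurons_bandIntegral (κ : ConePartition n) {m : ℕ} (hm : 2 ≤ m)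
    {q : ℕ} (hq : 2 ≤ q) {N : ℕ} {β A : ℝ} (r : ℕ)
    (i : Fin (n + 1)) :
    ∃ C : ℝ, 0 < C ∧ ∀ (f : (Fin (n + 1) → ℝ) → ℝ) (a b δ E ε : ℝ) (T M : ℕ),
      IsHolder β A (r + 1) f → (∀ y, 3 < ‖y‖ → f y = 0) → 0 < b → b ≤ a →
      0 < δ → δ ≤ 1 → 24 * a * δ ≤ 1 → 1 ≤ E → 1 ≤ T → 1 ≤ M →
      (∀ l ≤ m + 1, ∫ v, κ.chart i v ^ 2 * ∫ t, (2 * Real.pi * t) ^ (2 * l) *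
        (|t| ^ n * bandCutoff N a b t) ^ 2 *
        ‖piFourier (fun y => (f y : ℂ)) (t • i.insertNth 1 v)‖ ^ 2 ≤ E) →
      δ ^ q * (a + 1) ^ (2 * n + 2 * m + 3) ≤ ε → ε ≤ 1 →
      ∃ (ι : Type) (_ : Fintype ι) (c : ι → ℝ) (w : ι → Fin (n + 1) → ℝ) (b' : ι → ℝ),
        (Fintype.card ι : ℝ) ≤ C * ((1 / δ) ^ n * T) ∧ (∀ j l, |w j l| ≤ C) ∧
        (∀ j, |b' j| ≤ C) ∧ ∑ j, |c j| ≤ C * √E ∧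
        ∀ x ∈ Set.Icc (0 : Fin (n + 1) → ℝ) 1,
          |∑ j, c j * max (w j ⬝ᵥ x - b' j) 0 ^ m - (κ.bandIntegral N i a b f x).re| ≤
            C * (√E * (√(Real.log (M + 1)) * √(δ ^ n) / T ^ (m + 1) + 1 / M) + ε) ∧
          ∀ l, |∑ j, c j * (m * (w j l * max (w j ⬝ᵥ x - b' j) 0 ^ (m - 1))) -
            (κ.bandIntegral N i a b (partialD l f) x).re| ≤
            C * (√E * (√(Real.log (M + 1)) * √(δ ^ n) / T ^ m + 1 / M) + ε) := by
  have hn0 : (0 : ℝ) ≤ n := Nat.cast_nonneg n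
  obtain ⟨C₀, hC₀, H⟩ := exists_neurons_of_ridgeIntegral hm (κ.contDiff_chart i)
    (R := 2 * (n + 1)) (by linarith) (fun v j hj => κ.chart_eq_zero i v j hj) hq i
  set B : ℝ := 6 ^ (n + 1) * (|A| + 1) with hB
  have hB0 : 0 < B := by positivity
  set D : ℝ := 2 * (2 * Real.pi) ^ (2 * (m + 1)) * 4 ^ (N + 1) * B ^ 2 + 2 ^ (N + 2) * B + 1 with hD
  have hD1 : 1 ≤ D := by
    have : 0 ≤ 2 * (2 * Real.pi) ^ (2 * (m + 1)) * 4 ^ (N + 1) * B ^ 2 + 2 ^ (N + 2) * B := by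
      positivity
    linarith
  have hDa : 2 * (2 * Real.pi) ^ (2 * (m + 1)) * 4 ^ (N + 1) * B ^ 2 ≤ D := by
    have : 0 ≤ 2 ^ (N + 2) * B := by positivity
    linarith
  have hDb : 2 ^ (N + 2) * B ≤ D := by
    have : 0 ≤ 2 * (2 * Real.pi) ^ (2 * (m + 1)) * 4 ^ (N + 1) * B ^ 2 := by positivity
    linarith
  have hD0 : 0 < D := by linarith
  have hCD : C₀ ≤ C₀ * D := le_mul_of_one_le_right hC₀.le hD1
  have hpi : (1 : ℝ) ≤ 2 * Real.pi := by linarith [Real.pi_gt_three]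
  refine ⟨C₀ * D, by positivity, fun f a b δ E ε T M hf hsf hb hab hδ hδ1 haδ hE hT hM hen hal hε =>
    ?_⟩
  have ha : 0 < a := hb.trans_le hab
  have hfB : ∫ y, ‖f y‖ ≤ B := by
    refine (integral_norm_le_of_abs_le hf.abs_le hsf).trans ?_
    rw [hB]; gcongr; linarith [le_abs_self A]
  have hfB0 : 0 ≤ ∫ y, ‖f y‖ := integral_nonneg fun y => norm_nonneg _
  have hf'B : ∀ l, ∫ y, ‖partialD l f y‖ ≤ B := fun l => by
    refine (integral_norm_le_of_abs_le (hf.2.2 l).abs_le fun y hy => ?_).trans ?_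
    · exact iterate_partialD_eq_zero hsf l 1 hy
    · rw [hB]; gcongr; linarith [le_abs_self A]
  have hpow : ∀ k, k ≤ 2 * n + 2 * m + 3 → δ ^ q * a ^ k ≤ ε := fun k hk => by
    refine le_trans ?_ hal
    gcongr
    calc a ^ k ≤ (a + 1) ^ k := by gcongr; linarith
      _ ≤ _ := pow_le_pow_right₀ (by linarith) hk
  have hε0 : 0 ≤ ε := le_trans (by positivity) (hpow 0 (Nat.zero_le _))
  have hline : ∀ g : (Fin (n + 1) → ℝ) → ℝ, ∫ y, ‖g y‖ ≤ B →
      δ ^ q * ((∫ t, |(|t| ^ n * bandCutoff N a b t)|) * ∫ y, ‖g y‖) ≤ D * ε := fun g hg => by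
    have h1 := integral_abs_pow_mul_bandCutoff_le n N hb hab
    calc _ ≤ δ ^ q * ((2 ^ (N + 2) * a ^ (n + 1)) * B) := by gcongr
      _ = (2 ^ (N + 2) * B) * (δ ^ q * a ^ (n + 1)) := by ring
      _ ≤ D * ε := by
        gcongr
        exact hpow _ (by omega)
  have hDE : √(D * E) ≤ D * √E := by
    rw [Real.sqrt_mul hD0.le]
    gcongr
    rw [Real.sqrt_le_left hD0.le]
    nlinarith
  obtain ⟨ι, hι, c, w, b', h1, h2, h3, h4, h5⟩ := H (fun t => |t| ^ n * bandCutoff N a b t) f a δ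
    (D * E) (D * ε) T M (by
      have := (contDiff_bandCutoff N a b).continuous
      fun_prop)
    (fun t ht => by rw [bandCutoff_eq_zero_of_ge N hb hab ht.le, mul_zero]) hf.1 hsf hδ hδ1 haδ
    (by positivity) hT hM (fun l hl => (hen l hl).trans (le_mul_of_one_le_left (by linarith) hD1))
    (fun l hl => by
      have h1 := integral_abs_pow_mul_sq_bandCutoff_le n N l hb hab
      calc _ ≤ δ ^ q * ((2 * (2 * Real.pi) ^ (2 * l) * 4 ^ (N + 1) * a ^ (2 * n + 2 * l + 1)) *
            B ^ 2) := by gcongr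
        _ = (2 * (2 * Real.pi) ^ (2 * l) * 4 ^ (N + 1) * B ^ 2) *
            (δ ^ q * a ^ (2 * n + 2 * l + 1)) := by ring
        _ ≤ (2 * (2 * Real.pi) ^ (2 * (m + 1)) * 4 ^ (N + 1) * B ^ 2) * ε := by
            gcongr
            exact hpow _ (by omega)
        _ ≤ D * E := by
            gcongr
            exact hε.trans hE)
    (hline f hfB) (fun l => hline _ (hf'B l))
  have hfin : ∀ X : ℝ, 0 ≤ X → C₀ * (√(D * E) * X + D * ε) ≤ C₀ * D * (√E * X + ε) :=
    fun X hX => by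
      calc _ ≤ C₀ * (D * √E * X + D * ε) := by gcongr
        _ = _ := by ring
  refine ⟨ι, hι, c, w, b', h1.trans ?_, fun j l => (h2 j l).trans hCD, fun j => (h3 j).trans hCD,
    h4.trans ?_, fun x hx => ⟨(h5 x hx).1.trans (hfin _ ?_), fun l =>
      ((h5 x hx).2 l).trans (hfin _ ?_)⟩⟩
  · rw [mul_assoc C₀]
    gcongr
  · rw [mul_assoc]
    gcongr
  · positivity
  · positivity

end PieceNeurons

section BandNeurons

open MeasureTheory
open scoped ContDiff Matrix

/-- Approximation of a compactly supported Hölder function and its gradient by ridge neurons,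
assembled from finitely many frequency bands. -/
theorem ConePartition.exists_neurons_of_bands {n : ℕ} (κ : ConePartition n) {m : ℕ} (hm : 2 ≤ m)
    {qa : ℕ} (hqa : 2 ≤ qa) {β A : ℝ} (hβ : 0 < β) (r : ℕ) :
    ∃ C : ℝ, 0 < C ∧ ∀ (f : (Fin (n + 1) → ℝ) → ℝ) (F δ E : ℕ → ℝ) (ε : ℝ) (T : ℕ → ℕ) (M Q : ℕ),
      IsHolder β A (r + 1) f → (∀ y, 3 < ‖y‖ → f y = 0) → (∀ q, 0 < F q) → Antitone F →
      (∀ q < Q, 0 < δ q ∧ δ q ≤ 1 ∧ 24 * F q * δ q ≤ 1 ∧ 1 ≤ E q ∧ 1 ≤ T q) → 1 ≤ M →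
      (∀ q < Q, ∀ i, ∀ l ≤ m + 1, ∫ v, κ.chart i v ^ 2 * ∫ t, (2 * Real.pi * t) ^ (2 * l) *
        (|t| ^ n * bandCutoff (r + 2) (F q) (F (q + 1)) t) ^ 2 *
        ‖piFourier (fun y => (f y : ℂ)) (t • i.insertNth 1 v)‖ ^ 2 ≤ E q) →
      (∀ q < Q, δ q ^ qa * (F q + 1) ^ (2 * n + 2 * m + 3) ≤ ε) → ε ≤ 1 →
      ∃ (ι : Type) (_ : Fintype ι) (c : ι → ℝ) (w : ι → Fin (n + 1) → ℝ) (b : ι → ℝ),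
        (Fintype.card ι : ℝ) ≤ C * ∑ q ∈ Finset.range Q, (1 / δ q) ^ n * T q ∧
        (∀ j l, |w j l| ≤ C) ∧ (∀ j, |b j| ≤ C) ∧
        ∑ j, |c j| ≤ C * ∑ q ∈ Finset.range Q, √(E q) ∧
        ∀ x ∈ Set.Icc (0 : Fin (n + 1) → ℝ) 1,
          |∑ j, c j * max (w j ⬝ᵥ x - b j) 0 ^ m - f x| ≤
            C * (∑ q ∈ Finset.range Q, (√(E q) * (√(Real.log (M + 1)) * √(δ q ^ n) /
              T q ^ (m + 1) + 1 / M) + ε) + F 0 ^ (-(r + 1 + β)) + F Q ^ (n + 1)) ∧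
          ∀ l, |∑ j, c j * (m * (w j l * max (w j ⬝ᵥ x - b j) 0 ^ (m - 1))) - partialD l f x| ≤
            C * (∑ q ∈ Finset.range Q, (√(E q) * (√(Real.log (M + 1)) * √(δ q ^ n) /
              T q ^ m + 1 / M) + ε) + F 0 ^ (-(r + β)) + F Q ^ (n + 1)) := by
  have hr0 : (0 : ℝ) ≤ r := Nat.cast_nonneg r
  choose C₁ hC₁ H₁ using fun i => κ.exists_neurons_bandIntegral hm hqa (N := r + 2) (β := β)
    (A := A) r i
  obtain ⟨C₂, hC₂, H₂⟩ := κ.exists_cone_reproduction (N := r + 2) (by omega)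
    (γ := r + 1 + β) (by positivity)
  obtain ⟨C₃, hC₃, H₃⟩ := κ.exists_cone_reproduction (N := r + 2) (by omega)
    (γ := r + β) (by positivity)
  set B : ℝ := 6 ^ (n + 1) * (|A| + 1) with hB
  set A' : ℝ := 2 * ((n + 1 : ℕ) ^ (r + 1) * (|A| + 1)) with hA'
  have hA'0 : 0 < A' := by positivity
  have hB0 : 0 < B := by positivity
  set S : ℝ := ∑ i, C₁ i with hS
  have hS0 : 0 ≤ S := Finset.sum_nonneg fun i _ => (hC₁ i).le
  have hCS : ∀ i, C₁ i ≤ S := fun i =>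
    Finset.single_le_sum (f := C₁) (fun j _ => (hC₁ j).le) (Finset.mem_univ i)
  set C : ℝ := S + (C₂ + C₃) * (A' + B) with hC
  have hSC : S ≤ C := by rw [hC]; have : 0 ≤ (C₂ + C₃) * (A' + B) := by positivity
                         linarith
  have hA'le : ∀ k j : ℕ, k ≤ r + 1 → j ≤ 1 → ∀ Y : ℝ, 0 ≤ Y →
      2 ^ j * ((n + 1 : ℕ) ^ k * A * Y) ≤ A' * Y := fun k j hk hj Y hY => by
    have h8 : (1 : ℝ) ≤ (n + 1 : ℕ) := by exact_mod_cast Nat.succ_pos n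
    calc (2 : ℝ) ^ j * ((n + 1 : ℕ) ^ k * A * Y)
        ≤ 2 ^ j * ((n + 1 : ℕ) ^ k * (|A| + 1) * Y) := by
          gcongr; linarith [le_abs_self A]
      _ ≤ 2 ^ 1 * ((n + 1 : ℕ) ^ (r + 1) * (|A| + 1) * Y) := by
          gcongr
          exact one_le_two
      _ = A' * Y := by rw [hA']; ring
  refine ⟨C, by positivity, fun f F δ E ε T M Q hf hsf hF hFa hδ hM hen hal hε => ?_⟩
  choose ι hι c w b h1 h2 h3 h4 h5 using fun p : Fin (n + 1) × Fin Q =>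
    H₁ p.1 f (F p.2) (F (p.2 + 1)) (δ p.2) (E p.2) ε (T p.2) M hf hsf (hF _)
      (hFa (Nat.le_succ _)) (hδ _ p.2.2).1 (hδ _ p.2.2).2.1 (hδ _ p.2.2).2.2.1
      (hδ _ p.2.2).2.2.2.1 (hδ _ p.2.2).2.2.2.2 hM (hen _ p.2.2 p.1) (hal _ p.2.2) hε
  have hsum : ∀ X : ℕ → ℝ, ∑ p : Fin (n + 1) × Fin Q, C₁ p.1 * X p.2 =
      S * ∑ q ∈ Finset.range Q, X q := fun X => by
    rw [Fintype.sum_prod_type, hS, Finset.sum_mul]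
    exact Finset.sum_congr rfl fun i _ => by rw [Finset.mul_sum, Finset.sum_range]
  have hε0 : ∀ q < Q, 0 ≤ ε := fun q hq => le_trans (by
    have := (hδ q hq).1
    have := hF q
    positivity) (hal q hq)
  have hsumC : ∀ X : ℕ → ℝ, (∀ q < Q, 0 ≤ X q) →
      ∑ p : Fin (n + 1) × Fin Q, C₁ p.1 * X p.2 ≤ C * ∑ q ∈ Finset.range Q, X q := fun X hX => by
    rw [hsum]
    exact mul_le_mul_of_nonneg_right hSC
      (Finset.sum_nonneg fun q hq => hX q (Finset.mem_range.1 hq))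
  have hfin : ∀ (X : ℕ → ℝ) (g : (Fin (n + 1) → ℝ) → ℝ) (x : Fin (n + 1) → ℝ) (γ C₄ : ℝ)
      (Y : Fin (n + 1) × Fin Q → ℝ), 0 ≤ C₄ → C₄ ≤ C₂ + C₃ → (∀ q < Q, 0 ≤ X q) →
      (∀ p, |Y p - (κ.bandIntegral (r + 2) p.1 (F p.2) (F (p.2 + 1)) g x).re| ≤ C₁ p.1 * X p.2) →
      |g x - ∑ i, ∑ q ∈ Finset.range Q, (κ.bandIntegral (r + 2) i (F q) (F (q + 1)) g x).re| ≤
        C₄ * (A' * F 0 ^ (-γ) + F Q ^ (n + 1) * ∫ y, ‖g y‖) → ∫ y, ‖g y‖ ≤ B →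
      |∑ p, Y p - g x| ≤
        C * (∑ q ∈ Finset.range Q, X q + F 0 ^ (-γ) + F Q ^ (n + 1)) := by
    intro X g x γ C₄ Y hC₄ hC₄' hX hY hrep hg
    have e : ∑ i, ∑ q ∈ Finset.range Q, (κ.bandIntegral (r + 2) i (F q) (F (q + 1)) g x).re =
        ∑ p : Fin (n + 1) × Fin Q,
          (κ.bandIntegral (r + 2) p.1 (F p.2) (F (p.2 + 1)) g x).re := by
      rw [Fintype.sum_prod_type]
      simp only [Finset.sum_range]
    rw [e] at hrep
    have h6 : |∑ p, Y p - ∑ p : Fin (n + 1) × Fin Q,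
        (κ.bandIntegral (r + 2) p.1 (F p.2) (F (p.2 + 1)) g x).re| ≤
        S * ∑ q ∈ Finset.range Q, X q := by
      rw [← Finset.sum_sub_distrib, ← hsum]
      exact (Finset.abs_sum_le_sum_abs _ _).trans (Finset.sum_le_sum fun p _ => hY p)
    have hF0 : 0 < F 0 ^ (-γ) := Real.rpow_pos_of_pos (hF 0) _
    have hFQ : 0 < F Q ^ (n + 1) := pow_pos (hF Q) _
    have hXs : 0 ≤ ∑ q ∈ Finset.range Q, X q :=
      Finset.sum_nonneg fun q hq => hX q (Finset.mem_range.1 hq)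
    have h7 : C₄ * (A' * F 0 ^ (-γ) + F Q ^ (n + 1) * ∫ y, ‖g y‖) ≤
        (C₂ + C₃) * (A' + B) * (F 0 ^ (-γ) + F Q ^ (n + 1)) := by
      calc _ ≤ (C₂ + C₃) * (A' * F 0 ^ (-γ) + F Q ^ (n + 1) * B) := by gcongr
        _ ≤ (C₂ + C₃) * ((A' + B) * (F 0 ^ (-γ) + F Q ^ (n + 1))) := by
          refine mul_le_mul_of_nonneg_left ?_ (by positivity)
          have := mul_pos hA'0 hFQ
          have := mul_pos hB0 hF0
          rw [add_mul, mul_add, mul_add, mul_comm (F Q ^ (n + 1))]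
          linarith
        _ = _ := by rw [mul_assoc]
    rw [abs_sub_comm] at hrep
    calc _ ≤ S * ∑ q ∈ Finset.range Q, X q +
          (C₂ + C₃) * (A' + B) * (F 0 ^ (-γ) + F Q ^ (n + 1)) :=
          (abs_sub_le _ _ _).trans (add_le_add h6 (hrep.trans h7))
      _ ≤ S * (∑ q ∈ Finset.range Q, X q + F 0 ^ (-γ) + F Q ^ (n + 1)) +
          (C₂ + C₃) * (A' + B) * (∑ q ∈ Finset.range Q, X q + F 0 ^ (-γ) + F Q ^ (n + 1)) := by
          have h8 : 0 ≤ (C₂ + C₃) * (A' + B) := by positivity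
          exact add_le_add (mul_le_mul_of_nonneg_left (by linarith) hS0)
            (mul_le_mul_of_nonneg_left (by linarith) h8)
      _ = _ := by rw [hC]; ring
  have hX : ∀ (k q : ℕ), q < Q →
      0 ≤ √(E q) * (√(Real.log (M + 1)) * √(δ q ^ n) / T q ^ k + 1 / M) + ε := fun k q hq => by
    have := hε0 q hq
    positivity
  refine ⟨Σ p, ι p, inferInstance, fun j => c j.1 j.2, fun j => w j.1 j.2, fun j => b j.1 j.2, ?_,
    fun j l => (h2 _ _ _).trans ((hCS _).trans hSC), fun j => (h3 _ _).trans ((hCS _).trans hSC),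
    ?_, fun x hx => ⟨?_, fun l => ?_⟩⟩
  · rw [Fintype.card_sigma]
    push_cast
    refine (Finset.sum_le_sum fun p _ => h1 p).trans (hsumC (fun q => (1 / δ q) ^ n * T q) ?_)
    intro q hq
    have := (hδ q hq).1
    positivity
  · rw [Fintype.sum_sigma]
    exact (Finset.sum_le_sum fun p _ => h4 p).trans
      (hsumC (fun q => √(E q)) fun q _ => Real.sqrt_nonneg _)
  · rw [Fintype.sum_sigma]
    refine hfin _ f x _ C₂ _ hC₂.le (by linarith) (hX (m + 1)) (fun p => (h5 p x hx).1)
      (H₂ f A' F Q hf.1.continuous (hasCompactSupport_of_norm hsf) hA'0.le hF hFa ?_ x) ?_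
    · intro y x
      have := hf.abs_fwdDiff_iter_le' hβ y x 0
      rw [pow_zero, one_mul] at this
      have h9 := hA'le (r + 1) 0 le_rfl zero_le_one (‖y‖ ^ ((r : ℝ) + 1 + β)) (by positivity)
      push_cast at this h9
      linarith
    · refine (integral_norm_le_of_abs_le hf.abs_le hsf).trans ?_
      rw [hB]; gcongr; linarith [le_abs_self A]
  · rw [Fintype.sum_sigma]
    have hs' : ∀ y, 3 < ‖y‖ → partialD l f y = 0 := fun y hy =>
      iterate_partialD_eq_zero hsf l 1 hy
    refine hfin _ (partialD l f) x _ C₃ _ hC₃.le (by linarith) (hX m)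
      (fun p => (h5 p x hx).2 l)
      (H₃ (partialD l f) A' F Q ((hf.2.2 l).continuous hβ) (hasCompactSupport_of_norm hs') hA'0.le
        hF hFa ?_ x) ?_
    · intro y x
      have := (hf.2.2 l).abs_fwdDiff_iter_le' hβ y x 1
      have h9 := hA'le r 1 (Nat.le_succ r) le_rfl (‖y‖ ^ ((r : ℝ) + β)) (by positivity)
      linarith
    · refine (integral_norm_le_of_abs_le (hf.2.2 l).abs_le hs').trans ?_
      rw [hB]; gcongr; linarith [le_abs_self A]

end BandNeurons

section ShallowNetworks

open scoped Matrix

/-- Layer widths of a network with `k` neurons in one hidden layer. -/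
def shallowArch (d k : ℕ) : ℕ → ℕ
  | 0 => d
  | 1 => k
  | _ + 2 => 1

/-- A finite combination of ridge neurons is realised by a RePU network with one hidden layer. -/
theorem mem_NNfull_of_neurons {d m W L : ℕ} {S K B : ℝ} {ι : Type} [Fintype ι]
    (c : ι → ℝ) (w : ι → Fin d → ℝ) (b : ι → ℝ) (hB : 1 ≤ B)
    (hw : ∀ j l, |w j l| ≤ B) (hb : ∀ j, |b j| ≤ B) (hW : Fintype.card ι ≤ W) (hL : 1 ≤ L)
    (hS : (Fintype.card ι : ℝ) * (d + 1) ≤ S) (hK : m * (∑ j, |c j|) * ((d + 1) * B) ^ m ≤ K) :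
    (fun x => ∑ j, c j * max (w j ⬝ᵥ x - b j) 0 ^ m) ∈ NNfull m d W L S K := by
  set k := Fintype.card ι
  set e : ι ≃ Fin k := Fintype.equivFin ι
  refine ⟨1, shallowArch d k, rfl, le_rfl, hL, rfl, ?_, ?_,
    (fun | 0 => fun j => w (e.symm j) | 1 => fun _ j => c (e.symm j) | _ + 2 => 0),
    (fun | 0 => fun j => -b (e.symm j) | _ + 1 => 0), ?_, ?_⟩
  · intro ℓ h1 h2
    obtain rfl : ℓ = 1 := by omega
    exact hW
  · simpa [netSize, shallowArch] using hS
  · refine le_trans ?_ hK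
    have h1 : ∀ (A : Matrix (Fin 1) (Fin k) ℝ), matInfNorm A = ∑ j, |A 0 j| := fun A => by
      simp [matInfNorm]
    have h2 : matInfNorm (p := 1) (q := k) (fun _ j => c (e.symm j)) = ∑ j, |c j| := by
      exact (h1 _).trans (e.symm.sum_comp fun j => |c j|)
    have h3 : augInfNorm (p := k) (q := d) (fun j => w (e.symm j)) (fun j => -b (e.symm j)) ≤
        (d + 1) * B := by
      refine Real.iSup_le (fun i => ?_) (by positivity)
      calc _ ≤ ∑ _j : Fin d, B + B := by
            refine add_le_add (Finset.sum_le_sum fun l _ => hw _ l) ?_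
            rw [abs_neg]; exact hb _
        _ = _ := by simp; ring
    have h4 : (1 : ℝ) ≤ (d + 1) * B := by
      have : (0 : ℝ) ≤ d := Nat.cast_nonneg d
      nlinarith
    rw [kappa]
    simp only [Finset.prod_range_one, pow_one, Nat.sub_zero]
    refine mul_le_mul (le_of_eq ?_) (pow_le_pow_left₀ (by positivity) (max_le h3 h4) _)
      (by positivity) (by positivity)
    exact congrArg _ h2
  · intro x
    rw [netOut]
    refine Eq.symm ((Fintype.sum_unique (ι := Fin 1) _).trans ?_)
    exact e.symm.sum_comp fun j => c j * max (w j ⬝ᵥ x - b j) 0 ^ m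

/-- The derivative of a positive part power. -/
theorem hasDerivAt_max_zero_pow {m : ℕ} (hm : 2 ≤ m) (t : ℝ) :
    HasDerivAt (fun t : ℝ => max t 0 ^ m) (m * max t 0 ^ (m - 1)) t := by
  have hm1 : m - 1 ≠ 0 := by omega
  rcases lt_trichotomy t 0 with h | rfl | h
  · rw [max_eq_right h.le, zero_pow hm1, mul_zero]
    refine (hasDerivAt_const t (0 : ℝ)).congr_of_eventuallyEq ?_
    filter_upwards [gt_mem_nhds h] with s hs
    rw [max_eq_right hs.le, zero_pow (by omega)]
  · rw [max_self, zero_pow hm1, mul_zero, ← hasDerivWithinAt_univ, ← Set.Iic_union_Ici (a := 0)]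
    refine HasDerivWithinAt.union ?_ ?_
    · refine (hasDerivWithinAt_const 0 _ (0 : ℝ)).congr (fun s hs => ?_) ?_
      · rw [max_eq_right hs, zero_pow (by omega)]
      · rw [max_self, zero_pow (by omega)]
    · have := (hasDerivAt_pow m (0 : ℝ)).hasDerivWithinAt (s := Set.Ici 0)
      rw [zero_pow hm1, mul_zero] at this
      exact this.congr (fun s hs => by rw [max_eq_left hs]) (by rw [max_self])
  · rw [max_eq_left h.le]
    refine (hasDerivAt_pow m t).congr_of_eventuallyEq ?_
    filter_upwards [lt_mem_nhds h] with s hs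
    rw [max_eq_left hs.le]

/-- Partial derivatives of a combination of ridge neurons. -/
theorem fderiv_neurons {d m : ℕ} (hm : 2 ≤ m) {ι : Type} [Fintype ι]
    (c : ι → ℝ) (w : ι → Fin d → ℝ) (b : ι → ℝ) (x : Fin d → ℝ) (l : Fin d) :
    fderiv ℝ (fun x => ∑ j, c j * max (w j ⬝ᵥ x - b j) 0 ^ m) x (Pi.single l 1) =
      ∑ j, c j * (m * (w j l * max (w j ⬝ᵥ x - b j) 0 ^ (m - 1))) := by
  have h1 : ∀ j, HasFDerivAt (fun x => w j ⬝ᵥ x - b j)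
      (∑ i, w j i • (ContinuousLinearMap.proj i : (Fin d → ℝ) →L[ℝ] ℝ)) x := fun j => by
    refine HasFDerivAt.sub_const _ ?_
    exact HasFDerivAt.fun_sum fun i _ => (hasFDerivAt_apply i x).const_mul (w j i)
  have h2 := HasFDerivAt.fun_sum (u := Finset.univ) fun j _ =>
    ((hasDerivAt_max_zero_pow hm (w j ⬝ᵥ x - b j)).comp_hasFDerivAt x (h1 j)).const_mul (c j)
  rw [show (fun x => ∑ j, c j * max (w j ⬝ᵥ x - b j) 0 ^ m) = fun x => ∑ j, c j *
    ((fun t : ℝ => max t 0 ^ m) ∘ fun x => w j ⬝ᵥ x - b j) x from rfl, h2.fderiv]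
  simp [Pi.single_apply]
  refine Finset.sum_congr rfl fun j _ => by ring

end ShallowNetworks

section BandParameters

open MeasureTheory
open scoped ContDiff Matrix

theorem sq_add_one_le_four_mul_two_pow (k : ℕ) : (k + 1) ^ 2 ≤ 4 * 2 ^ k := by
  have : k ^ 2 + k + 2 ≤ 2 * 2 ^ k := by
    induction k with
    | zero => norm_num
    | succ k ih =>
      have : k ≤ k ^ 2 := Nat.le_self_pow two_ne_zero k
      rw [pow_succ 2 k]
      nlinarith
  nlinarith

/-- The oversampling exponent in the `q`-th band pays for a factor `4 ^ q`. -/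
theorem four_pow_le_mul_two_pow {q J A : ℕ} (h : 2 ^ q ≤ A * J) :
    4 ^ q ≤ 64 * (A + 1) ^ 2 * 2 ^ (min (2 ^ q - 1) J / 4) := by
  set x := min (2 ^ q - 1) J with hx
  have h1 : 2 ^ q ≤ (A + 1) * (x + 1) := by
    have : 1 ≤ 2 ^ q := Nat.one_le_two_pow
    rcases le_total (2 ^ q - 1) J with h2 | h2
    · rw [hx, min_eq_left h2, Nat.sub_add_cancel this]
      exact Nat.le_mul_of_pos_left _ (Nat.succ_pos A)
    · rw [hx, min_eq_right h2]
      nlinarith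
  have h2 : x + 1 ≤ 4 * (x / 4 + 1) := by omega
  calc 4 ^ q = (2 ^ q) ^ 2 := by rw [← pow_mul, mul_comm, pow_mul]; norm_num
    _ ≤ ((A + 1) * (4 * (x / 4 + 1))) ^ 2 :=
      Nat.pow_le_pow_left (h1.trans (Nat.mul_le_mul_left _ h2)) 2
    _ = 16 * (A + 1) ^ 2 * (x / 4 + 1) ^ 2 := by ring
    _ ≤ 16 * (A + 1) ^ 2 * (4 * 2 ^ (x / 4)) :=
      Nat.mul_le_mul_left _ (sq_add_one_le_four_mul_two_pow _)
    _ = _ := by ring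

theorem sum_sqrt_two_pow_le (Q : ℕ) : ∑ q ∈ Finset.range Q, √((2 : ℝ) ^ q) ≤ 3 * √(2 ^ Q) := by
  induction Q with
  | zero => simp
  | succ Q ih =>
    rw [Finset.sum_range_succ, pow_succ, Real.sqrt_mul (by positivity)]
    have : (4 : ℝ) / 3 ≤ √2 := Real.le_sqrt_of_sq_le (by norm_num)
    nlinarith [Real.sqrt_nonneg ((2 : ℝ) ^ Q)]

/-- The sum of the amplitudes of all bands. -/
theorem exists_sum_band_amplitude_le {σ : ℝ} (hσ : 0 ≤ σ) (A : ℕ) :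
    ∃ C : ℝ, 0 < C ∧ ∀ J Q : ℕ, 2 ^ Q ≤ 2 * (A * J + 1) →
      ∑ q ∈ Finset.range Q, √(2 ^ q) * max ((2 : ℝ) ^ J / 2 ^ (2 ^ q - 1)) 1 ^ σ ≤
        C * (2 ^ (σ * J) + √(J + 1)) := by
  set ρ : ℝ := 2 ^ (-σ) with hρ
  have hρ0 : 0 < ρ := by positivity
  obtain ⟨C, hC, H⟩ : ∃ C : ℝ, 0 ≤ C ∧ ∀ Q : ℕ, 0 < σ →
      ∑ q ∈ Finset.range Q, √((2 : ℝ) ^ q) * ρ ^ (2 ^ q - 1) ≤ C := by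
    refine ⟨∑' k : ℕ, ((k : ℝ) + 1) * ρ ^ k, tsum_nonneg fun k => by positivity,
      fun Q hσ => ?_⟩
    have hρ1 : ρ < 1 := Real.rpow_lt_one_of_one_lt_of_neg one_lt_two (by linarith)
    have hs : Summable fun k : ℕ => ((k : ℝ) + 1) * ρ ^ k := by
      simp only [add_mul, one_mul]
      refine Summable.add ?_ (summable_geometric_of_lt_one hρ0.le hρ1)
      simpa using summable_pow_mul_geometric_of_norm_lt_one 1
        (show ‖ρ‖ < 1 by rwa [Real.norm_of_nonneg hρ0.le])
    have hinj : Function.Injective fun q : ℕ => 2 ^ q - 1 := fun a b h => by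
      have h1 : 1 ≤ 2 ^ a := Nat.one_le_two_pow
      have h2 : 1 ≤ 2 ^ b := Nat.one_le_two_pow
      exact Nat.pow_right_injective le_rfl (by simp only at h ⊢; omega)
    calc _ ≤ ∑ q ∈ Finset.range Q, (((2 ^ q - 1 : ℕ) : ℝ) + 1) * ρ ^ (2 ^ q - 1) := by
          refine Finset.sum_le_sum fun q _ => ?_
          gcongr
          have h1 : 1 ≤ 2 ^ q := Nat.one_le_two_pow
          push_cast [h1]
          rw [sub_add_cancel]
          exact Real.sqrt_le_iff.2 ⟨by positivity, le_self_pow₀ (one_le_pow₀ one_le_two)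
              two_ne_zero⟩
      _ = ∑ k ∈ (Finset.range Q).image (fun q => 2 ^ q - 1), (((k : ℕ) : ℝ) + 1) * ρ ^ k :=
          (Finset.sum_image (f := fun k : ℕ => ((k : ℝ) + 1) * ρ ^ k) fun a _ b _ h => hinj h).symm
      _ ≤ _ := hs.sum_le_tsum _ fun k _ => by positivity
  set D : ℝ := 3 * √(2 * (A + 1)) with hD
  refine ⟨C + D, by positivity, fun J Q hQ => ?_⟩
  have hQ' : 3 * √((2 : ℝ) ^ Q) ≤ D * √(J + 1) := by
    rw [hD, mul_assoc, ← Real.sqrt_mul (by positivity)]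
    gcongr
    have : ((2 : ℝ) ^ Q) ≤ 2 * (A * J + 1) := by exact_mod_cast hQ
    have h1 : (0 : ℝ) ≤ A := Nat.cast_nonneg A
    have h2 : (0 : ℝ) ≤ J := Nat.cast_nonneg J
    nlinarith
  have hp : (0 : ℝ) < 2 ^ (σ * J) := by positivity
  have hsq : 0 ≤ √((J : ℝ) + 1) := Real.sqrt_nonneg _
  have hD0 : 0 ≤ D := by positivity
  rcases hσ.eq_or_lt with rfl | hσ
  · simp only [Real.rpow_zero, mul_one]
    refine (sum_sqrt_two_pow_le Q).trans (hQ'.trans ?_)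
    nlinarith [mul_nonneg hC hsq, mul_nonneg (add_nonneg hC hD0) hp.le]
  · calc _ ≤ ∑ q ∈ Finset.range Q, (2 ^ (σ * J) * (√(2 ^ q) * ρ ^ (2 ^ q - 1)) + √(2 ^ q)) := by
          refine Finset.sum_le_sum fun q _ => ?_
          have h1 : max ((2 : ℝ) ^ J / 2 ^ (2 ^ q - 1)) 1 ^ σ ≤
              ((2 : ℝ) ^ J / 2 ^ (2 ^ q - 1)) ^ σ + 1 := by
            rcases max_cases ((2 : ℝ) ^ J / 2 ^ (2 ^ q - 1)) 1 with h | h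
            · rw [h.1]; linarith
            · rw [h.1, Real.one_rpow]; linarith [show
                0 ≤ ((2 : ℝ) ^ J / 2 ^ (2 ^ q - 1)) ^ σ by positivity]
          have h2 : ((2 : ℝ) ^ J / 2 ^ (2 ^ q - 1)) ^ σ = 2 ^ (σ * J) * ρ ^ (2 ^ q - 1) := by
            rw [Real.div_rpow (by positivity) (by positivity), hρ, div_eq_mul_inv,
              ← Real.rpow_neg (by positivity), ← Real.rpow_natCast 2 J, ← Real.rpow_mul two_pos.le,
              mul_comm (J : ℝ), ← Real.rpow_natCast 2 (2 ^ q - 1), ← Real.rpow_mul two_pos.le,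
              ← Real.rpow_natCast _ (2 ^ q - 1), ← Real.rpow_mul two_pos.le, mul_comm (-σ)]
          rw [h2] at h1
          nlinarith [mul_le_mul_of_nonneg_left h1 (Real.sqrt_nonneg ((2 : ℝ) ^ q))]
      _ = 2 ^ (σ * J) * (∑ q ∈ Finset.range Q, √(2 ^ q) * ρ ^ (2 ^ q - 1)) +
          ∑ q ∈ Finset.range Q, √(2 ^ q) := by
          rw [Finset.sum_add_distrib, Finset.mul_sum]
      _ ≤ 2 ^ (σ * J) * C + D * √(J + 1) := by
          gcongr
          · exact H Q hσ
          · exact (sum_sqrt_two_pow_le Q).trans hQ'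
      _ ≤ _ := by nlinarith [mul_nonneg hC hsq, mul_nonneg hD0 hp.le]

end BandParameters

section BandExistence

open MeasureTheory
open scoped ContDiff Matrix

theorem sqrt_mul_mul_rpow_two {c x G σ : ℝ} (hc : 0 ≤ c) (hx : 0 ≤ x) (hG : 0 ≤ G) :
    √(c * x * G ^ (2 * σ)) = √c * (√x * G ^ σ) := by
  rw [Real.sqrt_mul (by positivity), Real.sqrt_mul hc, mul_comm 2 σ, Real.rpow_mul hG,
    Real.rpow_two, Real.sqrt_sq (by positivity), mul_assoc]

namespace ConePartition

variable {n : ℕ} (κ : ConePartition n)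

/-- Frequency bands for a compactly supported Hölder function: band edges `F`, energies `E` and
oversampling exponents `k`. -/
theorem exists_bands (m r : ℕ) {β A : ℝ} (hβ : 0 < β) {σ : ℝ}
    (hσ : σ = max (((n : ℝ) + 2 * m + 2) / 2 - (r + 1 + β)) 0) :
    ∃ C : ℝ, 0 < C ∧ ∀ (J : ℕ) (f : (Fin (n + 1) → ℝ) → ℝ), IsHolder β A (r + 1) f →
      (∀ y, 3 < ‖y‖ → f y = 0) → ∃ (F E : ℕ → ℝ) (k : ℕ → ℕ) (Q : ℕ),
        F 0 = 2 ^ J ∧ (∀ q, 0 < F q) ∧ Antitone F ∧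
        F Q ^ (n + 1) ≤ 2 ^ (-((r : ℝ) + 1 + β) * J) ∧
        ∑ q ∈ Finset.range Q, √(E q) ≤ C * (2 ^ (σ * J) + √(J + 1)) ∧
        ∀ q < Q, F q * 2 ^ (2 * k q) ≤ 2 ^ J ∧ 4 * k q ≤ J ∧ (4 : ℝ) ^ q ≤ C * 2 ^ k q ∧
          (n = 0 → k q = 0) ∧ 1 ≤ E q ∧ √(E q) ≤ C * 2 ^ q * 2 ^ (σ * J) ∧
          ∀ i, ∀ l ≤ m + 1, ∫ v, κ.chart i v ^ 2 * ∫ t, (2 * Real.pi * t) ^ (2 * l) *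
            (|t| ^ n * bandCutoff (r + 2) (F q) (F (q + 1)) t) ^ 2 *
            ‖piFourier (fun y => (f y : ℂ)) (t • i.insertNth 1 v)‖ ^ 2 ≤ E q := by
  have hσ0 : 0 ≤ σ := hσ ▸ le_max_right _ _
  by_cases hn : n = 0
  · set c : ℝ := 4 ^ (r + 2 + 1) * (2 * Real.pi) ^ (2 * (m + 1)) * (2 * 8 ^ (n + 1) * A ^ 2) + 1
      with hc
    have hc1 : 1 ≤ c := le_add_of_nonneg_left (by positivity)
    refine ⟨√c + 1, by positivity, fun J f hf hsf => ?_⟩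
    have hp : (0 : ℝ) < 2 ^ (σ * J) := by positivity
    have hJ1 : (1 : ℝ) ≤ 2 ^ J := one_le_pow₀ one_le_two
    have hpJ : ((2 : ℝ) ^ J) ^ σ = 2 ^ (σ * J) := by
      rw [mul_comm σ, Real.rpow_mul two_pos.le, Real.rpow_natCast]
    have ht : (2 : ℝ) ^ (-((r : ℝ) + 1 + β) * J) ≤ 1 := by
      refine Real.rpow_le_one_of_one_le_of_nonpos one_le_two ?_
      rw [neg_mul]
      exact neg_nonpos.2 (by positivity)
    have hE : √(c * 1 * ((2 : ℝ) ^ J) ^ (2 * σ)) = √c * 2 ^ (σ * J) := by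
      rw [sqrt_mul_mul_rpow_two (by linarith) zero_le_one (by positivity), hpJ, Real.sqrt_one,
        one_mul]
    refine ⟨fun q => if q = 0 then 2 ^ J else 2 ^ (-((r : ℝ) + 1 + β) * J),
      fun _ => c * 1 * ((2 : ℝ) ^ J) ^ (2 * σ), fun _ => 0, 1, if_pos rfl, fun q => ?_, ?_, ?_, ?_,
      fun q hq => ?_⟩
    · dsimp only; split_ifs <;> positivity
    · refine antitone_nat_of_succ_le fun q => ?_
      rw [if_neg q.succ_ne_zero]
      split_ifs
      · exact ht.trans hJ1
      · exact le_rfl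
    · simp [hn]
    · rw [Finset.sum_range_one, hE]
      nlinarith [mul_nonneg (Real.sqrt_nonneg c) (Real.sqrt_nonneg ((J : ℝ) + 1)),
        Real.sqrt_nonneg ((J : ℝ) + 1)]
    · obtain rfl : q = 0 := by omega
      refine ⟨by simp, by simp, by simp, fun _ => rfl, ?_, ?_, fun i l hl => ?_⟩
      · rw [mul_one]
        exact one_le_mul_of_one_le_of_one_le hc1 (Real.one_le_rpow hJ1 (by positivity))
      · rw [hE, pow_zero, mul_one]
        nlinarith
      · dsimp only
        rw [if_pos rfl, if_neg (by omega : ¬0 + 1 = 0)]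
        refine (κ.integral_chart_energy_le hf hβ hsf (N := r + 2) (by omega) i (by positivity)
          (ht.trans hJ1) hl).trans ?_
        have h3 := setIntegral_low_le hf hβ hsf i (m + 1) hJ1
          (2 ^ (-((r : ℝ) + 1 + β) * J) / (2 * ((r + 2 : ℕ) : ℝ)))
        have h4 : max (2 * ((m + 1 : ℕ) : ℝ) - 2 * (((r + 1 : ℕ) : ℝ) + β)) 0 = 2 * σ := by
          rw [hσ, mul_max_of_nonneg _ _ two_pos.le, hn]
          push_cast
          congr 1 <;> ring
        rw [h4] at h3
        have h5 : n + 2 * (m + 1) = 2 * (m + 1) := by omega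
        rw [h5]
        calc _ ≤ 4 ^ (r + 2 + 1) * (2 * Real.pi) ^ (2 * (m + 1)) *
              (2 * 8 ^ (n + 1) * A ^ 2 * ((2 : ℝ) ^ J) ^ (2 * σ)) :=
              mul_le_mul_of_nonneg_left h3 (by positivity)
          _ = (c - 1) * 1 * ((2 : ℝ) ^ J) ^ (2 * σ) := by rw [hc]; ring
          _ ≤ _ := by gcongr; linarith
  set A₀ : ℕ := ⌈(r : ℝ) + 1 + β⌉₊ + 1 with hA₀
  obtain ⟨C₁, hC₁, H₁⟩ := exists_sum_band_amplitude_le hσ0 A₀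
  set c : ℝ := 4 ^ (r + 2 + 1) * (2 * Real.pi) ^ (2 * (m + 1)) *
    ((r + 5) * (8 ^ (n + 1) * 4 ^ (r + 1 + 1) * A ^ 2)) + 1 with hc
  have hc1 : 1 ≤ c := le_add_of_nonneg_left (by positivity)
  have hc0 : 0 < c := by linarith
  set C : ℝ := √c * C₁ + √c + 64 * (A₀ + 1) ^ 2 with hC
  have hC1 : √c * C₁ ≤ C := by rw [hC]; linarith [Real.sqrt_nonneg c, sq_nonneg ((A₀ : ℝ) + 1)]
  have hC2 : √c ≤ C := by
    rw [hC]; linarith [sq_nonneg ((A₀ : ℝ) + 1), mul_nonneg (Real.sqrt_nonneg c) hC₁.le]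
  have hC3 : 64 * ((A₀ : ℝ) + 1) ^ 2 ≤ C := by
    rw [hC]; linarith [Real.sqrt_nonneg c, mul_nonneg (Real.sqrt_nonneg c) hC₁.le]
  refine ⟨C, by positivity, fun J f hf hsf => ?_⟩
  set F : ℕ → ℝ := fun q => 2 ^ J / 2 ^ (2 ^ q - 1) with hF
  set Q : ℕ := Nat.clog 2 (A₀ * J + 1) with hQ
  have hF0 : ∀ q, 0 < F q := fun q => by positivity
  have hFs : ∀ q, F (q + 1) * 2 ^ 2 ^ q = F q := fun q => by
    have h1 : 2 ^ (q + 1) - 1 = (2 ^ q - 1) + 2 ^ q := by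
      have : 1 ≤ 2 ^ q := Nat.one_le_two_pow
      rw [pow_succ]; omega
    simp only [hF]
    rw [h1, pow_add]
    field_simp
  have hFa : Antitone F := antitone_nat_of_succ_le fun q => by
    rw [← hFs q]
    exact le_mul_of_one_le_right (hF0 _).le (one_le_pow₀ one_le_two)
  have hFz : F 0 = 2 ^ J := by simp [hF]
  have hGJ : ∀ q, max (F q) 1 ≤ 2 ^ J := fun q =>
    max_le (hFz ▸ hFa (Nat.zero_le q)) (one_le_pow₀ one_le_two)
  have hQlt : ∀ q < Q, 2 ^ q ≤ A₀ * J := fun q hq =>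
    Nat.lt_succ_iff.1 ((Nat.lt_clog_iff_pow_lt one_lt_two).1 hq)
  refine ⟨F, fun q => c * 2 ^ q * max (F q) 1 ^ (2 * σ), fun q => min (2 ^ q - 1) J / 4, Q, hFz,
    hF0, hFa, ?_, ?_, fun q hq => ⟨?_, ?_, ?_, fun h => (hn h).elim, ?_, ?_, fun i l hl => ?_⟩⟩
  · have h1 : A₀ * J ≤ 2 ^ Q - 1 := by
      have : A₀ * J + 1 ≤ 2 ^ Q := Nat.le_pow_clog one_lt_two _
      omega
    have h2 : F Q ≤ 2 ^ (-((r : ℝ) + 1 + β) * J) := by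
      calc F Q ≤ 2 ^ J / 2 ^ (A₀ * J) := by
            simp only [hF]
            gcongr
            exact one_le_two
        _ = 2 ^ (-((⌈(r : ℝ) + 1 + β⌉₊ : ℝ)) * J) := by
            rw [← Real.rpow_natCast 2 J, ← Real.rpow_natCast 2 (A₀ * J),
              ← Real.rpow_sub two_pos, hA₀]
            congr 1
            push_cast
            ring
        _ ≤ _ := by
            refine Real.rpow_le_rpow_of_exponent_le one_le_two ?_
            exact mul_le_mul_of_nonneg_right (neg_le_neg (Nat.le_ceil _)) (Nat.cast_nonneg J)
    refine (pow_le_of_le_one (hF0 Q).le (h2.trans ?_) (Nat.succ_ne_zero n)).trans h2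
    refine Real.rpow_le_one_of_one_le_of_nonpos one_le_two ?_
    rw [neg_mul]
    exact neg_nonpos.2 (by positivity)
  · have h1 : 2 ^ Q ≤ 2 * (A₀ * J + 1) := by
      rcases Nat.eq_zero_or_pos Q with h | h
      · rw [h]; omega
      · have := hQlt (Q - 1) (by omega)
        rw [show Q = Q - 1 + 1 by omega, pow_succ]
        omega
    calc _ = √c * ∑ q ∈ Finset.range Q, √(2 ^ q) * max ((2 : ℝ) ^ J / 2 ^ (2 ^ q - 1)) 1 ^ σ := by
          rw [Finset.mul_sum]
          exact Finset.sum_congr rfl fun q _ =>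
            sqrt_mul_mul_rpow_two hc0.le (by positivity) (by positivity)
      _ ≤ √c * (C₁ * (2 ^ (σ * J) + √(J + 1))) := by
          gcongr
          exact H₁ J Q h1
      _ ≤ _ := by
          rw [← mul_assoc]
          gcongr
  · simp only [hF]
    rw [div_mul_eq_mul_div, div_le_iff₀ (by positivity)]
    gcongr
    · exact one_le_two
    · omega
  · dsimp only; omega
  · have := four_pow_le_mul_two_pow (hQlt q hq)
    calc (4 : ℝ) ^ q ≤ 64 * (A₀ + 1) ^ 2 * 2 ^ (min (2 ^ q - 1) J / 4) := by exact_mod_cast this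
      _ ≤ _ := by gcongr
  · have h1 : (1 : ℝ) ≤ 2 ^ q := one_le_pow₀ one_le_two
    have h2 : (1 : ℝ) ≤ max (F q) 1 ^ (2 * σ) := Real.one_le_rpow (le_max_right _ _) (by positivity)
    nlinarith [mul_le_mul hc1 h1 zero_le_one hc0.le, mul_nonneg hc0.le (zero_le_one.trans h1)]
  · rw [sqrt_mul_mul_rpow_two hc0.le (by positivity) (by positivity), mul_assoc]
    have h1 : (1 : ℝ) ≤ 2 ^ q := one_le_pow₀ one_le_two
    gcongr
    · exact Real.sqrt_le_iff.2 ⟨by positivity, le_self_pow₀ h1 two_ne_zero⟩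
    · rw [mul_comm σ, Real.rpow_mul two_pos.le, Real.rpow_natCast]
      exact Real.rpow_le_rpow (by positivity) (hGJ q) hσ0
  · refine (κ.integral_chart_energy_le hf hβ hsf (N := r + 2) (by omega) i (hF0 _)
      (hFa (Nat.le_succ q)) hl).trans ?_
    have hS : F q ≤ 2 ^ (2 ^ q + (r + 3)) * (F (q + 1) / (2 * ((r + 2 : ℕ) : ℝ))) := by
      have h1 : (2 : ℝ) * ((r + 2 : ℕ) : ℝ) ≤ 2 ^ (r + 3) := by
        have : 2 * (r + 2) ≤ 2 ^ (r + 3) := by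
          rw [pow_succ]
          have := (Nat.lt_two_pow_self (n := r + 2)).le
          omega
        exact_mod_cast this
      rw [mul_div_assoc', le_div_iff₀ (by positivity), pow_add, ← hFs q]
      have h2 : 0 ≤ F (q + 1) * 2 ^ 2 ^ q := by have := hF0 (q + 1); positivity
      nlinarith [mul_le_mul_of_nonneg_left h1 h2]
    have h3 := setIntegral_band_le hf hβ hsf i (n + 2 * (m + 1)) (2 ^ q + (r + 3)) (hF0 q) hS
    have h4 : max (((n + 2 * (m + 1) : ℕ) : ℝ) - 2 * (((r + 1 : ℕ) : ℝ) + β)) 0 = 2 * σ := by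
      rw [hσ, mul_max_of_nonneg _ _ two_pos.le]
      push_cast
      congr 1 <;> ring
    rw [h4] at h3
    have h5 : ((2 ^ q + (r + 3) : ℕ) : ℝ) + 1 ≤ (r + 5) * 2 ^ q := by
      have h1 : (1 : ℝ) ≤ 2 ^ q := one_le_pow₀ one_le_two
      have h2 : (0 : ℝ) ≤ r := Nat.cast_nonneg r
      push_cast
      nlinarith
    calc _ ≤ 4 ^ (r + 2 + 1) * (2 * Real.pi) ^ (2 * (m + 1)) * ((r + 5) * 2 ^ q *
          (8 ^ (n + 1) * 4 ^ (r + 1 + 1) * A ^ 2 * max (F q) 1 ^ (2 * σ))) := by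
          gcongr
          exact h3.trans (mul_le_mul_of_nonneg_right h5 (by positivity))
      _ = (c - 1) * 2 ^ q * max (F q) 1 ^ (2 * σ) := by rw [hc]; ring
      _ ≤ c * 2 ^ q * max (F q) 1 ^ (2 * σ) := by gcongr; linarith

end ConePartition

end BandExistence

section BandEstimates

open MeasureTheory
open scoped ContDiff Matrix

theorem sum_mul_half_pow_le {Q : ℕ} {X : ℕ → ℝ} {B : ℝ} (hB : 0 ≤ B)
    (h : ∀ q < Q, X q ≤ B * (1 / 2) ^ q) : ∑ q ∈ Finset.range Q, X q ≤ 2 * B := by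
  calc _ ≤ ∑ q ∈ Finset.range Q, B * (1 / 2) ^ q :=
        Finset.sum_le_sum fun q hq => h q (Finset.mem_range.1 hq)
    _ = B * ∑ q ∈ Finset.range Q, (1 / 2) ^ q := by rw [Finset.mul_sum]
    _ ≤ B * 2 := by
        gcongr
        exact sum_geometric_two_le Q
    _ = _ := mul_comm _ _

/-- The number of neurons of one band. -/
theorem band_card_le {n k J : ℕ} (hk : 4 * k ≤ J) (hn : n = 0 → k = 0) :
    (1 / (1 / (32 * (2 : ℝ) ^ (J - 2 * k)))) ^ n * ((2 ^ (J + (2 * n - 1) * k) : ℕ) : ℝ) ≤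
      32 ^ n * 2 ^ ((n + 1) * J) * (1 / 2 ^ k) := by
  rw [one_div_one_div, mul_pow, ← pow_mul, mul_one_div, le_div_iff₀ (by positivity)]
  push_cast
  rw [mul_assoc, mul_assoc, ← pow_add, ← pow_add]
  gcongr
  · exact one_le_two
  · rcases Nat.eq_zero_or_pos n with rfl | h
    · simp [hn rfl]
    · obtain ⟨a, rfl⟩ : ∃ a, J = 2 * k + a := ⟨J - 2 * k, by omega⟩
      obtain ⟨c, rfl⟩ : ∃ c, n = c + 1 := ⟨n - 1, by omega⟩
      rw [Nat.add_sub_cancel_left, show 2 * (c + 1) - 1 = 2 * c + 1 by omega]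
      nlinarith

/-- The discretisation error of one band, per unit of amplitude. -/
theorem band_error_le {n k J p : ℕ} (hk : 4 * k ≤ J) (hn : n = 0 → k = 0) (hp : 2 ≤ p) :
    √((1 / (32 * (2 : ℝ) ^ (J - 2 * k))) ^ n) / ((2 ^ (J + (2 * n - 1) * k) : ℕ) : ℝ) ^ p ≤
      2 ^ (-((n : ℝ) / 2 + p) * J) * (1 / 2 ^ k) := by
  have h1 : √((1 / (32 * (2 : ℝ) ^ (J - 2 * k))) ^ n) ≤ 2 ^ (-((n : ℝ) * (J - 2 * k) / 2)) := by
    rw [Real.sqrt_le_iff]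
    refine ⟨by positivity, ?_⟩
    rw [← Real.rpow_natCast (2 ^ _) 2, ← Real.rpow_mul two_pos.le, one_div, mul_inv, mul_pow]
    have h2 : (((2 : ℝ) ^ (J - 2 * k))⁻¹) ^ n = 2 ^ (-((n : ℝ) * (J - 2 * k) / 2) * (2 : ℕ)) := by
      rw [inv_pow, ← pow_mul, ← Real.rpow_natCast, ← Real.rpow_neg two_pos.le]
      congr 1
      push_cast [show 2 * k ≤ J by omega]
      ring
    rw [h2]
    refine mul_le_of_le_one_left (by positivity) (pow_le_one₀ (by norm_num) (by norm_num))
  rw [div_le_iff₀ (by positivity), mul_one_div, div_mul_eq_mul_div, le_div_iff₀ (by positivity)]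
  push_cast
  rw [← pow_mul]
  refine (mul_le_mul_of_nonneg_right h1 (by positivity)).trans ?_
  rw [← Real.rpow_natCast 2 k, ← Real.rpow_natCast 2 _, ← Real.rpow_add two_pos,
    ← Real.rpow_add two_pos]
  refine Real.rpow_le_rpow_of_exponent_le one_le_two ?_
  rcases Nat.eq_zero_or_pos n with rfl | h
  · simp [hn rfl]
    linarith
  · obtain ⟨c, rfl⟩ : ∃ c, n = c + 1 := ⟨n - 1, by omega⟩
    rw [show 2 * (c + 1) - 1 = 2 * c + 1 by omega]
    push_cast
    have h3 : (2 : ℝ) ≤ p := by exact_mod_cast hp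
    have h4 : (0 : ℝ) ≤ k := Nat.cast_nonneg k
    have h5 : (0 : ℝ) ≤ c := Nat.cast_nonneg c
    nlinarith [mul_nonneg h4 h5, mul_nonneg (mul_nonneg h4 h5) (sub_nonneg.2 h3),
      mul_nonneg h4 (sub_nonneg.2 h3)]

/-- The sampling width of a band is small enough for the aliasing error to be negligible. -/
theorem band_alias_le {G R k J : ℕ} {F : ℝ} (hk : 4 * k ≤ J) (hF0 : 0 ≤ F) (hF : F ≤ 2 ^ J) :
    (1 / (32 * (2 : ℝ) ^ (J - 2 * k))) ^ (2 * (G + R)) * (F + 1) ^ G ≤ 1 / 2 ^ (R * J) := by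
  have h1 : F + 1 ≤ 2 ^ (J + 1) := by
    have : (1 : ℝ) ≤ 2 ^ J := one_le_pow₀ one_le_two
    rw [pow_succ]
    linarith
  rw [one_div, inv_pow, inv_mul_eq_div, div_le_div_iff₀ (by positivity) (by positivity), one_mul]
  calc (F + 1) ^ G * 2 ^ (R * J) ≤ (2 ^ (J + 1)) ^ G * 2 ^ (R * J) := by gcongr
    _ = 2 ^ ((J + 1) * G + R * J) := by rw [← pow_mul, ← pow_add]
    _ ≤ 2 ^ ((5 + (J - 2 * k)) * (2 * (G + R))) := by
        refine pow_le_pow_right₀ one_le_two ?_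
        obtain ⟨a, rfl⟩ : ∃ a, J = 2 * k + a := ⟨J - 2 * k, by omega⟩
        rw [Nat.add_sub_cancel_left]
        have : 2 * k ≤ a := by omega
        nlinarith [Nat.mul_le_mul_right G this, Nat.mul_le_mul_right R this]
    _ = _ := by rw [pow_mul, pow_add]; norm_num

end BandEstimates

section Rates

open MeasureTheory
open scoped ContDiff Matrix

/-- The contribution of one band to the approximation error. -/
theorem band_term_le {n k J p q R : ℕ} {σ C E δ : ℝ} {T : ℕ} (hσ : 0 ≤ σ) (hC : 0 < C)
    (hp : (n : ℝ) / 2 + p + 1 ≤ R) (hk : 4 * k ≤ J) (hq : (4 : ℝ) ^ q ≤ C * 2 ^ k)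
    (hE : √E ≤ C * 2 ^ q * 2 ^ (σ * J))
    (hT : √(δ ^ n) / (T : ℝ) ^ p ≤ 2 ^ (-((n : ℝ) / 2 + p) * J) * (1 / 2 ^ k)) :
    √E * (√(Real.log ((2 ^ (R * J) : ℕ) + 1)) * √(δ ^ n) / (T : ℝ) ^ p +
        1 / (2 ^ (R * J) : ℕ)) + 1 / 2 ^ (R * J) ≤
      (C ^ 2 * √(R + 1) + C ^ 2 + C) * (√(J + 1) * 2 ^ (-((n : ℝ) / 2 + p - σ) * J)) *
        (1 / 2) ^ q := by
  set D : ℝ := 2 ^ (-((n : ℝ) / 2 + p - σ) * J) with hD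
  have hJ0 : (0 : ℝ) ≤ J := Nat.cast_nonneg J
  have hD0 : 0 < D := by positivity
  have hsq : 1 ≤ √((J : ℝ) + 1) := Real.one_le_sqrt.2 (by linarith)
  have hlog : √(Real.log ((2 ^ (R * J) : ℕ) + 1)) ≤ √(R + 1) * √(J + 1) := by
    rw [← Real.sqrt_mul (by positivity)]
    refine Real.sqrt_le_sqrt ?_
    calc Real.log ((2 ^ (R * J) : ℕ) + 1) ≤ Real.log (2 ^ (R * J + 1)) := by
          refine Real.log_le_log (by positivity) ?_
          have : (1 : ℝ) ≤ 2 ^ (R * J) := one_le_pow₀ one_le_two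
          push_cast
          rw [pow_succ]
          linarith
      _ = (R * J + 1) * Real.log 2 := by rw [Real.log_pow]; push_cast; ring
      _ ≤ (R * J + 1) * 1 := by
          gcongr
          exact Real.log_two_lt_d9.le.trans (by norm_num)
      _ ≤ _ := by nlinarith [(Nat.cast_nonneg R : (0 : ℝ) ≤ R)]
  have h2q : (2 : ℝ) ^ q * 2 ^ q = 4 ^ q := by rw [← mul_pow]; norm_num
  have hhalf : (1 / 2 : ℝ) ^ q * 2 ^ q = 1 := by rw [← mul_pow]; norm_num
  have h2k : (2 : ℝ) ^ k ≤ 2 ^ J := pow_le_pow_right₀ one_le_two (by omega)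
  have hqk : (2 : ℝ) ^ q * (1 / 2 ^ k) ≤ C * (1 / 2) ^ q := by
    rw [mul_one_div, div_le_iff₀ (by positivity)]
    calc (2 : ℝ) ^ q = 4 ^ q * (1 / 2) ^ q := by rw [← mul_pow]; norm_num
      _ ≤ C * 2 ^ k * (1 / 2) ^ q := by gcongr
      _ = _ := by ring
  have hqJ : (2 : ℝ) ^ q ≤ C * 2 ^ J * (1 / 2) ^ q := by
    calc (2 : ℝ) ^ q = 4 ^ q * (1 / 2) ^ q := by rw [← mul_pow]; norm_num
      _ ≤ C * 2 ^ k * (1 / 2) ^ q := by gcongr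
      _ ≤ _ := by gcongr
  have hY : (1 : ℝ) ≤ 2 ^ (σ * J) := Real.one_le_rpow one_le_two (by positivity)
  have hε : (2 : ℝ) ^ (σ * J) * 2 ^ J * (1 / 2 ^ (R * J)) ≤ D := by
    rw [← Real.rpow_natCast 2 J, ← Real.rpow_natCast 2 (R * J), one_div,
      ← Real.rpow_neg two_pos.le, ← Real.rpow_add two_pos, ← Real.rpow_add two_pos]
    refine Real.rpow_le_rpow_of_exponent_le one_le_two ?_
    push_cast
    nlinarith
  have hε' := hε.trans (le_mul_of_one_le_left hD0.le hsq)
  have h1 : √E * (√(Real.log ((2 ^ (R * J) : ℕ) + 1)) * √(δ ^ n) / (T : ℝ) ^ p) ≤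
      C ^ 2 * √(R + 1) * (√(J + 1) * D) * (1 / 2) ^ q := by
    calc _ ≤ C * 2 ^ q * 2 ^ (σ * J) * (√(R + 1) * √(J + 1) *
          (2 ^ (-((n : ℝ) / 2 + p) * J) * (1 / 2 ^ k))) := by
          rw [mul_div_assoc]
          gcongr
      _ = C * √(R + 1) * √(J + 1) * (2 ^ (σ * J) * 2 ^ (-((n : ℝ) / 2 + p) * J)) *
          (2 ^ q * (1 / 2 ^ k)) := by ring
      _ ≤ C * √(R + 1) * √(J + 1) * D * (C * (1 / 2) ^ q) := by
          have : (2 : ℝ) ^ (σ * J) * 2 ^ (-((n : ℝ) / 2 + p) * J) = D := by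
            rw [← Real.rpow_add two_pos, hD]; congr 1; ring
          rw [this]
          gcongr
      _ = _ := by ring
  have h2 : √E * (1 / (2 ^ (R * J) : ℕ)) ≤ C ^ 2 * (√(J + 1) * D) * (1 / 2) ^ q := by
    calc √E * (1 / (2 ^ (R * J) : ℕ)) ≤ C * (C * 2 ^ J * (1 / 2) ^ q) * 2 ^ (σ * J) *
          (1 / 2 ^ (R * J)) := by
          push_cast
          gcongr
          exact hE.trans (by gcongr)
      _ = C ^ 2 * (2 ^ (σ * J) * 2 ^ J * (1 / 2 ^ (R * J))) * (1 / 2) ^ q := by ring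
      _ ≤ C ^ 2 * (√(J + 1) * D) * (1 / 2) ^ q := 
          mul_le_mul_of_nonneg_right (mul_le_mul_of_nonneg_left hε' (by positivity))
            (by positivity)
  have h3 : 1 / (2 : ℝ) ^ (R * J) ≤ C * (√(J + 1) * D) * (1 / 2) ^ q := by
    calc 1 / (2 : ℝ) ^ (R * J) ≤ 2 ^ q * 2 ^ (σ * J) * (1 / 2 ^ (R * J)) := by
          refine le_mul_of_one_le_left (by positivity) ?_
          exact one_le_mul_of_one_le_of_one_le (one_le_pow₀ one_le_two) hY
      _ ≤ C * 2 ^ J * (1 / 2) ^ q * 2 ^ (σ * J) * (1 / 2 ^ (R * J)) := by gcongr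
      _ = C * (2 ^ (σ * J) * 2 ^ J * (1 / 2 ^ (R * J))) * (1 / 2) ^ q := by ring
      _ ≤ _ := mul_le_mul_of_nonneg_right (mul_le_mul_of_nonneg_left hε' hC.le)
          (by positivity)
  calc _ = √E * (√(Real.log ((2 ^ (R * J) : ℕ) + 1)) * √(δ ^ n) / (T : ℝ) ^ p) +
        √E * (1 / (2 ^ (R * J) : ℕ)) + 1 / 2 ^ (R * J) := by rw [mul_add]
    _ ≤ C ^ 2 * √(R + 1) * (√(J + 1) * D) * (1 / 2) ^ q +
        C ^ 2 * (√(J + 1) * D) * (1 / 2) ^ q + C * (√(J + 1) * D) * (1 / 2) ^ q := by gcongr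
    _ = _ := by ring

/-- Rate of simultaneous approximation of a compactly supported Hölder function and of its gradient
by about `2 ^ ((n + 1) * J)` ridge neurons. -/
theorem ConePartition.exists_neurons_rate {n : ℕ} (κ : ConePartition n) {m : ℕ} (hm : 2 ≤ m)
    {β A : ℝ} (hβ : 0 < β) (r : ℕ) {σ : ℝ}
    (hσ : σ = max (((n : ℝ) + 2 * m + 2) / 2 - (r + 1 + β)) 0) :
    ∃ C : ℝ, 0 < C ∧ ∀ (J : ℕ) (f : (Fin (n + 1) → ℝ) → ℝ), IsHolder β A (r + 1) f →
      (∀ y, 3 < ‖y‖ → f y = 0) →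
      ∃ (ι : Type) (_ : Fintype ι) (c : ι → ℝ) (w : ι → Fin (n + 1) → ℝ) (b : ι → ℝ),
        (Fintype.card ι : ℝ) ≤ C * 2 ^ ((n + 1) * J) ∧
        (∀ j l, |w j l| ≤ C) ∧ (∀ j, |b j| ≤ C) ∧
        ∑ j, |c j| ≤ C * (2 ^ (σ * J) + √(J + 1)) ∧
        ∀ x ∈ Set.Icc (0 : Fin (n + 1) → ℝ) 1,
          |∑ j, c j * max (w j ⬝ᵥ x - b j) 0 ^ m - f x| ≤
            C * (√(J + 1) * 2 ^ (-(((n : ℝ) + 2 * m + 2) / 2 - σ) * J)) ∧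
          ∀ l, |∑ j, c j * (m * (w j l * max (w j ⬝ᵥ x - b j) 0 ^ (m - 1))) - partialD l f x| ≤
            C * (√(J + 1) * 2 ^ (-(((n : ℝ) + 2 * m) / 2 - σ) * J)) := by
  have hσ0 : 0 ≤ σ := hσ ▸ le_max_right _ _
  have hσ1 : ((n : ℝ) + 2 * m + 2) / 2 - (r + 1 + β) ≤ σ := hσ ▸ le_max_left _ _
  set G : ℕ := 2 * n + 2 * m + 3 with hG
  set R : ℕ := n + m + 2 with hR
  obtain ⟨C₁, hC₁, H₁⟩ := κ.exists_neurons_of_bands hm (qa := 2 * (G + R)) (by omega) (A := A) hβ r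
  obtain ⟨C₂, hC₂, H₂⟩ := κ.exists_bands m r (A := A) hβ hσ
  set D : ℝ := C₂ ^ 2 * √(R + 1) + C₂ ^ 2 + C₂ with hD
  have hD0 : 0 < D := by positivity
  set C : ℝ := C₁ + C₁ * (2 * (32 ^ n * C₂)) + C₁ * C₂ + C₁ * (2 * D + 2) with hC
  have hCa : C₁ ≤ C := by
    rw [hC]
    have : 0 ≤ C₁ * (2 * (32 ^ n * C₂)) + C₁ * C₂ + C₁ * (2 * D + 2) := by positivity
    linarith
  have hCb : C₁ * (2 * (32 ^ n * C₂)) ≤ C := by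
    rw [hC]
    have : 0 ≤ C₁ + C₁ * C₂ + C₁ * (2 * D + 2) := by positivity
    linarith
  have hCc : C₁ * C₂ ≤ C := by
    rw [hC]
    have : 0 ≤ C₁ + C₁ * (2 * (32 ^ n * C₂)) + C₁ * (2 * D + 2) := by positivity
    linarith
  have hCd : C₁ * (2 * D + 2) ≤ C := by
    rw [hC]
    have : 0 ≤ C₁ + C₁ * (2 * (32 ^ n * C₂)) + C₁ * C₂ := by positivity
    linarith
  refine ⟨C, by positivity, fun J f hf hsf => ?_⟩
  obtain ⟨F, E, k, Q, hFz, hF0, hFa, hFQ, hsE, hq⟩ := H₂ J f hf hsf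
  have hFk : ∀ q < Q, F q ≤ 2 ^ (J - 2 * k q) := fun q hqQ => by
    have h1 := (hq q hqQ).1
    have h2 := (hq q hqQ).2.1
    rw [← le_div_iff₀ (by positivity)] at h1
    refine h1.trans (le_of_eq ?_)
    rw [pow_sub₀ _ two_ne_zero (by omega), div_eq_mul_inv]
  have hδ1 : ∀ q, 1 / (32 * (2 : ℝ) ^ (J - 2 * k q)) ≤ 1 := fun q => by
    rw [div_le_one (by positivity)]
    have : (1 : ℝ) ≤ 2 ^ (J - 2 * k q) := one_le_pow₀ one_le_two
    linarith
  have hδF : ∀ q < Q, 24 * F q * (1 / (32 * (2 : ℝ) ^ (J - 2 * k q))) ≤ 1 := fun q hqQ => by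
    rw [mul_one_div, div_le_one (by positivity)]
    linarith [hFk q hqQ, hF0 q]
  have hε1 : 1 / (2 : ℝ) ^ (R * J) ≤ 1 := by
    rw [div_le_one (by positivity)]
    exact one_le_pow₀ one_le_two
  obtain ⟨ι, hι, c, w, b, g1, g2, g3, g4, g5⟩ := H₁ f F (fun q => 1 / (32 * 2 ^ (J - 2 * k q))) E
    (1 / 2 ^ (R * J)) (fun q => 2 ^ (J + (2 * n - 1) * k q)) (2 ^ (R * J)) Q hf hsf hF0 hFa
    (fun q hqQ => ⟨by positivity, hδ1 q, hδF q hqQ, (hq q hqQ).2.2.2.2.1, Nat.one_le_two_pow⟩)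
    Nat.one_le_two_pow (fun q hqQ => (hq q hqQ).2.2.2.2.2.2)
    (fun q hqQ => band_alias_le (hq q hqQ).2.1 (hF0 q).le (hFz ▸ hFa (Nat.zero_le q)))
    hε1
  have hJ0 : (0 : ℝ) ≤ J := Nat.cast_nonneg J
  have hsq : 1 ≤ √((J : ℝ) + 1) := Real.one_le_sqrt.2 (by linarith)
  have herr : ∀ (p : ℕ) (γ e : ℝ), 2 ≤ p → (n : ℝ) / 2 + p + 1 ≤ R →
      e = (n : ℝ) / 2 + p - σ → e ≤ γ → e ≤ r + 1 + β →
      C₁ * (∑ q ∈ Finset.range Q, (√(E q) * (√(Real.log ((2 ^ (R * J) : ℕ) + 1)) *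
        √((1 / (32 * 2 ^ (J - 2 * k q))) ^ n) /
        ((2 ^ (J + (2 * n - 1) * k q) : ℕ) : ℝ) ^ p + 1 / (2 ^ (R * J) : ℕ)) +
        1 / 2 ^ (R * J)) + F 0 ^ (-γ) + F Q ^ (n + 1)) ≤
      C * (√(J + 1) * 2 ^ (-e * J)) := by
    intro p γ e hp hpR he heγ heα
    have h1 := sum_mul_half_pow_le (Q := Q) (B := D * (√(J + 1) * 2 ^ (-e * J)))
      (X := fun q => √(E q) * (√(Real.log ((2 ^ (R * J) : ℕ) + 1)) *
        √((1 / (32 * 2 ^ (J - 2 * k q))) ^ n) /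
        ((2 ^ (J + (2 * n - 1) * k q) : ℕ) : ℝ) ^ p + 1 / (2 ^ (R * J) : ℕ)) +
        1 / 2 ^ (R * J)) (by positivity)
      fun q hqQ => by
        rw [he]
        exact band_term_le hσ0 hC₂ hpR (hq q hqQ).2.1 (hq q hqQ).2.2.1 (hq q hqQ).2.2.2.2.2.1
          (band_error_le (hq q hqQ).2.1 (hq q hqQ).2.2.2.1 hp)
    have hs : (2 : ℝ) ^ (-e * J) ≤ √(J + 1) * 2 ^ (-e * J) :=
      le_mul_of_one_le_left (by positivity) hsq
    have h2 : F 0 ^ (-γ) ≤ √(J + 1) * 2 ^ (-e * J) := by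
      refine le_trans ?_ hs
      rw [hFz, ← Real.rpow_natCast, ← Real.rpow_mul two_pos.le]
      refine Real.rpow_le_rpow_of_exponent_le one_le_two ?_
      nlinarith
    have h3 : F Q ^ (n + 1) ≤ √(J + 1) * 2 ^ (-e * J) := by
      refine hFQ.trans (le_trans ?_ hs)
      refine Real.rpow_le_rpow_of_exponent_le one_le_two ?_
      nlinarith
    calc _ ≤ C₁ * (2 * (D * (√(J + 1) * 2 ^ (-e * J))) + √(J + 1) * 2 ^ (-e * J) +
          √(J + 1) * 2 ^ (-e * J)) := by gcongr
      _ = C₁ * (2 * D + 2) * (√(J + 1) * 2 ^ (-e * J)) := by ring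
      _ ≤ _ := by gcongr
  refine ⟨ι, hι, c, w, b, ?_, fun j l => (g2 j l).trans hCa, fun j => (g3 j).trans hCa, ?_,
    fun x hx => ⟨((g5 x hx).1).trans ?_, fun l => ((g5 x hx).2 l).trans ?_⟩⟩
  · refine g1.trans ?_
    have h1 := sum_mul_half_pow_le (Q := Q) (B := 32 ^ n * 2 ^ ((n + 1) * J) * C₂) (by positivity)
      (X := fun q => (1 / (1 / (32 * (2 : ℝ) ^ (J - 2 * k q)))) ^ n *
        ((2 ^ (J + (2 * n - 1) * k q) : ℕ) : ℝ))
      fun q hqQ => by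
        refine (band_card_le (hq q hqQ).2.1 (hq q hqQ).2.2.2.1).trans ?_
        rw [mul_assoc _ C₂]
        refine mul_le_mul_of_nonneg_left ?_ (by positivity)
        rw [one_div_pow, mul_one_div, div_le_div_iff₀ (by positivity) (by positivity), one_mul]
        refine le_trans ?_ (hq q hqQ).2.2.1
        exact pow_le_pow_left₀ two_pos.le (by norm_num) q
    calc _ ≤ C₁ * (2 * (32 ^ n * 2 ^ ((n + 1) * J) * C₂)) := by gcongr
      _ = C₁ * (2 * (32 ^ n * C₂)) * 2 ^ ((n + 1) * J) := by ring
      _ ≤ _ := by gcongr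
  · refine g4.trans ((mul_le_mul_of_nonneg_left hsE hC₁.le).trans ?_)
    rw [← mul_assoc]
    gcongr
  · refine herr (m + 1) (r + 1 + β) _ (by omega) ?_ ?_ ?_ ?_
    · rw [hR]; push_cast; linarith [(Nat.cast_nonneg n : (0 : ℝ) ≤ n)]
    · push_cast; ring
    · linarith
    · linarith
  · refine herr m (r + β) _ hm ?_ ?_ ?_ ?_
    · rw [hR]; push_cast; linarith [(Nat.cast_nonneg n : (0 : ℝ) ≤ n)]
    · ring
    · linarith
    · linarith

end Rates

section Levels

open scoped Matrix

/-- A dyadic resolution whose number of cells is comparable to `N / B`. -/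
theorem exists_dyadic_level {d N : ℕ} (hd : 0 < d) {B : ℝ} (hB : 0 < B) (h : B ≤ N) :
    ∃ J : ℕ, B * 2 ^ (d * J) ≤ N ∧ (N : ℝ) ≤ B * 2 ^ (d * (J + 1)) := by
  obtain ⟨J, h1, h2⟩ := exists_nat_pow_near (x := (N : ℝ) / B) (y := 2 ^ d)
    ((one_le_div hB).2 h) (one_lt_pow₀ one_lt_two hd.ne')
  refine ⟨J, ?_, ?_⟩
  · rw [pow_mul, mul_comm]; exact (le_div_iff₀ hB).1 h1
  · rw [pow_mul, mul_comm]; exact (div_le_iff₀ hB).1 h2.le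

theorem half_le_sqrt_log {N : ℕ} (hN : 2 ≤ N) : 1 / 2 ≤ √(Real.log N) := by
  refine Real.le_sqrt_of_sq_le ?_
  have := Real.log_le_log two_pos (show (2 : ℝ) ≤ N by exact_mod_cast hN)
  linarith [Real.log_two_gt_d9]

theorem sqrt_level_le {J N : ℕ} (hN : 2 ≤ N) (h : (2 : ℝ) ^ J ≤ N) :
    √(J + 1) ≤ 2 * √(Real.log N) := by
  have h1 := Real.log_le_log two_pos (show (2 : ℝ) ≤ N by exact_mod_cast hN)
  have h2 := Real.log_le_log (by positivity) h
  rw [Real.log_pow] at h2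
  have h3 := Real.log_two_gt_d9
  have hJ : (0 : ℝ) ≤ J := J.cast_nonneg
  rw [show (2 : ℝ) = √4 by rw [show (4 : ℝ) = 2 ^ 2 by norm_num, Real.sqrt_sq two_pos.le],
    ← Real.sqrt_mul (by norm_num)]
  refine Real.sqrt_le_sqrt ?_
  nlinarith

theorem two_rpow_level_le {d J N : ℕ} (hd : 0 < d) (hN : 2 ≤ N) {B e : ℝ} (hB : 1 ≤ B)
    (he : 0 ≤ e) (h : (N : ℝ) ≤ B * 2 ^ (d * (J + 1))) :
    (2 : ℝ) ^ (-e * J) ≤ 2 ^ e * B ^ (e / d) * (N : ℝ) ^ (-e / d) := by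
  have hN0 : (0 : ℝ) < N := by positivity
  have hd0 : (0 : ℝ) < d := by positivity
  have h1 : (N : ℝ) ^ (e / d) ≤ B ^ (e / d) * (2 ^ e * 2 ^ (e * J)) := by
    refine (Real.rpow_le_rpow hN0.le h (by positivity)).trans (le_of_eq ?_)
    rw [Real.mul_rpow (by positivity) (by positivity), ← Real.rpow_natCast, ← Real.rpow_mul
        two_pos.le,
      ← Real.rpow_add two_pos]
    congr 2
    push_cast
    field_simp
    ring
  rw [neg_div, Real.rpow_neg hN0.le, neg_mul, Real.rpow_neg two_pos.le, ← div_eq_mul_inv,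
    le_div_iff₀ (by positivity), inv_mul_le_iff₀ (by positivity)]
  linarith

theorem level_error_le {d J N : ℕ} (hd : 0 < d) (hN : 2 ≤ N) {B C e e' : ℝ} (hB : 1 ≤ B)
    (hC : 0 ≤ C) (he' : 0 ≤ e') (he : e' ≤ e) (h1 : B * 2 ^ (d * J) ≤ N)
    (h : (N : ℝ) ≤ B * 2 ^ (d * (J + 1))) :
    C * (√(J + 1) * 2 ^ (-e' * J)) ≤
      (2 * C * 2 ^ e + 2) * B ^ (e / d) * (N : ℝ) ^ (-e' / d) * √(Real.log N) := by
  have h2 : (2 : ℝ) ^ J ≤ N := by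
    refine le_trans ?_ ((le_mul_of_one_le_left (by positivity) hB).trans h1)
    exact pow_le_pow_right₀ one_le_two (Nat.le_mul_of_pos_left _ hd)
  calc _ ≤ C * ((2 * √(Real.log N)) * (2 ^ e * B ^ (e / d) * (N : ℝ) ^ (-e' / d))) := by
        gcongr
        · exact sqrt_level_le hN h2
        · refine (two_rpow_level_le hd hN hB he' h).trans ?_
          gcongr
          · norm_num
    _ = (2 * C * 2 ^ e) * B ^ (e / d) * (N : ℝ) ^ (-e' / d) * √(Real.log N) := by ring
    _ ≤ _ := by gcongr; linarith

theorem one_le_level_error {d N : ℕ} (hN : 2 ≤ N) {B C e e' : ℝ} (hB : 1 ≤ B)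
    (hC : 0 ≤ C) (he' : 0 ≤ e') (he : e' ≤ e) (h : (N : ℝ) ≤ B) :
    1 ≤ (2 * C * 2 ^ e + 2) * B ^ (e / d) * (N : ℝ) ^ (-e' / d) * √(Real.log N) := by
  have hN0 : (0 : ℝ) < N := by positivity
  have h1 : (N : ℝ) ^ (e' / d) ≤ B ^ (e / d) := by
    refine (Real.rpow_le_rpow hN0.le h (by positivity)).trans ?_
    gcongr
  calc (1 : ℝ) = 2 * ((N : ℝ) ^ (e' / d) * (N : ℝ) ^ (-e' / d)) * (1 / 2) := by
        rw [← Real.rpow_add hN0, neg_div, add_neg_cancel, Real.rpow_zero]; norm_num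
    _ ≤ (2 * C * 2 ^ e + 2) * (B ^ (e / d) * (N : ℝ) ^ (-e' / d)) * √(Real.log N) := by
        gcongr
        · have : 0 ≤ 2 * C * 2 ^ e := by positivity
          linarith
        · exact half_le_sqrt_log hN
    _ = _ := by ring

/-- The coefficient sum of the network is controlled by the weight budget. -/
theorem level_coeff_le {d J N : ℕ} (hd : 0 < d) (hN : 2 ≤ N) {t σ : ℝ} (hσ : σ = max t 0)
    (h : (2 : ℝ) ^ (d * J) ≤ N) :
    (2 : ℝ) ^ (σ * J) + √(J + 1) ≤ 5 * max ((N : ℝ) ^ (t / d)) √(Real.log N) := by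
  have hN0 : (0 : ℝ) < N := by positivity
  have hd0 : (0 : ℝ) < d := by positivity
  have h2 : (2 : ℝ) ^ J ≤ N :=
    le_trans (pow_le_pow_right₀ one_le_two (Nat.le_mul_of_pos_left _ hd)) h
  have h3 := sqrt_level_le hN h2
  have h4 := half_le_sqrt_log hN
  have h5 := le_max_left ((N : ℝ) ^ (t / d)) √(Real.log N)
  have h6 := le_max_right ((N : ℝ) ^ (t / d)) √(Real.log N)
  have h7 : 0 ≤ (N : ℝ) ^ (t / d) := by positivity
  have h8 : (2 : ℝ) ^ (σ * J) ≤ (N : ℝ) ^ (t / d) + 2 * √(Real.log N) := by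
    rcases le_total t 0 with ht | ht
    · rw [hσ, max_eq_right ht, zero_mul, Real.rpow_zero]; linarith
    · rw [hσ, max_eq_left ht]
      have := Real.rpow_le_rpow (by positivity) h (show 0 ≤ t / d by positivity)
      rw [← Real.rpow_natCast, ← Real.rpow_mul two_pos.le] at this
      rw [show t * J = ((d * J : ℕ) : ℝ) * (t / d) by push_cast; field_simp]
      linarith
  linarith

end Levels

section HolderOrder

open scoped Matrix

/-- The order of smoothness used in the Hölder class is determined by `α`. -/
theorem HolderClass.isHolder {d r : ℕ} {α β : ℝ} (hβ0 : 0 < β) (hβ1 : β ≤ 1)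
    (hα : α = r + β) {f : (Fin d → ℝ) → ℝ} (hf : f ∈ HolderClass d α) : IsHolder β 1 r f := by
  obtain ⟨r', β', h0, h1, h2, h3, h4, h5⟩ := hf
  have hr : r' = r := by
    have ha : (r' : ℝ) < r + 1 := by linarith
    have hb : (r : ℝ) < r' + 1 := by linarith
    have ha' : r' < r + 1 := by exact_mod_cast ha
    have hb' : r < r' + 1 := by exact_mod_cast hb
    omega
  subst hr
  obtain rfl : β' = β := by linarith
  exact isHolder_of_pderivList h3 h4 h5

theorem exists_succ_add_eq {α : ℝ} (hα : 1 < α) :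
    ∃ (r : ℕ) (β : ℝ), 0 < β ∧ β ≤ 1 ∧ α = (r + 1 : ℕ) + β := by
  have h2 : 1 < ⌈α⌉₊ := Nat.lt_ceil.2 (by simpa using hα)
  obtain ⟨r, hr⟩ := Nat.exists_eq_add_of_lt h2
  have h3 := Nat.ceil_lt_add_one (zero_le_one.trans hα.le)
  have h4 := Nat.le_ceil α
  rw [hr] at h3 h4
  push_cast at h3 h4
  refine ⟨r, α - (r + 1 : ℕ), ?_, ?_, by ring⟩ <;> push_cast <;> linarith

end HolderOrder

/-- Simultaneous approximation of Hölder functions and their gradients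
by norm-constrained RePU networks: for every `f ∈ H^α` there is
`g ∈ 𝒩𝒩(W, L, 𝒮, K)` with
`sup_{[0,1]^d} |g − f| ≲ N^{−min{d+2m+1,2α}/(2d)}·√(log N)` and
`sup_{[0,1]^d} ‖∇g − ∇f‖_∞ ≲ N^{−min{d+2m−1,2(α−1)}/(2d)}·√(log N)`. -/
theorem stmt7 (d m : ℕ) (hd : 0 < d) (hm : 2 ≤ m) (α : ℝ) (hα : 1 < α) :
    ∃ C C₀ : ℝ, 0 < C ∧ 0 < C₀ ∧
      ∀ N : ℕ, 2 ≤ N →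
      ∀ (W L : ℕ) (S K : ℝ), N ≤ W → 1 ≤ L → ((N : ℝ) * (d + 1)) ≤ S →
        C₀ * max ((N : ℝ) ^ (((d : ℝ) + 2 * m + 1 - 2 * α) / (2 * d)))
            (Real.sqrt (Real.log N)) ≤ K →
      ∀ f ∈ HolderClass d α, ∃ g ∈ NNfull m d W L S K,
        (∀ x ∈ Set.Icc (0 : Fin d → ℝ) 1,
          |g x - f x| ≤ C * (N : ℝ) ^ (-(min ((d : ℝ) + 2 * m + 1) (2 * α)) / (2 * d))
              * Real.sqrt (Real.log N)) ∧
        (∀ x ∈ Set.Icc (0 : Fin d → ℝ) 1, ∀ i : Fin d,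
          |fderiv ℝ g x (Pi.single i 1) - fderiv ℝ f x (Pi.single i 1)|
            ≤ C * (N : ℝ) ^ (-(min ((d : ℝ) + 2 * m - 1) (2 * (α - 1))) / (2 * d))
              * Real.sqrt (Real.log N)) := by
  obtain ⟨n, rfl⟩ := Nat.exists_eq_succ_of_ne_zero hd.ne'
  simp only [Nat.succ_eq_add_one]
  obtain ⟨r, β, hβ0, hβ1, hαr⟩ := exists_succ_add_eq hα
  obtain ⟨A, hA⟩ := exists_compactSupport_isHolder (n + 1) (r + 1) hβ0 hβ1
  obtain ⟨κ⟩ := ConePartition.nonempty n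
  set t : ℝ := ((n : ℝ) + 2 * m + 2) / 2 - α with ht
  set σ : ℝ := max t 0 with hσ
  set e : ℝ := ((n : ℝ) + 2 * m + 2) / 2 - σ with he
  have hm2 : (2 : ℝ) ≤ m := by exact_mod_cast hm
  have hn0 : (0 : ℝ) ≤ n := n.cast_nonneg
  have hd0 : (0 : ℝ) < (n : ℝ) + 1 := by positivity
  have he1 : 1 ≤ e := by
    rw [he, hσ]
    rcases le_total t 0 with h | h
    · rw [max_eq_right h]; linarith
    · rw [max_eq_left h, ht]; linarith
  obtain ⟨C₁, hC₁, H⟩ := κ.exists_neurons_rate hm (A := A) hβ0 r (σ := σ)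
    (by rw [hσ, ht, hαr]; push_cast; ring_nf)
  set B : ℝ := C₁ + 1 with hB
  have hB1 : 1 ≤ B := by linarith
  set C : ℝ := (2 * C₁ * 2 ^ e + 2) * B ^ (e / (n + 1 : ℕ)) with hC
  have hmin : min (((n + 1 : ℕ) : ℝ) + 2 * m + 1) (2 * α) = 2 * e := by
    rw [he, hσ, ht]
    push_cast
    rcases le_total (((n : ℝ) + 2 * m + 2) / 2 - α) 0 with h | h
    · rw [max_eq_right h, min_eq_left (by linarith)]; ring
    · rw [max_eq_left h, min_eq_right (by linarith)]; ring
  have hmin' : min (((n + 1 : ℕ) : ℝ) + 2 * m - 1) (2 * (α - 1)) = 2 * (e - 1) := by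
    rw [mul_sub 2 e, ← hmin, mul_one, ← min_sub_sub_right]
    congr 1 <;> ring
  have hq : ∀ a : ℝ, -(2 * a) / (2 * ((n + 1 : ℕ) : ℝ)) = -a / (n + 1 : ℕ) := fun a => by
    rw [← mul_neg, mul_div_mul_left _ _ two_ne_zero]
  have hq' : (((n + 1 : ℕ) : ℝ) + 2 * m + 1 - 2 * α) / (2 * ((n + 1 : ℕ) : ℝ)) =
      t / (n + 1 : ℕ) := by
    rw [ht]; push_cast; field_simp; ring
  refine ⟨C, m * (5 * C₁) * (((n + 1 : ℕ) + 1) * B) ^ m, by positivity, by positivity, ?_⟩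
  intro N hN W L S K hW hL hS hK f hf
  rw [hmin, hmin', hq, hq]
  rw [hq'] at hK
  have hfH := HolderClass.isHolder hβ0 hβ1 hαr hf
  rcases le_or_gt B N with hBN | hBN
  · obtain ⟨F, hF1, hF2, hF3⟩ := hA f hfH
    obtain ⟨J, hJ1, hJ2⟩ := exists_dyadic_level hd (by linarith) hBN
    have hJ3 : (2 : ℝ) ^ ((n + 1) * J) ≤ N :=
      (le_mul_of_one_le_left (by positivity) hB1).trans hJ1
    obtain ⟨ι, _, c, w, b, h1, h2, h3, h4, h5⟩ := H J F hF1 fun y hy =>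
      image_eq_zero_of_notMem_tsupport fun h => by
        have := hF2 h
        rw [mem_closedBall_zero_iff] at this
        linarith
    have hcard : (Fintype.card ι : ℝ) ≤ N := h1.trans <| (by gcongr; linarith : _ ≤ _).trans hJ1
    have hcard' : Fintype.card ι ≤ N := by exact_mod_cast hcard
    refine ⟨_, mem_NNfull_of_neurons c w b hB1 (fun j l => (h2 j l).trans (by linarith))
      (fun j => (h3 j).trans (by linarith)) (hcard'.trans hW) hL ?_ ?_, ?_, ?_⟩
    · refine le_trans ?_ hS
      gcongr
    · refine le_trans ?_ hK
      have := mul_le_mul_of_nonneg_left (level_coeff_le hd hN hσ hJ3) hC₁.le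
      calc _ ≤ m * (C₁ * (5 * max ((N : ℝ) ^ (t / (n + 1 : ℕ))) √(Real.log N))) *
            (((n + 1 : ℕ) + 1) * B) ^ m := by
            gcongr
            exact h4.trans this
        _ = _ := by ring
    · intro x hx
      rw [← (hF3 x hx).eq_of_nhds]
      exact ((h5 x hx).1).trans (level_error_le hd hN hB1 hC₁.le (by linarith) le_rfl hJ1 hJ2)
    · intro x hx l
      rw [← (hF3 x hx).fderiv_eq, fderiv_neurons hm]
      refine ((h5 x hx).2 l).trans ?_
      rw [show ((n : ℝ) + 2 * m) / 2 - σ = e - 1 by rw [he]; ring]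
      exact level_error_le hd hN hB1 hC₁.le (by linarith) (by linarith) hJ1 hJ2
  · have hK0 : 0 ≤ K := le_trans (by positivity) hK
    have hS0 : 0 ≤ S := le_trans (by positivity) hS
    refine ⟨_, mem_NNfull_of_neurons (ι := Fin 0) Fin.elim0 Fin.elim0 Fin.elim0 hB1
      (fun j => j.elim0) (fun j => j.elim0) (by simp) hL (by simpa using hS0)
      (by simpa using hK0), fun x hx => ?_, fun x hx l => ?_⟩
    · refine le_trans ?_ (one_le_level_error hN hB1 hC₁.le (by linarith) le_rfl hBN.le)
      simpa using hfH.2.1 x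
    · refine le_trans ?_ (one_le_level_error hN hB1 hC₁.le
        (by linarith : 0 ≤ e - 1) (by linarith) hBN.le)
      simpa [partialD] using (hfH.2.2 l).abs_le x
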